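/- For every ε > 0, ∫_2^T Δ(x)^7 dx = (7(5·s_{7;3}(d) − 3·s_{7;2}(d) − s_{7;1}(d))/(2816·π^7))·T^{11/4} + O(T^{11/4 − 1/336 + ε}) as T → ∞. -/

import Mathlib

open Filter MeasureTheory

/-- The divisor function `d(n)`. -/
def divfun (n : ℕ) : ℕ := n.divisors.card

/-- The error term in the Dirichlet divisor problem. -/
noncomputable def DirichletDelta (x : ℝ) : ℝ :=
  (∑ n ∈ Finset.Icc 1 ⌊x⌋₊, (divfun n : ℝ)) - x * Real.log x -
    (2 * Real.eulerMascheroniConstant - 1) * x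

/-- The series `s_{7;ℓ}(d)`: the sum of `d(n₁)⋯d(n₇)/(n₁⋯n₇)^{3/4}` over positive integer
7-tuples with `√n₁ + ⋯ + √n_ℓ = √n_{ℓ+1} + ⋯ + √n₇`. -/
noncomputable def s7 (l : ℕ) : ℝ :=
  ∑' v : {v : Fin 7 → ℕ+ //
      ∑ j : Fin 7, (if (j : ℕ) < l then (1 : ℝ) else -1) * Real.sqrt ((v j : ℕ)) = 0},
    (∏ j : Fin 7, (divfun (v.1 j) : ℝ)) / (∏ j : Fin 7, ((v.1 j : ℕ) : ℝ)) ^ ((3 : ℝ) / 4)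


section
open Filter MeasureTheory

lemma divfun_pow_le (ε : ℝ) (hε : 0 < ε) : ∃ C : ℝ, 1 ≤ C ∧ ∃ M : ℕ, ∀ p a : ℕ, 2 ≤ p →
    ((a : ℝ) + 1) ≤ (if p < M then C else 1) * ((p : ℝ) ^ a) ^ ε := by
  have hl2 : 0 < Real.log 2 := Real.log_pos (by norm_num)
  refine ⟨1 + 1 / (ε * Real.log 2), by
    have : 0 < 1 / (ε * Real.log 2) := by positivity
    linarith, ⌈(2:ℝ) ^ (1/ε)⌉₊, ?_⟩
  intro p a hp
  have hp0 : (0:ℝ) < p := by positivity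
  have hp2 : (2:ℝ) ≤ p := by exact_mod_cast hp
  have hpe : ((p : ℝ) ^ a) ^ ε = ((p:ℝ) ^ ε) ^ a := by
    rw [← Real.rpow_natCast, ← Real.rpow_natCast, ← Real.rpow_mul hp0.le, ← Real.rpow_mul hp0.le,
      mul_comm]
  split_ifs with h
  · have h1 : 1 + (a:ℝ) * (ε * Real.log 2) ≤ ((p : ℝ) ^ a) ^ ε := by
      have : ((2:ℝ)^ε)^a ≤ ((p:ℝ)^ε)^a := by gcongr
      rw [hpe]
      refine le_trans ?_ this
      rw [Real.rpow_def_of_pos (by norm_num : (0:ℝ) < 2), ← Real.exp_nat_mul]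
      have := Real.add_one_le_exp ((a:ℝ) * (Real.log 2 * ε))
      nlinarith
    have hx : 0 < ε * Real.log 2 := by positivity
    set x := ε * Real.log 2
    have h2 : (a:ℝ) + 1 ≤ (1 + 1/x) * (1 + a * x) := by
      have : (1 + 1/x) * (1 + a * x) = 1 + a * x + 1/x + a := by field_simp; ring
      rw [this]
      have : 0 < 1/x := by positivity
      have : 0 ≤ a * x := by positivity
      linarith
    refine h2.trans ?_
    gcongr
  · rw [one_mul, hpe]
    have : (2:ℝ) ≤ (p:ℝ)^ε := by
      have h3 : (2:ℝ)^(1/ε) ≤ p := by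
        push Not at h
        exact Nat.ceil_le.mp h
      calc (2:ℝ) = ((2:ℝ)^(1/ε))^ε := by
            rw [← Real.rpow_mul (by norm_num)]; field_simp; simp
        _ ≤ _ := by gcongr
    have h4 : (2:ℝ)^a ≤ ((p:ℝ)^ε)^a := by gcongr
    refine le_trans ?_ h4
    have := Nat.lt_two_pow_self (n := a)
    exact_mod_cast this

/-- The divisor bound. -/
lemma divfun_le (ε : ℝ) (hε : 0 < ε) : ∃ C : ℝ, 1 ≤ C ∧ ∀ n : ℕ, 1 ≤ n →
    (divfun n : ℝ) ≤ C * (n:ℝ) ^ ε := by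
  obtain ⟨C, hC, M, h⟩ := divfun_pow_le ε hε
  refine ⟨C ^ M, one_le_pow₀ hC, fun n hn => ?_⟩
  have hn0 : n ≠ 0 := by omega
  have h1 : (divfun n : ℝ) = ∏ p ∈ n.primeFactors, ((n.factorization p : ℝ) + 1) := by
    unfold divfun
    rw [Nat.card_divisors hn0]
    push_cast; rfl
  have h2 : (n:ℝ) ^ ε = ∏ p ∈ n.primeFactors, ((p:ℝ) ^ n.factorization p) ^ ε := by
    rw [Real.finsetProd_rpow]
    · congr 1
      have := Nat.prod_factorization_pow_eq_self hn0
      conv_lhs => rw [← this]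
      rw [Finsupp.prod]
      push_cast; rfl
    · intros; positivity
  rw [h1, h2]
  calc _ ≤ ∏ p ∈ n.primeFactors, (if p < M then C else 1) * ((p:ℝ) ^ n.factorization p) ^ ε := by
        apply Finset.prod_le_prod
        · intros; positivity
        · intro p hp
          exact h p _ (Nat.prime_of_mem_primeFactors hp).two_le
    _ = (∏ p ∈ n.primeFactors, (if p < M then C else 1)) * _ := Finset.prod_mul_distrib
    _ ≤ _ := by
        gcongr
        rw [Finset.prod_ite, Finset.prod_const, Finset.prod_const_one, mul_one]
        apply pow_le_pow_right₀ hC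
        calc _ ≤ (Finset.range M).card := by
              apply Finset.card_le_card
              intro p hp
              simp at hp ⊢
              exact hp.2
          _ = M := by simp

lemma one_le_divfun {n : ℕ} (hn : 1 ≤ n) : 1 ≤ divfun n := by
  unfold divfun
  exact Finset.card_pos.mpr ⟨1, by simp; omega⟩

end

section
open Filter MeasureTheory

lemma sum_divfun_sq (m : ℕ) :
    (∑ n ∈ Finset.Icc 1 (m^2), divfun n) + m^2 = 2 * ∑ a ∈ Finset.Icc 1 m, m^2 / a := by
  have h1 : ∑ n ∈ Finset.Icc 1 (m^2), divfun n = ∑ a ∈ Finset.Icc 1 (m^2), m^2 / a := by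
    have := ArithmeticFunction.sum_Ioc_sigma0_eq_sum_div (m^2)
    simp only [ArithmeticFunction.sigma_zero_apply] at this
    exact this
  have h2 : ∀ a ∈ Finset.Icc 1 (m^2), m^2 / a =
      ∑ b ∈ Finset.Icc 1 (m^2), if a * b ≤ m^2 then 1 else 0 := by
    intro a ha
    rw [← Finset.card_filter]
    have : (Finset.Icc 1 (m^2)).filter (fun b => a * b ≤ m^2) = Finset.Icc 1 (m^2/a) := by
      ext b
      simp only [Finset.mem_filter, Finset.mem_Icc] at *
      rw [Nat.le_div_iff_mul_le (by omega)]
      constructor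
      · rintro ⟨h, h'⟩; exact ⟨h.1, by rw [mul_comm]; exact h'⟩
      · rintro ⟨h, h'⟩
        have : b * 1 ≤ b * a := Nat.mul_le_mul_left _ ha.1
        exact ⟨⟨h, by omega⟩, by rw [mul_comm]; exact h'⟩
    rw [this]; simp
  have h3 : ∀ a ∈ Finset.Icc 1 m, m^2 / a =
      ∑ b ∈ Finset.Icc 1 (m^2), if a * b ≤ m^2 then 1 else 0 := by
    intro a ha
    apply h2
    simp only [Finset.mem_Icc] at *
    exact ⟨ha.1, by nlinarith⟩
  rw [h1, Finset.sum_congr rfl h2, Finset.sum_congr rfl h3]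
  have hsub : Finset.Icc 1 m ⊆ Finset.Icc 1 (m^2) :=
    Finset.Icc_subset_Icc_right (by nlinarith [Nat.zero_le m])
  rw [← Finset.sum_sdiff hsub, add_right_comm, two_mul]
  congr 1
  rw [Finset.sum_comm]
  rw [← Finset.sum_sdiff hsub]
  have h5 : ∑ y ∈ Finset.Icc 1 (m^2) \ Finset.Icc 1 m, ∑ x ∈ Finset.Icc 1 (m^2) \ Finset.Icc 1 m,
      (if x * y ≤ m^2 then 1 else 0) = 0 := by
    apply Finset.sum_eq_zero
    intro y hy
    apply Finset.sum_eq_zero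
    intro x hx
    simp only [Finset.mem_sdiff, Finset.mem_Icc, not_and, not_le] at hx hy
    rw [if_neg]
    have := hx.2 hx.1.1
    have := hy.2 hy.1.1
    nlinarith
  rw [h5, zero_add]
  have h6 : m^2 = ∑ b ∈ Finset.Icc 1 m, ∑ a ∈ Finset.Icc 1 m, if a * b ≤ m^2 then 1 else 0 := by
    have : ∀ b ∈ Finset.Icc 1 m, (∑ a ∈ Finset.Icc 1 m, if a * b ≤ m^2 then 1 else 0) = m := by
      intro b hb
      rw [Finset.sum_congr rfl (g := fun _ => 1)]
      · simp
      · intro a ha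
        simp only [Finset.mem_Icc] at ha hb
        rw [if_pos]; nlinarith [Nat.mul_le_mul ha.2 hb.2]
    rw [Finset.sum_congr rfl this]; simp [sq]
  refine (congrArg (_ + ·) h6).trans ?_
  rw [← Finset.sum_add_distrib]
  apply Finset.sum_congr rfl
  intro b hb
  have := Finset.sum_sdiff (f := fun a => if a * b ≤ m^2 then 1 else 0) hsub
  rw [this]
  apply Finset.sum_congr rfl
  intro a ha
  rw [mul_comm]

lemma tendsto_sum_divfun_sq :
    Tendsto (fun m : ℕ => (∑ n ∈ Finset.Icc 1 (m^2), (divfun n : ℝ)) / (m:ℝ)^2 - Real.log ((m:ℝ)^2))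
      atTop (nhds (2 * Real.eulerMascheroniConstant - 1)) := by
  have h1 : Tendsto (fun m : ℕ => 2 * ((harmonic m : ℝ) - Real.log m) - 1) atTop
      (nhds (2 * Real.eulerMascheroniConstant - 1)) :=
    (Real.tendsto_harmonic_sub_log.const_mul 2).sub_const 1
  have h2 : Tendsto (fun m : ℕ => 2 * ((harmonic m : ℝ) - Real.log m) - 1 - 2 / (m:ℝ)) atTop
      (nhds (2 * Real.eulerMascheroniConstant - 1)) := by
    have := h1.sub (tendsto_const_div_atTop_nhds_zero_nat (2:ℝ))
    simpa using this
  refine tendsto_of_tendsto_of_tendsto_of_le_of_le' h2 h1 ?_ ?_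
  all_goals
    filter_upwards [eventually_ge_atTop 1] with m hm
    have hm0 : (0:ℝ) < m := by positivity
    have hS : (∑ n ∈ Finset.Icc 1 (m^2), (divfun n : ℝ)) =
        2 * ∑ a ∈ Finset.Icc 1 m, ((m^2 / a : ℕ) : ℝ) - (m:ℝ)^2 := by
      have := sum_divfun_sq m
      have h : ((∑ n ∈ Finset.Icc 1 (m^2), divfun n : ℕ) : ℝ) + (m:ℝ)^2
        = 2 * ∑ a ∈ Finset.Icc 1 m, ((m^2 / a : ℕ) : ℝ) := by exact_mod_cast this
      push_cast at h
      linarith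
    have hH : (harmonic m : ℝ) = ∑ a ∈ Finset.Icc 1 m, (1 / (a:ℝ)) := by
      rw [harmonic_eq_sum_Icc]; push_cast; simp
    rw [hS, Real.log_pow]
  · have : (m:ℝ)^2 * harmonic m - m ≤ ∑ a ∈ Finset.Icc 1 m, ((m^2 / a : ℕ) : ℝ) := by
      rw [hH, Finset.mul_sum]
      have : (m:ℝ) = ∑ a ∈ Finset.Icc 1 m, (1:ℝ) := by simp
      nth_rw 2 [this]
      rw [← Finset.sum_sub_distrib]
      apply Finset.sum_le_sum
      intro a ha
      have := Nat.lt_floor_add_one (((m^2 : ℕ):ℝ) / a)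
      rw [Nat.floor_div_natCast, Nat.floor_natCast] at this
      push_cast at this ⊢
      rw [mul_one_div]; linarith
    have h3 : 2 * ((m:ℝ)^2 * harmonic m - m) - (m:ℝ)^2 ≤ 
      2 * ∑ a ∈ Finset.Icc 1 m, ((m^2 / a : ℕ) : ℝ) - (m:ℝ)^2 := by linarith
    have h4 := div_le_div_of_nonneg_right h3 (sq_nonneg (m:ℝ))
    have h5 : (2 * ((m:ℝ)^2 * harmonic m - m) - (m:ℝ)^2)/(m:ℝ)^2 = 2 * harmonic m - 2/m - 1 := by
      field_simp
    rw [h5] at h4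
    push_cast
    linarith
  · have : ∑ a ∈ Finset.Icc 1 m, ((m^2 / a : ℕ) : ℝ) ≤ (m:ℝ)^2 * harmonic m := by
      rw [hH, Finset.mul_sum]
      apply Finset.sum_le_sum
      intro a ha
      have := @Nat.cast_div_le ℝ _ _ _ (m^2) a
      push_cast at this ⊢
      rw [mul_one_div]; exact this
    have h3 : 2 * ∑ a ∈ Finset.Icc 1 m, ((m^2 / a : ℕ) : ℝ) - (m:ℝ)^2 ≤ 
      2 * ((m:ℝ)^2 * harmonic m) - (m:ℝ)^2 := by linarith
    have h4 := div_le_div_of_nonneg_right h3 (sq_nonneg (m:ℝ))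
    have h5 : (2 * ((m:ℝ)^2 * harmonic m) - (m:ℝ)^2)/(m:ℝ)^2 = 2 * harmonic m - 1 := by
      field_simp
    rw [h5] at h4
    push_cast
    linarith

end

section
open Filter MeasureTheory

/-- Holomorphy of Laplace type integrals. -/
lemma hasDerivAt_laplace {α : Type*} [MeasurableSpace α] (μ : Measure α) (φ ψ : α → ℝ)
    (hφ : Measurable φ) (hψ : Measurable ψ) (h0 : ∀ᵐ t ∂μ, 0 ≤ φ t)
    (hIntg : ∀ x : ℝ, 0 < x → Integrable (fun t => Real.exp (-x * φ t) * ψ t) μ)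
    (w : ℂ) (hw : 0 < w.re) :
    Integrable (fun t => (φ t : ℂ) * Complex.exp (-w * φ t) * ψ t) μ ∧
    HasDerivAt (fun w : ℂ => ∫ t, Complex.exp (-w * φ t) * ψ t ∂μ)
      (-∫ t, (φ t : ℂ) * Complex.exp (-w * φ t) * ψ t ∂μ) w := by
  have hmeas : ∀ z : ℂ, Measurable (fun t => Complex.exp (-z * φ t) * ψ t) := by
    intro z; fun_prop
  have key := hasDerivAt_integral_of_dominated_loc_of_deriv_le (μ := μ) (𝕜 := ℂ)
    (F := fun w t => Complex.exp (-w * φ t) * ψ t) (x₀ := w)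
    (F' := fun w t => -((φ t : ℂ) * Complex.exp (-w * φ t) * ψ t))
    (s := Metric.ball w (w.re/2))
    (bound := fun t => (4 / w.re) * ‖Real.exp (-(w.re/4) * φ t) * ψ t‖)
    (Metric.ball_mem_nhds _ (by positivity)) (Eventually.of_forall fun z => (hmeas z).aestronglyMeasurable)
    ?_ ?_ ?_ ?_ ?_
  · refine ⟨?_, ?_⟩
    · simpa using key.1.neg
    · have := key.2
      rw [integral_neg] at this
      exact this
  · have h1 := (hIntg w.re hw)
    refine h1.norm.mono' (hmeas w).aestronglyMeasurable ?_
    filter_upwards with t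
    rw [norm_mul, Complex.norm_exp, norm_mul]
    simp
  · apply Measurable.aestronglyMeasurable
    fun_prop
  · filter_upwards [h0] with t ht z hz
    rw [norm_neg, norm_mul, norm_mul, Complex.norm_exp, norm_mul]
    have hz' : w.re / 2 ≤ z.re := by
      rw [Metric.mem_ball, dist_eq_norm] at hz
      have := (Complex.abs_re_le_norm (z - w)).trans hz.le
      rw [Complex.sub_re, abs_le] at this
      linarith
    have h1 : (-z * (φ t : ℂ)).re = -z.re * φ t := by simp
    rw [h1]
    simp only [Complex.norm_real, Real.norm_eq_abs, Real.abs_exp, abs_of_nonneg ht]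
    have h2 : φ t * Real.exp (-z.re * φ t) ≤ 4 / w.re * Real.exp (-(w.re/4) * φ t) := by
      have h3 : w.re/4 * φ t ≤ Real.exp (w.re/4 * φ t) := by
        linarith [Real.add_one_le_exp (w.re/4 * φ t)]
      have h4 : Real.exp (-z.re * φ t) ≤ Real.exp (-(w.re/4) * φ t) * Real.exp (-(w.re/4 * φ t)) := by
        rw [← Real.exp_add]
        apply Real.exp_le_exp.mpr
        nlinarith
      calc φ t * Real.exp (-z.re * φ t) ≤ φ t * (Real.exp (-(w.re/4) * φ t) * Real.exp (-(w.re/4 * φ t))) := by gcongr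
        _ = 4 / w.re * Real.exp (-(w.re/4) * φ t) * ((w.re/4 * φ t) * Real.exp (-(w.re/4 * φ t))) := by
            field_simp
        _ ≤ 4 / w.re * Real.exp (-(w.re/4) * φ t) * (Real.exp (w.re/4 * φ t) * Real.exp (-(w.re/4 * φ t))) := by gcongr
        _ = _ := by rw [← Real.exp_add]; simp
    calc _ ≤ 4 / w.re * Real.exp (-(w.re/4) * φ t) * |ψ t| := by gcongr
      _ = _ := by ring
  · exact ((hIntg (w.re/4) (by positivity)).norm.const_mul _)
  · filter_upwards with t z hz
    have h1 : HasDerivAt (fun z : ℂ => -z * (φ t : ℂ)) (-1 * (φ t : ℂ)) z :=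
      (hasDerivAt_id z).neg.mul_const _
    have h2 := (h1.cexp).mul_const (ψ t : ℂ)
    exact h2.congr_deriv (by ring)

lemma one_add_sq_le_cosh (t : ℝ) : 1 + t^2/2 ≤ Real.cosh t := by
  wlog ht : 0 ≤ t with H
  · have := H (-t) (by linarith)
    simpa using this
  have h1 : Real.cosh t = 1 + 2 * Real.sinh (t/2)^2 := by
    have := Real.cosh_two_mul (t/2)
    rw [show 2 * (t/2) = t by ring, Real.cosh_sq] at this
    rw [this]; ring
  have h2 : t/2 ≤ Real.sinh (t/2) := Real.self_le_sinh_iff.mpr (by linarith)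
  rw [h1]
  nlinarith

lemma self_le_cosh (t : ℝ) : t ≤ Real.cosh t := by
  nlinarith [one_add_sq_le_cosh t, sq_nonneg (t-1)]

/-- The integrals `∫ exp(-w cosh t) cosh^k t`. -/
noncomputable def kint (k : ℕ) (w : ℂ) : ℂ :=
  ∫ t in Set.Ioi (0:ℝ), Complex.exp (-w * (Real.cosh t : ℝ)) * ((Real.cosh t ^ k : ℝ) : ℂ)

lemma integrable_cosh_exp (k : ℕ) (x : ℝ) (hx : 0 < x) :
    IntegrableOn (fun t => Real.exp (-x * Real.cosh t) * Real.cosh t ^ k) (Set.Ioi 0) := by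
  have h1 : IntegrableOn (fun t : ℝ => (k.factorial / (x/2)^k) * Real.exp (-(x/2) * t)) (Set.Ioi 0) :=
    (integrableOn_exp_mul_Ioi (by linarith) 0).const_mul _
  refine h1.mono' (by fun_prop) ?_
  filter_upwards with t
  have hc : 0 < Real.cosh t := Real.cosh_pos t
  rw [Real.norm_of_nonneg (by positivity)]
  have h2 := Real.pow_div_factorial_le_exp (x/2 * Real.cosh t) (by positivity) k
  rw [div_le_iff₀ (by positivity), mul_pow] at h2
  have h3 : Real.cosh t ^ k ≤ k.factorial / (x/2)^k * Real.exp (x/2 * Real.cosh t) := by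
    rw [div_mul_eq_mul_div, le_div_iff₀ (by positivity)]
    linarith
  calc Real.exp (-x * Real.cosh t) * Real.cosh t ^ k
      ≤ Real.exp (-x * Real.cosh t) * (k.factorial / (x/2)^k * Real.exp (x/2 * Real.cosh t)) := by gcongr
    _ = k.factorial / (x/2)^k * Real.exp (-(x/2) * Real.cosh t) := by
        rw [mul_left_comm, ← Real.exp_add]; ring_nf
    _ ≤ _ := by
        gcongr 2
        nlinarith [self_le_cosh t]

lemma integrable_kint (k : ℕ) (w : ℂ) (hw : 0 < w.re) :
    IntegrableOn (fun t : ℝ => Complex.exp (-w * (Real.cosh t : ℝ)) * ((Real.cosh t ^ k : ℝ) : ℂ))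
      (Set.Ioi 0) := by
  refine (integrable_cosh_exp k w.re hw).norm.mono' (by fun_prop) ?_
  filter_upwards with t
  rw [norm_mul, Complex.norm_exp, norm_mul]
  simp [-Complex.ofReal_cosh]

lemma hasDerivAt_kint (k : ℕ) (w : ℂ) (hw : 0 < w.re) :
    HasDerivAt (kint k) (-kint (k+1) w) w := by
  have := (hasDerivAt_laplace (volume.restrict (Set.Ioi (0:ℝ))) Real.cosh (fun t => Real.cosh t ^ k)
    (by fun_prop) (by fun_prop) (Eventually.of_forall fun t => (Real.cosh_pos t).le)
    (integrable_cosh_exp k) w hw).2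
  refine this.congr_deriv ?_
  unfold kint
  congr 2
  ext t
  push_cast
  ring

lemma kint_parts (w : ℂ) (hw : 0 < w.re) : w * (kint 2 w - kint 0 w) = kint 1 w := by
  have h1 := integral_Ioi_of_hasDerivAt_of_tendsto (a := 0) (m := (0:ℂ))
    (f := fun t : ℝ => (Real.sinh t : ℂ) * Complex.exp (-w * (Real.cosh t : ℝ)))
    (f' := fun t : ℝ => Complex.exp (-w * (Real.cosh t : ℝ)) * ((Real.cosh t ^ 1 : ℝ) : ℂ) -
      w * (Complex.exp (-w * (Real.cosh t : ℝ)) * ((Real.cosh t ^ 2 : ℝ) : ℂ) -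
        Complex.exp (-w * (Real.cosh t : ℝ)) * ((Real.cosh t ^ 0 : ℝ) : ℂ)))
    (by fun_prop) ?_ ?_ ?_
  · rw [integral_sub (integrable_kint 1 w hw), integral_const_mul,
      integral_sub (integrable_kint 2 w hw) (integrable_kint 0 w hw)] at h1
    · have h2 : kint 1 w - w * (kint 2 w - kint 0 w) = 0 := by
        unfold kint; rw [h1]; simp
      linear_combination -h2
    · exact ((integrable_kint 2 w hw).sub (integrable_kint 0 w hw)).const_mul _
  · intro t ht
    have hs : HasDerivAt (fun t : ℝ => (Real.sinh t : ℂ)) (Real.cosh t : ℂ) t :=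
      (Real.hasDerivAt_sinh t).ofReal_comp
    have hc : HasDerivAt (fun t : ℝ => (Real.cosh t : ℂ)) (Real.sinh t : ℂ) t :=
      (Real.hasDerivAt_cosh t).ofReal_comp
    have := hs.mul ((hc.const_mul (-w)).cexp)
    refine this.congr_deriv ?_
    have hsq : ((Real.sinh t : ℝ) : ℂ)^2 = (Real.cosh t : ℂ)^2 - 1 := by
      have := Real.sinh_sq t
      exact_mod_cast this
    push_cast
    push_cast at hsq
    linear_combination (-w) * Complex.exp (-w * Complex.cosh t) * hsq
  · exact (integrable_kint 1 w hw).sub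
      (((integrable_kint 2 w hw).sub (integrable_kint 0 w hw)).const_mul _)
  · have h2 : Tendsto (fun t : ℝ => Real.cosh t * Real.exp (- w.re * Real.cosh t)) atTop (nhds 0) := by
      have h3 : Tendsto (fun y : ℝ => y ^ 1 * Real.exp (- w.re * y)) atTop (nhds 0) := by
        have := tendsto_rpow_mul_exp_neg_mul_atTop_nhds_zero 1 w.re hw
        simpa using this
      have h4 : Tendsto Real.cosh atTop atTop :=
        tendsto_atTop_mono self_le_cosh tendsto_id
      simpa [Function.comp_def] using h3.comp h4
    refine squeeze_zero_norm (fun t => ?_) h2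
    rw [norm_mul, Complex.norm_exp]
    have : (-w * ((Real.cosh t : ℝ):ℂ)).re = -w.re * Real.cosh t := by
      rw [Complex.re_mul_ofReal]; simp
    rw [this]
    gcongr
    rw [Complex.norm_real, Real.norm_eq_abs, ← Real.sqrt_sq_eq_abs]
    apply Real.sqrt_le_iff.mpr
    exact ⟨(Real.cosh_pos t).le, by rw [Real.cosh_sq]; linarith⟩

lemma norm_kint_zero_le (w : ℂ) (hw : 0 < w.re) :
    ‖kint 0 w‖ ≤ Real.exp (-w.re) * Real.sqrt (Real.pi / w.re) := by
  have h1 : IntegrableOn (fun t : ℝ => Real.exp (-w.re) * Real.exp (-(w.re/2) * t^2)) (Set.Ioi 0) :=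
    ((integrable_exp_neg_mul_sq (by positivity)).integrableOn).const_mul _
  have h2 : ∫ t in Set.Ioi (0:ℝ), Real.exp (-w.re) * Real.exp (-(w.re/2) * t^2) =
      Real.exp (-w.re) * (Real.sqrt (Real.pi / (w.re/2)) / 2) := by
    rw [integral_const_mul, integral_gaussian_Ioi]
  refine (norm_integral_le_of_norm_le h1 ?_).trans ?_
  · filter_upwards with t
    rw [norm_mul, Complex.norm_exp, ← Real.exp_add]
    simp only [pow_zero, Complex.ofReal_one, norm_one, mul_one]
    apply Real.exp_le_exp.mpr
    have : (-w * ((Real.cosh t : ℝ):ℂ)).re = -w.re * Real.cosh t := by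
      rw [Complex.re_mul_ofReal]; simp
    rw [this]
    nlinarith [one_add_sq_le_cosh t]
  · rw [h2]
    gcongr
    rw [div_le_iff₀ (by norm_num)]
    apply Real.sqrt_le_iff.mpr
    refine ⟨by positivity, ?_⟩
    rw [mul_pow, Real.sq_sqrt (by positivity)]
    have : Real.pi / (w.re/2) = Real.pi / w.re * 2 := by field_simp
    rw [this]
    have : 0 ≤ Real.pi / w.re := by positivity
    nlinarith

/-- `Ψ(w) = w K₁(w)`. -/
noncomputable def Psi (w : ℂ) : ℂ := w * kint 1 w

lemma hasDerivAt_Psi (w : ℂ) (hw : 0 < w.re) : HasDerivAt Psi (-(w * kint 0 w)) w := by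
  have := (hasDerivAt_id w).mul (hasDerivAt_kint 1 w hw)
  refine this.congr_deriv ?_
  simp only [id]
  linear_combination -kint_parts w hw

end

section
open Filter MeasureTheory

lemma sinh_lt_cosh' (x : ℝ) : Real.sinh x ≤ Real.cosh x := (Real.sinh_lt_cosh x).le

lemma half_exp_le_cosh (x : ℝ) : Real.exp x / 2 ≤ Real.cosh x := by
  rw [Real.cosh_eq]
  have := Real.exp_pos (-x)
  linarith

/-- auxiliary weight for the partial integration -/
noncomputable def qaux (t : ℝ) : ℝ :=
  Real.sinh (t/4) / Real.cosh (t/4) * (1 + 1/(2 * Real.cosh (t/2)))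

noncomputable def qaux' (t : ℝ) : ℝ :=
  (1/4) / Real.cosh (t/4)^2 * (1 + 1/(2 * Real.cosh (t/2))) +
    Real.sinh (t/4) / Real.cosh (t/4) * (-(Real.sinh (t/2) / (4 * Real.cosh (t/2)^2)))

lemma qaux_mul_sinh (t : ℝ) : qaux t * Real.sinh t = Real.cosh t - Real.cosh (t/2) := by
  have h1 : Real.sinh t = 2 * Real.sinh (t/2) * Real.cosh (t/2) := by
    rw [← Real.sinh_two_mul]; ring_nf
  have h2 : Real.cosh t = 2 * Real.cosh (t/2)^2 - 1 := by
    have := Real.cosh_two_mul (t/2)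
    rw [show 2 * (t/2) = t by ring, Real.sinh_sq] at this
    rw [this]; ring
  have h3 : Real.sinh (t/2) = 2 * Real.sinh (t/4) * Real.cosh (t/4) := by
    rw [← Real.sinh_two_mul]; ring_nf
  have h4 : Real.cosh (t/2) = 2 * Real.sinh (t/4)^2 + 1 := by
    have := Real.cosh_two_mul (t/4)
    rw [show 2 * (t/4) = t/2 by ring, Real.cosh_sq] at this
    rw [this]; ring
  have hc : Real.cosh (t/4) ≠ 0 := (Real.cosh_pos _).ne'
  have hc2 : Real.cosh (t/2) ≠ 0 := (Real.cosh_pos _).ne'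
  unfold qaux
  rw [h1, h2, h3]
  field_simp
  have : 4 * Real.sinh (t/4)^2 = 2 * (Real.cosh (t/2) - 1) := by rw [h4]; ring
  linear_combination (1/2) * (2 * Real.cosh (t/2) + 1) * this

lemma hasDerivAt_qaux (t : ℝ) : HasDerivAt qaux (qaux' t) t := by
  have hc : Real.cosh (t/4) ≠ 0 := (Real.cosh_pos _).ne'
  have hc2 : Real.cosh (t/2) ≠ 0 := (Real.cosh_pos _).ne'
  have e4 : HasDerivAt (fun t : ℝ => t/4) (1/4) t := (hasDerivAt_id t).div_const 4
  have e2 : HasDerivAt (fun t : ℝ => t/2) (1/2) t := (hasDerivAt_id t).div_const 2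
  have hd := ((e4.sinh).div (e4.cosh) hc).mul
    (((hasDerivAt_const t (1:ℝ)).div (e2.cosh.const_mul 2) (by simpa using hc2)).const_add 1)
  refine hd.congr_deriv ?_
  unfold qaux'
  have := Real.cosh_sq (t/4)
  simp only [Pi.div_apply]
  field_simp
  rw [this]
  ring

lemma abs_qaux'_le (t : ℝ) (ht : 0 ≤ t) : |qaux' t| ≤ 2 * Real.exp (-(1/2) * t) := by
  have c4 : 0 < Real.cosh (t/4) := Real.cosh_pos _
  have c2 : 1 ≤ Real.cosh (t/2) := Real.one_le_cosh _
  have s4 : 0 ≤ Real.sinh (t/4) := Real.sinh_nonneg_iff.mpr (by linarith)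
  have s2 : 0 ≤ Real.sinh (t/2) := Real.sinh_nonneg_iff.mpr (by linarith)
  have sc4 := sinh_lt_cosh' (t/4)
  have sc2 := sinh_lt_cosh' (t/2)
  have h1 : (1/4) / Real.cosh (t/4)^2 ≤ Real.exp (-(1/2) * t) := by
    rw [div_le_iff₀ (by positivity)]
    have := half_exp_le_cosh (t/4)
    have h : (Real.exp (t/4)/2)^2 ≤ Real.cosh (t/4)^2 := by gcongr
    have h' : Real.exp (-(1/2) * t) * (Real.exp (t/4)/2)^2 = 1/4 := by
      rw [div_pow, ← Real.exp_nat_mul, mul_div_assoc', ← Real.exp_add]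
      ring_nf; simp
    rw [← h']
    gcongr
  have h2 : 1 + 1/(2 * Real.cosh (t/2)) ≤ 3/2 := by
    have : 1/(2 * Real.cosh (t/2)) ≤ 1/2 := by
      apply one_div_le_one_div_of_le <;> linarith
    linarith
  have h3 : Real.sinh (t/4) / Real.cosh (t/4) ≤ 1 := by
    rw [div_le_one c4]; exact sc4
  have h4 : Real.sinh (t/2) / (4 * Real.cosh (t/2)^2) ≤ (1/2) * Real.exp (-(1/2) * t) := by
    rw [div_le_iff₀ (by positivity)]
    have := half_exp_le_cosh (t/2)
    have h' : Real.exp (-(1/2) * t) * Real.exp (t/2) = 1 := by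
      rw [← Real.exp_add]; ring_nf; simp
    have he := Real.exp_pos (-(1/2) * t)
    have : 1 / 2 ≤ Real.exp (-(1/2) * t) * Real.cosh (t/2) := by nlinarith
    nlinarith
  unfold qaux'
  rw [abs_le]
  have hA : 0 ≤ (1/4) / Real.cosh (t/4)^2 * (1 + 1/(2 * Real.cosh (t/2))) := by positivity
  have hA' : (1/4) / Real.cosh (t/4)^2 * (1 + 1/(2 * Real.cosh (t/2))) ≤ Real.exp (-(1/2) * t) * (3/2) := by
    gcongr
  have hB : 0 ≤ Real.sinh (t/4) / Real.cosh (t/4) * ((Real.sinh (t/2) / (4 * Real.cosh (t/2)^2))) := by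
    positivity
  have hB' : Real.sinh (t/4) / Real.cosh (t/4) * ((Real.sinh (t/2) / (4 * Real.cosh (t/2)^2)))
      ≤ 1 * ((1/2) * Real.exp (-(1/2) * t)) := by
    gcongr
  constructor <;> nlinarith [Real.exp_pos (-(1/2) * t)]

lemma cosh_sub_one (t : ℝ) : Real.cosh t - 1 = 2 * Real.sinh (t/2)^2 := by
  have := Real.cosh_two_mul (t/2)
  rw [show 2 * (t/2) = t by ring, Real.cosh_sq] at this
  rw [this]; ring

lemma integrable_sinh_gauss (w : ℂ) (hw : 0 < w.re) : IntegrableOn (fun t : ℝ =>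
    Complex.exp (-w * ((Real.cosh t - 1 : ℝ) : ℂ)) * (Real.cosh (t/2) : ℝ)) (Set.Ioi 0) := by
  have h1 := ((integrable_kint 1 w hw).norm).const_mul (‖Complex.exp w‖)
  refine h1.mono' (by fun_prop) ?_
  filter_upwards with t
  rw [norm_mul, norm_mul, ← mul_assoc, ← norm_mul (Complex.exp w), ← Complex.exp_add]
  have : w + -w * ((Real.cosh t : ℝ):ℂ) = -w * ((Real.cosh t - 1 : ℝ) : ℂ) := by push_cast; ring
  rw [this]
  gcongr
  rw [Complex.norm_real, Complex.norm_real, Real.norm_of_nonneg (Real.cosh_pos _).le,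
    Real.norm_of_nonneg (by have := Real.cosh_pos t; positivity), pow_one, Real.cosh_le_cosh]
  rw [abs_div]
  have := abs_nonneg t
  simp

lemma gauss_part (w : ℂ) (hw : 0 < w.re) :
    ∫ t in Set.Ioi (0:ℝ), Complex.exp (-w * ((Real.cosh t - 1 : ℝ) : ℂ)) * (Real.cosh (t/2) : ℝ)
      = ((Real.pi : ℂ) / (2 * w)) ^ (1/2 : ℂ) := by
  have hre : 0 < (2 * w).re := by simpa using hw
  have hsub := integral_deriv_smul_comp_Ioi (a := 0) (f := fun t : ℝ => Real.sinh (t/2))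
    (f' := fun t => Real.cosh (t/2) * (1/2)) (g := fun r : ℝ => Complex.exp (-(2*w) * (r:ℂ)^2))
    (by fun_prop) ?_ ?_ (by fun_prop) ?_ ?_
  · rw [show Real.sinh (0/2) = 0 by simp, integral_gaussian_complex_Ioi hre] at hsub
    have h2 : ∀ t : ℝ, (Real.cosh (t/2) * (1/2)) • ((fun r : ℝ => Complex.exp (-(2*w) * (r:ℂ)^2)) ∘
        (fun t : ℝ => Real.sinh (t/2))) t = (1/2) * (Complex.exp (-w * ((Real.cosh t - 1 : ℝ) : ℂ)) * (Real.cosh (t/2) : ℝ)) := by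
      intro t
      rw [cosh_sub_one]
      simp only [Function.comp]
      rw [Complex.real_smul]
      push_cast
      ring_nf
    simp_rw [h2] at hsub
    rw [integral_const_mul] at hsub
    linear_combination 2 * hsub
  · apply tendsto_atTop_mono' (f₁ := fun t : ℝ => t/2)
    · filter_upwards [eventually_ge_atTop 0] with t ht
      exact Real.self_le_sinh_iff.mpr (by linarith)
    · exact tendsto_id.atTop_div_const (by norm_num)
  · intro t ht
    exact (((hasDerivAt_id t).div_const 2).sinh).hasDerivWithinAt
  · exact (integrable_cexp_neg_mul_sq hre).integrableOn
  · rw [integrableOn_Ici_iff_integrableOn_Ioi]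
    have := (integrable_sinh_gauss w hw).const_mul (1/2)
    refine this.congr ?_
    filter_upwards with t
    rw [cosh_sub_one]
    simp only [Function.comp]
    rw [Complex.real_smul]
    push_cast
    ring_nf

lemma Psi_asymp (w : ℂ) (hw : 0 < w.re) :
    ‖Psi w - w * ((Real.pi : ℂ) / (2 * w)) ^ (1/2 : ℂ) * Complex.exp (-w)‖ ≤ 4 * Real.exp (-w.re) := by
  set E : ℝ → ℂ := fun t => Complex.exp (-w * ((Real.cosh t - 1 : ℝ) : ℂ)) with hE
  have hEn : ∀ t, ‖E t‖ ≤ 1 := by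
    intro t
    rw [hE, Complex.norm_exp, Complex.re_mul_ofReal, Real.exp_le_one_iff, Complex.neg_re]
    nlinarith [Real.one_le_cosh t]
  have hK : kint 1 w = Complex.exp (-w) * ∫ t in Set.Ioi (0:ℝ), E t * (Real.cosh t : ℝ) := by
    unfold kint
    rw [← integral_const_mul]
    congr 1; ext t
    rw [hE]
    simp only
    rw [← mul_assoc, ← Complex.exp_add]
    congr 2
    · push_cast; ring
    · simp
  have hi1 : IntegrableOn (fun t => E t * (Real.cosh t : ℝ)) (Set.Ioi 0) := by
    have := (integrable_kint 1 w hw).const_mul (Complex.exp w)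
    refine this.congr ?_
    filter_upwards with t
    rw [← mul_assoc, ← Complex.exp_add, hE]
    congr 2
    · push_cast; ring
    · simp
  have hi2 := integrable_sinh_gauss w hw
  have hsplit : ∫ t in Set.Ioi (0:ℝ), E t * (Real.cosh t : ℝ) =
      ((Real.pi : ℂ) / (2 * w)) ^ (1/2 : ℂ) +
      ∫ t in Set.Ioi (0:ℝ), (qaux t : ℂ) * (E t * (Real.sinh t : ℝ)) := by
    rw [← gauss_part w hw, ← integral_add hi2]
    · congr 1; ext t
      have := qaux_mul_sinh t
      have h' : (qaux t : ℂ) * (Real.sinh t : ℝ) = (Real.cosh t : ℝ) - (Real.cosh (t/2) : ℝ) := by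
        exact_mod_cast this
      linear_combination (-E t) * h'
    · refine (hi1.sub hi2).congr ?_
      filter_upwards with t
      have := qaux_mul_sinh t
      have h' : (qaux t : ℂ) * (Real.sinh t : ℝ) = (Real.cosh t : ℝ) - (Real.cosh (t/2) : ℝ) := by
        exact_mod_cast this
      simp only [Pi.sub_apply]
      linear_combination (-E t) * h'
  have hiq : IntegrableOn (fun t => (qaux t : ℂ) * (E t * (Real.sinh t : ℝ))) (Set.Ioi 0) := by
    refine (hi1.sub hi2).congr ?_
    filter_upwards with t
    have := qaux_mul_sinh t
    have h' : (qaux t : ℂ) * (Real.sinh t : ℝ) = (Real.cosh t : ℝ) - (Real.cosh (t/2) : ℝ) := by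
      exact_mod_cast this
    simp only [Pi.sub_apply]
    linear_combination (-E t) * h'
  have hexp : IntegrableOn (fun t : ℝ => 2 * Real.exp (-(1/2) * t)) (Set.Ioi 0) :=
    (integrableOn_exp_mul_Ioi (by norm_num) 0).const_mul 2
  have hEc : Continuous E := by rw [hE]; fun_prop
  have hqc : Continuous qaux' := by
    unfold qaux'
    have h4 : ∀ t : ℝ, Real.cosh (t/4) ≠ 0 := fun t => (Real.cosh_pos _).ne'
    have h2 : ∀ t : ℝ, Real.cosh (t/2) ≠ 0 := fun t => (Real.cosh_pos _).ne'
    fun_prop (disch := intro t; simp [h4, h2])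
  have hbd : ∀ᵐ t ∂(volume.restrict (Set.Ioi (0:ℝ))), ‖(qaux' t : ℂ) * E t‖ ≤ 2 * Real.exp (-(1/2) * t) := by
    filter_upwards [ae_restrict_mem measurableSet_Ioi] with t ht
    rw [norm_mul, Complex.norm_real, Real.norm_eq_abs]
    calc _ ≤ |qaux' t| * 1 := by gcongr; exact hEn t
      _ ≤ _ := by rw [mul_one]; exact abs_qaux'_le t (le_of_lt ht)
  have hiq' : IntegrableOn (fun t => (qaux' t : ℂ) * E t) (Set.Ioi 0) := by
    refine hexp.mono' ?_ hbd
    exact ((Complex.continuous_ofReal.comp hqc).mul hEc).aestronglyMeasurable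
  have hq1 : ∀ t, |qaux t| ≤ 2 := by
    intro t
    unfold qaux
    rw [abs_mul, abs_div, abs_of_pos (Real.cosh_pos (t/4))]
    have h1 : |Real.sinh (t/4)| / Real.cosh (t/4) ≤ 1 := by
      rw [div_le_one (Real.cosh_pos _), ← Real.sqrt_sq_eq_abs]
      apply Real.sqrt_le_iff.mpr
      exact ⟨(Real.cosh_pos _).le, by rw [Real.cosh_sq (t/4)]; linarith⟩
    have h2 : |1 + 1/(2 * Real.cosh (t/2))| ≤ 2 := by
      have c2 : 1 ≤ Real.cosh (t/2) := Real.one_le_cosh _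
      rw [abs_of_pos (by positivity)]
      have : 1/(2 * Real.cosh (t/2)) ≤ 1/2 := by
        apply one_div_le_one_div_of_le <;> linarith
      linarith
    calc _ ≤ (1:ℝ) * 2 := by gcongr
      _ = 2 := by norm_num
  have hparts : w * ∫ t in Set.Ioi (0:ℝ), (qaux t : ℂ) * (E t * (Real.sinh t : ℝ)) =
      ∫ t in Set.Ioi (0:ℝ), (qaux' t : ℂ) * E t := by
    have h := integral_Ioi_mul_deriv_eq_deriv_mul (a := (0:ℝ)) (a' := (0:ℂ)) (b' := 0)
      (u := fun t => (qaux t : ℂ)) (u' := fun t => (qaux' t : ℂ)) (v := E)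
      (v' := fun t => -w * (E t * (Real.sinh t : ℝ))) ?_ ?_ ?_ hiq' ?_ ?_
    · have h2 : ∀ t, (qaux t : ℂ) * (-w * (E t * (Real.sinh t : ℝ))) = -w * ((qaux t : ℂ) * (E t * (Real.sinh t : ℝ))) := by
        intro t; ring
      simp_rw [h2] at h
      rw [integral_const_mul] at h
      linear_combination -h
    · intro t ht
      exact (hasDerivAt_qaux t).ofReal_comp
    · intro t ht
      have hc : HasDerivAt (fun t : ℝ => ((Real.cosh t - 1 : ℝ) : ℂ)) (Real.sinh t : ℂ) t :=
        ((Real.hasDerivAt_cosh t).sub_const 1).ofReal_comp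
      refine ((hc.const_mul (-w)).cexp).congr_deriv ?_
      rw [hE]; ring
    · refine (hiq.const_mul (-w)).congr ?_
      filter_upwards with t
      simp only [Pi.mul_apply]; ring
    · have h1 : Tendsto (fun t => (qaux t : ℂ) * E t) (nhds 0) (nhds ((qaux 0 : ℂ) * E 0)) := by
        apply Tendsto.mul _ (hEc.tendsto 0)
        exact (Complex.continuous_ofReal.tendsto _).comp (hasDerivAt_qaux 0).continuousAt.tendsto
      have h0 : qaux 0 = 0 := by simp [qaux]
      rw [h0] at h1
      simp only [Complex.ofReal_zero, zero_mul] at h1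
      exact h1.mono_left nhdsWithin_le_nhds
    · have h4 : Tendsto (fun t : ℝ => 2 * Real.exp (-(w.re * (Real.cosh t - 1)))) atTop (nhds 0) := by
        have hc : Tendsto (fun t => w.re * (Real.cosh t - 1)) atTop atTop := by
          apply Tendsto.const_mul_atTop hw
          exact tendsto_atTop_add_const_right _ _ (tendsto_atTop_mono self_le_cosh tendsto_id)
        have := (Real.tendsto_exp_neg_atTop_nhds_zero.comp hc).const_mul 2
        simpa [Function.comp_def] using this
      refine squeeze_zero_norm (fun t => ?_) h4
      simp only [Pi.mul_apply]
      rw [norm_mul, Complex.norm_real, Real.norm_eq_abs]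
      refine mul_le_mul (hq1 t) ?_ (norm_nonneg _) (by norm_num)
      rw [hE, Complex.norm_exp, Complex.re_mul_ofReal]
      simp
  have hfin : Psi w - w * ((Real.pi : ℂ) / (2 * w)) ^ (1/2 : ℂ) * Complex.exp (-w) =
      Complex.exp (-w) * ∫ t in Set.Ioi (0:ℝ), (qaux' t : ℂ) * E t := by
    rw [← hparts]
    unfold Psi
    rw [hK, hsplit]
    ring
  rw [hfin, norm_mul, Complex.norm_exp, Complex.neg_re, mul_comm]
  gcongr
  refine (norm_integral_le_of_norm_le hexp hbd).trans ?_
  rw [integral_const_mul, integral_exp_mul_Ioi (by norm_num)]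
  norm_num

end

section
open Filter MeasureTheory

/-- principal square root -/
noncomputable def csqrt (z : ℂ) : ℂ := z ^ (2⁻¹ : ℂ)

lemma csqrt_sq (z : ℂ) : csqrt z ^ 2 = z := by
  unfold csqrt
  exact_mod_cast Complex.cpow_nat_inv_pow z (two_ne_zero)

lemma csqrt_re (z : ℂ) : (csqrt z).re = Real.sqrt ((‖z‖ + z.re)/2) := by
  unfold csqrt
  rw [Complex.cpow_inv_two_re]

lemma csqrt_re_pos {z : ℂ} (hz : z ∈ Complex.slitPlane) : 0 < (csqrt z).re := by
  rw [csqrt_re]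
  apply Real.sqrt_pos.mpr
  have h1 : -‖z‖ ≤ z.re := (abs_le.mp (Complex.abs_re_le_norm z)).1
  have h2 : -‖z‖ ≠ z.re := by
    intro h
    rcases hz with hz | hz
    · have := norm_nonneg z; linarith
    · have h3 := Complex.abs_re_lt_norm.mpr hz
      rw [← h, abs_neg, abs_norm] at h3
      exact lt_irrefl _ h3
  have := lt_of_le_of_ne h1 h2
  linarith

lemma csqrt_unique {z v : ℂ} (hv : 0 < v.re) (h : v^2 = z) : csqrt z = v := by
  have hz : z ∈ Complex.slitPlane := by
    rw [← h, Complex.mem_slitPlane_iff_not_le_zero]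
    intro hle
    rw [Complex.le_def] at hle
    simp only [sq, Complex.mul_re, Complex.mul_im, Complex.zero_re, Complex.zero_im] at hle
    have him : v.im = 0 := by
      have : v.re * v.im = 0 := by linarith [hle.2]
      rcases mul_eq_zero.mp this with h | h
      · linarith
      · exact h
    rw [him] at hle
    nlinarith [hle.1]
  have h1 := csqrt_re_pos hz
  have h2 : csqrt z ^ 2 = v ^ 2 := by rw [csqrt_sq, h]
  rcases sq_eq_sq_iff_eq_or_eq_neg.mp h2 with h3 | h3
  · exact h3
  · rw [h3] at h1
    simp at h1
    linarith

lemma differentiableAt_csqrt {z : ℂ} (hz : z ∈ Complex.slitPlane) : DifferentiableAt ℂ csqrt z := by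
  unfold csqrt
  exact DifferentiableAt.cpow_const (f := fun z => z) differentiableAt_id hz

lemma isOpen_rhp : IsOpen {z : ℂ | 0 < z.re} := isOpen_lt continuous_const Complex.continuous_re

lemma rhp_identity (f g : ℂ → ℂ) (hf : DifferentiableOn ℂ f {z : ℂ | 0 < z.re})
    (hg : DifferentiableOn ℂ g {z : ℂ | 0 < z.re}) (h : ∀ x : ℝ, 0 < x → f x = g x)
    (z : ℂ) (hz : 0 < z.re) : f z = g z := by
  have hf' := hf.analyticOnNhd isOpen_rhp
  have hg' := hg.analyticOnNhd isOpen_rhp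
  refine hf'.eqOn_of_preconnected_of_frequently_eq hg' (convex_halfSpace_re_gt 0).isPreconnected
    (z₀ := 1) (by simp) ?_ hz
  have hT : Tendsto (fun n : ℕ => ((1 + 1/((n:ℝ)+1) : ℝ) : ℂ)) atTop (nhdsWithin 1 {1}ᶜ) := by
    rw [tendsto_nhdsWithin_iff]
    constructor
    · have h1 : Tendsto (fun n : ℕ => (1 + 1/((n:ℝ)+1) : ℝ)) atTop (nhds (1+0)) :=
        tendsto_const_nhds.add tendsto_one_div_add_atTop_nhds_zero_nat
      rw [add_zero] at h1
      have := (Complex.continuous_ofReal.tendsto 1).comp h1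
      simpa [Function.comp_def] using this
    · filter_upwards with n
      simp only [Set.mem_compl_iff, Set.mem_singleton_iff]
      intro h
      have h2 : (1 + 1/((n:ℝ)+1) : ℝ) = 1 := by exact_mod_cast h
      have : (0:ℝ) < 1/((n:ℝ)+1) := by positivity
      linarith
  refine hT.frequently (Frequently.of_forall fun n => ?_)
  apply h
  positivity

lemma integrable_recip_exp (A : ℝ) (hA : 0 < A) (x : ℝ) (hx : 0 < x) :
    IntegrableOn (fun a : ℝ => Real.exp (-x * a) * (a⁻¹ * Real.exp (-A / a))) (Set.Ioi 0) := by
  have h1 : IntegrableOn (fun a : ℝ => A⁻¹ * Real.exp (-x * a)) (Set.Ioi 0) :=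
    (integrableOn_exp_mul_Ioi (by linarith) 0).const_mul _
  refine h1.mono' (Measurable.aestronglyMeasurable (by fun_prop)) ?_
  filter_upwards [ae_restrict_mem measurableSet_Ioi] with a ha
  have ha' : 0 < a := ha
  rw [Real.norm_of_nonneg (by positivity), mul_comm]
  gcongr
  have h2 : A / a ≤ Real.exp (A / a) := by linarith [Real.add_one_le_exp (A/a)]
  have h3 : Real.exp (-A/a) = (Real.exp (A/a))⁻¹ := by rw [← Real.exp_neg]; ring_nf
  rw [h3]
  rw [← mul_inv]
  apply inv_anti₀ hA
  calc A = a * (A/a) := by field_simp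
    _ ≤ _ := by gcongr

lemma bessel_real (A B : ℝ) (hA : 0 < A) (hB : 0 < B) :
    ∫ a in Set.Ioi (0:ℝ), Complex.exp (-(B:ℂ) * a) * ((a⁻¹ * Real.exp (-A / a) : ℝ) : ℂ) =
      2 * kint 0 ((2 * Real.sqrt (A * B) : ℝ) : ℂ) := by
  set c := Real.sqrt (A/B) with hc
  have hc0 : 0 < c := Real.sqrt_pos.mpr (by positivity)
  have hs0 : 0 < Real.sqrt (A*B) := Real.sqrt_pos.mpr (by positivity)
  have h1 : B * c = Real.sqrt (A*B) := by
    rw [eq_comm, Real.sqrt_eq_iff_mul_self_eq (by positivity) (by positivity)]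
    have := Real.mul_self_sqrt (show 0 ≤ A/B by positivity)
    rw [← hc, eq_div_iff hB.ne'] at this
    linear_combination (-B) * this
  have h2 : A / c = Real.sqrt (A*B) := by
    rw [eq_comm, Real.sqrt_eq_iff_mul_self_eq (by positivity) (by positivity)]
    have := Real.mul_self_sqrt (show 0 ≤ A/B by positivity)
    rw [← hc, eq_div_iff hB.ne'] at this
    field_simp
    linear_combination this
  have himg : (fun t : ℝ => c * Real.exp t) '' Set.univ = Set.Ioi 0 := by
    ext a
    simp only [Set.image_univ, Set.mem_range, Set.mem_Ioi]
    constructor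
    · rintro ⟨t, rfl⟩; positivity
    · intro ha
      exact ⟨Real.log (a/c), by rw [Real.exp_log (by positivity)]; field_simp⟩
  rw [← himg, integral_image_eq_integral_abs_deriv_smul MeasurableSet.univ
    (f' := fun t => c * Real.exp t)]
  · rw [Measure.restrict_univ]
    have hk : kint 0 ((2 * Real.sqrt (A * B) : ℝ) : ℂ) =
        ((∫ t in Set.Ioi (0:ℝ), Real.exp (-(2 * Real.sqrt (A*B)) * Real.cosh t) : ℝ) : ℂ) := by
      unfold kint
      rw [← integral_complex_ofReal]
      congr 1; ext t
      push_cast; simp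
    rw [hk]
    have hk2 := integral_comp_abs (f := fun t => Real.exp (-(2 * Real.sqrt (A*B)) * Real.cosh t))
    have hk3 := congrArg (fun x : ℝ => (x:ℂ)) hk2
    simp only [Complex.ofReal_mul, Complex.ofReal_ofNat] at hk3
    rw [← hk3, ← integral_complex_ofReal]
    congr 1; ext t
    rw [abs_of_pos (by positivity), Real.cosh_abs, Complex.real_smul]
    rw [← Complex.ofReal_neg, ← Complex.ofReal_mul, ← Complex.ofReal_exp, ← Complex.ofReal_mul,
      ← Complex.ofReal_mul]
    rw [show c * Real.exp t * (Real.exp (-B * (c * Real.exp t)) * ((c * Real.exp t)⁻¹ * Real.exp (-A / (c * Real.exp t)))) =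
      Real.exp (-B * (c * Real.exp t)) * Real.exp (-A / (c * Real.exp t)) by field_simp, ← Real.exp_add]
    congr 2
    rw [Real.cosh_eq, neg_mul, ← mul_assoc, h1, neg_div, ← div_div, h2, Real.exp_neg]
    field_simp
    ring
  · intro t _
    exact ((Real.hasDerivAt_exp t).const_mul c).hasDerivWithinAt
  · intro s _ t _ h
    simp only at h
    exact Real.exp_injective (mul_left_cancel₀ hc0.ne' h)

lemma mem_slit_of_re {z : ℂ} (hz : 0 < z.re) : z ∈ Complex.slitPlane := Or.inl hz

lemma bessel_complex (A : ℝ) (hA : 0 < A) (B : ℂ) (hB : 0 < B.re) :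
    ∫ a in Set.Ioi (0:ℝ), Complex.exp (-B * a) * ((a⁻¹ * Real.exp (-A / a) : ℝ) : ℂ) =
      2 * kint 0 (2 * csqrt (A * B)) := by
  refine rhp_identity (fun B => ∫ a in Set.Ioi (0:ℝ), Complex.exp (-B * a) *
    ((a⁻¹ * Real.exp (-A / a) : ℝ) : ℂ)) (fun B => 2 * kint 0 (2 * csqrt (A * B))) ?_ ?_ ?_ B hB
  · intro z hz
    exact (hasDerivAt_laplace (volume.restrict (Set.Ioi (0:ℝ))) (fun a => a)
      (fun a => a⁻¹ * Real.exp (-A/a)) (by fun_prop) (by fun_prop)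
      (by filter_upwards [ae_restrict_mem measurableSet_Ioi] with a ha using le_of_lt ha)
      (integrable_recip_exp A hA) z hz).2.differentiableAt.differentiableWithinAt
  · intro z hz
    have hz' : 0 < z.re := hz
    have hs : (A:ℂ) * z ∈ Complex.slitPlane := by
      apply mem_slit_of_re
      rw [Complex.re_ofReal_mul]; positivity
    have h1 : DifferentiableAt ℂ (fun z => 2 * csqrt (A * z)) z :=
      ((differentiableAt_csqrt hs).comp z (by fun_prop : DifferentiableAt ℂ (fun z => (A:ℂ) * z) z)).const_mul 2
    have h2 : 0 < (2 * csqrt (A * z)).re := by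
      have := csqrt_re_pos hs
      simpa using this
    exact (((hasDerivAt_kint 0 _ h2).differentiableAt.comp z h1).const_mul 2).differentiableWithinAt
  · intro x hx
    rw [bessel_real A x hA hx]
    congr 2
    have : csqrt (A * x) = ((Real.sqrt (A*x) : ℝ) : ℂ) := by
      apply csqrt_unique
      · simp; positivity
      · rw [← Complex.ofReal_pow, Real.sq_sqrt (by positivity)]; push_cast; rfl
    rw [this]; push_cast; rfl

end

section
open Filter MeasureTheory

lemma norm_kint_zero_le' (w : ℂ) (hw : 0 < w.re) : ‖kint 0 w‖ ≤ 60 / w.re ^ 4 := by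
  refine (norm_kint_zero_le w hw).trans ?_
  set x := w.re
  rw [le_div_iff₀ (by positivity)]
  have h1 : Real.sqrt (Real.pi / x) ≤ 2 * (1 + 1/x) / 2 := by
    rw [Real.sqrt_le_left (by positivity)]
    have : Real.pi / x = Real.pi * (1/x) := by ring
    rw [this]
    have hy : 0 < 1/x := by positivity
    nlinarith [Real.pi_lt_four, sq_nonneg (1 - 1/x)]
  have h3 := Real.pow_div_factorial_le_exp x hw.le 3
  have h4 := Real.pow_div_factorial_le_exp x hw.le 4
  norm_num [Nat.factorial] at h3 h4
  have h5 : Real.exp (-x) * Real.exp x = 1 := by rw [← Real.exp_add]; simp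
  have he := Real.exp_pos (-x)
  calc Real.exp (-x) * Real.sqrt (Real.pi / x) * x^4 ≤ Real.exp (-x) * (2 * (1 + 1/x) / 2) * x^4 := by gcongr
    _ = Real.exp (-x) * (x^4 + x^3) := by field_simp
    _ ≤ Real.exp (-x) * (30 * Real.exp x) := by gcongr; linarith
    _ ≤ 60 := by nlinarith

/-- The function to which Poisson summation is applied. -/
noncomputable def pf (A δ : ℝ) (a : ℝ) : ℂ :=
  ((A⁻¹ * ((a/A)⁻¹ * expNegInvGlue (a/A)) * Real.exp (-δ * a) : ℝ) : ℂ)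

lemma pf_nonpos (A δ a : ℝ) (hA : 0 < A) (ha : a ≤ 0) : pf A δ a = 0 := by
  unfold pf
  rw [expNegInvGlue.zero_of_nonpos (div_nonpos_of_nonpos_of_nonneg ha hA.le)]
  simp

lemma pf_pos (A δ a : ℝ) (hA : 0 < A) (ha : 0 < a) :
    pf A δ a = ((a⁻¹ * Real.exp (-A/a) * Real.exp (-δ * a) : ℝ) : ℂ) := by
  unfold pf
  have : ¬ (a/A ≤ 0) := not_le.mpr (by positivity)
  rw [expNegInvGlue, if_neg this]
  congr 1
  have h2 : -(a/A)⁻¹ = -A/a := by rw [inv_div]; ring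
  rw [h2]
  field_simp

lemma continuous_pf (A δ : ℝ) : Continuous (pf A δ) := by
  unfold pf
  have h1 := expNegInvGlue.continuous_polynomial_eval_inv_mul (Polynomial.X)
  simp only [Polynomial.eval_X] at h1
  have h2 : Continuous (fun a : ℝ => (a/A)⁻¹ * expNegInvGlue (a/A)) :=
    h1.comp (continuous_id.div_const A)
  have h3 : Continuous (fun a : ℝ => A⁻¹ * ((a/A)⁻¹ * expNegInvGlue (a/A)) * Real.exp (-δ * a)) := by
    fun_prop
  exact Complex.continuous_ofReal.comp h3

lemma norm_pf_le (A δ : ℝ) (hA : 0 < A) (hδ : 0 < δ) (a : ℝ) (ha : a ≠ 0) :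
    ‖pf A δ a‖ ≤ (12 / (A^2 * δ^3)) * |a| ^ (-2:ℝ) := by
  rcases le_or_gt a 0 with h | h
  · rw [pf_nonpos A δ a hA h]; simp; positivity
  rw [pf_pos A δ a hA h, Complex.norm_real, Real.norm_of_nonneg (by positivity), abs_of_pos h,
    Real.rpow_neg h.le, Real.rpow_two]
  have h2 := Real.pow_div_factorial_le_exp (A/a) (by positivity) 2
  have h3 := Real.pow_div_factorial_le_exp (δ*a) (by positivity) 3
  norm_num [Nat.factorial] at h2 h3
  have e2 : Real.exp (-A/a) = (Real.exp (A/a))⁻¹ := by rw [← Real.exp_neg]; ring_nf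
  have e3 : Real.exp (-δ*a) = (Real.exp (δ*a))⁻¹ := by rw [← Real.exp_neg]; ring_nf
  rw [e2, e3]
  have g2 : (Real.exp (A/a))⁻¹ ≤ ((A/a)^2/2)⁻¹ := inv_anti₀ (by positivity) h2
  have g3 : (Real.exp (δ*a))⁻¹ ≤ ((δ*a)^3/6)⁻¹ := inv_anti₀ (by positivity) h3
  calc _ ≤ a⁻¹ * ((A/a)^2/2)⁻¹ * ((δ*a)^3/6)⁻¹ := by gcongr
    _ = _ := by field_simp; norm_num

open scoped FourierTransform in
lemma fourier_pf (A δ : ℝ) (hA : 0 < A) (hδ : 0 < δ) (ξ : ℝ) :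
    𝓕 (pf A δ) ξ = 2 * kint 0 (2 * csqrt (A * (δ + 2 * Real.pi * ξ * Complex.I))) := by
  rw [Real.fourier_real_eq_integral_exp_smul]
  rw [← bessel_complex A hA _ (by simpa using hδ)]
  rw [← integral_indicator measurableSet_Ioi]
  congr 1; ext a
  by_cases h : 0 < a
  · rw [Set.indicator_of_mem (by exact h), pf_pos A δ a hA h, smul_eq_mul]
    rw [Complex.ofReal_mul _ (Real.exp (-δ * a)), Complex.ofReal_exp, mul_comm, mul_assoc,
      ← Complex.exp_add, mul_comm]
    congr 2
    push_cast; ring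
  · rw [Set.indicator_of_notMem (by simpa using h), pf_nonpos A δ a hA (not_lt.mp h)]
    simp

lemma csqrt_re_ge (A δ ξ : ℝ) (hA : 0 < A) (hδ : 0 ≤ δ) :
    Real.sqrt (A * Real.pi * |ξ|) ≤ (csqrt (A * (δ + 2 * Real.pi * ξ * Complex.I))).re := by
  rw [csqrt_re]
  apply Real.sqrt_le_sqrt
  have h1 : ((A:ℂ) * (δ + 2 * Real.pi * ξ * Complex.I)).re = A * δ := by simp
  have h2 : ((A:ℂ) * (δ + 2 * Real.pi * ξ * Complex.I)).im = A * (2 * Real.pi * ξ) := by simp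
  have h3 := Complex.abs_im_le_norm ((A:ℂ) * (δ + 2 * Real.pi * ξ * Complex.I))
  rw [h2, abs_mul, abs_mul, abs_of_pos hA, abs_of_pos (by positivity)] at h3
  rw [h1]
  have : 0 ≤ A * δ := by positivity
  linarith

lemma norm_dual_term_le (A δ : ℝ) (hA : 0 < A) (hδ : 0 ≤ δ) (k : ℤ) (hk : k ≠ 0) :
    ‖kint 0 (2 * csqrt (A * (δ + 2 * Real.pi * k * Complex.I)))‖ ≤ 1 / A^2 * (1/(k:ℝ)^2) := by
  have h1 := csqrt_re_ge A δ k hA hδ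
  have hk' : 0 < |(k:ℝ)| := by simpa using hk
  have hs : 0 < Real.sqrt (A * Real.pi * |(k:ℝ)|) := Real.sqrt_pos.mpr (by positivity)
  rw [Complex.ofReal_intCast] at h1
  set v := csqrt (A * (δ + 2 * Real.pi * k * Complex.I))
  have h2 : (2 * v).re = 2 * v.re := by simp
  have hv : 0 < v.re := by linarith
  refine (norm_kint_zero_le' (2*v) (by rw [h2]; linarith)).trans ?_
  rw [h2, mul_pow]
  have h4 : (A * Real.pi * |(k:ℝ)|)^2 ≤ v.re ^ 4 := by
    calc _ = Real.sqrt (A * Real.pi * |(k:ℝ)|)^4 := by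
          rw [show (4:ℕ) = 2 * 2 by norm_num, pow_mul, Real.sq_sqrt (by positivity)]
      _ ≤ _ := by gcongr
  rw [mul_pow, mul_pow, sq_abs] at h4
  have hk2 : 0 < (k:ℝ)^2 := by positivity
  rw [div_mul_div_comm, one_mul, div_le_div_iff₀ (by positivity) (by positivity)]
  have hpi : 9 ≤ Real.pi^2 := by nlinarith [Real.pi_gt_three]
  have : 9 * (A^2 * (k:ℝ)^2) ≤ Real.pi^2 * (A^2 * (k:ℝ)^2) := by gcongr
  nlinarith

lemma summable_dual (A δ : ℝ) (hA : 0 < A) (hδ : 0 ≤ δ) :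
    Summable (fun k : ℤ => kint 0 (2 * csqrt (A * (δ + 2 * Real.pi * k * Complex.I)))) := by
  have h1 : Summable (fun k : ℤ => 1/A^2 * (1/(k:ℝ)^2)) :=
    ((Real.summable_one_div_int_pow (p := 2)).mpr (by norm_num)).mul_left _
  refine Summable.of_norm_bounded_eventually h1 ?_
  have : ({0}ᶜ : Set ℤ) ∈ cofinite := (Set.finite_singleton 0).compl_mem_cofinite
  filter_upwards [this] with k hk
  exact norm_dual_term_le A δ hA hδ k hk

lemma poisson_pf (A δ : ℝ) (hA : 0 < A) (hδ : 0 < δ) :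
    ∑' a : ℕ+, (((a:ℝ)⁻¹ * Real.exp (-A/a) * Real.exp (-δ * a) : ℝ) : ℂ) =
      ∑' k : ℤ, 2 * kint 0 (2 * csqrt (A * (δ + 2 * Real.pi * k * Complex.I))) := by
  have hF : ∀ n : ℤ, FourierTransform.fourier (pf A δ) (n:ℝ) =
      2 * kint 0 (2 * csqrt (A * (δ + 2 * Real.pi * n * Complex.I))) := by
    intro n
    have := fourier_pf A δ hA hδ n
    rw [this, Complex.ofReal_intCast]
  have h := Real.tsum_eq_tsum_fourier_of_rpow_decay_of_summable (continuous_pf A δ) (b := 2)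
    (by norm_num) ?_ ?_ 0
  · simp only [zero_add] at h
    rw [← tsum_congr (fun n => hF n)]
    have h2 : ∀ n : ℤ, FourierTransform.fourier (pf A δ) (n:ℝ) * fourier n ((0:ℝ) : UnitAddCircle)
      = FourierTransform.fourier (pf A δ) (n:ℝ) := by
      intro n
      simp
    rw [tsum_congr h2] at h
    rw [← h]
    rw [← Function.Injective.tsum_eq (g := fun a : ℕ+ => ((a:ℕ):ℤ))]
    · apply tsum_congr
      intro a
      have ha : (0:ℝ) < ((a:ℕ):ℝ) := by exact_mod_cast a.pos
      have := pf_pos A δ a hA ha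
      rw [← this]; simp
    · intro a b hab
      simp only at hab
      exact PNat.coe_injective (by exact_mod_cast hab)
    · intro n hn
      simp only [Function.mem_support] at hn
      by_cases h0 : 0 < n
      · refine ⟨⟨n.toNat, by omega⟩, ?_⟩
        simp; omega
      · exfalso; apply hn
        apply pf_nonpos A δ _ hA
        exact_mod_cast not_lt.mp h0
  · apply Asymptotics.IsBigO.of_bound (12 / (A^2 * δ^3))
    have : ({0}ᶜ : Set ℝ) ∈ cocompact ℝ := (isCompact_singleton).compl_mem_cocompact
    filter_upwards [this] with a ha
    refine (norm_pf_le A δ hA hδ a ha).trans ?_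
    gcongr
    exact le_abs_self _
  · simp_rw [hF]
    exact (summable_dual A δ hA hδ.le).mul_left 2

end

section
open Filter MeasureTheory

lemma coth_aux (z : ℂ) (hz : 0 < z.im) :
    1 / z + ∑' n : ℕ+, (1 / (z - n) + 1 / (z + n)) =
     Real.pi * Complex.I - 2 * Real.pi * Complex.I * ∑' n : ℕ, Complex.exp (2 * Real.pi * Complex.I * z) ^ n := by
  have h1 := pi_mul_cot_pi_q_exp ⟨z, hz⟩
  have h2 := cot_series_rep (UpperHalfPlane.coe_mem_integerComplement ⟨z, hz⟩)
  rw [h2] at h1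
  exact h1

lemma coth_aux2 (q : ℂ) (hq : ‖q‖ < 1) : ∑' n : ℕ, q ^ n = 1 + ∑' n : ℕ+, q ^ (n:ℕ) := by
  have h := summable_geometric_of_norm_lt_one hq
  rw [h.tsum_eq_zero_add, pow_zero, tsum_pnat_eq_tsum_succ (f := fun n => q ^ n)]

lemma coth_series (y : ℝ) (hy : 0 < y) :
    ∑' h : ℕ+, ((2 * y / (y^2 + (h:ℝ)^2) : ℝ) : ℂ) =
      ((Real.pi - 1 / y : ℝ) : ℂ) + 2 * Real.pi * ∑' m : ℕ+, ((Real.exp (-2 * Real.pi * m * y) : ℝ) : ℂ) := by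
  have hz : 0 < ((y : ℂ) * Complex.I).im := by simpa using hy
  have h1 := coth_aux (y * Complex.I) hz
  have hq : ‖Complex.exp (2 * Real.pi * Complex.I * (y * Complex.I))‖ < 1 := by
    rw [Complex.norm_exp, Real.exp_lt_one_iff]
    simp
    positivity
  rw [coth_aux2 _ hq] at h1
  have e1 : ∀ n : ℕ+, (1 / ((y:ℂ) * Complex.I - n) + 1 / ((y:ℂ) * Complex.I + n)) =
      -Complex.I * ((2 * y / (y^2 + (n:ℝ)^2) : ℝ) : ℂ) := by
    intro n
    have hn : (0:ℝ) < n := by exact_mod_cast n.pos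
    have d1 : ((y:ℂ) * Complex.I - n) ≠ 0 := by
      intro h; have := congrArg Complex.im h; simp at this; linarith
    have d2 : ((y:ℂ) * Complex.I + n) ≠ 0 := by
      intro h; have := congrArg Complex.im h; simp at this; linarith
    have d3 : ((y:ℂ)^2 + (n:ℂ)^2) ≠ 0 := by
      have : (y^2 + (n:ℝ)^2) ≠ 0 := by positivity
      exact_mod_cast this
    have hI := Complex.I_mul_I
    generalize Complex.I = i at *
    push_cast
    rw [div_add_div _ _ d1 d2, mul_div_assoc', div_eq_div_iff (mul_ne_zero d1 d2) d3]
    linear_combination (2 * (y:ℂ)^3 * i) * hI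
  have e2 : ∀ n : ℕ+, Complex.exp (2 * Real.pi * Complex.I * (y * Complex.I)) ^ (n:ℕ) =
     ((Real.exp (-2 * Real.pi * n * y) : ℝ) : ℂ) := by
    intro n
    rw [← Complex.exp_nat_mul]
    push_cast
    congr 1
    ring_nf
    simp
  simp_rw [e1, e2] at h1
  rw [tsum_mul_left] at h1
  have hyc : (y:ℂ) ≠ 0 := by exact_mod_cast hy.ne'
  set S := ∑' h : ℕ+, ((2 * y / (y^2 + (h:ℝ)^2) : ℝ) : ℂ)
  set R := ∑' m : ℕ+, ((Real.exp (-2 * Real.pi * m * y) : ℝ) : ℂ)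
  have h4 : Complex.I * (1 / ((y:ℂ) * Complex.I) + -Complex.I * S) = Complex.I * (Real.pi * Complex.I - 2 * Real.pi * Complex.I * (1 + R)) := by
    rw [h1]
  have h5 : Complex.I * (1 / ((y:ℂ) * Complex.I)) = 1 / y := by field_simp
  rw [mul_add, h5] at h4
  push_cast
  linear_combination h4 + (S - Real.pi -2 * Real.pi * R) * Complex.I_mul_I

lemma tsum_pairs (g : ℕ+ → ℂ) (hg : Summable (fun p : ℕ+ × ℕ+ => g (p.1 * p.2))) :
    ∑' p : ℕ+ × ℕ+, g (p.1 * p.2) = ∑' n : ℕ+, (divfun n : ℂ) * g n := by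
  rw [← sigmaAntidiagonalEquivProd.tsum_eq]
  have hs := sigmaAntidiagonalEquivProd.summable_iff.mpr hg
  have key : ∀ c : (Σ n : ℕ+, Nat.divisorsAntidiagonal n),
      (sigmaAntidiagonalEquivProd c).1 * (sigmaAntidiagonalEquivProd c).2 = c.1 := by
    intro c
    have := sigmaAntidiagonalEquivProd_symm_apply_fst (sigmaAntidiagonalEquivProd c)
    rw [Equiv.symm_apply_apply] at this
    exact PNat.coe_injective (by rw [PNat.mul_coe]; exact this.symm)
  simp only [Function.comp_def, key] at hs ⊢
  rw [Summable.tsum_sigma hs]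
  refine tsum_congr fun n => ?_
  rw [tsum_fintype]
  have hc : (n:ℕ).divisorsAntidiagonal.card = (n:ℕ).divisors.card := by
    rw [← Nat.map_div_right_divisors, Finset.card_map]
  simp [divfun, hc]

lemma summable_pairs_real : Summable (fun p : ℕ+ × ℕ+ => 1 / (p.1:ℝ)^2 * (1 / (p.2:ℝ)^2)) := by
  have h : Summable (fun n : ℕ+ => 1/(n:ℝ)^2) := by
    have := (Real.summable_one_div_nat_pow (p := 2)).mpr (by norm_num)
    exact this.comp_injective PNat.coe_injective
  exact h.mul_of_nonneg h (fun _ => by positivity) (fun _ => by positivity)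

lemma tsum_int_split (f : ℤ → ℂ) (hf : Summable f) :
    ∑' k : ℤ, f k = f 0 + ∑' k : ℕ+, (f k + f (-(k:ℤ))) := by
  have h1 : Summable (fun n : ℕ => f (n + 1 : ℕ)) :=
    hf.comp_injective (i := fun n : ℕ => ((n+1:ℕ):ℤ)) (fun a b h => by simpa using h)
  have h2 : Summable (fun n : ℕ => f (-((n + 1 : ℕ):ℤ))) :=
    hf.comp_injective (i := fun n : ℕ => -((n+1:ℕ):ℤ)) (fun a b h => by simpa using h)
  have h3 := HasSum.of_add_one_of_neg_add_one (f := f) (by simpa using h1.hasSum) (by simpa using h2.hasSum)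
  rw [h3.tsum_eq, tsum_pnat_eq_tsum_succ (f := fun k : ℕ => f k + f (-(k:ℤ))), h1.tsum_add h2]
  simp; ring

end

section
open Filter MeasureTheory

lemma ta_series (Y : ℝ) (hY : 0 < Y) (a : ℕ+) :
    ∑' h : ℕ+, ((2 * Y / (Y^2 + ((a:ℝ) * h)^2) : ℝ) : ℂ) =
      ((Real.pi * (a:ℝ)⁻¹ - 1 / Y : ℝ) : ℂ) +
       2 * Real.pi * ∑' h : ℕ+, (((a:ℝ)⁻¹ * Real.exp (-(2 * Real.pi * h * Y) / a) : ℝ) : ℂ) := by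
  have ha : (0:ℝ) < a := by exact_mod_cast a.pos
  have h := coth_series (Y / a) (by positivity)
  have e1 : ∀ h : ℕ+, ((2 * Y / (Y^2 + ((a:ℝ) * h)^2) : ℝ) : ℂ) =
      ((a:ℝ)⁻¹ : ℝ) * ((2 * (Y/a) / ((Y/a)^2 + (h:ℝ)^2) : ℝ) : ℂ) := by
    intro h
    have hh : (0:ℝ) < h := by exact_mod_cast h.pos
    rw [← Complex.ofReal_mul]
    congr 1
    field_simp
  have e2 : ∀ h : ℕ+, (((a:ℝ)⁻¹ * Real.exp (-(2 * Real.pi * h * Y) / a) : ℝ) : ℂ) =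
      ((a:ℝ)⁻¹ : ℝ) * ((Real.exp (-2 * Real.pi * h * (Y/a)) : ℝ) : ℂ) := by
    intro h
    rw [← Complex.ofReal_mul]
    congr 3
    ring
  simp_rw [e1, e2]
  rw [tsum_mul_left, tsum_mul_left, h]
  have hac : (a:ℂ) ≠ 0 := by exact_mod_cast ha.ne'
  have hYc : (Y:ℂ) ≠ 0 := by exact_mod_cast hY.ne'
  push_cast
  field_simp

lemma pnat_pos_real (a : ℕ+) : (0:ℝ) < (a:ℝ) := by exact_mod_cast a.pos

/-- The terms of the dual sum. -/
noncomputable def gd (Y δ : ℝ) (h : ℕ+) (k : ℤ) : ℂ :=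
  kint 0 (2 * csqrt ((2 * Real.pi * h * Y : ℝ) * (δ + 2 * Real.pi * k * Complex.I)))

lemma norm_gd_le (Y δ : ℝ) (hY : 0 < Y) (hδ : 0 ≤ δ) (h : ℕ+) (k : ℤ) (hk : k ≠ 0) :
    ‖gd Y δ h k‖ ≤ 1 / Y^2 * (1/(h:ℝ)^2 * (1/(k:ℝ)^2)) := by
  have hh := pnat_pos_real h
  have hpi := Real.pi_pos
  refine (norm_dual_term_le (2 * Real.pi * h * Y) δ (by positivity) hδ k hk).trans ?_
  have hk' : 0 < (k:ℝ)^2 := by positivity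
  rw [← mul_assoc]
  refine mul_le_mul_of_nonneg_right ?_ (by positivity)
  rw [div_mul_div_comm, one_mul]
  apply one_div_le_one_div_of_le (by positivity)
  have : 1 ≤ (2 * Real.pi)^2 := by nlinarith [Real.pi_gt_three]
  have h2 : 0 ≤ Y^2 * (h:ℝ)^2 := by positivity
  nlinarith

lemma norm_gd_zero_le (Y δ : ℝ) (hY : 0 < Y) (hδ : 0 < δ) (h : ℕ+) :
    ‖gd Y δ h 0‖ ≤ 60 / (4 * (2 * Real.pi * Y * δ)^2) * (1/(h:ℝ)^2) := by
  have hh := pnat_pos_real h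
  have hpi := Real.pi_pos
  have e : (2 * csqrt ((2 * Real.pi * h * Y : ℝ) * (δ + 2 * Real.pi * (0:ℤ) * Complex.I))).re =
      2 * Real.sqrt (2 * Real.pi * h * Y * δ) := by
    have : ((2 * Real.pi * h * Y : ℝ) * (δ + 2 * Real.pi * (0:ℤ) * Complex.I) : ℂ) =
      ((2 * Real.pi * h * Y * δ : ℝ) : ℂ) := by push_cast; ring
    rw [this, show (2:ℂ) = ((2:ℝ):ℂ) by simp, Complex.re_ofReal_mul, csqrt_re, Complex.norm_real, Complex.ofReal_re,
      Real.norm_of_nonneg (by positivity), add_self_div_two]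
  have hp : 0 < Real.sqrt (2 * Real.pi * h * Y * δ) := Real.sqrt_pos.mpr (by positivity)
  refine (norm_kint_zero_le' _ (by rw [e]; positivity)).trans ?_
  rw [e, mul_pow, show Real.sqrt (2 * Real.pi * h * Y * δ)^4 = (2 * Real.pi * h * Y * δ)^2 by
    rw [show (4:ℕ) = 2 * 2 by norm_num, pow_mul, Real.sq_sqrt (by positivity)]]
  rw [div_mul_div_comm]
  apply div_le_div₀ (by norm_num) (by norm_num) (by positivity)
  ring_nf
  have : 0 ≤ Real.pi ^ 2 * (h:ℝ)^2 * Y^2 * δ^2 := by positivity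
  nlinarith

lemma summable_pnat_sq : Summable (fun n : ℕ+ => 1/(n:ℝ)^2) := by
  have := (Real.summable_one_div_nat_pow (p := 2)).mpr (by norm_num)
  exact this.comp_injective PNat.coe_injective

lemma summable_gd (Y δ : ℝ) (hY : 0 < Y) (hδ : 0 ≤ δ) :
    Summable (fun p : ℕ+ × ℕ+ => gd Y δ p.1 p.2 + gd Y δ p.1 (-(p.2:ℤ))) := by
  have h := summable_pairs_real.mul_left (1/Y^2)
  refine Summable.add (Summable.of_norm_bounded h fun p => ?_) (Summable.of_norm_bounded h fun p => ?_)
  · simpa using norm_gd_le Y δ hY hδ p.1 p.2 (by simp)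
  · simpa using norm_gd_le Y δ hY hδ p.1 (-(p.2:ℤ)) (by simp)

lemma poisson_gd (Y δ : ℝ) (hY : 0 < Y) (hδ : 0 < δ) (h : ℕ+) :
    ∑' a : ℕ+, (((a:ℝ)⁻¹ * Real.exp (-(2 * Real.pi * h * Y)/a) * Real.exp (-δ * a) : ℝ) : ℂ) =
      2 * gd Y δ h 0 + ∑' k : ℕ+, 2 * (gd Y δ h k + gd Y δ h (-(k:ℤ))) := by
  have hh := pnat_pos_real h
  have hpi := Real.pi_pos
  rw [poisson_pf _ δ (by positivity) hδ, tsum_int_split _ ((summable_dual _ δ (by positivity) hδ.le).mul_left 2)]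
  simp only [gd, mul_add]

lemma summable_ptriple (Y δ : ℝ) (hY : 0 < Y) (hδ : 0 < δ) :
    Summable (fun p : ℕ+ × ℕ+ => (((p.1:ℝ)⁻¹ * Real.exp (-(2 * Real.pi * p.2 * Y)/p.1) * Real.exp (-δ * p.1) : ℝ) : ℂ)) := by
  have h := summable_pairs_real.mul_left (12 / ((2 * Real.pi * Y)^2 * δ^3))
  refine Summable.of_norm_bounded h fun p => ?_
  have h1 := pnat_pos_real p.1
  have h2 := pnat_pos_real p.2
  have hpi := Real.pi_pos
  have hA : 0 < 2 * Real.pi * p.2 * Y := by positivity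
  have := norm_pf_le (2 * Real.pi * p.2 * Y) δ hA hδ p.1 h1.ne'
  rw [pf_pos _ _ _ hA h1] at this
  refine this.trans (le_of_eq ?_)
  rw [abs_of_pos h1, Real.rpow_neg h1.le, Real.rpow_two]
  field_simp

lemma summable_exp_pnat (δ : ℝ) (hδ : 0 < δ) : Summable (fun a : ℕ+ => Real.exp (-δ * a)) := by
  have h := Real.summable_exp_nat_mul_iff.mpr (show -δ < 0 by linarith)
  have := h.comp_injective PNat.coe_injective
  refine this.congr fun a => ?_
  simp [mul_comm]

lemma summable_exp_div_pnat (δ : ℝ) (hδ : 0 < δ) : Summable (fun a : ℕ+ => Real.exp (-δ * a) * (a:ℝ)⁻¹) := by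
  refine Summable.of_nonneg_of_le (fun a => by have := pnat_pos_real a; positivity) (fun a => ?_) (summable_exp_pnat δ hδ)
  have h1 : (1:ℝ) ≤ a := by exact_mod_cast a.2
  have : (a:ℝ)⁻¹ ≤ 1 := inv_le_one_of_one_le₀ h1
  nlinarith [Real.exp_pos (-δ * a)]

lemma summable_fpair (Y : ℝ) (hY : 0 < Y) (c : ℕ+ → ℝ) (hc : ∀ a, 0 ≤ c a ∧ c a ≤ 1) :
    Summable (fun p : ℕ+ × ℕ+ => ((c p.1 * (2 * Y / (Y^2 + ((p.1:ℝ) * p.2)^2)) : ℝ) : ℂ)) := by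
  have h := summable_pairs_real.mul_left (2 * Y)
  refine Summable.of_norm_bounded h fun p => ?_
  have h1 := pnat_pos_real p.1
  have h2 := pnat_pos_real p.2
  rw [Complex.norm_real, Real.norm_of_nonneg (mul_nonneg (hc _).1 (by positivity))]
  calc _ ≤ 1 * (2 * Y / (((p.1:ℝ) * p.2)^2)) := by
        gcongr
        · exact (hc _).2
        · nlinarith [sq_nonneg Y]
    _ = _ := by field_simp

lemma fdelta_formula (Y δ : ℝ) (hY : 0 < Y) (hδ : 0 < δ) :
    ∑' p : ℕ+ × ℕ+, ((Real.exp (-δ * p.1) * (2 * Y / (Y^2 + ((p.1:ℝ) * p.2)^2)) : ℝ) : ℂ) =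
     Real.pi * ((∑' a : ℕ+, Real.exp (-δ * a) * (a:ℝ)⁻¹ : ℝ) : ℂ) - ((∑' a : ℕ+, Real.exp (-δ * a) : ℝ) : ℂ) / Y
      + 4 * Real.pi * ∑' h : ℕ+, gd Y δ h 0 +
      4 * Real.pi * ∑' p : ℕ+ × ℕ+, (gd Y δ p.1 p.2 + gd Y δ p.1 (-(p.2:ℤ))) := by
  have hc : ∀ a : ℕ+, 0 ≤ Real.exp (-δ * a) ∧ Real.exp (-δ * a) ≤ 1 := fun a =>
    ⟨(Real.exp_pos _).le, Real.exp_le_one_iff.mpr (by have := pnat_pos_real a; nlinarith)⟩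
  rw [(summable_fpair Y hY _ hc).tsum_prod]
  have hsp := summable_ptriple Y δ hY hδ
  have e1 : ∀ a : ℕ+, ∑' h : ℕ+, ((Real.exp (-δ * a) * (2 * Y / (Y^2 + ((a:ℝ) * h)^2)) : ℝ) : ℂ) =
     ((Real.pi * (Real.exp (-δ * a) * (a:ℝ)⁻¹) - 1/Y * Real.exp (-δ * a) : ℝ) : ℂ) +
      2 * Real.pi * ∑' h : ℕ+, (((a:ℝ)⁻¹ * Real.exp (-(2 * Real.pi * h * Y)/a) * Real.exp (-δ * a) : ℝ) : ℂ) := by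
    intro a
    simp only [Complex.ofReal_mul (Real.exp (-δ * a))]
    rw [tsum_mul_left, ta_series Y hY a]
    have : ∀ h : ℕ+, (((a:ℝ)⁻¹ * Real.exp (-(2 * Real.pi * h * Y)/a) * Real.exp (-δ * a) : ℝ) : ℂ) =
      ((Real.exp (-δ * a) : ℝ):ℂ) * (((a:ℝ)⁻¹ * Real.exp (-(2 * Real.pi * h * Y)/a) : ℝ) : ℂ) := by
      intro h; rw [← Complex.ofReal_mul, mul_comm]
    simp_rw [this]
    rw [tsum_mul_left]
    push_cast
    ring
  simp_rw [e1]
  have s1 : Summable (fun a : ℕ+ => Real.pi * (Real.exp (-δ * a) * (a:ℝ)⁻¹)) :=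
    (summable_exp_div_pnat δ hδ).mul_left _
  have s2 : Summable (fun a : ℕ+ => 1/Y * Real.exp (-δ * a)) := (summable_exp_pnat δ hδ).mul_left _
  have s3 : Summable (fun a : ℕ+ => ∑' h : ℕ+, (((a:ℝ)⁻¹ * Real.exp (-(2 * Real.pi * h * Y)/a) * Real.exp (-δ * a) : ℝ) : ℂ)) :=
    hsp.prod
  rw [Summable.tsum_add (Complex.summable_ofReal.mpr (s1.sub s2)) (s3.mul_left _), tsum_mul_left, ← Complex.ofReal_tsum, s1.tsum_sub s2,
    tsum_mul_left, tsum_mul_left]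
  have hsp' := hsp.prod_symm
  rw [← Summable.tsum_comm (f := fun a h : ℕ+ => (((a:ℝ)⁻¹ * Real.exp (-(2 * Real.pi * h * Y)/a) * Real.exp (-δ * a) : ℝ) : ℂ)) hsp]
  simp_rw [poisson_gd Y δ hY hδ]
  have g1 : Summable (fun h : ℕ+ => 2 * gd Y δ h 0) :=
    Summable.mul_left _ (Summable.of_norm_bounded (summable_pnat_sq.mul_left _) (norm_gd_zero_le Y δ hY hδ))
  have g2 := (summable_gd Y δ hY hδ.le).mul_left 2
  have g3 := g2.tsum_prod
  rw [g1.tsum_add g2.prod, ← g2.tsum_prod, tsum_mul_left, tsum_mul_left]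
  push_cast
  ring

end

section
open Filter MeasureTheory Topology

lemma tendsto_L : Tendsto (fun δ : ℝ => (∑' a : ℕ+, Real.exp (-δ * a) * (a:ℝ)⁻¹) + Real.log δ) (𝓝[>] 0) (𝓝 0) := by
  have h1 : ∀ δ : ℝ, 0 < δ → (∑' a : ℕ+, Real.exp (-δ * a) * (a:ℝ)⁻¹) = -Real.log (1 - Real.exp (-δ)) := by
    intro δ hδ
    have hx : |Real.exp (-δ)| < 1 := by
      rw [abs_of_pos (Real.exp_pos _), Real.exp_lt_one_iff]; linarith
    have := (Real.hasSum_pow_div_log_of_abs_lt_one hx).tsum_eq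
    rw [← this, tsum_pnat_eq_tsum_succ (f := fun a : ℕ => Real.exp (-δ * a) * (a:ℝ)⁻¹)]
    refine tsum_congr fun n => ?_
    rw [← Real.exp_nat_mul, div_eq_mul_inv]
    push_cast
    congr 2
    ring
  have h2 : Tendsto (fun δ : ℝ => -Real.log ((1 - Real.exp (-δ))/δ)) (𝓝[>] 0) (𝓝 0) := by
    have hd : HasDerivAt (fun δ : ℝ => 1 - Real.exp (-δ)) 1 0 := by
      have := ((hasDerivAt_id (0:ℝ)).neg.exp).const_sub 1
      simpa using this
    have := hd.tendsto_slope_zero_right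
    simp only [zero_add, neg_zero, Real.exp_zero, sub_self, sub_zero, smul_eq_mul] at this
    have h3 := (this.log (by norm_num)).neg
    simp only [Real.log_one, neg_zero] at h3
    refine h3.congr fun δ => ?_
    rw [div_eq_inv_mul]
  refine h2.congr' ?_
  filter_upwards [self_mem_nhdsWithin] with δ hδ
  have hδ : 0 < δ := hδ
  rw [h1 δ hδ, Real.log_div _ hδ.ne']
  · ring
  · have : Real.exp (-δ) < 1 := by rw [Real.exp_lt_one_iff]; linarith
    linarith

lemma tendsto_S : Tendsto (fun δ : ℝ => (∑' a : ℕ+, Real.exp (-δ * a)) - 1/δ) (𝓝[>] 0) (𝓝 (-1/2)) := by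
  have h1 : ∀ δ : ℝ, 0 < δ → (∑' a : ℕ+, Real.exp (-δ * a)) = 1 / (Real.exp δ - 1) := by
    intro δ hδ
    have hx : Real.exp (-δ) < 1 := by rw [Real.exp_lt_one_iff]; linarith
    rw [tsum_pnat_eq_tsum_succ (f := fun a : ℕ => Real.exp (-δ * a))]
    have : ∀ n : ℕ, Real.exp (-δ * ((n+1:ℕ):ℝ)) = Real.exp (-δ) * Real.exp (-δ) ^ n := by
      intro n
      rw [← Real.exp_nat_mul, ← Real.exp_add]; congr 1; push_cast; ring
    simp_rw [this]
    rw [tsum_mul_left, tsum_geometric_of_lt_one (Real.exp_pos _).le hx, Real.exp_neg] 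
    have h2 : 1 < Real.exp δ := by rw [Real.one_lt_exp_iff]; exact hδ
    have h3 : Real.exp δ - 1 ≠ 0 := by linarith
    field_simp
  have hd : Tendsto (fun δ : ℝ => δ⁻¹ * (Real.exp δ - 1)) (𝓝[>] 0) (𝓝 1) := by
    have := (Real.hasDerivAt_exp 0).tendsto_slope_zero_right
    simpa using this
  have h2 : Tendsto (fun δ : ℝ => (Real.exp δ - 1 - δ)/δ^2) (𝓝[>] 0) (𝓝 (1/2)) := by
    rw [tendsto_iff_norm_sub_tendsto_zero]
    have hz : Tendsto (fun δ : ℝ => δ) (𝓝[>] 0) (𝓝 0) := tendsto_id.mono_left nhdsWithin_le_nhds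
    refine squeeze_zero' (Eventually.of_forall fun _ => norm_nonneg _) ?_ hz
    filter_upwards [Ioo_mem_nhdsGT (show (0:ℝ) < 1 by norm_num)] with δ hδ
    have h0 : 0 < δ := hδ.1
    have := Real.exp_bound (x := δ) (by rw [abs_of_pos h0]; exact hδ.2.le) (n := 3) (by norm_num)
    simp [Finset.sum_range_succ, Nat.factorial] at this
    rw [abs_of_pos h0] at this
    rw [Real.norm_eq_abs]
    have e : (Real.exp δ - 1 - δ)/δ^2 - 1/2 = (Real.exp δ - (1 + δ + δ^2/2))/δ^2 := by field_simp; ring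
    rw [e, abs_div, abs_of_pos (show 0 < δ^2 by positivity), div_le_iff₀ (by positivity)]
    refine this.trans ?_
    have : 0 < δ^3 := by positivity
    nlinarith
  have h3 := (h2.mul (hd.inv₀ (by norm_num))).neg
  simp only [inv_one, mul_one] at h3
  rw [show (-1/2:ℝ) = -(1/2) by ring]
  refine h3.congr' ?_
  filter_upwards [self_mem_nhdsWithin] with δ hδ
  have hδ : 0 < δ := hδ
  have h4 : 1 < Real.exp δ := by rw [Real.one_lt_exp_iff]; exact hδ
  have h5 : Real.exp δ - 1 ≠ 0 := by linarith
  rw [h1 δ hδ]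
  field_simp
  ring

lemma tendsto_gd (Y : ℝ) (hY : 0 < Y) (h : ℕ+) (k : ℤ) (hk : k ≠ 0) :
    Tendsto (fun δ : ℝ => gd Y δ h k) (𝓝[>] 0) (𝓝 (gd Y 0 h k)) := by
  have hh := pnat_pos_real h
  have hpi := Real.pi_pos
  have hs : ((2 * Real.pi * h * Y : ℝ) * (((0:ℝ):ℂ) + 2 * Real.pi * k * Complex.I)) ∈ Complex.slitPlane := by
    right
    have : ((2 * Real.pi * h * Y : ℝ) * (((0:ℝ):ℂ) + 2 * Real.pi * k * Complex.I)).im = (2 * Real.pi * h * Y) * (2 * Real.pi * k) := by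
      rw [Complex.im_ofReal_mul]; simp
    rw [this]
    positivity
  have hc : ContinuousAt (fun δ : ℝ => gd Y δ h k) 0 := by
    unfold gd
    have c1 : ContinuousAt (kint 0) (2 * csqrt ((2 * Real.pi * h * Y : ℝ) * (((0:ℝ):ℂ) + 2 * Real.pi * k * Complex.I))) :=
      (hasDerivAt_kint 0 _ (by
        rw [show (2:ℂ) = ((2:ℝ):ℂ) by simp, Complex.re_ofReal_mul]
        have := csqrt_re_pos hs
        simp only [Complex.ofReal_ofNat] at *
        positivity)).continuousAt
    have c2 : ContinuousAt csqrt ((2 * Real.pi * h * Y : ℝ) * (((0:ℝ):ℂ) + 2 * Real.pi * k * Complex.I)) :=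
      (differentiableAt_csqrt hs).continuousAt
    have c3 : ContinuousAt (fun δ : ℝ => ((2 * Real.pi * h * Y : ℝ) * ((δ:ℂ) + 2 * Real.pi * k * Complex.I) : ℂ)) 0 := by
      fun_prop
    have c4 : ContinuousAt (fun δ : ℝ => 2 * csqrt ((2 * Real.pi * h * Y : ℝ) * ((δ:ℂ) + 2 * Real.pi * k * Complex.I) : ℂ)) 0 :=
      ContinuousAt.mul continuousAt_const (ContinuousAt.comp (f := (fun δ : ℝ => ((2 * Real.pi * h * Y : ℝ) * ((δ:ℂ) + 2 * Real.pi * k * Complex.I) : ℂ))) c2 c3)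
    exact ContinuousAt.comp (f := fun δ : ℝ => 2 * csqrt ((2 * Real.pi * h * Y : ℝ) * ((δ:ℂ) + 2 * Real.pi * k * Complex.I) : ℂ)) c1 c4
  exact hc.tendsto.mono_left nhdsWithin_le_nhds

/-- limiting dual sum -/
noncomputable def dd (Y : ℝ) : ℂ := 4 * Real.pi * ∑' p : ℕ+ × ℕ+, (gd Y 0 p.1 p.2 + gd Y 0 p.1 (-(p.2:ℤ)))

lemma tendsto_dual_sum (Y : ℝ) (hY : 0 < Y) :
    Tendsto (fun δ : ℝ => ∑' p : ℕ+ × ℕ+, (gd Y δ p.1 p.2 + gd Y δ p.1 (-(p.2:ℤ)))) (𝓝[>] 0)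
     (𝓝 (∑' p : ℕ+ × ℕ+, (gd Y 0 p.1 p.2 + gd Y 0 p.1 (-(p.2:ℤ))))) := by
  refine tendsto_tsum_of_dominated_convergence (summable_pairs_real.mul_left (2/Y^2)) ?_ ?_
  · intro p
    exact (tendsto_gd Y hY p.1 p.2 (by simp)).add (tendsto_gd Y hY p.1 (-(p.2:ℤ)) (by simp))
  · filter_upwards [self_mem_nhdsWithin] with δ hδ p
    have hδ : 0 < δ := hδ
    refine (norm_add_le _ _).trans ?_
    have h1 := norm_gd_le Y δ hY hδ.le p.1 p.2 (by simp)
    have h2 := norm_gd_le Y δ hY hδ.le p.1 (-(p.2:ℤ)) (by simp)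
    simp only [Int.cast_neg, neg_sq, Int.cast_natCast] at h1 h2
    calc _ ≤ _ := add_le_add h1 h2
      _ = _ := by ring

/-- the left side -/
noncomputable def ff (Y : ℝ) : ℂ := ∑' p : ℕ+ × ℕ+, ((2 * Y / (Y^2 + ((p.1:ℝ) * p.2)^2) : ℝ) : ℂ)

lemma tendsto_ff (Y : ℝ) (hY : 0 < Y) :
    Tendsto (fun δ : ℝ => ∑' p : ℕ+ × ℕ+, ((Real.exp (-δ * p.1) * (2 * Y / (Y^2 + ((p.1:ℝ) * p.2)^2)) : ℝ) : ℂ))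
     (𝓝[>] 0) (𝓝 (ff Y)) := by
  refine tendsto_tsum_of_dominated_convergence (summable_pairs_real.mul_left (2*Y)) ?_ ?_
  · intro p
    have : ContinuousAt (fun δ : ℝ => ((Real.exp (-δ * p.1) * (2 * Y / (Y^2 + ((p.1:ℝ) * p.2)^2)) : ℝ) : ℂ)) 0 := by
      fun_prop
    have h2 := this.tendsto.mono_left (nhdsWithin_le_nhds (s := Set.Ioi 0))
    simpa using h2
  · filter_upwards [self_mem_nhdsWithin] with δ hδ p
    have hδ : 0 < δ := hδ
    have h1 := pnat_pos_real p.1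
    have h2 := pnat_pos_real p.2
    rw [Complex.norm_real, Real.norm_of_nonneg (by positivity)]
    calc _ ≤ 1 * (2 * Y / (((p.1:ℝ) * p.2)^2)) := by
          gcongr
          · exact Real.exp_le_one_iff.mpr (by nlinarith)
          · nlinarith [sq_nonneg Y]
      _ = _ := by field_simp

/-- the `k = 0` part -/
noncomputable def qq (x : ℝ) : ℂ := 4 * Real.pi * ∑' h : ℕ+, kint 0 (2 * csqrt ((2 * Real.pi * h * x : ℝ)))

lemma qq_eq (Y δ : ℝ) : 4 * Real.pi * ∑' h : ℕ+, gd Y δ h 0 = qq (δ * Y) := by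
  unfold qq gd
  congr 1
  refine tsum_congr fun h => ?_
  congr 3
  push_cast; ring

lemma tendsto_pp (Y : ℝ) (hY : 0 < Y) :
    Tendsto (fun δ : ℝ => ((- Real.pi * Real.log (δ * Y) - 1/(δ*Y) : ℝ):ℂ) + qq (δ * Y)) (𝓝[>] 0)
      (𝓝 (ff Y - dd Y - ((Real.pi * Real.log Y + 1/(2*Y) : ℝ):ℂ))) := by
  have h1 := tendsto_ff Y hY
  have h2 := (tendsto_dual_sum Y hY).const_mul (4 * Real.pi : ℂ)
  have h3 := (Complex.continuous_ofReal.tendsto _).comp ((tendsto_L.const_mul Real.pi).sub (tendsto_S.mul_const (1/Y)))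
  have h4 := ((h1.sub h2).sub h3).sub_const ((Real.pi * Real.log Y : ℝ) : ℂ)
  have e : ff Y - 4 * Real.pi * ∑' p : ℕ+ × ℕ+, (gd Y 0 p.1 p.2 + gd Y 0 p.1 (-(p.2:ℤ))) -
      ((Real.pi * 0 - -1/2 * (1/Y) : ℝ) : ℂ) - ((Real.pi * Real.log Y : ℝ) : ℂ) =
      ff Y - dd Y - ((Real.pi * Real.log Y + 1/(2*Y) : ℝ):ℂ) := by
    unfold dd; push_cast; ring
  rw [e] at h4
  refine h4.congr' ?_
  filter_upwards [self_mem_nhdsWithin] with δ hδ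
  have hδ : 0 < δ := hδ
  rw [fdelta_formula Y δ hY hδ, qq_eq, Real.log_mul hδ.ne' hY.ne']
  simp only [Function.comp]
  have hYc : (Y:ℂ) ≠ 0 := by exact_mod_cast hY.ne'
  have hdc : (δ:ℂ) ≠ 0 := by exact_mod_cast hδ.ne'
  push_cast
  field_simp
  ring

lemma ff_formula : ∃ P : ℂ, ∀ Y : ℝ, 0 < Y → ff Y = ((Real.pi * Real.log Y + 1/(2*Y) : ℝ):ℂ) + P + dd Y := by
  refine ⟨ff 1 - dd 1 - ((Real.pi * Real.log 1 + 1/(2*1) : ℝ):ℂ), fun Y hY => ?_⟩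
  have h1 := tendsto_pp 1 one_pos
  have h2 := tendsto_pp Y hY
  have h3 : Tendsto (fun δ : ℝ => δ * Y) (𝓝[>] 0) (𝓝[>] 0) := by
    rw [tendsto_nhdsWithin_iff]
    constructor
    · have : ContinuousAt (fun δ : ℝ => δ * Y) 0 := by fun_prop
      simpa using this.tendsto.mono_left (nhdsWithin_le_nhds (s := Set.Ioi 0))
    · filter_upwards [self_mem_nhdsWithin] with δ hδ
      exact mul_pos hδ hY
  have h4 := h1.comp h3
  simp only [Function.comp_def, mul_one] at h4
  have := tendsto_nhds_unique h2 h4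
  rw [mul_one (2:ℝ)]
  linear_combination this

/-- derivative of W -/
noncomputable def fp (Y : ℂ) : ℂ := ∑' n : ℕ+, (divfun n : ℂ) * (2 * Y / (Y^2 + (n:ℂ)^2))

/-- derivative of the dual sum -/
noncomputable def dual1 (Y : ℂ) : ℂ := ∑' n : ℕ+, (divfun n : ℂ) *
  (kint 0 (4 * Real.pi * csqrt (Complex.I * n * Y)) + kint 0 (4 * Real.pi * csqrt (-Complex.I * n * Y)))

lemma gd_zero (Y : ℝ) (hY : 0 < Y) (h k : ℕ+) (s : ℤ) (hs : s^2 = 1) :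
    gd Y 0 h (s * (k:ℤ)) = kint 0 (4 * Real.pi * csqrt (s * Complex.I * (h * k : ℕ+) * Y)) := by
  have hh := pnat_pos_real h
  have hk := pnat_pos_real k
  have hpi := Real.pi_pos
  unfold gd
  congr 1
  have hsl : (s * Complex.I * (h * k : ℕ+) * Y) ∈ Complex.slitPlane := by
    right
    have : (s * Complex.I * (h * k : ℕ+) * Y) = (s * (h * k) * Y : ℝ) * Complex.I := by push_cast; ring
    rw [this, Complex.im_ofReal_mul]
    have : (s:ℝ) ≠ 0 := by
      intro h0
      have : s = 0 := by exact_mod_cast h0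
      rw [this] at hs; norm_num at hs
    simp only [Complex.I_im, mul_one]
    exact mul_ne_zero (mul_ne_zero this (by positivity)) hY.ne'
  have hp := csqrt_re_pos hsl
  have := csqrt_unique (z := (2 * Real.pi * h * Y : ℝ) * (((0:ℝ):ℂ) + 2 * Real.pi * (s * (k:ℤ) : ℤ) * Complex.I))
     (v := ((2 * Real.pi : ℝ):ℂ) * csqrt (s * Complex.I * (h * k : ℕ+) * Y)) (by
      rw [Complex.re_ofReal_mul]; positivity) (by
      rw [mul_pow, csqrt_sq]; push_cast; ring)
  rw [this]
  push_cast; ring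

lemma fp_formula : ∃ P : ℂ, ∀ Y : ℝ, 0 < Y →
    fp Y = ((Real.pi * Real.log Y + 1/(2*Y) : ℝ):ℂ) + P + 4 * Real.pi * dual1 Y := by
  obtain ⟨P, hP⟩ := ff_formula
  refine ⟨P, fun Y hY => ?_⟩
  have h1 := hP Y hY
  have e1 : ff Y = fp Y := by
    unfold ff fp
    rw [← tsum_pairs (fun n => 2 * (Y:ℂ) / (Y^2 + (n:ℂ)^2))]
    · refine tsum_congr fun p => ?_
      push_cast; rfl
    · have := summable_fpair Y hY (fun _ => 1) (fun _ => by norm_num)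
      refine this.congr fun p => ?_
      push_cast; rw [one_mul]
  have hk : ∀ p : ℕ+ × ℕ+, gd Y 0 p.1 p.2 + gd Y 0 p.1 (-(p.2:ℤ)) = 
     (kint 0 (4 * Real.pi * csqrt (Complex.I * (p.1 * p.2 : ℕ+) * Y)) + kint 0 (4 * Real.pi * csqrt (-Complex.I * (p.1 * p.2 : ℕ+) * Y))) := by
    intro p
    have a := gd_zero Y hY p.1 p.2 1 (by norm_num)
    have b := gd_zero Y hY p.1 p.2 (-1) (by norm_num)
    simp only [one_mul, Int.cast_one, Int.cast_neg, neg_one_mul] at a b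
    rw [a, b]
  have e2 : dd Y = 4 * Real.pi * dual1 Y := by
    unfold dd dual1
    congr 1
    rw [← tsum_pairs (fun n => (kint 0 (4 * Real.pi * csqrt (Complex.I * n * Y)) + kint 0 (4 * Real.pi * csqrt (-Complex.I * n * Y))))]
    · exact tsum_congr hk
    · exact (summable_gd Y 0 hY le_rfl).congr hk
  rw [← e1, h1, e2]

end

section
open Filter MeasureTheory Topology

lemma summable_divfun_sq : Summable (fun n : ℕ+ => (divfun n : ℝ) * (1/(n:ℝ)^2)) := by
  obtain ⟨C, hC, h⟩ := divfun_le (1/2) (by norm_num)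
  have hs : Summable (fun n : ℕ => C * (1/(n:ℝ)^(3/2:ℝ))) :=
    ((Real.summable_one_div_nat_rpow (p := 3/2)).mpr (by norm_num)).mul_left C
  refine Summable.of_nonneg_of_le (fun n => by positivity) (fun n => ?_) (hs.comp_injective PNat.coe_injective)
  have hn := pnat_pos_real n
  simp only [Function.comp]
  calc (divfun n : ℝ) * (1/(n:ℝ)^2) ≤ (C * (n:ℝ)^(1/2:ℝ)) * (1/(n:ℝ)^2) := by
        gcongr; exact h n n.pos
    _ = _ := by
        rw [mul_assoc]; congr 1
        rw [← Real.rpow_two, one_div ((n:ℝ)^(2:ℝ)), one_div ((n:ℝ)^(3/2:ℝ)), ← Real.rpow_neg hn.le, ← Real.rpow_neg hn.le, ← Real.rpow_add hn]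
        norm_num

/-- Local domain. -/
def tdom (c R : ℝ) : Set ℂ := {Y | c < Y.re} ∩ Metric.ball 0 R

lemma isOpen_tdom (c R : ℝ) : IsOpen (tdom c R) :=
  (isOpen_lt continuous_const Complex.continuous_re).inter Metric.isOpen_ball

lemma convex_tdom (c R : ℝ) : Convex ℝ (tdom c R) :=
  (convex_halfSpace_re_gt c).inter (convex_ball 0 R)

lemma norm_den_ge (c R : ℝ) (hc : 0 < c) (hR : 0 < R) : ∃ κ : ℝ, 0 < κ ∧ ∀ Y ∈ tdom c R, ∀ n : ℕ+, 
    κ * (n:ℝ)^2 ≤ ‖Y^2 + (n:ℂ)^2‖ := by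
  refine ⟨min (3/4) (c^2/(4*R^2)), by positivity, fun Y hY n => ?_⟩
  obtain ⟨h1, h2⟩ := hY
  have h1 : c < Y.re := h1
  have hn := pnat_pos_real n
  rw [mem_ball_zero_iff] at h2
  rcases le_or_gt (2*R) n with h | h
  · have h3 : ‖(n:ℂ)^2‖ - ‖Y^2‖ ≤ ‖Y^2 + (n:ℂ)^2‖ := by
      have := norm_sub_norm_le ((n:ℂ)^2) (-Y^2)
      rw [norm_neg] at this
      rw [add_comm]; simpa using this
    rw [norm_pow, norm_pow, Complex.norm_natCast] at h3
    have h4 : ‖Y‖^2 ≤ R^2 := by gcongr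
    calc _ ≤ 3/4 * (n:ℝ)^2 := by gcongr; exact min_le_left _ _
      _ ≤ _ := by nlinarith
  · have e : Y^2 + (n:ℂ)^2 = (Y + n * Complex.I) * (Y - n * Complex.I) := by
      ring_nf; rw [Complex.I_sq]; ring
    have a1 : c ≤ ‖Y + n * Complex.I‖ := by
      refine le_trans ?_ (Complex.re_le_norm _); simp; exact h1.le
    have a2 : c ≤ ‖Y - n * Complex.I‖ := by
      refine le_trans ?_ (Complex.re_le_norm _); simp; exact h1.le
    rw [e, norm_mul]
    calc _ ≤ c^2/(4*R^2) * (2*R)^2 := by gcongr; exact min_le_right _ _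
      _ = c * c := by field_simp; ring
      _ ≤ _ := by gcongr

lemma fp_bound (c R : ℝ) (hc : 0 < c) (hR : 0 < R) : ∃ K : ℝ, 0 < K ∧ ∀ Y ∈ tdom c R, ∀ n : ℕ+, 
    ‖(divfun n : ℂ) * (2 * Y / (Y^2 + (n:ℂ)^2))‖ ≤ K * ((divfun n : ℝ) * (1/(n:ℝ)^2)) := by
  obtain ⟨κ, hκ, h⟩ := norm_den_ge c R hc hR
  refine ⟨2 * R / κ, by positivity, fun Y hY n => ?_⟩
  have hn := pnat_pos_real n
  have h2 := mem_ball_zero_iff.mp hY.2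
  rw [norm_mul, norm_div, norm_mul, Complex.norm_natCast, Complex.norm_ofNat]
  calc (divfun n : ℝ) * (2 * ‖Y‖ / ‖Y^2 + (n:ℂ)^2‖) ≤ (divfun n : ℝ) * (2 * R / (κ * (n:ℝ)^2)) := by
        gcongr
        exact h Y hY n
    _ = _ := by field_simp

lemma mem_tdom (Y : ℂ) (hY : 0 < Y.re) : Y ∈ tdom (Y.re/2) (‖Y‖+1) :=
  ⟨by show Y.re/2 < Y.re; linarith, by rw [mem_ball_zero_iff]; linarith⟩

lemma den_ne (Y : ℂ) (hY : 0 < Y.re) (n : ℕ+) : Y^2 + (n:ℂ)^2 ≠ 0 := by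
  obtain ⟨κ, hκ, h⟩ := norm_den_ge (Y.re/2) (‖Y‖+1) (by positivity) (by positivity)
  have := h Y (mem_tdom Y hY) n
  intro h0
  rw [h0, norm_zero] at this
  have hn := pnat_pos_real n
  have : 0 < κ * (n:ℝ)^2 := by positivity
  linarith

lemma differentiable_fp : DifferentiableOn ℂ fp {z | 0 < z.re} := by
  intro Y hY
  have hY : 0 < Y.re := hY
  obtain ⟨K, hK, h⟩ := fp_bound (Y.re/2) (‖Y‖+1) (by positivity) (by positivity)
  have hd : DifferentiableOn ℂ fp (tdom (Y.re/2) (‖Y‖+1)) := by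
    refine Complex.differentiableOn_tsum_of_summable_norm (summable_divfun_sq.mul_left K) ?_ (isOpen_tdom _ _) (fun n w hw => h w hw n)
    intro n w hw
    have hw0 : 0 < w.re := lt_trans (by positivity) hw.1
    have := den_ne w hw0 n
    apply DifferentiableAt.differentiableWithinAt
    fun_prop (disch := assumption)
  exact ((hd Y (mem_tdom Y hY)).differentiableAt ((isOpen_tdom _ _).mem_nhds (mem_tdom Y hY))).differentiableWithinAt

/-- W(Y) = ∑ d(n) (log(1 - iY/n) + log (1 + iY/n)) -/
noncomputable def Wt (n : ℕ+) (Y : ℂ) : ℂ := (divfun n : ℂ) *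
  (Complex.log (1 - Complex.I * Y / n) + Complex.log (1 + Complex.I * Y / n))

noncomputable def WW (Y : ℂ) : ℂ := ∑' n : ℕ+, Wt n Y

lemma slit1 (Y : ℂ) (hY : 0 < Y.re) (n : ℕ+) : 1 - Complex.I * Y / n ∈ Complex.slitPlane := by
  right
  have hn := pnat_pos_real n
  have : (1 - Complex.I * Y / n).im = - (Y.re / n) := by
    simp [Complex.div_im, Complex.normSq_apply]
    field_simp
  rw [this]
  have : 0 < Y.re / n := by positivity
  linarith

lemma slit2 (Y : ℂ) (hY : 0 < Y.re) (n : ℕ+) : 1 + Complex.I * Y / n ∈ Complex.slitPlane := by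
  right
  have hn := pnat_pos_real n
  have : (1 + Complex.I * Y / n).im = (Y.re / n) := by
    simp [Complex.div_im, Complex.normSq_apply]
    field_simp
  rw [this]
  positivity

lemma hasDerivAt_Wt (Y : ℂ) (hY : 0 < Y.re) (n : ℕ+) :
    HasDerivAt (Wt n) ((divfun n : ℂ) * (2 * Y / (Y^2 + (n:ℂ)^2))) Y := by
  have hn := pnat_pos_real n
  have hnc : (n:ℂ) ≠ 0 := by exact_mod_cast hn.ne'
  have d0 : HasDerivAt (fun Y : ℂ => Complex.I * Y / n) (Complex.I / n) Y := by
    simpa using ((hasDerivAt_id Y).const_mul Complex.I).div_const (n:ℂ)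
  have d1 := (d0.const_sub 1).clog (slit1 Y hY n)
  have d2 := (d0.const_add 1).clog (slit2 Y hY n)
  have d3 := (d1.add d2).const_mul (divfun n : ℂ)
  refine d3.congr_deriv ?_
  congr 1
  have n1 := Complex.slitPlane_ne_zero (slit1 Y hY n)
  have n2 := Complex.slitPlane_ne_zero (slit2 Y hY n)
  have n3 := den_ne Y hY n
  have hI := Complex.I_mul_I
  have m1 : (n:ℂ) - Complex.I * Y ≠ 0 := by
    intro h0; apply n1; field_simp; rw [h0, mul_zero]
  have m2 : (n:ℂ) + Complex.I * Y ≠ 0 := by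
    intro h0; apply n2; field_simp; rw [h0, mul_zero]
  have e1 : -(Complex.I / n) / (1 - Complex.I * Y / n) = -Complex.I / (n - Complex.I * Y) := by
    field_simp
  have e2 : (Complex.I / n) / (1 + Complex.I * Y / n) = Complex.I / (n + Complex.I * Y) := by
    field_simp
  rw [e1, e2, div_add_div _ _ m1 m2, div_eq_div_iff (mul_ne_zero m1 m2) n3]
  generalize Complex.I = i at *
  linear_combination (-2 * Y * (n:ℂ)^2) * hI

lemma norm_Wt_one (n : ℕ+) : ‖Wt n 1‖ ≤ (divfun n : ℝ) * (1/(n:ℝ)^2) := by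
  have hn := pnat_pos_real n
  unfold Wt
  rw [norm_mul, Complex.norm_natCast]
  gcongr
  have hs := slit2 1 (by simp) n
  have hconj : (1 - Complex.I * 1 / n : ℂ) = (starRingEnd ℂ) (1 + Complex.I * 1 / n) := by
    simp; ring
  have harg : (1 + Complex.I * 1 / n : ℂ).arg ≠ Real.pi := by
    intro h
    rw [Complex.mem_slitPlane_iff_arg] at hs
    exact hs.1 h
  rw [hconj, Complex.log_conj _ harg, add_comm, Complex.add_conj, Complex.norm_real, Complex.log_re]
  have h2 : ‖(1 + Complex.I * 1 / n : ℂ)‖^2 = 1 + 1/(n:ℝ)^2 := by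
    rw [← Complex.normSq_eq_norm_sq, Complex.normSq_apply]
    simp [Complex.div_re, Complex.div_im, Complex.normSq_apply]
    field_simp
  have h3 : 2 * Real.log ‖(1 + Complex.I * 1 / n : ℂ)‖ = Real.log (1 + 1/(n:ℝ)^2) := by
    rw [← h2, Real.log_pow]; norm_num
  rw [h3, Real.norm_of_nonneg (Real.log_nonneg (by have : 0 < 1/(n:ℝ)^2 := by positivity
                                                   linarith))]
  have := Real.log_le_sub_one_of_pos (x := 1 + 1/(n:ℝ)^2) (by positivity)
  linarith

lemma hasDerivAt_WW (Y : ℂ) (hY : 0 < Y.re) : Summable (fun n => Wt n Y) ∧ HasDerivAt WW (fp Y) Y := by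
  set c := min (Y.re/2) (1/2)
  set R := max (‖Y‖+1) 2
  have hc : 0 < c := by positivity
  have hR : 0 < R := by positivity
  obtain ⟨K, hK, h⟩ := fp_bound c R hc hR
  have hm : Y ∈ tdom c R := ⟨lt_of_le_of_lt (min_le_left _ _) (half_lt_self hY), by
    rw [mem_ball_zero_iff]; exact lt_of_lt_of_le (by linarith) (le_max_left _ _)⟩
  have hm1 : (1:ℂ) ∈ tdom c R := ⟨lt_of_le_of_lt (min_le_right (Y.re/2) (1/2:ℝ)) (show (1/2:ℝ) < (1:ℂ).re by norm_num), by
    rw [mem_ball_zero_iff]; exact lt_of_lt_of_le (b := (2:ℝ)) (by norm_num) (le_max_right _ _)⟩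
  have s1 : Summable (fun n => Wt n 1) := Summable.of_norm_bounded summable_divfun_sq norm_Wt_one
  have hD : ∀ (n : ℕ+) (y : ℂ), y ∈ tdom c R → HasDerivAt (Wt n) ((divfun n : ℂ) * (2 * y / (y^2 + (n:ℂ)^2))) y :=
    fun n y hy => hasDerivAt_Wt y (lt_trans hc hy.1) n
  constructor
  · exact summable_of_summable_hasDerivAt_of_isPreconnected (summable_divfun_sq.mul_left K) (isOpen_tdom c R)
      (convex_tdom c R).isPreconnected hD (fun n y hy => h y hy n) hm1 s1 hm
  · exact hasDerivAt_tsum_of_isPreconnected (summable_divfun_sq.mul_left K) (isOpen_tdom c R)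
      (convex_tdom c R).isPreconnected hD (fun n y hy => h y hy n) hm1 s1 hm

end

section
open Filter MeasureTheory Topology

/-- real part of csqrt(± i n Y), `s = ± 1` -/
lemma csqrt_dual_re (Y : ℂ) (hY : 0 < Y.re) (n : ℕ+) (s : ℂ) (hs : s = Complex.I ∨ s = -Complex.I) :
    s * n * Y ∈ Complex.slitPlane ∧
    Real.sqrt (n * (Y.re^2 / (4 * ‖Y‖))) ≤ (csqrt (s * n * Y)).re := by
  have hn := pnat_pos_real n
  have hYn : 0 < ‖Y‖ := lt_of_lt_of_le hY (Complex.re_le_norm Y)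
  have hre : ∃ t : ℝ, |t| = 1 ∧ (s * n * Y) = (n : ℝ) * (t * (Complex.I * Y)) := by
    rcases hs with h | h
    · exact ⟨1, by simp, by rw [h]; push_cast; ring⟩
    · exact ⟨-1, by simp, by rw [h]; push_cast; ring⟩
  obtain ⟨t, ht, he⟩ := hre
  have ht0 : t ≠ 0 := by intro h; rw [h] at ht; simp at ht
  rw [he]
  constructor
  · right
    rw [Complex.im_ofReal_mul, Complex.im_ofReal_mul]
    simp
    exact ⟨ht0, hY.ne'⟩
  · rw [csqrt_re]
    apply Real.sqrt_le_sqrt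
    rw [norm_mul, norm_mul, norm_mul, Complex.norm_I, Complex.norm_real, Complex.norm_real, Real.norm_eq_abs t, ht,
      Real.norm_of_nonneg hn.le, Complex.re_ofReal_mul, Complex.re_ofReal_mul]
    have h1 : (Complex.I * Y).re = -Y.im := by simp
    rw [h1, one_mul, one_mul]
    have h2 : -|Y.im| ≤ t * (-Y.im) := by
      have : |t * (-Y.im)| = |Y.im| := by rw [abs_mul, ht, abs_neg, one_mul]
      rw [← this]; exact neg_abs_le _
    have h3 : Y.re^2 / (4 * ‖Y‖) ≤ (‖Y‖ - |Y.im|)/2 := by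
      rw [div_le_div_iff₀ (by positivity) (by norm_num)]
      have h4 : ‖Y‖^2 = Y.re^2 + |Y.im|^2 := by
        rw [← Complex.normSq_eq_norm_sq, Complex.normSq_apply, sq_abs]; ring
      have h5 := Complex.abs_im_le_norm Y
      nlinarith [abs_nonneg Y.im]
    calc (n:ℝ) * (Y.re^2 / (4 * ‖Y‖)) ≤ n * ((‖Y‖ - |Y.im|)/2) := by gcongr
      _ ≤ n * ((‖Y‖ + t * (-Y.im))/2) := by gcongr; linarith
      _ = _ := by ring

lemma csqrt_dual_re' (c R : ℝ) (hc : 0 < c) (hR : 0 < R) (Y : ℂ) (hY : Y ∈ tdom c R) (n : ℕ+) (s : ℂ) (hs : s = Complex.I ∨ s = -Complex.I) :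
    Real.sqrt (n * (c^2 / (4 * R))) ≤ (4 * Real.pi * csqrt (s * n * Y)).re := by
  have hY0 : 0 < Y.re := lt_trans hc hY.1
  have h := (csqrt_dual_re Y hY0 n s hs).2
  have hYn : 0 < ‖Y‖ := lt_of_lt_of_le hY0 (Complex.re_le_norm Y)
  have h2 := mem_ball_zero_iff.mp hY.2
  have hn := pnat_pos_real n
  have h3 : Real.sqrt (n * (c^2 / (4 * R))) ≤ Real.sqrt (n * (Y.re^2 / (4 * ‖Y‖))) := by
    apply Real.sqrt_le_sqrt
    have : c < Y.re := hY.1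
    gcongr
  rw [show (4 * Real.pi : ℂ) = ((4 * Real.pi : ℝ) : ℂ) by push_cast; ring, Complex.re_ofReal_mul]
  have h4 := Real.sqrt_nonneg (n * (c^2 / (4 * R)))
  nlinarith [Real.pi_gt_three]

lemma kint_dual_bound (c R : ℝ) (hc : 0 < c) (hR : 0 < R) : ∃ K : ℝ, 0 < K ∧ ∀ Y ∈ tdom c R, ∀ n : ℕ+,
    ∀ s : ℂ, s = Complex.I ∨ s = -Complex.I →  
    ‖kint 0 (4 * Real.pi * csqrt (s * n * Y))‖ ≤ K * (1/(n:ℝ)^2) := by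
  refine ⟨60 / (c^2 / (4 * R))^2, by positivity, fun Y hY n s hs => ?_⟩
  have hn := pnat_pos_real n
  have h := csqrt_dual_re' c R hc hR Y hY n s hs
  have hp : 0 < Real.sqrt (n * (c^2 / (4 * R))) := Real.sqrt_pos.mpr (by positivity)
  refine (norm_kint_zero_le' _ (lt_of_lt_of_le hp h)).trans ?_
  have h4 : Real.sqrt (n * (c^2 / (4 * R)))^4 = (n * (c^2 / (4 * R)))^2 := by
    rw [show (4:ℕ) = 2 * 2 by norm_num, pow_mul, Real.sq_sqrt (by positivity)]
  calc _ ≤ 60 / Real.sqrt (n * (c^2 / (4 * R)))^4 := by gcongr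
    _ = _ := by rw [h4]; field_simp

lemma norm_Psi_le (w : ℂ) (hw : 0 < w.re) : ‖Psi w‖ ≤ (2 * Real.sqrt ‖w‖ + 4) * Real.exp (-w.re) := by
  have h := Psi_asymp w hw
  have hw0 : w ≠ 0 := by intro h0; rw [h0] at hw; simp at hw
  have hwn : 0 < ‖w‖ := norm_pos_iff.mpr hw0
  have h2 : ‖w*((Real.pi:ℂ)/(2*w))^(1/2:ℂ)*Complex.exp (-w)‖ ≤ 2 * Real.sqrt ‖w‖ * Real.exp (-w.re) := by
    rw [norm_mul, norm_mul, Complex.norm_exp, Complex.neg_re]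
    refine mul_le_mul_of_nonneg_right ?_ (Real.exp_pos _).le
    have e : (Real.pi:ℂ)/(2*w) ≠ 0 := div_ne_zero (by exact_mod_cast Real.pi_ne_zero) (by simpa using hw0)
    have h3 : ‖((Real.pi:ℂ)/(2*w))^(1/2:ℂ)‖ = Real.sqrt (Real.pi / (2 * ‖w‖)) := by
      rw [Complex.norm_cpow_of_ne_zero e]
      simp [Real.sqrt_eq_rpow, abs_of_pos Real.pi_pos]
    rw [h3]
    have h4 : ‖w‖ = Real.sqrt ‖w‖ * Real.sqrt ‖w‖ := (Real.mul_self_sqrt hwn.le).symm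
    calc ‖w‖ * Real.sqrt (Real.pi / (2 * ‖w‖)) = Real.sqrt ‖w‖ * (Real.sqrt ‖w‖ * Real.sqrt (Real.pi / (2 * ‖w‖))) := by
          rw [← mul_assoc, ← h4]
      _ = Real.sqrt ‖w‖ * Real.sqrt (Real.pi / 2) := by
          rw [← Real.sqrt_mul hwn.le]; congr 2; field_simp
      _ ≤ Real.sqrt ‖w‖ * 2 := by
          gcongr
          rw [Real.sqrt_le_left (by norm_num)]; linarith [Real.pi_lt_four]
      _ = _ := by ring
  calc ‖Psi w‖ ≤ ‖Psi w - w*((Real.pi:ℂ)/(2*w))^(1/2:ℂ)*Complex.exp (-w)‖ + ‖w*((Real.pi:ℂ)/(2*w))^(1/2:ℂ)*Complex.exp (-w)‖ := by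
        simpa using norm_add_le (Psi w - w*((Real.pi:ℂ)/(2*w))^(1/2:ℂ)*Complex.exp (-w)) (w*((Real.pi:ℂ)/(2*w))^(1/2:ℂ)*Complex.exp (-w))
    _ ≤ 4 * Real.exp (-w.re) + 2 * Real.sqrt ‖w‖ * Real.exp (-w.re) := add_le_add h h2
    _ = _ := by ring

/-- terms of the dual sum -/
noncomputable def D0t (n : ℕ+) (Y : ℂ) : ℂ := -(1/(2 * Real.pi * Complex.I)) * ((divfun n : ℂ) / n) *
  (Psi (4 * Real.pi * csqrt (Complex.I * n * Y)) - Psi (4 * Real.pi * csqrt (-Complex.I * n * Y)))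

noncomputable def dual0 (Y : ℂ) : ℂ := ∑' n : ℕ+, D0t n Y

lemma hasDerivAt_Psi_dual (Y : ℂ) (hY : 0 < Y.re) (n : ℕ+) (s : ℂ) (hs : s = Complex.I ∨ s = -Complex.I) :
    HasDerivAt (fun Y => Psi (4 * Real.pi * csqrt (s * n * Y)))
      (-(8 * Real.pi^2 * s * n) * kint 0 (4 * Real.pi * csqrt (s * n * Y))) Y := by
  obtain ⟨hsl, hre⟩ := csqrt_dual_re Y hY n s hs
  have hp := csqrt_re_pos hsl
  have hc0 : csqrt (s * n * Y) ≠ 0 := by intro h; rw [h] at hp; simp at hp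
  obtain ⟨d, hd⟩ : ∃ d, HasDerivAt csqrt d (s * n * Y) := ⟨_, (differentiableAt_csqrt hsl).hasDerivAt⟩
  have hd2 : 2 * csqrt (s * n * Y) * d = 1 := by
    have h1 := hd.pow 2
    have h2 : HasDerivAt (fun z : ℂ => z) 1 (s * n * Y) := hasDerivAt_id _
    have h3 : (csqrt ^ 2) = fun z : ℂ => z := by ext z; simp [csqrt_sq]
    rw [h3] at h1
    have := h1.unique h2
    simpa using this
  have hin : HasDerivAt (fun Y : ℂ => s * n * Y) (s * n) Y := by
    simpa using (hasDerivAt_id Y).const_mul (s * n)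
  have h4 : HasDerivAt (fun Y : ℂ => 4 * Real.pi * csqrt (s * n * Y)) (4 * Real.pi * (d * (s * n))) Y :=
    (HasDerivAt.comp Y hd hin).const_mul _
  have hwre : 0 < (4 * Real.pi * csqrt (s * n * Y)).re := by
    rw [show (4 * Real.pi : ℂ) = ((4 * Real.pi : ℝ) : ℂ) by push_cast; ring, Complex.re_ofReal_mul]
    have := Real.pi_pos
    positivity
  have h5 := HasDerivAt.comp Y (hasDerivAt_Psi _ hwre) h4
  refine h5.congr_deriv ?_
  linear_combination (-(8 * Real.pi^2 * s * n) * kint 0 (4 * Real.pi * csqrt (s * n * Y))) * hd2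

lemma hasDerivAt_D0t (Y : ℂ) (hY : 0 < Y.re) (n : ℕ+) :
    HasDerivAt (D0t n) (4 * Real.pi * ((divfun n : ℂ) *
  (kint 0 (4 * Real.pi * csqrt (Complex.I * n * Y)) + kint 0 (4 * Real.pi * csqrt (-Complex.I * n * Y))))) Y := by
  have h1 := hasDerivAt_Psi_dual Y hY n Complex.I (Or.inl rfl)
  have h2 := hasDerivAt_Psi_dual Y hY n (-Complex.I) (Or.inr rfl)
  have h3 := (h1.sub h2).const_mul (-(1/(2 * Real.pi * Complex.I)) * ((divfun n : ℂ) / n))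
  refine h3.congr_deriv ?_
  have hnc : (n:ℂ) ≠ 0 := by exact_mod_cast (pnat_pos_real n).ne'
  have hp : (Real.pi:ℂ) ≠ 0 := by exact_mod_cast Real.pi_ne_zero
  have hI := Complex.I_ne_zero
  generalize kint 0 (4 * Real.pi * csqrt (Complex.I * n * Y)) = A
  generalize kint 0 (4 * Real.pi * csqrt (-Complex.I * n * Y)) = B
  field_simp
  ring

lemma D0t_bound (c R : ℝ) (hc : 0 < c) (hR : 0 < R) : ∃ K : ℝ, 0 < K ∧ ∀ Y ∈ tdom c R, ∀ n : ℕ+,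
    ‖4 * Real.pi * ((divfun n : ℂ) *
  (kint 0 (4 * Real.pi * csqrt (Complex.I * n * Y)) + kint 0 (4 * Real.pi * csqrt (-Complex.I * n * Y))))‖ ≤ K * ((divfun n : ℝ) * (1/(n:ℝ)^2)) := by
  obtain ⟨K, hK, h⟩ := kint_dual_bound c R hc hR
  have hpi := Real.pi_pos
  refine ⟨8 * Real.pi * K, by positivity, fun Y hY n => ?_⟩
  have h1 := h Y hY n Complex.I (Or.inl rfl)
  have h2 := h Y hY n (-Complex.I) (Or.inr rfl)
  rw [norm_mul, norm_mul, norm_mul, Complex.norm_natCast, Complex.norm_real, Complex.norm_ofNat, Real.norm_of_nonneg hpi.le]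
  calc _ ≤ 4 * Real.pi * ((divfun n : ℝ) * (K * (1/(n:ℝ)^2) + K * (1/(n:ℝ)^2))) := by
        gcongr
        exact (norm_add_le _ _).trans (add_le_add h1 h2)
    _ = _ := by ring

lemma norm_Psi_dual_one : ∃ K : ℝ, 0 < K ∧ ∀ n : ℕ+, ∀ s : ℂ, s = Complex.I ∨ s = -Complex.I →
    ‖Psi (4 * Real.pi * csqrt (s * n * 1))‖ ≤ K * (1/(n:ℝ)) := by
  have hpi := Real.pi_pos
  refine ⟨(2 * 4 * Real.pi + 4) * 400000, by positivity, fun n s hs => ?_⟩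
  have hn := pnat_pos_real n
  have hn1 : (1:ℝ) ≤ n := by exact_mod_cast n.2
  obtain ⟨hsl, hre⟩ := csqrt_dual_re 1 (by simp) n s hs
  have hp := csqrt_re_pos hsl
  have hw : (4 * Real.pi * csqrt (s * n * 1)).re = 4 * Real.pi * (csqrt (s * n * 1)).re := by
    rw [show (4 * Real.pi : ℂ) = ((4 * Real.pi : ℝ) : ℂ) by push_cast; ring, Complex.re_ofReal_mul]
  have hsn : ‖s‖ = 1 := by rcases hs with h | h <;> simp [h]
  have hnorm : ‖csqrt (s * n * 1)‖ = Real.sqrt n := by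
    have : ‖csqrt (s * n * 1)‖^2 = n := by
      rw [← norm_pow, csqrt_sq, norm_mul, norm_mul, hsn]; simp
    rw [← this, Real.sqrt_sq (norm_nonneg _)]
  have hre2 : Real.sqrt n ≤ (4 * Real.pi * csqrt (s * n * 1)).re := by
    rw [hw]
    have : Real.sqrt (n * ((1:ℂ).re^2 / (4 * ‖(1:ℂ)‖))) = Real.sqrt n / 2 := by
      simp
      rw [show (4:ℝ) = 2^2 by norm_num, Real.sqrt_sq (by norm_num)]; ring
    rw [this] at hre
    nlinarith [Real.pi_gt_three, Real.sqrt_nonneg (n:ℝ)]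
  have hsq : 0 < Real.sqrt n := Real.sqrt_pos.mpr hn
  have hs1 : 1 ≤ Real.sqrt n := by rw [Real.one_le_sqrt]; exact hn1
  refine (norm_Psi_le _ (lt_of_lt_of_le hsq hre2)).trans ?_
  have hA : 2 * Real.sqrt ‖4 * Real.pi * csqrt (s * n * 1)‖ + 4 ≤ (2 * 4 * Real.pi + 4) * Real.sqrt n := by
    rw [norm_mul, hnorm, norm_mul, Complex.norm_real, Complex.norm_ofNat, Real.norm_of_nonneg hpi.le]
    have : Real.sqrt (4 * Real.pi * Real.sqrt n) ≤ 4 * Real.pi * Real.sqrt n := by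
      rw [Real.sqrt_le_left (by positivity)]
      have : 1 ≤ 4 * Real.pi * Real.sqrt n := by nlinarith [Real.pi_gt_three]
      nlinarith
    nlinarith
  have hB : Real.exp (-(4 * Real.pi * csqrt (s * n * 1)).re) ≤ 6 / (Real.sqrt n)^3 := by
    have h3 := Real.pow_div_factorial_le_exp (Real.sqrt n) hsq.le 3
    norm_num [Nat.factorial] at h3
    calc _ ≤ Real.exp (-Real.sqrt n) := Real.exp_le_exp.mpr (by linarith)
      _ = (Real.exp (Real.sqrt n))⁻¹ := Real.exp_neg _
      _ ≤ (Real.sqrt n ^ 3 / 6)⁻¹ := inv_anti₀ (by positivity) h3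
      _ = _ := by rw [inv_div]
  calc _ ≤ ((2 * 4 * Real.pi + 4) * Real.sqrt n) * (6 / (Real.sqrt n)^3) := by gcongr
    _ = (2 * 4 * Real.pi + 4) * 6 * (1/ (Real.sqrt n)^2) := by field_simp
    _ = (2 * 4 * Real.pi + 4) * 6 * (1/ n) := by rw [Real.sq_sqrt hn.le]
    _ ≤ _ := by gcongr; norm_num

lemma summable_D0t_one : Summable (fun n => D0t n 1) := by
  obtain ⟨K, hK, h⟩ := norm_Psi_dual_one
  have hpi := Real.pi_pos
  refine Summable.of_norm_bounded (summable_divfun_sq.mul_left (1 / (2 * Real.pi) * (2 * K))) fun n => ?_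
  have hn := pnat_pos_real n
  unfold D0t
  rw [norm_mul, norm_mul, norm_neg, norm_div, norm_div, norm_mul, norm_mul, Complex.norm_I, Complex.norm_natCast, Complex.norm_natCast, Complex.norm_real, Complex.norm_ofNat, Real.norm_of_nonneg hpi.le, norm_one, mul_one]
  calc _ ≤ 1 / (2 * Real.pi) * ((divfun n : ℝ) / n) * (K * (1/(n:ℝ)) + K * (1/(n:ℝ))) := by
        gcongr
        exact (norm_sub_le _ _).trans (add_le_add (h n _ (Or.inl rfl)) (h n _ (Or.inr rfl)))
    _ = _ := by field_simp; ring

lemma hasDerivAt_dual0 (Y : ℂ) (hY : 0 < Y.re) : Summable (fun n => D0t n Y) ∧ HasDerivAt dual0 (4 * Real.pi * dual1 Y) Y := by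
  set c := min (Y.re/2) (1/2)
  set R := max (‖Y‖+1) 2
  have hc : 0 < c := by positivity
  have hR : 0 < R := by positivity
  obtain ⟨K, hK, h⟩ := D0t_bound c R hc hR
  have hm : Y ∈ tdom c R := ⟨lt_of_le_of_lt (min_le_left _ _) (half_lt_self hY), by
    rw [mem_ball_zero_iff]; exact lt_of_lt_of_le (by linarith) (le_max_left _ _)⟩
  have hm1 : (1:ℂ) ∈ tdom c R := ⟨lt_of_le_of_lt (min_le_right (Y.re/2) (1/2:ℝ)) (show (1/2:ℝ) < (1:ℂ).re by norm_num), by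
    rw [mem_ball_zero_iff]; exact lt_of_lt_of_le (b := (2:ℝ)) (by norm_num) (le_max_right _ _)⟩
  have hD : ∀ (n : ℕ+) (y : ℂ), y ∈ tdom c R → HasDerivAt (D0t n) _ y :=
    fun n y hy => hasDerivAt_D0t y (lt_trans hc hy.1) n
  constructor
  · exact summable_of_summable_hasDerivAt_of_isPreconnected (summable_divfun_sq.mul_left K) (isOpen_tdom c R)
      (convex_tdom c R).isPreconnected hD (fun n y hy => h y hy n) hm1 summable_D0t_one hm
  · have := hasDerivAt_tsum_of_isPreconnected (summable_divfun_sq.mul_left K) (isOpen_tdom c R)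
      (convex_tdom c R).isPreconnected hD (fun n y hy => h y hy n) hm1 summable_D0t_one hm
    rw [tsum_mul_left] at this
    exact this

lemma differentiable_dual1 : DifferentiableOn ℂ (fun Y => 4 * Real.pi * dual1 Y) {z | 0 < z.re} := by
  have h : DifferentiableOn ℂ dual0 {z | 0 < z.re} := fun Y hY => (hasDerivAt_dual0 Y hY).2.differentiableAt.differentiableWithinAt
  refine (h.deriv isOpen_rhp).congr fun Y hY => ?_
  exact (hasDerivAt_dual0 Y hY).2.deriv.symm

theorem WW_formula : ∃ P c0 : ℂ, ∀ Y : ℂ, 0 < Y.re →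
    WW Y = Real.pi * (Y * Complex.log Y - Y) + P * Y + 1/2 * Complex.log Y + c0 + dual0 Y := by
  obtain ⟨P, hP⟩ := fp_formula
  have key : ∀ Y : ℂ, 0 < Y.re → fp Y = Real.pi * Complex.log Y + 1/(2*Y) + P + 4 * Real.pi * dual1 Y := by
    intro Y hY
    refine rhp_identity fp (fun Y => Real.pi * Complex.log Y + 1/(2*Y) + P + 4 * Real.pi * dual1 Y) differentiable_fp ?_ ?_ Y hY
    · refine DifferentiableOn.add ?_ differentiable_dual1
      intro z hz
      have hz0 : z ≠ 0 := by intro h; rw [h] at hz; simp at hz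
      have hsl := mem_slit_of_re hz
      apply DifferentiableAt.differentiableWithinAt
      have hz2 : 2 * z ≠ 0 := by simpa using hz0
      fun_prop (disch := assumption)
    · intro x hx
      rw [hP x hx]
      push_cast [Complex.ofReal_log hx.le]
      ring
  set V : ℂ → ℂ := fun Y => Real.pi * (Y * Complex.log Y - Y) + P * Y + 1/2 * Complex.log Y + dual0 Y
  have hV : ∀ Y : ℂ, 0 < Y.re → HasDerivAt (fun Y => WW Y - V Y) 0 Y := by
    intro Y hY
    have hsl := mem_slit_of_re hY
    have hY0 : Y ≠ 0 := by intro h; rw [h] at hY; simp at hY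
    have l := Complex.hasDerivAt_log hsl
    have i := hasDerivAt_id Y
    have a := ((i.mul l).sub i).const_mul (Real.pi:ℂ)
    have b := i.const_mul P
    have c := l.const_mul (1/2:ℂ)
    have d := ((a.add b).add c).add (hasDerivAt_dual0 Y hY).2
    have e := (hasDerivAt_WW Y hY).2.sub d
    refine e.congr_deriv ?_
    rw [key Y hY]
    simp only [id]
    field_simp
    ring
  refine ⟨P, WW 1 - V 1, fun Y hY => ?_⟩
  have hconst := (isOpen_rhp).is_const_of_deriv_eq_zero (f := fun Y => WW Y - V Y)
    (convex_halfSpace_re_gt 0).isPreconnected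
    (fun z hz => (hV z hz).differentiableAt.differentiableWithinAt) (fun z hz => (hV z hz).deriv) (x := Y) (y := 1) hY (by simp)
  have : WW Y = (WW 1 - V 1) + V Y := by rw [← hconst]; ring
  rw [this]
  simp only [V]
  ring

end

section
open Filter MeasureTheory Topology

lemma exp_neg_le_rpow (k t : ℝ) (hk : 0 < k) (ht : 0 < t) : Real.exp (-t) ≤ k^k * t^(-k) := by
  have h1 : t/k ≤ Real.exp (t/k) := by have := Real.add_one_le_exp (t/k); linarith
  have h2 : (t/k)^k ≤ Real.exp (t/k)^k := Real.rpow_le_rpow (by positivity) h1 hk.le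
  rw [← Real.exp_mul, div_mul_cancel₀ _ hk.ne', Real.div_rpow ht.le hk.le] at h2
  rw [Real.exp_neg, Real.rpow_neg ht.le, ← div_eq_mul_inv, ← inv_div]
  exact inv_anti₀ (by positivity) h2

lemma sum_exp_bound (a k : ℝ) (hk : 0 < k) (hak : 1 < a + k/2) : ∃ C : ℝ, 0 < C ∧ ∀ β : ℝ, 0 < β →
    Summable (fun n : ℕ+ => (divfun n : ℝ) * (n:ℝ)^(-a) * Real.exp (-(4 * Real.pi * Real.sqrt n * β))) ∧
    ∑' n : ℕ+, (divfun n : ℝ) * (n:ℝ)^(-a) * Real.exp (-(4 * Real.pi * Real.sqrt n * β)) ≤ C * β^(-k) := by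
  set ε := (a + k/2 - 1)/2 with hε
  have hε0 : 0 < ε := by rw [hε]; linarith
  obtain ⟨C1, hC1, hd⟩ := divfun_le ε hε0
  have hs : Summable (fun n : ℕ => (n:ℝ)^(-(1+ε))) := Real.summable_nat_rpow.mpr (by linarith)
  have hs' : Summable (fun n : ℕ+ => (n:ℝ)^(-(1+ε))) := hs.comp_injective PNat.coe_injective
  have hS : 0 ≤ ∑' n : ℕ+, (n:ℝ)^(-(1+ε)) := tsum_nonneg fun n => by positivity
  have hkk : 0 < k^k := by positivity
  have key : ∀ β : ℝ, 0 < β → ∀ n : ℕ+, (divfun n : ℝ) * (n:ℝ)^(-a) * Real.exp (-(4 * Real.pi * Real.sqrt n * β)) ≤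
      (C1 * k^k * β^(-k)) * (n:ℝ)^(-(1+ε)) := by
    intro β hβ n
    have hn := pnat_pos_real n
    have hsq : 0 < Real.sqrt n := Real.sqrt_pos.mpr hn
    have h1 : Real.exp (-(4 * Real.pi * Real.sqrt n * β)) ≤ k^k * ((n:ℝ)^(-(k/2)) * β^(-k)) := by
      calc _ ≤ Real.exp (-(Real.sqrt n * β)) := by
            apply Real.exp_le_exp.mpr
            have : 0 < Real.sqrt n * β := by positivity
            nlinarith [Real.pi_gt_three]
        _ ≤ k^k * (Real.sqrt n * β)^(-k) := exp_neg_le_rpow k _ hk (by positivity)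
        _ = _ := by
            rw [Real.mul_rpow hsq.le hβ.le, Real.sqrt_eq_rpow, ← Real.rpow_mul hn.le]
            congr 3; ring
    calc _ ≤ (C1 * (n:ℝ)^ε) * (n:ℝ)^(-a) * (k^k * ((n:ℝ)^(-(k/2)) * β^(-k))) := by
          gcongr
          exact hd n n.pos
      _ = (C1 * k^k * β^(-k)) * ((n:ℝ)^ε * (n:ℝ)^(-a) * (n:ℝ)^(-(k/2))) := by ring
      _ = _ := by
          rw [← Real.rpow_add hn, ← Real.rpow_add hn]; congr 2; rw [hε]; ring
  refine ⟨C1 * k^k * (∑' n : ℕ+, (n:ℝ)^(-(1+ε)) + 1), by positivity, fun β hβ => ?_⟩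
  have hsum : Summable (fun n : ℕ+ => (divfun n : ℝ) * (n:ℝ)^(-a) * Real.exp (-(4 * Real.pi * Real.sqrt n * β))) :=
    Summable.of_nonneg_of_le (fun n => by positivity) (key β hβ) (hs'.mul_left _)
  refine ⟨hsum, ?_⟩
  calc _ ≤ ∑' n : ℕ+, (C1 * k^k * β^(-k)) * (n:ℝ)^(-(1+ε)) := hsum.tsum_le_tsum (key β hβ) (hs'.mul_left _)
    _ = (C1 * k^k * β^(-k)) * ∑' n : ℕ+, (n:ℝ)^(-(1+ε)) := tsum_mul_left
    _ ≤ (C1 * k^k * β^(-k)) * (∑' n : ℕ+, (n:ℝ)^(-(1+ε)) + 1) := by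
        have : 0 < C1 := by linarith
        gcongr; linarith
    _ = _ := by ring

lemma abs_arg_le (v : ℂ) (hv : 0 < v.re) : |v.arg| ≤ 2 * (|v.im| / ‖v‖) := by
  have hv0 : v ≠ 0 := by intro h; rw [h] at hv; simp at hv
  have h1 : |v.arg| ≤ Real.pi/2 := Complex.abs_arg_le_pi_div_two_iff.mpr hv.le
  have h2 := Real.mul_le_sin (abs_nonneg v.arg) h1
  have h3 : Real.sin |v.arg| = |v.im| / ‖v‖ := by
    have := Complex.sin_arg v
    have hn : |Real.sin v.arg| = |v.im|/‖v‖ := by rw [this, abs_div, abs_norm]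
    rw [← hn]
    rcases abs_cases v.arg with ⟨h, h'⟩ | ⟨h, h'⟩
    · rw [h, abs_of_nonneg]
      apply Real.sin_nonneg_of_nonneg_of_le_pi h'; rw [h] at h1; linarith [Real.pi_pos]
    · rw [h, Real.sin_neg, abs_of_nonpos]
      apply Real.sin_nonpos_of_nonpos_of_neg_pi_le h'.le; rw [h] at h1; linarith [Real.pi_pos]
  rw [← h3]
  have h4 : |v.arg| * (1/2) ≤ 2/Real.pi * |v.arg| := by
    rw [mul_comm]
    refine mul_le_mul_of_nonneg_right ?_ (abs_nonneg _)
    rw [div_le_div_iff₀ (by norm_num) Real.pi_pos]; linarith [Real.pi_lt_four]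
  linarith

/-- the n-th jump -/
noncomputable def jn (z : ℂ) (n : ℕ+) : ℝ := -((1 - z / n).arg + (1 + z/n).arg) / Real.pi

lemma one_sub_re_im (z : ℂ) (n : ℕ+) : (1 - z / n).re = (n - z.re)/n ∧ (1 - z/n).im = -(z.im/n) ∧
   (1 + z / n).re = (n + z.re)/n ∧ (1 + z/n).im = (z.im/n) := by
  have hn := pnat_pos_real n
  have h1 : (z / n).re = z.re / n := by
    rw [← Complex.ofReal_natCast, Complex.div_ofReal_re]
  have h2 : (z / n).im = z.im / n := by
    rw [← Complex.ofReal_natCast, Complex.div_ofReal_im]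
  simp only [Complex.sub_re, Complex.add_re, Complex.sub_im, Complex.add_im, Complex.one_re, Complex.one_im, h1, h2]
  refine ⟨by field_simp, by ring, by field_simp, by ring⟩

lemma arg_div_le (a b : ℝ) (v : ℂ) (n : ℝ) (hn : 0 < n) (hre : v.re = a / n) (him : |v.im| = b/n) (ha : 0 < a) (hb : 0 ≤ b) :
    |v.arg| ≤ 2 * (b / a) := by
  have hv : 0 < v.re := by rw [hre]; positivity
  refine (abs_arg_le v hv).trans ?_
  have : v.re ≤ ‖v‖ := Complex.re_le_norm v
  calc 2 * (|v.im| / ‖v‖) ≤ 2 * (|v.im| / v.re) := by gcongr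
    _ = _ := by rw [hre, him]; field_simp

/-- near terms -/
lemma jn_near (z : ℂ) (hzr : 0 < z.re) (H : ℝ) (hH : z.im = H) (hH1 : 1 ≤ H) (x : ℝ) (hx : z.re ≤ x) (hx1 : x ≤ z.re + 1)
    (n : ℕ+) : |jn z n - (if (n:ℝ) ≤ x then 1 else 0)| ≤ 8 * H / (1 + |(n:ℝ) - ⌊x⌋₊|) + H / z.re := by
  have hn := pnat_pos_real n
  obtain ⟨r1, i1, r2, i2⟩ := one_sub_re_im z n
  have hpi := Real.pi_pos
  have hH0 : 0 < H := by linarith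
  rw [hH] at i1 i2
  have hx0 : 0 ≤ x := by linarith
  have hfl := Nat.floor_le hx0
  have hfl2 := Nat.lt_floor_add_one x
  have i1' : |(1 - z/n).im| = H/n := by rw [i1, abs_neg, abs_of_pos (by positivity)]
  have i2' : |(1 + z/n).im| = H/n := by rw [i2, abs_of_pos (by positivity)]
  have b2 : |(1 + z/n).arg| ≤ 2 * (H / z.re) := by
    refine (arg_div_le (n + z.re) H _ n hn r2 i2' (by positivity) hH0.le).trans ?_
    gcongr
    linarith
  have p3 := Real.pi_gt_three
  suffices hs : |-(1 - z/n).arg / Real.pi - (if (n:ℝ) ≤ x then 1 else 0)| ≤ 8 * H / (1 + |(n:ℝ) - ⌊x⌋₊|) by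
    have e : jn z n - (if (n:ℝ) ≤ x then 1 else 0) = (-(1 - z/n).arg / Real.pi - (if (n:ℝ) ≤ x then 1 else 0)) + (-(1 + z/n).arg/Real.pi) := by
      unfold jn; ring
    rw [e]
    refine (abs_add_le _ _).trans (add_le_add hs ?_)
    rw [abs_div, abs_neg, abs_of_pos hpi, div_le_iff₀ hpi]
    have : 0 < H / z.re := by positivity
    nlinarith
  have hargneg : (1 - z/n).arg < 0 := by
    rw [Complex.arg_neg_iff, i1]
    have : 0 < H/n := by positivity
    linarith
  have harggt := Complex.neg_pi_lt_arg (1 - z/n)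
  have hA0 : 0 ≤ -(1 - z/n).arg / Real.pi := by apply div_nonneg _ hpi.le; linarith
  have hA1 : -(1 - z/n).arg / Real.pi ≤ 1 := by rw [div_le_one hpi]; linarith
  rcases le_or_gt |(n:ℝ) - ⌊x⌋₊| 4 with h4 | h4
  · have : |-(1 - z/n).arg / Real.pi - (if (n:ℝ) ≤ x then 1 else 0)| ≤ 1 := by
      split_ifs <;> rw [abs_le] <;> constructor <;> linarith
    refine this.trans ?_
    rw [le_div_iff₀ (by positivity)]
    linarith
  · rcases abs_cases ((n:ℝ) - ⌊x⌋₊) with ⟨h, h'⟩ | ⟨h, h'⟩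
    · rw [h] at h4 ⊢
      rw [if_neg (by push Not; linarith), sub_zero]
      have b1 := arg_div_le (n - z.re) H _ n hn r1 i1' (by linarith) hH0.le
      rw [abs_div, abs_neg, abs_of_pos hpi, div_le_iff₀ hpi]
      refine b1.trans ?_
      have : 2 * (H / (n - z.re)) ≤ 8 * H / (1 + ((n:ℝ) - ⌊x⌋₊)) := by
        rw [mul_div_assoc', div_le_div_iff₀ (by linarith) (by linarith)]
        nlinarith
      have h8 : 0 ≤ 8 * H / (1 + ((n:ℝ) - ⌊x⌋₊)) := by apply div_nonneg <;> linarith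
      nlinarith
    · rw [h] at h4 ⊢
      rw [if_pos (by linarith)]
      have e2 : (1 - z/n).arg = (-(1 - z/n)).arg - Real.pi := by
        have := Complex.arg_neg_eq_arg_sub_pi_of_im_pos (x := -(1 - z/n)) (by
          rw [Complex.neg_im, i1]; have : 0 < H/n := by positivity
          linarith)
        rwa [neg_neg] at this
      have b1 := arg_div_le (z.re - n) H (-(1 - z/n)) n hn (by rw [Complex.neg_re, r1]; ring) (by rw [Complex.neg_im, abs_neg, i1']) (by linarith) hH0.le
      have e3 : -(1 - z/n).arg / Real.pi - 1 = -(-(1 - z/n)).arg / Real.pi := by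
        rw [e2]; field_simp; ring
      rw [e3, abs_div, abs_neg, abs_of_pos hpi, div_le_iff₀ hpi]
      refine b1.trans ?_
      have : 2 * (H / (z.re - n)) ≤ 8 * H / (1 + -((n:ℝ) - ⌊x⌋₊)) := by
        rw [mul_div_assoc', div_le_div_iff₀ (by linarith) (by linarith)]
        nlinarith
      have h8 : 0 ≤ 8 * H / (1 + -((n:ℝ) - ⌊x⌋₊)) := by apply div_nonneg <;> linarith
      nlinarith

/-- far terms -/
lemma jn_far (z : ℂ) (n : ℕ+) (hn2 : 2 * ‖z‖ ≤ n) : |jn z n| ≤ 2 * ‖z‖ * |z.im| / (n:ℝ)^2 := by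
  have hn := pnat_pos_real n
  obtain ⟨r1, i1, r2, i2⟩ := one_sub_re_im z n
  have hpi := Real.pi_pos
  have hre := Complex.abs_re_le_norm z
  have hz0 := norm_nonneg z
  have hlt : |z.re| < n := by
    rcases eq_or_lt_of_le hz0 with h | h
    · rw [← h] at hre; linarith
    · linarith
  have p1 : 0 < (1 - z/n).re := by rw [r1]; apply div_pos _ hn; linarith [le_abs_self z.re]
  have p2 : 0 < (1 + z/n).re := by rw [r2]; apply div_pos _ hn; linarith [neg_abs_le z.re]
  have a1 := abs_lt.mp (Complex.abs_arg_lt_pi_div_two_iff.mpr (Or.inl p1))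
  have a2 := abs_lt.mp (Complex.abs_arg_lt_pi_div_two_iff.mpr (Or.inl p2))
  have n1 : (1 - z/n) ≠ 0 := by intro h; rw [h] at p1; simp at p1
  have n2 : (1 + z/n) ≠ 0 := by intro h; rw [h] at p2; simp at p2
  have hmul := Complex.arg_mul n1 n2 ⟨by linarith, by linarith⟩
  have hnc : (n:ℂ) ≠ 0 := by exact_mod_cast hn.ne'
  have e : (1 - z/n) * (1 + z/n) = 1 - z^2 / ((n:ℝ)^2 : ℝ) := by push_cast; field_simp; ring
  have hzn : ‖z^2 / (((n:ℝ)^2 : ℝ):ℂ)‖ ≤ 1/4 := by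
    rw [norm_div, norm_pow, Complex.norm_real, Real.norm_of_nonneg (by positivity), div_le_iff₀ (by positivity)]
    nlinarith
  have hre1 : (3:ℝ)/4 ≤ (1 - z^2 / (((n:ℝ)^2 : ℝ):ℂ)).re := by
    rw [Complex.sub_re, Complex.one_re]
    have := Complex.re_le_norm (z^2 / (((n:ℝ)^2 : ℝ):ℂ))
    linarith
  have him : |(1 - z^2 / (((n:ℝ)^2 : ℝ):ℂ)).im| ≤ 2 * ‖z‖ * |z.im| / (n:ℝ)^2 := by
    rw [Complex.sub_im, Complex.one_im, zero_sub, abs_neg, Complex.div_ofReal_im, abs_div, abs_of_pos (show 0 < (n:ℝ)^2 by positivity)]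
    gcongr
    rw [sq, Complex.mul_im]
    calc |z.re * z.im + z.im * z.re| = 2 * |z.re| * |z.im| := by
          rw [show z.re * z.im + z.im * z.re = 2 * z.re * z.im by ring, abs_mul, abs_mul, abs_two]
      _ ≤ _ := by gcongr
  unfold jn
  rw [← hmul, e, abs_div, abs_neg, abs_of_pos hpi, div_le_iff₀ hpi]
  refine (abs_arg_le _ (by linarith)).trans ?_
  have hnorm : (3:ℝ)/4 ≤ ‖1 - z^2 / (((n:ℝ)^2 : ℝ):ℂ)‖ := hre1.trans (Complex.re_le_norm _)
  have hB : 0 ≤ 2 * ‖z‖ * |z.im| / (n:ℝ)^2 := by positivity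
  calc 2 * (|(1 - z^2 / (((n:ℝ)^2 : ℝ):ℂ)).im| / ‖1 - z^2 / (((n:ℝ)^2 : ℝ):ℂ)‖) ≤ 2 * ((2 * ‖z‖ * |z.im| / (n:ℝ)^2) / (3/4)) := by
        gcongr
    _ ≤ _ := by rw [div_eq_mul_inv _ (3/4:ℝ)]; nlinarith [Real.pi_gt_three]

end

section
open Filter MeasureTheory Topology

lemma summable_shift (e : ℝ) (he : 0 < e) : ∃ Z : ℝ, 0 < Z ∧ ∀ m : ℕ,
    Summable (fun n : ℕ+ => (1 + |(n:ℝ) - m|)^(-(1+e))) ∧ ∑' n : ℕ+, (1 + |(n:ℝ) - m|)^(-(1+e)) ≤ Z := by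
  have h0 : Summable (fun n : ℕ => (1 + |(n:ℝ)|)^(-(1+e))) := by
    have hs : Summable (fun n : ℕ => (n:ℝ)^(-(1+e))) := Real.summable_nat_rpow.mpr (by linarith)
    have h1 := (summable_nat_add_iff 1).mpr hs
    refine h1.congr fun n => ?_
    rw [abs_of_nonneg (by positivity)]; push_cast; rw [add_comm]
  have h1 : Summable (fun k : ℤ => (1 + |(k:ℝ)|)^(-(1+e))) := by
    refine Summable.of_nat_of_neg (by simpa using h0) (by simpa using h0)
  have hnn : ∀ k : ℤ, 0 ≤ (1 + |(k:ℝ)|)^(-(1+e)) := fun k => by positivity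
  refine ⟨∑' k : ℤ, (1 + |(k:ℝ)|)^(-(1+e)) + 1, add_pos_of_nonneg_of_pos (tsum_nonneg hnn) one_pos, fun m => ?_⟩
  let i : ℕ+ → ℤ := fun n => (n:ℤ) - m
  have hi : Function.Injective i := fun a b h => by
    have : ((a:ℕ):ℤ) = (b:ℕ) := by simpa [i] using h
    exact PNat.coe_injective (by exact_mod_cast this)
  have e1 : (fun n : ℕ+ => (1 + |(n:ℝ) - m|)^(-(1+e))) = (fun k : ℤ => (1 + |(k:ℝ)|)^(-(1+e))) ∘ i := by
    ext n; simp [i]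
  rw [e1]
  refine ⟨h1.comp_injective hi, ?_⟩
  have := (h1.comp_injective hi).tsum_le_tsum_of_inj i hi (fun c _ => hnn c) (fun n => le_refl _) h1
  simp only [Function.comp_def] at this ⊢
  linarith

lemma jump_term (e C1 : ℝ) (he : 0 < e) (he2 : e ≤ 1/2) (hC1 : 1 ≤ C1) (hd : ∀ n, 1 ≤ n → (divfun n:ℝ) ≤ C1*(n:ℝ)^e)
    (z : ℂ) (x H : ℝ) (hx2 : 4 ≤ x) (hzr : z.re ≤ x) (hzr1 : x ≤ z.re + 1) (hH : z.im = H) (hH1 : 1 ≤ H)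
    (hz : ‖z‖ ≤ x + 1) (n : ℕ+) :
    |(divfun n:ℝ) * (jn z n - (if (n:ℝ) ≤ x then 1 else 0))| ≤
      (8 * C1 * H * (6*x)^(2*e)) * ((1 + |(n:ℝ) - ⌊x⌋₊|)^(-(1+e)) + (n:ℝ)^(-(1+e))) := by
  have hn := pnat_pos_real n
  have hdn := hd n n.pos
  have hx0 : 0 < x := by linarith
  have hd0 : (0:ℝ) ≤ divfun n := by positivity
  have h62 : (6*x)^(2*e) = (6*x)^e * (6*x)^e := by rw [← Real.rpow_add (by positivity)]; ring_nf
  rw [abs_mul, abs_of_nonneg hd0]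
  rcases le_or_gt (n:ℝ) (5*x) with h5 | h5
  · have hnear := jn_near z (by linarith) H hH hH1 x hzr hzr1 n
    have hne : (n:ℝ)^e ≤ (6*x)^e := Real.rpow_le_rpow hn.le (by linarith) he.le
    set k := |(n:ℝ) - ⌊x⌋₊| with hk
    have hk0 : 0 ≤ k := abs_nonneg _
    have hk1 : 1 + k ≤ 6 * x := by
      have := Nat.floor_le hx0.le
      have h0 : (0:ℝ) ≤ ⌊x⌋₊ := by positivity
      have : k ≤ 5 * x := by rw [hk, abs_le]; constructor <;> linarith
      linarith
    have hke : (1+k)^e ≤ (6*x)^e := Real.rpow_le_rpow (by linarith) hk1 he.le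
    have h1 : 8 * H / (1 + k) ≤ 8 * H * (6*x)^e * (1+k)^(-(1+e)) := by
      have : 8 * H / (1 + k) = 8 * H * (1+k)^e * (1+k)^(-(1+e)) := by
        rw [mul_assoc, ← Real.rpow_add (by linarith), show e + -(1+e) = -1 by ring, Real.rpow_neg_one]; rfl
      rw [this]; gcongr
    have h2 : H / z.re ≤ 8 * H * (6*x)^e * (n:ℝ)^(-(1+e)) := by
      have : H / z.re ≤ 8 * H * (n:ℝ)^e * (n:ℝ)^(-(1+e)) := by
        rw [mul_assoc, ← Real.rpow_add hn, show e + -(1+e) = -1 by ring, Real.rpow_neg_one, ← div_eq_mul_inv,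
          div_le_div_iff₀ (by linarith) hn]
        nlinarith
      refine this.trans ?_
      gcongr
    calc _ ≤ (C1 * (6*x)^e) * (8 * H * (6*x)^e * (1+k)^(-(1+e)) + 8 * H * (6*x)^e * (n:ℝ)^(-(1+e))) := by
          gcongr
          · exact hdn.trans (by gcongr)
          · linarith
      _ = _ := by rw [h62]; ring
  · rw [if_neg (by push Not; linarith), sub_zero]
    have hfar := jn_far z n (by linarith)
    have hn2 : (n:ℝ)^(e) * ((n:ℝ)^2)⁻¹ = (n:ℝ)^(-(1+e)) * (n:ℝ)^(2*e-1) := by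
      rw [← Real.rpow_natCast, ← Real.rpow_neg hn.le, ← Real.rpow_add hn, ← Real.rpow_add hn]; congr 1; push_cast; ring
    have hn3 : (n:ℝ)^(2*e-1) ≤ (5*x)^(2*e-1) := Real.rpow_le_rpow_of_nonpos (by positivity) h5.le (by linarith)
    have hn4 : (5*x)^(2*e-1) = (5*x)^(2*e) / (5*x) := by rw [Real.rpow_sub_one (by positivity)]
    have hn5 : (5*x)^(2*e) ≤ (6*x)^(2*e) := Real.rpow_le_rpow (by positivity) (by linarith) (by positivity)
    rw [hH, abs_of_pos (by linarith : 0 < H)] at hfar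
    calc _ ≤ (C1 * (n:ℝ)^e) * (2 * (2*x) * H / (n:ℝ)^2) := by
          gcongr
          refine hfar.trans ?_
          gcongr; linarith
      _ = C1 * (4 * x * H) * ((n:ℝ)^(e) * ((n:ℝ)^2)⁻¹) := by rw [div_eq_mul_inv]; ring
      _ ≤ C1 * (4 * x * H) * ((n:ℝ)^(-(1+e)) * ((6*x)^(2*e) / (5*x))) := by
          rw [hn2]
          gcongr
          rw [hn4] at hn3
          refine hn3.trans ?_
          gcongr
      _ = (4/5 * C1 * H * (6*x)^(2*e)) * (n:ℝ)^(-(1+e)) := by field_simp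
      _ ≤ (8 * C1 * H * (6*x)^(2*e)) * (n:ℝ)^(-(1+e)) := by gcongr; norm_num
      _ ≤ _ := by
          gcongr
          have : 0 ≤ (1 + |(n:ℝ) - ⌊x⌋₊|)^(-(1+e)) := by positivity
          linarith

lemma jump_sum (ε : ℝ) (hε : 0 < ε) : ∃ C : ℝ, 0 < C ∧ ∀ u β : ℝ, 2 ≤ u → 1/u ≤ β → β ≤ 1 → ∀ z : ℂ, z = ((u:ℂ) + β * Complex.I)^2 →
    |(∑' n : ℕ+, (divfun n:ℝ) * jn z n) - ∑ n ∈ Finset.Icc 1 ⌊u^2⌋₊, (divfun n : ℝ)| ≤ C * u^(1+ε) * β := by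
  set e := min (ε/4) (1/2) with hedef
  have he : 0 < e := by rw [hedef]; positivity
  have he2 : e ≤ 1/2 := min_le_right _ _
  have he4 : 4 * e ≤ ε := by have := min_le_left (ε/4) (1/2); linarith
  obtain ⟨C1, hC1, hd⟩ := divfun_le e he
  obtain ⟨Z, hZ, hZs⟩ := summable_shift e he
  have hs : Summable (fun n : ℕ => (n:ℝ)^(-(1+e))) := Real.summable_nat_rpow.mpr (by linarith)
  have hs' : Summable (fun n : ℕ+ => (n:ℝ)^(-(1+e))) := hs.comp_injective PNat.coe_injective
  have hS : 0 ≤ ∑' n : ℕ+, (n:ℝ)^(-(1+e)) := tsum_nonneg fun n => by positivity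
  refine ⟨16 * C1 * (6:ℝ)^(2*e) * (Z + ∑' n : ℕ+, (n:ℝ)^(-(1+e))), by positivity, fun u β hu hβ1 hβ2 z hz => ?_⟩
  have hu0 : 0 < u := by linarith
  have hβ0 : 0 < β := lt_of_lt_of_le (by positivity) hβ1
  have hre : z.re = u^2 - β^2 := by rw [hz]; simp [sq]
  have him : z.im = 2 * u * β := by rw [hz]; simp [sq]; ring
  have hnorm : ‖z‖ = u^2 + β^2 := by
    rw [hz, norm_pow, ← Complex.normSq_eq_norm_sq, Complex.normSq_add_mul_I]
  have huβ : 1 ≤ u * β := by rw [div_le_iff₀ hu0] at hβ1; linarith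
  have hβsq : β^2 ≤ 1 := by nlinarith
  set B := 8 * C1 * (2*u*β) * (6*u^2)^(2*e) with hB
  have hterm := jump_term e C1 he he2 hC1 hd z (u^2) (2*u*β) (by nlinarith) (by rw [hre]; nlinarith) (by rw [hre]; nlinarith) him (by linarith) (by rw [hnorm]; linarith)
  rw [← hB] at hterm
  obtain ⟨z1, z2⟩ := hZs ⌊u^2⌋₊
  have hsb : Summable (fun n : ℕ+ => B * ((1 + |(n:ℝ) - ⌊u^2⌋₊|)^(-(1+e)) + (n:ℝ)^(-(1+e)))) := (z1.add hs').mul_left _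
  have hsd : Summable (fun n : ℕ+ => (divfun n:ℝ) * (jn z n - (if (n:ℝ) ≤ u^2 then 1 else 0))) :=
    Summable.of_norm_bounded hsb hterm
  have hind : HasSum (fun n : ℕ+ => (divfun n:ℝ) * (if (n:ℝ) ≤ u^2 then 1 else 0)) (∑ n ∈ Finset.Icc 1 ⌊u^2⌋₊, (divfun n : ℝ)) := by
    have h1 : HasSum (fun n : ℕ => if n ∈ Finset.Icc 1 ⌊u^2⌋₊ then (divfun n:ℝ) else 0) (∑ n ∈ Finset.Icc 1 ⌊u^2⌋₊, (divfun n : ℝ)) := by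
      have := hasSum_sum_of_ne_finset_zero (L := SummationFilter.unconditional ℕ) (f := fun n : ℕ => if n ∈ Finset.Icc 1 ⌊u^2⌋₊ then (divfun n:ℝ) else 0) (s := Finset.Icc 1 ⌊u^2⌋₊) (fun b hb => if_neg hb)
      rwa [Finset.sum_congr rfl (fun b hb => if_pos hb)] at this
    have h2 := (Function.Injective.hasSum_iff PNat.coe_injective (f := fun n : ℕ => if n ∈ Finset.Icc 1 ⌊u^2⌋₊ then (divfun n:ℝ) else 0) (a := (∑ n ∈ Finset.Icc 1 ⌊u^2⌋₊, (divfun n : ℝ))) (fun x hx => by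
      have : x = 0 := by
        by_contra h
        exact hx ⟨⟨x, Nat.pos_of_ne_zero h⟩, rfl⟩
      subst this; simp)).mpr h1
    refine h2.congr_fun ?_ |> fun h => h
    intro n
    have : (n:ℕ) ∈ Finset.Icc 1 ⌊u^2⌋₊ ↔ (n:ℝ) ≤ u^2 := by
      rw [Finset.mem_Icc, Nat.le_floor_iff (by positivity)]
      exact ⟨fun h => h.2, fun h => ⟨n.pos, h⟩⟩
    simp only [Function.comp, this, mul_ite, mul_one, mul_zero]
  have hsum : Summable (fun n : ℕ+ => (divfun n:ℝ) * jn z n) := by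
    refine (hsd.add hind.summable).congr fun n => by ring
  rw [← hind.tsum_eq, ← hsum.tsum_sub hind.summable]
  have e1 : ∑' n : ℕ+, ((divfun n:ℝ) * jn z n - (divfun n:ℝ) * (if (n:ℝ) ≤ u^2 then 1 else 0)) = ∑' n : ℕ+, (divfun n:ℝ) * (jn z n - (if (n:ℝ) ≤ u^2 then 1 else 0)) :=
    tsum_congr fun n => by ring
  rw [e1]
  have hb := tsum_of_norm_bounded (f := fun n : ℕ+ => (divfun n:ℝ) * (jn z n - (if (n:ℝ) ≤ u^2 then 1 else 0))) hsb.hasSum hterm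
  rw [Real.norm_eq_abs] at hb
  refine hb.trans ?_
  rw [tsum_mul_left, z1.tsum_add hs']
  have hB2 : B ≤ 16 * C1 * (6:ℝ)^(2*e) * u^(1+ε) * β := by
    rw [hB, Real.mul_rpow (by norm_num) (by positivity), ← Real.rpow_natCast u 2, ← Real.rpow_mul hu0.le]
    have : u * u^(((2:ℕ):ℝ)*(2*e)) ≤ u^(1+ε) := by
      rw [← Real.rpow_one_add' hu0.le (by positivity)]
      exact Real.rpow_le_rpow_of_exponent_le (by linarith) (by push_cast; linarith)
    calc _ = 16 * C1 * (6:ℝ)^(2*e) * (u * u^(((2:ℕ):ℝ)*(2*e))) * β := by ring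
      _ ≤ _ := by gcongr
  calc _ ≤ (16 * C1 * (6:ℝ)^(2*e) * u^(1+ε) * β) * (Z + ∑' n : ℕ+, (n:ℝ)^(-(1+e))) := by gcongr
    _ = _ := by ring

end

section
open Filter MeasureTheory Topology

/-- weights -/
noncomputable def wt (n : ℕ) : ℝ := (divfun n : ℝ) * (n:ℝ)^(-(3/4:ℝ))

/-- smoothed Voronoi sum -/
noncomputable def Sb (β u : ℝ) : ℝ :=
  ∑' n : ℕ+, wt n * Real.exp (-(4 * Real.pi * Real.sqrt n * β)) * Real.cos (4 * Real.pi * Real.sqrt n * u - Real.pi/4)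

lemma csqrt_dual_vals (u β : ℝ) (hu : 0 < u) (hβ : 0 < β) (n : ℕ+) (Y : ℂ) (hY : Y = -Complex.I * ((u:ℂ) + β * Complex.I)^2) :
    csqrt (Complex.I * n * Y) = (Real.sqrt n : ℂ) * (u + β * Complex.I) ∧
    csqrt (-Complex.I * n * Y) = (Real.sqrt n : ℂ) * (β - u * Complex.I) := by
  have hn := pnat_pos_real n
  have hs : 0 < Real.sqrt n := Real.sqrt_pos.mpr hn
  have hsq : ((Real.sqrt n : ℝ) : ℂ)^2 = n := by
    rw [← Complex.ofReal_pow, Real.sq_sqrt hn.le]; simp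
  constructor
  · apply csqrt_unique
    · simp; positivity
    · rw [mul_pow, hsq, hY]; linear_combination ((n:ℂ) * ((u:ℂ) + β * Complex.I)^2) * Complex.I_sq
  · apply csqrt_unique
    · simp; positivity
    · rw [mul_pow, hsq, hY]
      have hI := Complex.I_sq
      generalize Complex.I = i at *
      linear_combination ((n:ℂ) * (-β^2 + u^2 - 2*β*u*i) - n * β^2 * (i^2-1) + n * (β^2 - u^2)) * hI

lemma psi_main (u β : ℝ) (hu : 0 < u) (hβ : 0 < β) (n : ℕ+) :
    ‖Psi (4 * Real.pi * ((Real.sqrt n : ℂ) * (β - u * Complex.I))) -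
      ((Real.sqrt 2 * Real.pi * (n:ℝ)^(1/4:ℝ) * Real.sqrt u : ℝ) : ℂ) * Complex.exp (-(Real.pi/4:ℝ) * Complex.I) *
        Complex.exp (4 * Real.pi * Real.sqrt n * (u + β * Complex.I) * Complex.I)‖ ≤
      (4 + 2 * Real.pi * (n:ℝ)^(1/4:ℝ) * (β / Real.sqrt u)) * Real.exp (-(4 * Real.pi * Real.sqrt n * β)) := by
  have hn := pnat_pos_real n
  have hpi := Real.pi_pos
  have hs : 0 < Real.sqrt n := Real.sqrt_pos.mpr hn
  have hsu : 0 < Real.sqrt u := Real.sqrt_pos.mpr hu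
  have hn4 : 0 < (n:ℝ)^(1/4:ℝ) := by positivity
  set w : ℂ := 4 * Real.pi * ((Real.sqrt n : ℂ) * (β - u * Complex.I)) with hw
  have hwre : w.re = 4 * Real.pi * Real.sqrt n * β := by rw [hw]; simp; ring
  have hwpos : 0 < w.re := by rw [hwre]; positivity
  have hw0 : w ≠ 0 := by intro h; rw [h] at hwpos; simp at hwpos
  have has := Psi_asymp w hwpos
  rw [hwre] at has
  have hexp : Complex.exp (4 * Real.pi * Real.sqrt n * (u + β * Complex.I) * Complex.I) = Complex.exp (-w) := by
    congr 1; rw [hw]; linear_combination (4 * Real.pi * Real.sqrt n * β : ℂ) * Complex.I_sq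
  have hne : ‖Complex.exp (-w)‖ = Real.exp (-(4 * Real.pi * Real.sqrt n * β)) := by
    rw [Complex.norm_exp, Complex.neg_re, hwre]
  set q : ℂ := ((Real.pi:ℂ)/(2*w))^(1/2:ℂ) with hq
  have hq' : q = csqrt ((Real.pi:ℂ)/(2*w)) := by rw [hq]; unfold csqrt; norm_num
  have hqre0 : 0 < ((Real.pi:ℂ)/(2*w)).re := by
    have : (Real.pi:ℂ)/(2*w) = ((Real.pi/2 : ℝ):ℂ) * w⁻¹ := by push_cast; field_simp
    rw [this, Complex.re_ofReal_mul, Complex.inv_re]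
    have := Complex.normSq_pos.mpr hw0
    positivity
  have hqsq : q^2 = (Real.pi:ℂ)/(2*w) := by rw [hq', csqrt_sq]
  have hqre : 0 < q.re := by
    rw [hq']; exact csqrt_re_pos (mem_slit_of_re hqre0)
  have hq0 : q ≠ 0 := by intro h; rw [h] at hqre; simp at hqre
  have hpic : (Real.pi:ℂ) ≠ 0 := by exact_mod_cast hpi.ne'
  set v : ℂ := w * q with hv
  have hvq : v = ((Real.pi/2 : ℝ):ℂ) * q⁻¹ := by
    rw [hv]; field_simp
    have : 2 * w * q^2 = Real.pi := by rw [hqsq]; field_simp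
    push_cast; linear_combination this/2
  have hvre : 0 < v.re := by
    rw [hvq, Complex.re_ofReal_mul, Complex.inv_re]
    have := Complex.normSq_pos.mpr hq0
    positivity
  have hvsq : v^2 = Real.pi * w / 2 := by rw [hv, mul_pow, hqsq]; field_simp
  set r : ℝ := Real.sqrt 2 * Real.pi * (n:ℝ)^(1/4:ℝ) * Real.sqrt u with hr
  set s : ℂ := (r : ℂ) * Complex.exp (-(Real.pi/4:ℝ) * Complex.I) with hsdef
  have h4 : ((n:ℝ)^(1/4:ℝ))^2 = Real.sqrt n := by
    rw [← Real.rpow_natCast, ← Real.rpow_mul hn.le, Real.sqrt_eq_rpow]; norm_num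
  have hr2 : r^2 = 2 * Real.pi^2 * Real.sqrt n * u := by
    rw [hr, mul_pow, mul_pow, mul_pow, Real.sq_sqrt (by norm_num), h4, Real.sq_sqrt hu.le]
  have hssq : s^2 = -(2 * Real.pi^2 * Real.sqrt n * u : ℝ) * Complex.I := by
    rw [hsdef, mul_pow, ← Complex.ofReal_pow, hr2, ← Complex.exp_nat_mul]
    have : Complex.exp (((2:ℕ):ℂ) * (-(Real.pi/4:ℝ) * Complex.I)) = -Complex.I := by
      rw [show ((2:ℕ):ℂ) * (-(Real.pi/4:ℝ) * Complex.I) = -(Real.pi/2 * Complex.I) by push_cast; ring, Complex.exp_neg, Complex.exp_pi_div_two_mul_I, Complex.inv_I]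
    rw [this]; ring
  have hsre : s.re = Real.pi * (n:ℝ)^(1/4:ℝ) * Real.sqrt u := by
    have : (Complex.exp (-(Real.pi/4:ℝ) * Complex.I)).re = Real.sqrt 2 / 2 := by
      have := Complex.exp_ofReal_mul_I_re (-(Real.pi/4))
      rw [Real.cos_neg, Real.cos_pi_div_four] at this
      rw [← this]; push_cast; rfl
    rw [hsdef, Complex.re_ofReal_mul, this, hr]
    have h2 : Real.sqrt 2 * Real.sqrt 2 = 2 := Real.mul_self_sqrt (by norm_num)
    linear_combination (Real.pi * (n:ℝ)^(1/4:ℝ) * Real.sqrt u / 2) * h2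
  have hdiff : (v - s) * (v + s) = (2 * Real.pi^2 * Real.sqrt n * β : ℝ) := by
    have : (v - s) * (v + s) = v^2 - s^2 := by ring
    rw [this, hvsq, hssq, hw]; push_cast; ring
  have hnorm : ‖v - s‖ * (Real.pi * (n:ℝ)^(1/4:ℝ) * Real.sqrt u) ≤ 2 * Real.pi^2 * Real.sqrt n * β := by
    have h1 := congrArg norm hdiff
    rw [norm_mul, Complex.norm_real, Real.norm_of_nonneg (by positivity)] at h1
    rw [← h1]
    gcongr
    calc _ ≤ (v+s).re := by rw [Complex.add_re, hsre]; linarith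
      _ ≤ _ := Complex.re_le_norm _
  have hvs : ‖v - s‖ ≤ 2 * Real.pi * (n:ℝ)^(1/4:ℝ) * (β / Real.sqrt u) := by
    have hP : 0 < Real.pi * (n:ℝ)^(1/4:ℝ) * Real.sqrt u := by positivity
    rw [← mul_le_mul_iff_left₀ hP]
    refine hnorm.trans (le_of_eq ?_)
    rw [← h4]; field_simp
  rw [hexp]
  have e : Psi w - s * Complex.exp (-w) = (Psi w - v * Complex.exp (-w)) + (v - s) * Complex.exp (-w) := by ring
  rw [e]
  refine (norm_add_le _ _).trans ?_
  rw [norm_mul, hne]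
  have := mul_le_mul_of_nonneg_right hvs (Real.exp_pos (-(4 * Real.pi * Real.sqrt n * β))).le
  linarith

lemma psi_neg (u β : ℝ) (hu : 2 ≤ u) (hβ : 0 < β) (hβ1 : β ≤ 1) (n : ℕ+) :
    ‖Psi (4 * Real.pi * ((Real.sqrt n : ℂ) * (u + β * Complex.I)))‖ ≤ 5 * Real.exp (-(4 * Real.pi * Real.sqrt n * β)) := by
  have hn := pnat_pos_real n
  have hpi := Real.pi_pos
  have hs : 0 < Real.sqrt n := Real.sqrt_pos.mpr hn
  set w : ℂ := 4 * Real.pi * ((Real.sqrt n : ℂ) * (u + β * Complex.I)) with hw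
  set t : ℝ := 4 * Real.pi * Real.sqrt n * u with ht
  have ht0 : 0 < t := by rw [ht]; positivity
  have hwre : w.re = t := by rw [hw, ht]; simp; ring
  have hwn : ‖w‖ ≤ 2 * t := by
    have : w.im = 4 * Real.pi * Real.sqrt n * β := by rw [hw]; simp; ring
    refine (Complex.norm_le_abs_re_add_abs_im w).trans ?_
    rw [hwre, this, abs_of_pos ht0, abs_of_pos (by positivity), ht]
    have : 4 * Real.pi * Real.sqrt n * β ≤ 4 * Real.pi * Real.sqrt n * u := by gcongr; linarith
    linarith
  refine (norm_Psi_le w (by rw [hwre]; exact ht0)).trans ?_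
  rw [hwre]
  have h1 : 2 * Real.sqrt ‖w‖ + 4 ≤ 5 * Real.exp (t/2) := by
    have h2 : Real.sqrt ‖w‖ ≤ (1 + 2 * t)/2 := by
      rw [Real.sqrt_le_left (by linarith)]; nlinarith [sq_nonneg (1 - 2*t)]
    have := Real.add_one_le_exp (t/2)
    linarith
  calc _ ≤ 5 * Real.exp (t/2) * Real.exp (-t) := by gcongr
    _ = 5 * Real.exp (-(t/2)) := by rw [mul_assoc, ← Real.exp_add]; ring_nf
    _ ≤ _ := by
      gcongr
      rw [ht]
      have : 4 * Real.pi * Real.sqrt n * (2*β) ≤ 4 * Real.pi * Real.sqrt n * u := by gcongr; linarith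
      linarith

lemma dual_term (u β : ℝ) (hu : 2 ≤ u) (hβ : 0 < β) (hβ1 : β ≤ 1) (n : ℕ+) (Y : ℂ) (hY : Y = -Complex.I * ((u:ℂ) + β * Complex.I)^2) :
    |-(D0t n Y).im / Real.pi - 1/(Real.pi * Real.sqrt 2) * Real.sqrt u *
      (wt n * Real.exp (-(4 * Real.pi * Real.sqrt n * β)) * Real.cos (4 * Real.pi * Real.sqrt n * u - Real.pi/4))| ≤
    (divfun n:ℝ) * (n:ℝ)^(-1:ℝ) * Real.exp (-(4 * Real.pi * Real.sqrt n * β)) +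
    β / Real.sqrt u * ((divfun n:ℝ) * (n:ℝ)^(-(3/4):ℝ) * Real.exp (-(4 * Real.pi * Real.sqrt n * β))) := by
  have hn := pnat_pos_real n
  have hpi := Real.pi_pos
  have hu0 : 0 < u := by linarith
  have hsu : 0 < Real.sqrt u := Real.sqrt_pos.mpr hu0
  obtain ⟨c1, c2⟩ := csqrt_dual_vals u β hu0 hβ n Y hY
  have hm := psi_main u β hu0 hβ n
  have hneg := psi_neg u β hu hβ hβ1 n
  set E := Real.exp (-(4 * Real.pi * Real.sqrt n * β)) with hE
  set A := Psi (4 * Real.pi * ((Real.sqrt n : ℂ) * (u + β * Complex.I)))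
  set B := Psi (4 * Real.pi * ((Real.sqrt n : ℂ) * (β - u * Complex.I)))
  set r : ℝ := Real.sqrt 2 * Real.pi * (n:ℝ)^(1/4:ℝ) * Real.sqrt u with hr
  set M : ℂ := (r : ℂ) * Complex.exp (-(Real.pi/4:ℝ) * Complex.I) *
        Complex.exp (4 * Real.pi * Real.sqrt n * (u + β * Complex.I) * Complex.I) with hM
  have hMre : M.re = r * (E * Real.cos (4 * Real.pi * Real.sqrt n * u - Real.pi/4)) := by
    rw [hM, mul_assoc, ← Complex.exp_add, Complex.re_ofReal_mul]
    congr 1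
    have : -(Real.pi/4:ℝ) * Complex.I + 4 * Real.pi * Real.sqrt n * (u + β * Complex.I) * Complex.I =
      ((-(4 * Real.pi * Real.sqrt n * β) : ℝ) : ℂ) + ((4 * Real.pi * Real.sqrt n * u - Real.pi/4 : ℝ):ℂ) * Complex.I := by
      push_cast; linear_combination (4 * Real.pi * Real.sqrt n * β : ℂ) * Complex.I_sq
    rw [this, Complex.exp_add, ← Complex.ofReal_exp, Complex.re_ofReal_mul, Complex.exp_ofReal_mul_I_re]
  have hD : -(D0t n Y).im / Real.pi = (divfun n:ℝ) / n / (2 * Real.pi^2) * (B.re - A.re) := by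
    unfold D0t
    rw [c1, c2]
    change -(-(1/(2 * Real.pi * Complex.I)) * ((divfun n : ℂ) / n) * (A - B)).im / Real.pi = _
    have : -(1/(2 * Real.pi * Complex.I)) * ((divfun n : ℂ) / n) * (A - B) = (((divfun n:ℝ) / n / (2 * Real.pi) : ℝ) : ℂ) * (Complex.I * (A - B)) := by
      have hpic : (Real.pi:ℂ) ≠ 0 := by exact_mod_cast hpi.ne'
      have hnc : (n:ℂ) ≠ 0 := by exact_mod_cast hn.ne'
      push_cast
      rw [one_div, mul_inv, Complex.inv_I]; field_simp
    rw [this, Complex.im_ofReal_mul, Complex.I_mul_im, Complex.sub_re]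
    field_simp; ring
  have hw : 1/(Real.pi * Real.sqrt 2) * Real.sqrt u * (wt n * E * Real.cos (4 * Real.pi * Real.sqrt n * u - Real.pi/4)) =
      (divfun n:ℝ) / n / (2 * Real.pi^2) * M.re := by
    rw [hMre, hr]
    unfold wt
    have h1 : (n:ℝ)^(-(3/4:ℝ)) = (n:ℝ)^(1/4:ℝ) / n := by
      rw [← Real.rpow_sub_one hn.ne']; norm_num
    have h2 : Real.sqrt 2 * Real.sqrt 2 = 2 := Real.mul_self_sqrt (by norm_num)
    have h3 : 0 < Real.sqrt 2 := by positivity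
    rw [h1]; field_simp; rw [show Real.sqrt 2 ^ 2 = 2 by rw [sq, h2]]; ring
  rw [hD, hw]
  have e : (divfun n:ℝ) / n / (2 * Real.pi^2) * (B.re - A.re) - (divfun n:ℝ) / n / (2 * Real.pi^2) * M.re = (divfun n:ℝ) / n / (2 * Real.pi^2) * ((B - M).re - A.re) := by
    rw [Complex.sub_re]; ring
  rw [e, abs_mul, abs_of_nonneg (by positivity)]
  have hb : |(B - M).re - A.re| ≤ (9 + 2 * Real.pi * (n:ℝ)^(1/4:ℝ) * (β / Real.sqrt u)) * E := by
    calc _ ≤ |(B-M).re| + |A.re| := abs_sub _ _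
      _ ≤ ‖B - M‖ + ‖A‖ := add_le_add (Complex.abs_re_le_norm _) (Complex.abs_re_le_norm _)
      _ ≤ _ := by linarith
  have hE0 : 0 < E := Real.exp_pos _
  have h1 : (n:ℝ)^(-(3/4):ℝ) = (n:ℝ)^(1/4:ℝ) / n := by
    rw [← Real.rpow_sub_one hn.ne']; norm_num
  rw [h1, Real.rpow_neg_one]
  have h9 : 9 + 2 * Real.pi * (n:ℝ)^(1/4:ℝ) * (β / Real.sqrt u) ≤ 2 * Real.pi^2 * (1 + (n:ℝ)^(1/4:ℝ) * (β / Real.sqrt u)) := by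
    have : 0 ≤ (n:ℝ)^(1/4:ℝ) * (β / Real.sqrt u) := by positivity
    nlinarith [Real.pi_gt_three, mul_nonneg this hpi.le]
  calc _ ≤ (divfun n:ℝ) / n / (2 * Real.pi^2) * ((2 * Real.pi^2 * (1 + (n:ℝ)^(1/4:ℝ) * (β / Real.sqrt u))) * E) := by
        gcongr
        exact hb.trans (mul_le_mul_of_nonneg_right h9 hE0.le)
    _ = _ := by field_simp

lemma dual_sum (ε : ℝ) (hε : 0 < ε) : ∃ C : ℝ, 0 < C ∧ ∀ u β : ℝ, 2 ≤ u → 1/u ≤ β → β ≤ 1 → ∀ Y : ℂ, Y = -Complex.I * ((u:ℂ) + β * Complex.I)^2 →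
    |-(dual0 Y).im / Real.pi - 1/(Real.pi * Real.sqrt 2) * Real.sqrt u * Sb β u| ≤ C * u^(1+ε) * β := by
  obtain ⟨C1, hC1, h1⟩ := sum_exp_bound 1 ε hε (by linarith)
  obtain ⟨C2, hC2, h2⟩ := sum_exp_bound (3/4) 1 (by norm_num) (by norm_num)
  refine ⟨C1 + C2, by positivity, fun u β hu hβ1 hβ2 Y hY => ?_⟩
  have hu0 : 0 < u := by linarith
  have hβ0 : 0 < β := lt_of_lt_of_le (by positivity) hβ1
  have huβ : 1 ≤ u * β := by rw [div_le_iff₀ hu0] at hβ1; linarith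
  have hsu : 1 ≤ Real.sqrt u := by rw [Real.one_le_sqrt]; linarith
  obtain ⟨s1, b1⟩ := h1 β hβ0
  obtain ⟨s2, b2⟩ := h2 β hβ0
  have hYre : 0 < Y.re := by rw [hY]; simp [sq]; nlinarith
  have sD := (hasDerivAt_dual0 Y hYre).1
  have sS : Summable (fun n : ℕ+ => wt n * Real.exp (-(4 * Real.pi * Real.sqrt n * β)) * Real.cos (4 * Real.pi * Real.sqrt n * u - Real.pi/4)) := by
    refine Summable.of_norm_bounded s2 fun n => ?_
    have : 0 ≤ wt n * Real.exp (-(4 * Real.pi * Real.sqrt n * β)) := by unfold wt; positivity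
    rw [norm_mul, Real.norm_of_nonneg this, Real.norm_eq_abs]
    calc _ ≤ wt n * Real.exp (-(4 * Real.pi * Real.sqrt n * β)) * 1 := by
          gcongr; exact Real.abs_cos_le_one _
      _ = _ := by unfold wt; rw [mul_one]
  have sDi : Summable (fun n => -(D0t n Y).im / Real.pi) := ((Complex.imCLM.summable sD).neg.div_const _)
  have e1 : -(dual0 Y).im / Real.pi = ∑' n, -(D0t n Y).im / Real.pi := by
    rw [tsum_div_const, tsum_neg]
    congr 2
    exact Complex.im_tsum sD
  unfold Sb
  rw [e1, ← tsum_mul_left, ← sDi.tsum_sub (sS.mul_left _)]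
  have hsb := s1.add (s2.mul_left (β / Real.sqrt u))
  have hb := tsum_of_norm_bounded (f := fun n : ℕ+ => -(D0t n Y).im / Real.pi - 1/(Real.pi * Real.sqrt 2) * Real.sqrt u *
      (wt n * Real.exp (-(4 * Real.pi * Real.sqrt n * β)) * Real.cos (4 * Real.pi * Real.sqrt n * u - Real.pi/4))) hsb.hasSum (fun n => dual_term u β hu hβ0 hβ2 n Y hY)
  rw [Real.norm_eq_abs] at hb
  refine hb.trans ?_
  rw [s1.tsum_add (s2.mul_left _), tsum_mul_left]
  have hue : 1 ≤ u^ε := Real.one_le_rpow (by linarith) hε.le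
  have hu1 : u^(1+ε) = u * u^ε := by rw [Real.rpow_add hu0, Real.rpow_one]
  have k1 : C1 * β^(-ε) ≤ C1 * u^(1+ε) * β := by
    rw [mul_assoc]; gcongr
    have : β^(-ε) ≤ u^ε := by
      rw [Real.rpow_neg hβ0.le, ← Real.inv_rpow hβ0.le]
      apply Real.rpow_le_rpow (by positivity) _ hε.le
      rw [inv_le_comm₀ hβ0 hu0, ← one_div]; exact hβ1
    rw [hu1]; nlinarith
  have k2 : β / Real.sqrt u * (C2 * β^(-(1:ℝ))) ≤ C2 * u^(1+ε) * β := by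
    rw [Real.rpow_neg_one]
    have : β / Real.sqrt u * (C2 * β⁻¹) = C2 / Real.sqrt u := by field_simp
    rw [this]
    calc C2 / Real.sqrt u ≤ C2 / 1 := by gcongr
      _ = C2 * 1 := by ring
      _ ≤ C2 * (u^(1+ε) * β) := by gcongr; rw [hu1]; nlinarith
      _ = _ := by ring
  calc _ ≤ C1 * β^(-ε) + β / Real.sqrt u * (C2 * β^(-(1:ℝ))) := by gcongr
    _ ≤ _ := by linarith

end

section
open Filter MeasureTheory Topology

lemma WW_im (z Y : ℂ) (hz : Complex.I * Y = z) (hY : 0 < Y.re) : ∑' n : ℕ+, (divfun n:ℝ) * jn z n = -(WW Y).im / Real.pi := by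
  have hs := (hasDerivAt_WW Y hY).1
  unfold WW
  rw [Complex.im_tsum hs, ← tsum_neg, ← tsum_div_const]
  refine tsum_congr fun n => ?_
  unfold Wt jn
  rw [hz, ← Complex.ofReal_natCast (divfun n), Complex.im_ofReal_mul, Complex.add_im, Complex.log_im, Complex.log_im]
  ring

lemma main_term (P c0 : ℂ) : ∃ K : ℝ, 0 < K ∧ ∀ u β : ℝ, 2 ≤ u → 1/u ≤ β → β ≤ 1 → ∀ Y : ℂ, Y = -Complex.I * ((u:ℂ) + β * Complex.I)^2 →
    |-(Real.pi * (Y * Complex.log Y - Y) + P * Y + 1/2 * Complex.log Y + c0).im / Real.pi -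
      (u^2 * Real.log (u^2) - u^2 + P.re / Real.pi * u^2)| ≤ K * (u * β) := by
  have hpi := Real.pi_pos
  refine ⟨2*Real.pi + 2 * |P.im|/Real.pi + 1/2 + |c0.im|/Real.pi + 1 + 2 + 1 + |P.re|/Real.pi, by positivity, fun u β hu hβ1 hβ2 Y hY => ?_⟩
  have hu0 : 0 < u := by linarith
  have hβ0 : 0 < β := lt_of_lt_of_le (by positivity) hβ1
  have huβ : 1 ≤ u * β := by rw [div_le_iff₀ hu0] at hβ1; linarith
  have hre : Y.re = 2 * u * β := by rw [hY]; simp [sq]; ring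
  have him : Y.im = -(u^2 - β^2) := by rw [hY]; simp [sq]
  have hnorm : ‖Y‖ = u^2 + β^2 := by
    rw [hY, norm_mul, norm_neg, Complex.norm_I, one_mul, norm_pow, ← Complex.normSq_eq_norm_sq, Complex.normSq_add_mul_I]
  have hβsq : β^2 ≤ 1 := by nlinarith
  have hexp : (Real.pi * (Y * Complex.log Y - Y) + P * Y + 1/2 * Complex.log Y + c0).im =
     Real.pi * ((2*u*β) * Y.arg + -(u^2 - β^2) * Real.log (u^2+β^2) + (u^2 - β^2)) + (P.re * (-(u^2-β^2)) + P.im * (2*u*β)) + 1/2 * Y.arg + c0.im := by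
    have h12 : (1/2 : ℂ) = ((1/2:ℝ):ℂ) := by push_cast; rfl
    rw [Complex.add_im, Complex.add_im, Complex.add_im, h12, Complex.im_ofReal_mul, Complex.im_ofReal_mul, Complex.mul_im P Y, Complex.sub_im, Complex.mul_im Y,
      Complex.log_im, Complex.log_re, hre, him, hnorm]
    ring
  rw [hexp]
  have hdec : -(Real.pi * ((2*u*β) * Y.arg + -(u^2 - β^2) * Real.log (u^2+β^2) + (u^2 - β^2)) + (P.re * (-(u^2-β^2)) + P.im * (2*u*β)) + 1/2 * Y.arg + c0.im) / Real.pi -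
      (u^2 * Real.log (u^2) - u^2 + P.re / Real.pi * u^2) =
      -((2*u*β) * Y.arg) + -(2 * P.im / Real.pi * (u * β)) + -(Y.arg/Real.pi/2) + -(c0.im/Real.pi) + u^2 * (Real.log (u^2+β^2) - Real.log (u^2)) + -(β^2 * Real.log (u^2+β^2)) + β^2 + -(P.re/Real.pi * β^2) := by
    field_simp; ring
  rw [hdec]
  have harg : |Y.arg| ≤ Real.pi := Complex.abs_arg_le_pi Y
  have t1 : |-((2*u*β) * Y.arg)| ≤ 2*Real.pi * (u*β) := by
    rw [abs_neg, abs_mul, abs_of_pos (by positivity)]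
    calc _ ≤ 2*u*β*Real.pi := by gcongr
      _ = _ := by ring
  have t2 : |-(2 * P.im / Real.pi * (u * β))| ≤ 2 * |P.im|/Real.pi * (u*β) := by
    rw [abs_neg, abs_mul, abs_div, abs_mul, abs_of_pos hpi, abs_of_pos (show 0 < u*β by positivity), abs_two]
  have t3 : |-(Y.arg/Real.pi/2)| ≤ 1/2 * (u*β) := by
    rw [abs_neg, abs_div, abs_div, abs_of_pos hpi, abs_two]
    have : |Y.arg|/Real.pi ≤ 1 := by rw [div_le_one hpi]; exact harg
    linarith
  have t4 : |-(c0.im/Real.pi)| ≤ |c0.im|/Real.pi * (u*β) := by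
    rw [abs_neg, abs_div, abs_of_pos hpi]
    have : 0 ≤ |c0.im|/Real.pi := by positivity
    nlinarith
  have t5 : |u^2 * (Real.log (u^2+β^2) - Real.log (u^2))| ≤ 1 * (u*β) := by
    rw [← Real.log_div (by positivity) (by positivity)]
    have h1 : (u^2+β^2)/u^2 = 1 + β^2/u^2 := by field_simp
    have h2 : 0 ≤ Real.log ((u^2+β^2)/u^2) := Real.log_nonneg (by rw [h1]; exact le_add_of_nonneg_right (by positivity))
    have h3 : Real.log ((u^2+β^2)/u^2) ≤ β^2/u^2 := by
      have := Real.log_le_sub_one_of_pos (show 0 < (u^2+β^2)/u^2 by positivity)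
      linarith
    rw [abs_of_nonneg (by positivity)]
    have : u^2 * Real.log ((u^2+β^2)/u^2) ≤ u^2 * (β^2/u^2) := by gcongr
    have e : u^2 * (β^2/u^2) = β^2 := by field_simp
    linarith
  have hlog1 : 0 ≤ Real.log (u^2+β^2) := Real.log_nonneg (by nlinarith)
  have t6 : |-(β^2 * Real.log (u^2+β^2))| ≤ 2 * (u*β) := by
    rw [abs_neg, abs_of_nonneg (by positivity)]
    have h1 : Real.log (u^2+β^2) ≤ 2 * u := by
      calc _ ≤ Real.log ((u+1)^2) := Real.log_le_log (by positivity) (by nlinarith)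
        _ = 2 * Real.log (u+1) := by rw [Real.log_pow]; push_cast; rfl
        _ ≤ 2 * u := by have := Real.log_le_sub_one_of_pos (show 0 < u+1 by positivity); linarith
    calc β^2 * Real.log (u^2+β^2) ≤ β^2 * (2*u) := by gcongr
      _ = β * (2 * (u*β)) := by ring
      _ ≤ 1 * (2 * (u * β)) := by gcongr
      _ = _ := by ring
  have t7 : |β^2| ≤ 1 * (u*β) := by rw [abs_of_nonneg (by positivity)]; linarith
  have t8 : |-(P.re/Real.pi * β^2)| ≤ |P.re|/Real.pi * (u*β) := by
    rw [abs_neg, abs_mul, abs_div, abs_of_pos hpi, abs_of_nonneg (show 0 ≤ β^2 by positivity)]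
    gcongr; linarith
  have := abs_add_le (-((2*u*β) * Y.arg) + -(2 * P.im / Real.pi * (u * β)) + -(Y.arg/Real.pi/2) + -(c0.im/Real.pi) + u^2 * (Real.log (u^2+β^2) - Real.log (u^2)) + -(β^2 * Real.log (u^2+β^2)) + β^2) (-(P.re/Real.pi * β^2))
  have := abs_add_le (-((2*u*β) * Y.arg) + -(2 * P.im / Real.pi * (u * β)) + -(Y.arg/Real.pi/2) + -(c0.im/Real.pi) + u^2 * (Real.log (u^2+β^2) - Real.log (u^2)) + -(β^2 * Real.log (u^2+β^2))) (β^2)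
  have := abs_add_le (-((2*u*β) * Y.arg) + -(2 * P.im / Real.pi * (u * β)) + -(Y.arg/Real.pi/2) + -(c0.im/Real.pi) + u^2 * (Real.log (u^2+β^2) - Real.log (u^2))) (-(β^2 * Real.log (u^2+β^2)))
  have := abs_add_le (-((2*u*β) * Y.arg) + -(2 * P.im / Real.pi * (u * β)) + -(Y.arg/Real.pi/2) + -(c0.im/Real.pi)) (u^2 * (Real.log (u^2+β^2) - Real.log (u^2)))
  have := abs_add_le (-((2*u*β) * Y.arg) + -(2 * P.im / Real.pi * (u * β)) + -(Y.arg/Real.pi/2)) (-(c0.im/Real.pi))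
  have := abs_add_le (-((2*u*β) * Y.arg) + -(2 * P.im / Real.pi * (u * β))) (-(Y.arg/Real.pi/2))
  have := abs_add_le (-((2*u*β) * Y.arg)) (-(2 * P.im / Real.pi * (u * β)))
  linarith

lemma voronoi_pre : ∃ p : ℝ, ∀ ε : ℝ, 0 < ε → ∃ C : ℝ, 0 < C ∧ ∀ u β : ℝ, 2 ≤ u → 1/u ≤ β → β ≤ 1 →
    |(∑ n ∈ Finset.Icc 1 ⌊u^2⌋₊, (divfun n : ℝ)) - (u^2 * Real.log (u^2) - u^2 + p * u^2) -
       1/(Real.pi * Real.sqrt 2) * Real.sqrt u * Sb β u| ≤ C * u^(1+ε) * β := by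
  obtain ⟨P, c0, hW⟩ := WW_formula
  obtain ⟨K, hK, hmain⟩ := main_term P c0
  refine ⟨P.re/Real.pi, fun ε hε => ?_⟩
  obtain ⟨C1, hC1, hj⟩ := jump_sum ε hε
  obtain ⟨C2, hC2, hd⟩ := dual_sum ε hε
  refine ⟨C1 + C2 + K, by positivity, fun u β hu hβ1 hβ2 => ?_⟩
  have hu0 : 0 < u := by linarith
  have hβ0 : 0 < β := lt_of_lt_of_le (by positivity) hβ1
  set z : ℂ := ((u:ℂ) + β * Complex.I)^2 with hz
  set Y : ℂ := -Complex.I * z with hY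
  have hYre : 0 < Y.re := by
    have : Y.re = 2 * u * β := by rw [hY, hz]; simp [sq]; ring
    rw [this]; positivity
  have hIY : Complex.I * Y = z := by rw [hY]; linear_combination (-z) * Complex.I_sq
  have h1 := hj u β hu hβ1 hβ2 z hz
  have h2 := hd u β hu hβ1 hβ2 Y hY
  have h3 := hmain u β hu hβ1 hβ2 Y hY
  rw [WW_im z Y hIY hYre, hW Y hYre] at h1
  have h4 : u * β ≤ u^(1+ε) * β := by
    gcongr
    conv_lhs => rw [← Real.rpow_one u]
    exact Real.rpow_le_rpow_of_exponent_le (by linarith) (by linarith)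
  rw [Complex.add_im, neg_add, add_div] at h1
  have h5 : K * (u*β) ≤ K * (u^(1+ε) * β) := by gcongr
  rw [abs_le] at *
  constructor <;> linarith [h1.1, h1.2, h2.1, h2.2, h3.1, h3.2]

lemma Sb_le : ∃ C : ℝ, 0 < C ∧ ∀ β u : ℝ, 0 < β → |Sb β u| ≤ C * β^(-1:ℝ) := by
  obtain ⟨C2, hC2, h2⟩ := sum_exp_bound (3/4) 1 (by norm_num) (by norm_num)
  refine ⟨C2, hC2, fun β u hβ => ?_⟩
  obtain ⟨s2, b2⟩ := h2 β hβ
  refine le_trans ?_ b2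
  unfold Sb
  rw [← Real.norm_eq_abs]
  refine tsum_of_norm_bounded s2.hasSum fun n => ?_
  have : 0 ≤ wt n * Real.exp (-(4 * Real.pi * Real.sqrt n * β)) := by unfold wt; positivity
  rw [norm_mul, Real.norm_of_nonneg this, Real.norm_eq_abs]
  calc _ ≤ wt n * Real.exp (-(4 * Real.pi * Real.sqrt n * β)) * 1 := by
        gcongr; exact Real.abs_cos_le_one _
    _ = _ := by unfold wt; rw [mul_one]

theorem voronoi (ε : ℝ) (hε : 0 < ε) : ∃ C : ℝ, 0 < C ∧ ∀ u β : ℝ, 2 ≤ u → 1/u ≤ β → β ≤ 1 →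
    |DirichletDelta (u^2) - 1/(Real.pi * Real.sqrt 2) * Real.sqrt u * Sb β u| ≤ C * u^(1+ε) * β := by
  obtain ⟨p, hp⟩ := voronoi_pre
  have hp2 : p = 2 * Real.eulerMascheroniConstant := by
    obtain ⟨C, hC, h⟩ := hp 1 one_pos
    obtain ⟨C', hC', h'⟩ := Sb_le
    have hA := tendsto_sum_divfun_sq
    set k := 1/(Real.pi * Real.sqrt 2) with hk
    have hk0 : 0 < k := by positivity
    have hlim : Tendsto (fun m : ℕ => (∑ n∈Finset.Icc 1 (m^2), (divfun n:ℝ))/(m:ℝ)^2 - Real.log ((m:ℝ)^2)) atTop (nhds (p - 1)) := by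
      rw [tendsto_iff_norm_sub_tendsto_zero]
      have hz : Tendsto (fun m : ℕ => (C + k * C') * (m:ℝ)^(-(1/2):ℝ)) atTop (nhds 0) := by
        have : Tendsto (fun m : ℕ => (m:ℝ)^(-(1/2):ℝ)) atTop (nhds 0) :=
          (tendsto_rpow_neg_atTop (by norm_num : (0:ℝ) < 1/2)).comp tendsto_natCast_atTop_atTop
        simpa using this.const_mul (C + k * C')
      refine squeeze_zero' (Eventually.of_forall fun _ => norm_nonneg _) ?_ hz
      filter_upwards [eventually_ge_atTop 2] with m hm
      have hm' : (2:ℝ) ≤ m := by exact_mod_cast hm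
      have hm0 : (0:ℝ) < m := by linarith
      have h1 := h m (1/m) hm' le_rfl (by rw [div_le_one hm0]; linarith)
      have h2 := h' (1/m) m (by positivity)
      have hfl : ⌊(m:ℝ)^2⌋₊ = m^2 := by rw [← Nat.cast_pow, Nat.floor_natCast]
      rw [hfl] at h1
      have h3 : C * (m:ℝ)^((1:ℝ)+1) * (1/m) = C * m := by
        rw [show (1:ℝ)+1 = ((2:ℕ):ℝ) by norm_num, Real.rpow_natCast]; field_simp
      have h4 : (1/(m:ℝ))^(-1:ℝ) = m := by rw [Real.rpow_neg_one]; field_simp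
      rw [h3] at h1
      rw [h4] at h2
      have h5 : |k * Real.sqrt m * Sb (1/m) m| ≤ k * C' * (Real.sqrt m * m) := by
        rw [abs_mul, abs_of_nonneg (by positivity)]
        calc _ ≤ k * Real.sqrt m * (C' * m) := by gcongr
          _ = _ := by ring
      have hsm : 1 ≤ Real.sqrt m := by rw [Real.one_le_sqrt]; linarith
      have h6 : C * m ≤ C * (Real.sqrt m * m) := by gcongr; nlinarith
      have e : (∑ n∈Finset.Icc 1 (m^2), (divfun n:ℝ))/(m:ℝ)^2 - Real.log ((m:ℝ)^2) - (p - 1) =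
         ((∑ n∈Finset.Icc 1 (m^2), (divfun n:ℝ)) - ((m:ℝ)^2 * Real.log ((m:ℝ)^2) - (m:ℝ)^2 + p * (m:ℝ)^2)) / (m:ℝ)^2 := by
        field_simp; ring
      rw [e, norm_div, Real.norm_eq_abs, Real.norm_of_nonneg (by positivity), div_le_iff₀ (by positivity)]
      have h7 : (m:ℝ)^(-(1/2):ℝ) * (m:ℝ)^2 = Real.sqrt m * m := by
        rw [Real.sqrt_eq_rpow, ← Real.rpow_natCast, ← Real.rpow_add hm0, ← Real.rpow_add_one hm0.ne']; norm_num
      rw [mul_assoc, h7]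
      rw [abs_le] at *
      constructor <;> linarith [h1.1, h1.2, h5.1, h5.2]
    have := tendsto_nhds_unique hlim hA
    linarith
  obtain ⟨C, hC, h⟩ := hp ε hε
  refine ⟨C, hC, fun u β hu h1 h2 => ?_⟩
  have h3 := h u β hu h1 h2
  rw [hp2] at h3
  unfold DirichletDelta
  convert h3 using 3
  ring

end

section
open Filter MeasureTheory Topology

/-- additive character -/
noncomputable def ee (x : ℝ) : ℂ := Complex.exp ((2 * Real.pi * x : ℝ) * Complex.I)

lemma norm_ee (x : ℝ) : ‖ee x‖ = 1 := Complex.norm_exp_ofReal_mul_I _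

lemma ee_add (x y : ℝ) : ee (x+y) = ee x * ee y := by
  unfold ee; rw [← Complex.exp_add]; congr 1; push_cast; ring

lemma ee_int (k : ℤ) : ee k = 1 := by
  unfold ee; rw [Complex.exp_eq_one_iff]; exact ⟨k, by push_cast; ring⟩

noncomputable def gg (x : ℝ) : ℂ := 1/2 * (1 + (Real.cot (Real.pi * x) : ℝ) * Complex.I)

lemma gg_mul (x : ℝ) (h : Real.sin (Real.pi * x) ≠ 0) : (1 - ee x) * gg x = 1 := by
  unfold ee gg
  have e : Complex.exp ((2 * Real.pi * x : ℝ) * Complex.I) = (Real.cos (Real.pi*x) + Real.sin (Real.pi*x) * Complex.I)^2 := by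
    rw [Complex.ofReal_cos, Complex.ofReal_sin, ← Complex.exp_mul_I, ← Complex.exp_nat_mul]; congr 1; push_cast; ring
  rw [e, Real.cot_eq_cos_div_sin]
  have hs : ((Real.sin (Real.pi*x) : ℝ):ℂ) ≠ 0 := by exact_mod_cast h
  have h1 : ((Real.sin (Real.pi*x) : ℝ):ℂ)^2 + ((Real.cos (Real.pi*x) : ℝ):ℂ)^2 = 1 := by
    exact_mod_cast Real.sin_sq_add_cos_sq (Real.pi*x)
  push_cast [-Complex.ofReal_sin, -Complex.ofReal_cos]
  have hI := Complex.I_sq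
  generalize Complex.I = i at *
  generalize ((Real.sin (Real.pi*x) : ℝ):ℂ) = s at *
  generalize ((Real.cos (Real.pi*x) : ℝ):ℂ) = c at *
  field_simp
  have hc : c^2 = 1 - s^2 := by linear_combination h1
  have hi3 : i^3 = -i := by linear_combination i * hI
  have : (1 - (c + s*i)^2) * (s + c*i) - s*2 = 0 := by
    have : (1 - (c + s*i)^2) * (s + c*i) - s*2 = s + c*i - c^2*s - c^2*c*i - 2*s^2*c*i - 2*s*c^2*i^2 - s^3*i^2 - s^2*c*i^3 - 2*s := by ring
    rw [this, hi3, hI, hc]; ring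
  linear_combination this

lemma sin_lower (x lam : ℝ) (hl : 0 < lam) (h1 : lam ≤ x) (h2 : x ≤ 1 - lam) : 2 * lam ≤ Real.sin (Real.pi * x) := by
  have hpi := Real.pi_pos
  rcases le_or_gt x (1/2) with h | h
  · have := Real.mul_le_sin (x := Real.pi * x) (by have : 0 < x := by linarith
                                                   positivity) (by nlinarith)
    have e : 2 / Real.pi * (Real.pi * x) = 2 * x := by field_simp
    linarith
  · have := Real.mul_le_sin (x := Real.pi * (1 - x)) (by have : 0 < 1 - x := by linarith
                                                         positivity) (by nlinarith)
    have e : 2 / Real.pi * (Real.pi * (1-x)) = 2 * (1-x) := by field_simp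
    have e2 : Real.sin (Real.pi * (1 - x)) = Real.sin (Real.pi * x) := by
      rw [show Real.pi * (1 - x) = Real.pi - Real.pi * x by ring, Real.sin_pi_sub]
    linarith

lemma cot_bound (x lam : ℝ) (hl : 0 < lam) (h1 : lam ≤ x) (h2 : x ≤ 1 - lam) :
    |Real.cot (Real.pi * x)| ≤ 1/(2*lam) ∧ ‖gg x‖ ≤ 1/(4*lam) := by
  have hs := sin_lower x lam hl h1 h2
  have hs0 : 0 < Real.sin (Real.pi * x) := by linarith
  have hc : |Real.cot (Real.pi * x)| ≤ 1/(2*lam) := by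
    rw [Real.cot_eq_cos_div_sin, abs_div, abs_of_pos hs0]
    exact div_le_div₀ (by norm_num) (Real.abs_cos_le_one _) (by positivity) hs
  refine ⟨hc, ?_⟩
  have h := congrArg norm (gg_mul x hs0.ne')
  rw [norm_mul, norm_one] at h
  have hne : ‖1 - ee x‖ = 2 * Real.sin (Real.pi * x) := by
    have : 1 - ee x = (-2 * Real.sin (Real.pi*x) : ℝ) * (Complex.I * Complex.exp ((Real.pi * x : ℝ)*Complex.I)) := by
      unfold ee
      have e : Complex.exp ((2 * Real.pi * x : ℝ) * Complex.I) = (Real.cos (Real.pi*x) + Real.sin (Real.pi*x) * Complex.I)^2 := by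
        rw [Complex.ofReal_cos, Complex.ofReal_sin, ← Complex.exp_mul_I, ← Complex.exp_nat_mul]; congr 1; push_cast; ring
      rw [e, Complex.exp_mul_I, ← Complex.ofReal_cos, ← Complex.ofReal_sin, Complex.ofReal_mul, Complex.ofReal_neg]
      have h1 : ((Real.sin (Real.pi*x) : ℝ):ℂ)^2 + ((Real.cos (Real.pi*x) : ℝ):ℂ)^2 = 1 := by
        exact_mod_cast Real.sin_sq_add_cos_sq (Real.pi*x)
      have hI := Complex.I_sq
      generalize ((Real.sin (Real.pi*x) : ℝ):ℂ) = s at *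
      generalize ((Real.cos (Real.pi*x) : ℝ):ℂ) = c at *
      push_cast
      linear_combination (-1:ℂ) * h1 + s^2 * hI
    rw [this, norm_mul, norm_mul, Complex.norm_I, Complex.norm_exp_ofReal_mul_I, Complex.norm_real, Real.norm_eq_abs, abs_mul, abs_of_pos hs0]
    norm_num
  rw [hne] at h
  rw [le_div_iff₀ (by positivity)]
  have := norm_nonneg (gg x)
  nlinarith

lemma cot_anti (a b : ℝ) (ha : 0 < a) (hab : a ≤ b) (hb : b < 1) : Real.cot (Real.pi * b) ≤ Real.cot (Real.pi * a) := by
  have hpi := Real.pi_pos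
  have sa : 0 < Real.sin (Real.pi * a) := Real.sin_pos_of_pos_of_lt_pi (by positivity) (by nlinarith)
  have sb : 0 < Real.sin (Real.pi * b) := Real.sin_pos_of_pos_of_lt_pi (by nlinarith) (by nlinarith)
  rw [Real.cot_eq_cos_div_sin, Real.cot_eq_cos_div_sin, div_le_div_iff₀ sb sa]
  have : 0 ≤ Real.sin (Real.pi * b - Real.pi * a) := Real.sin_nonneg_of_nonneg_of_le_pi (by nlinarith) (by nlinarith)
  rw [Real.sin_sub] at this
  linarith

lemma gg_sub (a b : ℝ) (ha : 0 < a) (hab : a ≤ b) (hb : b < 1) : ‖gg a - gg b‖ = 1/2 * (Real.cot (Real.pi*a) - Real.cot (Real.pi*b)) := by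
  have : gg a - gg b = ((1/2 * (Real.cot (Real.pi*a) - Real.cot (Real.pi*b)) : ℝ):ℂ) * Complex.I := by
    unfold gg; push_cast; ring
  rw [this, norm_mul, Complex.norm_I, mul_one, Complex.norm_real, Real.norm_of_nonneg]
  linarith [cot_anti a b ha hab hb]

/-- Kuzmin-Landau -/
lemma kuzmin_landau (F : ℕ → ℝ) (M : ℕ) (lam : ℝ) (hl : 0 < lam) (k : ℤ)
    (h : ∀ i, i < M → k + lam ≤ F (i+1) - F i ∧ F (i+1) - F i ≤ k + 1 - lam)
    (hanti : ∀ i, i + 1 < M → F (i+2) - F (i+1) ≤ F (i+1) - F i) :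
    ‖∑ i ∈ Finset.range M, ee (F i)‖ ≤ 1/lam := by
  set th : ℕ → ℝ := fun i => F (i+1) - F i - k with hth
  have hstep : ∀ i, i < M → ee (F i) - ee (F (i+1)) = ee (F i) * (1 - ee (th i)) := by
    intro i _
    have : F (i+1) = F i + th i + k := by rw [hth]; ring
    rw [this, ee_add, ee_add, ee_int]; ring
  have hb : ∀ i, i < M → lam ≤ th i ∧ th i ≤ 1 - lam := fun i hi => by
    have := h i hi
    constructor <;> simp only [hth] <;> linarith
  have hE : ∀ i, i < M → ee (F i) = (ee (F i) - ee (F (i+1))) * gg (th i) := by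
    intro i hi
    have hs := sin_lower (th i) lam hl (hb i hi).1 (hb i hi).2
    rw [hstep i hi, mul_assoc, gg_mul _ (by linarith), mul_one]
  rcases Nat.eq_zero_or_pos M with h0 | hM
  · rw [h0]; simp; positivity
  have key : ∀ m, m < M → ‖∑ i ∈ Finset.range (m+1), ee (F i) + ee (F (m+1)) * gg (th m)‖ ≤ ‖gg (th 0)‖ + 1/2 * (Real.cot (Real.pi * th m) - Real.cot (Real.pi * th 0)) := by
    intro m
    induction m with
    | zero =>
      intro hm
      have := hE 0 hm
      simp only [zero_add, Finset.sum_range_one, sub_self, mul_zero, add_zero]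
      have e : ee (F 0) + ee (F 1) * gg (th 0) = ee (F 0) * gg (th 0) := by
        linear_combination this
      rw [e, norm_mul, norm_ee, one_mul]
    | succ m ih =>
      intro hm
      have h1 := ih (by omega)
      have h2 := hE (m+1) hm
      rw [Finset.sum_range_succ]
      have e : ∑ i ∈ Finset.range (m+1), ee (F i) + ee (F (m+1)) + ee (F (m+1+1)) * gg (th (m+1)) =
        (∑ i ∈ Finset.range (m+1), ee (F i) + ee (F (m+1)) * gg (th m)) + ee (F (m+1)) * (gg (th (m+1)) - gg (th m)) := by
        linear_combination h2
      rw [e]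
      refine (norm_add_le _ _).trans ?_
      rw [norm_mul, norm_ee, one_mul]
      have b1 := hb m (by omega)
      have b2 := hb (m+1) hm
      have ha : th (m+1) ≤ th m := by simp only [hth]; linarith [hanti m hm]
      rw [gg_sub _ _ (by linarith) ha (by linarith)]
      linarith
  have hk := key (M-1) (by omega)
  rw [show M - 1 + 1 = M by omega] at hk
  have c0 := cot_bound (th 0) lam hl (hb 0 hM).1 (hb 0 hM).2
  have c1 := cot_bound (th (M-1)) lam hl (hb (M-1) (by omega)).1 (hb (M-1) (by omega)).2
  have e : ∑ i ∈ Finset.range M, ee (F i) = (∑ i ∈ Finset.range M, ee (F i) + ee (F M) * gg (th (M-1))) - ee (F M) * gg (th (M-1)) := by ring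
  rw [e]
  refine (norm_sub_le _ _).trans ?_
  rw [norm_mul, norm_ee, one_mul]
  have l1 : 1/(2*lam) = (1/lam)/2 := by field_simp
  have l2 : 1/(4*lam) = (1/lam)/4 := by field_simp
  rw [l1, l2] at c0 c1
  have := (abs_le.mp c0.1).1
  have := (abs_le.mp c1.1).2
  linarith

end

section
open Filter MeasureTheory Topology

lemma ord_finset_eq (s : Finset ℕ) (hs : s.Nonempty) (hc : ∀ a ∈ s, ∀ b ∈ s, ∀ n, a ≤ n → n ≤ b → n ∈ s) :
    s = Finset.Icc (s.min' hs) (s.max' hs) := by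
  ext n
  rw [Finset.mem_Icc]
  exact ⟨fun h => ⟨s.min'_le n h, s.le_max' n h⟩, fun h => hc _ (s.min'_mem hs) _ (s.max'_mem hs) n h.1 h.2⟩

lemma delta_sub (F : ℕ → ℝ) (a b : ℕ) (mu : ℝ) (hd : ∀ n, a ≤ n → n + 1 < b → mu ≤ (F (n+1) - F n) - (F (n+2) - F (n+1)))
    (p q : ℕ) (hp : a ≤ p) (hpq : p ≤ q) (hq : q < b) : ((q:ℝ) - p) * mu ≤ (F (p+1) - F p) - (F (q+1) - F q) := by
  induction q, hpq using Nat.le_induction with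
  | base => simp
  | succ q hpq ih =>
    have h1 := ih (by omega)
    have h2 := hd q (by omega) (by omega)
    push_cast
    have e : ((q:ℝ) + 1 - p) * mu = (q - p) * mu + mu := by ring
    rw [e]; linarith

lemma vdc (F : ℕ → ℝ) (a b : ℕ) (mu lam D : ℝ) (hmu : 0 < mu) (hl : 0 < lam) (hl2 : lam ≤ 1/2)
    (hd : ∀ n, a ≤ n → n + 1 < b → mu ≤ (F (n+1) - F n) - (F (n+2) - F (n+1)))
    (h0 : ∀ n, a ≤ n → n < b → 0 ≤ F (n+1) - F n ∧ F (n+1) - F n ≤ D) (hD : 0 ≤ D) :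
    ‖∑ n ∈ Finset.Ico a b, ee (F n)‖ ≤ 3 * (D+1) * (1/lam + lam/mu + 1) := by
  set dl : ℕ → ℝ := fun n => F (n+1) - F n with hdl
  set lab : ℕ → ℤ := fun n => 3 * ⌊dl n⌋ + (if Int.fract (dl n) < lam then 0 else if Int.fract (dl n) ≤ 1 - lam then 1 else 2) with hlab
  set T : Finset ℤ := Finset.Icc 0 (3 * ⌊D⌋ + 2) with hT
  have hmaps : ∀ n ∈ Finset.Ico a b, lab n ∈ T := by
    intro n hn
    rw [Finset.mem_Ico] at hn
    obtain ⟨h1, h2⟩ := h0 n hn.1 hn.2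
    have f1 : 0 ≤ ⌊dl n⌋ := Int.floor_nonneg.mpr h1
    have f2 : ⌊dl n⌋ ≤ ⌊D⌋ := Int.floor_le_floor h2
    rw [hT, Finset.mem_Icc]
    simp only [hlab]
    split_ifs <;> constructor <;> omega
  rw [← Finset.sum_fiberwise_of_maps_to hmaps]
  have hsub := delta_sub F a b mu hd
  have hfib : ∀ k ∈ T, ‖∑ n ∈ Finset.Ico a b with lab n = k, ee (F n)‖ ≤ 1/lam + lam/mu + 1 := by
    intro k _
    set s := (Finset.Ico a b).filter (fun n => lab n = k) with hs
    rcases s.eq_empty_or_nonempty with he | hne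
    · rw [he, Finset.sum_empty, norm_zero]; positivity
    have hmem : ∀ n ∈ s, a ≤ n ∧ n < b ∧ lab n = k := by
      intro n hn
      rw [hs, Finset.mem_filter, Finset.mem_Ico] at hn
      exact ⟨hn.1.1, hn.1.2, hn.2⟩
    -- characterise label
    have hfl : ∀ n, lab n = k → ⌊dl n⌋ = k / 3 ∧ (Int.fract (dl n) < lam ↔ k % 3 = 0) ∧ (¬ (Int.fract (dl n) < lam) ∧ Int.fract (dl n) ≤ 1 - lam ↔ k % 3 = 1) := by
      intro n hn
      simp only [hlab] at hn
      by_cases c1 : Int.fract (dl n) < lam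
      · rw [if_pos c1] at hn
        refine ⟨by omega, by simp only [c1, true_iff]; omega, by simp only [c1, not_true, false_and, false_iff]; omega⟩
      · rw [if_neg c1] at hn
        by_cases c2 : Int.fract (dl n) ≤ 1 - lam
        · rw [if_pos c2] at hn
          refine ⟨by omega, by simp only [c1, false_iff]; omega, by simp only [c1, c2, not_false_iff, true_and, true_iff]; omega⟩
        · rw [if_neg c2] at hn
          refine ⟨by omega, by simp only [c1, false_iff]; omega, by simp only [c1, c2, and_false, false_iff]; omega⟩
    have hdn : ∀ n, lab n = k → dl n = ((k/3 : ℤ):ℝ) + Int.fract (dl n) := by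
      intro n hn
      rw [← (hfl n hn).1]; exact (Int.floor_add_fract _).symm
    set p := s.min' hne
    set q := s.max' hne
    have hp := hmem p (s.min'_mem hne)
    have hq := hmem q (s.max'_mem hne)
    have hpq : p ≤ q := s.min'_le _ (s.max'_mem hne)
    by_cases h1 : k % 3 = 1
    · -- middle
      have hrange : ∀ n, lab n = k → ((k/3 : ℤ):ℝ) + lam ≤ dl n ∧ dl n ≤ ((k/3 : ℤ):ℝ) + 1 - lam := by
        intro n hn
        have h2 := (hfl n hn).2.2.mpr h1
        have h3 := hdn n hn
        constructor
        · linarith [h2.1]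
        · linarith [h2.2]
      have hconn : s = Finset.Icc p q := by
        apply ord_finset_eq
        intro x hx y hy n hxn hny
        have hx' := hmem x hx
        have hy' := hmem y hy
        rw [hs, Finset.mem_filter, Finset.mem_Ico]
        refine ⟨⟨by omega, by omega⟩, ?_⟩
        have g1 := hsub x n hx'.1 hxn (by omega)
        have g2 := hsub n y (by omega) hny hy'.2.1
        have g1' : dl n ≤ dl x := by
          have : (0:ℝ) ≤ ((n:ℝ) - x) * mu := mul_nonneg (by rw [sub_nonneg]; exact_mod_cast hxn) hmu.le
          simp only [hdl]; linarith
        have g2' : dl y ≤ dl n := by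
          have : (0:ℝ) ≤ ((y:ℝ) - n) * mu := mul_nonneg (by rw [sub_nonneg]; exact_mod_cast hny) hmu.le
          simp only [hdl]; linarith
        have rx := hrange x hx'.2.2
        have ry := hrange y hy'.2.2
        have hfloor : ⌊dl n⌋ = k/3 := by
          rw [Int.floor_eq_iff]; constructor <;> linarith
        have hfr : Int.fract (dl n) = dl n - ((k/3:ℤ):ℝ) := by
          rw [← hfloor]; rfl
        simp only [hlab]
        rw [if_neg (by rw [hfr]; push Not; linarith), if_pos (by rw [hfr]; linarith), hfloor]
        omega
      have hinS : ∀ n, p ≤ n → n ≤ q → lab n = k ∧ a ≤ n ∧ n < b := by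
        intro n h1 h2
        have : n ∈ s := by rw [hconn, Finset.mem_Icc]; exact ⟨h1, h2⟩
        have := hmem n this
        exact ⟨this.2.2, this.1, this.2.1⟩
      rw [hconn]
      have hkl := kuzmin_landau (fun i => F (p+i)) (q+1-p) lam hl (k/3) (fun i hi => by
          have := hrange (p+i) (hinS (p+i) (by omega) (by omega)).1
          simpa only [hdl, add_assoc] using this) (fun i hi => by
          have hS := hinS (p+i+1) (by omega) (by omega)
          have := hd (p+i) (by omega) (by omega)
          simp only [add_assoc] at this ⊢
          linarith)
      have e : ∑ n ∈ Finset.Icc p q, ee (F n) = ∑ i ∈ Finset.range (q+1-p), ee (F (p+i)) := by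
        have h3 := Finset.sum_Ico_eq_sum_range (fun n => ee (F n)) p (q+1)
        have h4 : Finset.Icc p q = Finset.Ico p (q+1) := by
          ext x; simp only [Finset.mem_Icc, Finset.mem_Ico]; omega
        rw [h4, h3]
      rw [e]
      refine hkl.trans ?_
      have : 0 ≤ lam/mu := by positivity
      linarith
    · -- ends: count
      have hdiff : dl p - dl q ≤ lam := by
        have ep := hdn p hp.2.2
        have eq := hdn q hq.2.2
        have fp1 := Int.fract_lt_one (dl p)
        have fq0 := Int.fract_nonneg (dl q)
        by_cases hk0 : k % 3 = 0
        · have := (hfl p hp.2.2).2.1.mpr hk0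
          linarith
        · have c1 : ¬ Int.fract (dl q) < lam := fun h => hk0 ((hfl q hq.2.2).2.1.mp h)
          have c2 : ¬ Int.fract (dl q) ≤ 1 - lam := fun h => h1 ((hfl q hq.2.2).2.2.mp ⟨c1, h⟩)
          push Not at c2
          linarith
      have hcard : ((q:ℝ) - p) ≤ lam / mu := by
        rw [le_div_iff₀ hmu]
        have := hsub p q hp.1 hpq hq.2.1
        simp only [hdl] at hdiff
        linarith
      have hsubset : s ⊆ Finset.Icc p q := fun n hn => by
        rw [Finset.mem_Icc]; exact ⟨s.min'_le n hn, s.le_max' n hn⟩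
      have hc : (s.card:ℝ) ≤ (q:ℝ) - p + 1 := by
        have := Finset.card_le_card hsubset
        rw [Nat.card_Icc] at this
        have h3 : s.card + p ≤ q + 1 := by omega
        have : (s.card:ℝ) + p ≤ q + 1 := by exact_mod_cast h3
        linarith
      calc _ ≤ ∑ n ∈ s, ‖ee (F n)‖ := norm_sum_le _ _
        _ = s.card := by simp [norm_ee]
        _ ≤ _ := by
          have : 0 ≤ 1/lam := by positivity
          linarith
  calc _ ≤ ∑ k ∈ T, ‖∑ n ∈ Finset.Ico a b with lab n = k, ee (F n)‖ := norm_sum_le _ _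
    _ ≤ ∑ k ∈ T, (1/lam + lam/mu + 1) := Finset.sum_le_sum hfib
    _ = T.card * (1/lam + lam/mu + 1) := by rw [Finset.sum_const, nsmul_eq_mul]
    _ ≤ _ := by
      have hfl0 : 0 ≤ ⌊D⌋ := Int.floor_nonneg.mpr hD
      have hTc : (T.card:ℝ) ≤ 3 * (D+1) := by
        rw [hT, Int.card_Icc]
        have e : (((3 * ⌊D⌋ + 2 + 1 - 0).toNat : ℕ) : ℝ) = ((3 * ⌊D⌋ + 3 : ℤ) : ℝ) := by
          have : (((3 * ⌊D⌋ + 2 + 1 - 0).toNat : ℕ) : ℤ) = 3 * ⌊D⌋ + 3 := by omega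
          exact_mod_cast this
        rw [e]; push_cast
        linarith [Int.floor_le D]
      gcongr

noncomputable def Kern (N : ℕ) (t : ℝ) : ℂ := ∑ n ∈ Finset.Ico N (2*N), ee (2 * Real.sqrt n * t)

lemma Kern_neg (N : ℕ) (t : ℝ) : ‖Kern N (-t)‖ = ‖Kern N t‖ := by
  have : Kern N (-t) = (starRingEnd ℂ) (Kern N t) := by
    unfold Kern
    rw [map_sum]
    refine Finset.sum_congr rfl fun n _ => ?_
    unfold ee
    rw [← Complex.exp_conj]; congr 1
    rw [map_mul, Complex.conj_ofReal, Complex.conj_I]; push_cast; ring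
  rw [this, RCLike.norm_conj]

lemma Kern_triv (N : ℕ) (t : ℝ) : ‖Kern N t‖ ≤ N := by
  unfold Kern
  refine (norm_sum_le _ _).trans ?_
  simp only [norm_ee, Finset.sum_const, Nat.card_Ico, nsmul_eq_mul, mul_one]
  exact_mod_cast (by omega : 2*N - N ≤ N)

lemma sqrt_diff (n : ℕ) : (Real.sqrt ((n+1:ℕ):ℝ) - Real.sqrt n) * (Real.sqrt ((n+1:ℕ):ℝ) + Real.sqrt n) = 1 := by
  have h1 := Real.mul_self_sqrt (show (0:ℝ) ≤ ((n+1:ℕ):ℝ) by positivity)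
  have h2 := Real.mul_self_sqrt (show (0:ℝ) ≤ (n:ℝ) by positivity)
  push_cast at *
  linear_combination h1 - h2

lemma Kern_small (N : ℕ) (hN : 1 ≤ N) (t : ℝ) (ht : 0 < t) (ht2 : t ≤ Real.sqrt N / 2) : ‖Kern N t‖ ≤ 2 * Real.sqrt N / t := by
  have hN' : (1:ℝ) ≤ N := by exact_mod_cast hN
  set R := Real.sqrt N with hR
  have hR1 : 1 ≤ R := by rw [hR, Real.one_le_sqrt]; exact hN'
  have hbd : ∀ n : ℕ, N ≤ n → n < 2*N → t/(2*R) ≤ 2 * Real.sqrt ((n+1:ℕ):ℝ) * t - 2 * Real.sqrt n * t ∧ 2 * Real.sqrt ((n+1:ℕ):ℝ) * t - 2 * Real.sqrt n * t ≤ t / R := by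
    intro n h1 h2
    have hs := sqrt_diff n
    have a1 : R ≤ Real.sqrt n := Real.sqrt_le_sqrt (by exact_mod_cast h1)
    have a2 : Real.sqrt n ≤ Real.sqrt ((n+1:ℕ):ℝ) := Real.sqrt_le_sqrt (by push_cast; linarith)
    have a3 : Real.sqrt ((n+1:ℕ):ℝ) ≤ 2 * R := by
      rw [Real.sqrt_le_left (by positivity), mul_pow, hR, Real.sq_sqrt (by positivity)]
      have : n + 1 ≤ 4 * N := by omega
      have : ((n+1:ℕ):ℝ) ≤ 4 * N := by exact_mod_cast this
      linarith
    set x := Real.sqrt ((n+1:ℕ):ℝ)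
    set y := Real.sqrt n
    have hxy : 0 < x + y := by linarith
    have e : 2 * x * t - 2 * y * t = 2 * t / (x + y) := by
      rw [eq_div_iff hxy.ne']; linear_combination 2 * t * hs
    rw [e]
    constructor
    · rw [div_le_div_iff₀ (by positivity) hxy]; nlinarith
    · rw [div_le_div_iff₀ hxy (by positivity)]; nlinarith
  have hkl := kuzmin_landau (fun i => 2 * Real.sqrt ((N+i:ℕ):ℝ) * t) N (t/(2*R)) (by positivity) 0 (fun i hi => by
      have := hbd (N+i) (by omega) (by omega)
      rw [Int.cast_zero, zero_add]
      refine ⟨this.1, this.2.trans ?_⟩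
      have h1 : t/R ≤ 1/2 := by rw [div_le_iff₀ (by positivity)]; linarith
      have h2 : t/(2*R) = t/R/2 := by field_simp
      rw [h2]; linarith) (fun i hi => by
      have s1 := sqrt_diff (N+i)
      have s2 := sqrt_diff (N+i+1)
      have a1 : 0 < Real.sqrt ((N+i:ℕ):ℝ) := Real.sqrt_pos.mpr (by exact_mod_cast (by omega : 0 < N+i))
      have a2 : Real.sqrt ((N+i:ℕ):ℝ) ≤ Real.sqrt ((N+i+1:ℕ):ℝ) := Real.sqrt_le_sqrt (by push_cast; linarith)
      have a3 : Real.sqrt ((N+i+1:ℕ):ℝ) ≤ Real.sqrt ((N+i+1+1:ℕ):ℝ) := Real.sqrt_le_sqrt (by push_cast; linarith)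
      change 2 * Real.sqrt ((N+i+1+1:ℕ):ℝ) * t - 2 * Real.sqrt ((N+i+1:ℕ):ℝ) * t ≤ 2 * Real.sqrt ((N+i+1:ℕ):ℝ) * t - 2 * Real.sqrt ((N+i:ℕ):ℝ) * t
      set x := Real.sqrt ((N+i:ℕ):ℝ)
      set y := Real.sqrt ((N+i+1:ℕ):ℝ)
      set w := Real.sqrt ((N+i+1+1:ℕ):ℝ)
      have : w - y ≤ y - x := by
        by_contra hcon
        push Not at hcon
        nlinarith
      nlinarith)
  have e : Kern N t = ∑ i ∈ Finset.range N, ee (2 * Real.sqrt ((N+i:ℕ):ℝ) * t) := by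
    unfold Kern
    rw [Finset.sum_Ico_eq_sum_range]; congr 1; congr 1; omega
  rw [e]
  refine hkl.trans (le_of_eq ?_)
  field_simp

lemma Kern_big (N : ℕ) (hN : 1 ≤ N) (t : ℝ) (ht2 : Real.sqrt N / 2 ≤ t) : ‖Kern N t‖ ≤ 108 * Real.sqrt (Real.sqrt N * t) := by
  have hN' : (1:ℝ) ≤ N := by exact_mod_cast hN
  set R := Real.sqrt N with hR
  have hR1 : 1 ≤ R := by rw [hR, Real.one_le_sqrt]; exact hN'
  have hRsq : R * R = N := Real.mul_self_sqrt (by positivity)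
  have ht : 0 < t := by linarith
  set mu := t/(16*R^3) with hmu
  have hmu0 : 0 < mu := by positivity
  rcases le_or_gt (Real.sqrt mu) (1/2) with hc | hc
  · have hsm : 0 < Real.sqrt mu := Real.sqrt_pos.mpr hmu0
    have hv := vdc (fun n => 2 * Real.sqrt n * t) N (2*N) mu (Real.sqrt mu) (t/R) hmu0 hsm hc (fun n h1 h2 => by
      have s1 := sqrt_diff n
      have s2 := sqrt_diff (n+1)
      have a0 : R ≤ Real.sqrt n := Real.sqrt_le_sqrt (by exact_mod_cast h1)
      have a2 : Real.sqrt n ≤ Real.sqrt ((n+1:ℕ):ℝ) := Real.sqrt_le_sqrt (by push_cast; linarith)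
      have a3 : Real.sqrt ((n+1:ℕ):ℝ) ≤ Real.sqrt ((n+1+1:ℕ):ℝ) := Real.sqrt_le_sqrt (by push_cast; linarith)
      have a4 : Real.sqrt ((n+1+1:ℕ):ℝ) ≤ 2 * R := by
        rw [Real.sqrt_le_left (by positivity), mul_pow, hR, Real.sq_sqrt (by positivity)]
        have : n + 1 + 1 ≤ 4 * N := by omega
        have : ((n+1+1:ℕ):ℝ) ≤ 4 * N := by exact_mod_cast this
        linarith
      change mu ≤ 2 * Real.sqrt ((n+1:ℕ):ℝ) * t - 2 * Real.sqrt (n:ℝ) * t - (2 * Real.sqrt ((n+1+1:ℕ):ℝ) * t - 2 * Real.sqrt ((n+1:ℕ):ℝ) * t)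
      set x := Real.sqrt (n:ℝ)
      set y := Real.sqrt ((n+1:ℕ):ℝ)
      set w := Real.sqrt ((n+1+1:ℕ):ℝ)
      have hxy : 0 < y + x := by linarith
      have hyw : 0 < w + y := by linarith
      have hxw : 0 < w + x := by linarith
      have e1 : y - x = 1/(y+x) := by rw [eq_div_iff hxy.ne']; exact s1
      have e2 : w - y = 1/(w+y) := by rw [eq_div_iff hyw.ne']; exact s2
      have e3 : w - x = 2/(w+x) := by rw [eq_div_iff hxw.ne']; linear_combination s1 + s2
      have e4 : 2 * y * t - 2 * x * t - (2 * w * t - 2 * y * t) = 4 * t / ((w+x)*(y+x)*(w+y)) := by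
        have : (y - x) - (w - y) = (w-x)/((y+x)*(w+y)) := by
          rw [e1, e2, div_sub_div _ _ hxy.ne' hyw.ne']; congr 1; ring
        rw [e3] at this
        have h2 : 2 * y * t - 2 * x * t - (2 * w * t - 2 * y * t) = 2 * t * ((y - x) - (w - y)) := by ring
        rw [h2, this]; field_simp; ring
      rw [e4, hmu]
      have hprod : (w+x)*(y+x)*(w+y) ≤ (4*R)*(4*R)*(4*R) := by
        gcongr <;> linarith
      rw [div_le_div_iff₀ (by positivity) (by positivity)]
      nlinarith) (fun n h1 h2 => by
      have s1 := sqrt_diff n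
      have a0 : R ≤ Real.sqrt n := Real.sqrt_le_sqrt (by exact_mod_cast h1)
      have a2 : Real.sqrt n ≤ Real.sqrt ((n+1:ℕ):ℝ) := Real.sqrt_le_sqrt (by push_cast; linarith)
      change 0 ≤ 2 * Real.sqrt ((n+1:ℕ):ℝ) * t - 2 * Real.sqrt (n:ℝ) * t ∧ 2 * Real.sqrt ((n+1:ℕ):ℝ) * t - 2 * Real.sqrt (n:ℝ) * t ≤ t / R
      set x := Real.sqrt (n:ℝ)
      set y := Real.sqrt ((n+1:ℕ):ℝ)
      have hxy : 0 < y + x := by linarith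
      constructor
      · nlinarith
      · have e : 2 * y * t - 2 * x * t = 2 * t / (y + x) := by
          rw [eq_div_iff hxy.ne']; linear_combination 2 * t * s1
        rw [e, div_le_div_iff₀ hxy (by positivity)]; nlinarith) (by positivity)
    refine le_trans hv ?_
    have hq : Real.sqrt mu / mu = 1 / Real.sqrt mu := by
      rw [div_eq_div_iff hmu0.ne' hsm.ne', Real.mul_self_sqrt hmu0.le, one_mul]
    rw [hq]
    have h1 : 1 ≤ 1 / Real.sqrt mu := by rw [le_div_iff₀ hsm]; linarith
    have h2 : t/R + 1 ≤ 3 * (t/R) := by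
      have : 1/2 ≤ t/R := by rw [le_div_iff₀ (by positivity)]; linarith
      linarith
    have h3 : t/R * (1/Real.sqrt mu) = 4 * Real.sqrt (R*t) := by
      have : (t/R * (1/Real.sqrt mu))^2 = 16 * (R * t) := by
        rw [mul_pow, div_pow, div_pow, Real.sq_sqrt hmu0.le, hmu]; field_simp
      have h4 : t/R * (1/Real.sqrt mu) = Real.sqrt (16 * (R*t)) := by
        rw [← this, Real.sqrt_sq (by positivity)]
      rw [h4, Real.sqrt_mul (by norm_num), show (16:ℝ) = 4^2 by norm_num, Real.sqrt_sq (by norm_num)]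
    calc 3 * (t/R+1) * (1/Real.sqrt mu + 1/Real.sqrt mu + 1) ≤ 3 * (3 * (t/R)) * (3 * (1/Real.sqrt mu)) := by
          gcongr; linarith
      _ = 27 * (t/R * (1/Real.sqrt mu)) := by ring
      _ = 108 * Real.sqrt (R*t) := by rw [h3]; ring
  · refine (Kern_triv N t).trans ?_
    have h1 : 1/4 < mu := by
      have := Real.lt_sqrt (x := 1/2) (y := mu) (by norm_num) |>.mp hc
      linarith
    rw [hmu, lt_div_iff₀ (by positivity)] at h1
    have h2 : (N:ℝ) ≤ Real.sqrt (R*t) := by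
      apply Real.le_sqrt_of_sq_le
      rw [← hRsq]
      nlinarith [pow_pos (lt_of_lt_of_le one_pos hR1) 3]
    have := Real.sqrt_nonneg (R*t)
    linarith

lemma Kern_bound (N : ℕ) (hN : 1 ≤ N) (t : ℝ) (ht : |t| ≤ Real.sqrt N / 2) : ‖Kern N t‖ ≤ 4 * Real.sqrt N / (|t| + 1/Real.sqrt N) := by
  have hN' : (1:ℝ) ≤ N := by exact_mod_cast hN
  have e : ‖Kern N t‖ = ‖Kern N |t|‖ := by
    rcases abs_cases t with ⟨h, _⟩ | ⟨h, _⟩ <;> rw [h]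
    rw [Kern_neg]
  rw [e]
  set R := Real.sqrt N with hR
  have hR1 : 1 ≤ R := by rw [hR, Real.one_le_sqrt]; exact hN'
  have hRsq : R * R = N := Real.mul_self_sqrt (by positivity)
  have h0 := abs_nonneg t
  rcases le_or_gt |t| (1/R) with h | h
  · refine (Kern_triv N _).trans ?_
    rw [le_div_iff₀ (by positivity), ← hRsq]
    have h3 : R * (1/R) = 1 := by field_simp
    have : R * (|t| + 1/R) ≤ 2 := by nlinarith
    nlinarith
  · have hp : 0 < |t| := lt_trans (by positivity) h
    refine (Kern_small N hN |t| hp ht).trans ?_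
    rw [div_le_div_iff₀ hp (by positivity)]
    nlinarith

lemma Kern_bound' (N : ℕ) (hN : 1 ≤ N) (t : ℝ) : ‖Kern N t‖ ≤ 4 * Real.sqrt N / (|t| + 1/Real.sqrt N) + 108 * Real.sqrt (Real.sqrt N * |t|) := by
  rcases le_or_gt |t| (Real.sqrt N / 2) with h | h
  · have := Kern_bound N hN t h
    have := Real.sqrt_nonneg (Real.sqrt N * |t|)
    linarith
  · have e : ‖Kern N t‖ = ‖Kern N |t|‖ := by
      rcases abs_cases t with ⟨h, _⟩ | ⟨h, _⟩ <;> rw [h]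
      rw [Kern_neg]
    rw [e]
    have := Kern_big N hN |t| h.le
    have : 0 ≤ 4 * Real.sqrt N / (|t| + 1/Real.sqrt N) := by positivity
    linarith

end

section
open Filter MeasureTheory Topology

noncomputable def fB (N : ℕ) (c : ℕ → ℂ) (u : ℝ) : ℂ := ∑ n ∈ Finset.Ico N (2*N), c n * ee (2 * Real.sqrt n * u)

lemma ee_cont : Continuous ee := by unfold ee; fun_prop

lemma fB_cont (N : ℕ) (c : ℕ → ℂ) : Continuous (fB N c) := by
  unfold fB
  refine continuous_finsetSum _ fun n _ => ?_
  exact continuous_const.mul (ee_cont.comp (by fun_prop))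

lemma Kern_cont (N : ℕ) : Continuous (Kern N) := by
  unfold Kern
  refine continuous_finsetSum _ fun n _ => ?_
  exact (ee_cont.comp (by fun_prop))

lemma fB_bd (N : ℕ) (c : ℕ → ℂ) (u : ℝ) : ‖fB N c u‖ ≤ ∑ n ∈ Finset.Ico N (2*N), ‖c n‖ := by
  unfold fB
  refine (norm_sum_le _ _).trans (Finset.sum_le_sum fun n _ => ?_)
  rw [norm_mul, norm_ee, mul_one]

lemma ee_conj (x : ℝ) : (starRingEnd ℂ) (ee x) = ee (-x) := by
  unfold ee
  rw [← Complex.exp_conj]; congr 1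
  rw [map_mul, Complex.conj_ofReal, Complex.conj_I]; push_cast; ring

lemma dual_bound (N : ℕ) (c : ℕ → ℂ) (μ : Measure ℝ) [IsFiniteMeasure μ] (A : ℝ) (hA0 : 0 ≤ A)
    (hA : ∀ᵐ u ∂μ, ∫ v, ‖Kern N (u - v)‖ ∂μ ≤ A) :
    ∫ u, ‖fB N c u‖^2 ∂μ ≤ (∑ n ∈ Finset.Ico N (2*N), ‖c n‖^2) * A := by
  set f := fB N c with hf
  set S := ∑ n ∈ Finset.Ico N (2*N), ‖c n‖ with hS
  have hS0 : 0 ≤ S := Finset.sum_nonneg fun _ _ => norm_nonneg _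
  set G := ∑ n ∈ Finset.Ico N (2*N), ‖c n‖^2 with hG
  have hG0 : 0 ≤ G := Finset.sum_nonneg fun _ _ => by positivity
  set J := ∫ u, ‖f u‖^2 ∂μ with hJ
  have hJ0 : 0 ≤ J := integral_nonneg fun _ => by positivity
  have hfc : Continuous f := fB_cont N c
  have hfb : ∀ u, ‖f u‖ ≤ S := fB_bd N c
  set gn : ℕ → ℂ := fun n => ∫ u, (starRingEnd ℂ) (f u) * ee (2*Real.sqrt n * u) ∂μ with hgn
  have hIntg : ∀ n : ℕ, Integrable (fun u => (starRingEnd ℂ) (f u) * ee (2*Real.sqrt n * u)) μ := by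
    intro n
    refine Integrable.of_bound (C := S) ?_ ?_
    · refine Continuous.aestronglyMeasurable ?_
      exact (Complex.continuous_conj.comp hfc).mul (ee_cont.comp (by fun_prop))
    · refine ae_of_all _ fun u => ?_
      rw [norm_mul, norm_ee, mul_one, RCLike.norm_conj]; exact hfb u
  have hJg : (J:ℂ) = ∑ n ∈ Finset.Ico N (2*N), c n * gn n := by
    have : ∀ n ∈ Finset.Ico N (2*N), c n * gn n = ∫ u, c n * ((starRingEnd ℂ) (f u) * ee (2*Real.sqrt n * u)) ∂μ := by
      intro n _; rw [integral_const_mul]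
    rw [Finset.sum_congr rfl this, ← integral_finsetSum _ (fun n _ => (hIntg n).const_mul (c n)), hJ, ← integral_complex_ofReal]
    refine integral_congr_ae (ae_of_all _ fun u => ?_)
    show ((‖f u‖^2 : ℝ) : ℂ) = _
    have e : ∑ n ∈ Finset.Ico N (2*N), c n * ((starRingEnd ℂ) (f u) * ee (2*Real.sqrt n * u)) = (starRingEnd ℂ) (f u) * f u := by
      conv_rhs => rw [hf]
      conv_rhs => arg 2; unfold fB
      rw [Finset.mul_sum]
      refine Finset.sum_congr rfl fun n _ => by ring
    beta_reduce
    rw [e, Complex.conj_mul']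
    push_cast; rfl
  have hprod : (∑ n ∈ Finset.Ico N (2*N), ‖gn n‖^2) ≤ A * J := by
    have e1 : ((∑ n ∈ Finset.Ico N (2*N), ‖gn n‖^2 : ℝ) : ℂ) = ∫ z : ℝ × ℝ, ((starRingEnd ℂ) (f z.1) * f z.2) * Kern N (z.1 - z.2) ∂(μ.prod μ) := by
      have e2 : ∀ n ∈ Finset.Ico N (2*N), ((‖gn n‖^2 : ℝ) : ℂ) = ∫ z : ℝ × ℝ, ((starRingEnd ℂ) (f z.1) * ee (2*Real.sqrt n * z.1)) * (starRingEnd ℂ) ((starRingEnd ℂ) (f z.2) * ee (2*Real.sqrt n * z.2)) ∂(μ.prod μ) := by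
        intro n _
        rw [integral_prod_mul (μ := μ) (ν := μ) (fun u => (starRingEnd ℂ) (f u) * ee (2*Real.sqrt n * u)) (fun u => (starRingEnd ℂ) ((starRingEnd ℂ) (f u) * ee (2*Real.sqrt n * u)))]
        rw [integral_conj]
        show _ = gn n * (starRingEnd ℂ) (gn n)
        rw [Complex.mul_conj']; push_cast; rfl
      push_cast at e2 ⊢
      rw [Finset.sum_congr rfl e2, ← integral_finsetSum]
      · refine integral_congr_ae (ae_of_all _ fun z => ?_)
        show _ = _
        simp only
        unfold Kern
        rw [Finset.mul_sum]
        refine Finset.sum_congr rfl fun n _ => ?_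
        rw [map_mul, Complex.conj_conj, ee_conj, show 2 * Real.sqrt n * (z.1 - z.2) = 2*Real.sqrt n * z.1 + -(2*Real.sqrt n*z.2) by ring, ee_add]
        ring
      · intro n _
        have := (hIntg n).mul_prod (ν := μ) (g := fun u => (starRingEnd ℂ) ((starRingEnd ℂ) (f u) * ee (2*Real.sqrt n * u))) (by
          have := (hIntg n)
          exact (LinearIsometryEquiv.integrable_comp_iff (Complex.conjLIE) |>.mpr this))
        exact this
    have hKb := Kern_triv N
    have hKc := Kern_cont N
    have hI1 : Integrable (fun z : ℝ × ℝ => ‖f z.1‖^2 * ‖Kern N (z.1 - z.2)‖) (μ.prod μ) := by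
      refine Integrable.of_bound (C := S^2 * N) ?_ ?_
      · refine Continuous.aestronglyMeasurable ?_
        fun_prop
      · refine ae_of_all _ fun z => ?_
        rw [norm_mul, norm_pow, norm_norm, norm_norm]
        have := hfb z.1
        have := hKb (z.1 - z.2)
        gcongr
    have hI2 : Integrable (fun z : ℝ × ℝ => ‖f z.2‖^2 * ‖Kern N (z.1 - z.2)‖) (μ.prod μ) := by
      refine Integrable.of_bound (C := S^2 * N) ?_ ?_
      · refine Continuous.aestronglyMeasurable ?_
        fun_prop
      · refine ae_of_all _ fun z => ?_
        rw [norm_mul, norm_pow, norm_norm, norm_norm]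
        have := hfb z.2
        have := hKb (z.1 - z.2)
        gcongr
    have e12 : ∫ z : ℝ × ℝ, ‖f z.2‖^2 * ‖Kern N (z.1 - z.2)‖ ∂(μ.prod μ) = ∫ z : ℝ × ℝ, ‖f z.1‖^2 * ‖Kern N (z.1 - z.2)‖ ∂(μ.prod μ) := by
      rw [← integral_prod_swap]
      refine integral_congr_ae (ae_of_all _ fun z => ?_)
      simp only [Prod.fst_swap, Prod.snd_swap]
      rw [← Kern_neg, neg_sub]
    have hle1 : ∫ z : ℝ × ℝ, ‖f z.1‖^2 * ‖Kern N (z.1 - z.2)‖ ∂(μ.prod μ) ≤ A * J := by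
      rw [integral_prod _ hI1, hJ, ← integral_const_mul]
      refine integral_mono_ae ?_ ?_ ?_
      · exact hI1.integral_prod_left
      · refine Integrable.of_bound (C := |A| * S^2) ?_ ?_
        · refine Continuous.aestronglyMeasurable ?_
          fun_prop
        · refine ae_of_all _ fun z => ?_
          rw [norm_mul, norm_pow, norm_norm, Real.norm_eq_abs]
          have := hfb z
          gcongr
      · filter_upwards [hA] with u hu
        rw [integral_const_mul, mul_comm]
        gcongr
    have e3 : (∑ n ∈ Finset.Ico N (2*N), ‖gn n‖^2) = ‖((∑ n ∈ Finset.Ico N (2*N), ‖gn n‖^2 : ℝ) : ℂ)‖ := by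
      rw [Complex.norm_real, Real.norm_of_nonneg (Finset.sum_nonneg fun _ _ => by positivity)]
    rw [e3, e1]
    refine (norm_integral_le_integral_norm _).trans ?_
    calc _ ≤ ∫ z : ℝ × ℝ, (1/2) * (‖f z.1‖^2 * ‖Kern N (z.1 - z.2)‖ + ‖f z.2‖^2 * ‖Kern N (z.1 - z.2)‖) ∂(μ.prod μ) := by
          refine integral_mono_of_nonneg (ae_of_all _ fun z => norm_nonneg _) ((hI1.add hI2).const_mul _) (ae_of_all _ fun z => ?_)
          simp only
          rw [norm_mul, norm_mul, RCLike.norm_conj]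
          have := norm_nonneg (Kern N (z.1 - z.2))
          nlinarith [mul_nonneg (sq_nonneg (‖f z.1‖ - ‖f z.2‖)) this]
      _ = 1/2 * (∫ z : ℝ × ℝ, ‖f z.1‖^2 * ‖Kern N (z.1 - z.2)‖ ∂(μ.prod μ) + ∫ z : ℝ × ℝ, ‖f z.2‖^2 * ‖Kern N (z.1 - z.2)‖ ∂(μ.prod μ)) := by
          rw [integral_const_mul, integral_add hI1 hI2]
      _ ≤ _ := by rw [e12]; linarith
  have hcs : J^2 ≤ G * (A * J) := by
    have h1 : J ≤ ∑ n ∈ Finset.Ico N (2*N), ‖c n‖ * ‖gn n‖ := by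
      have : J = ‖(J:ℂ)‖ := by rw [Complex.norm_real, Real.norm_of_nonneg hJ0]
      rw [this, hJg]
      refine (norm_sum_le _ _).trans (Finset.sum_le_sum fun n _ => ?_)
      rw [norm_mul]
    calc J^2 ≤ (∑ n ∈ Finset.Ico N (2*N), ‖c n‖ * ‖gn n‖)^2 := by gcongr
      _ ≤ G * (∑ n ∈ Finset.Ico N (2*N), ‖gn n‖^2) := Finset.sum_mul_sq_le_sq_mul_sq _ _ _
      _ ≤ _ := by gcongr
  rcases hJ0.eq_or_lt with h | h
  · rw [← h]; positivity
  · nlinarith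

end

section
open Filter MeasureTheory Topology

lemma log_kernel_int (a b u r : ℝ) (hr : 0 < r) (hu : u ∈ Set.Icc a b) :
    ∫ v in Set.Icc a b, 1/(|u-v|+r) ≤ 2 * Real.log (1 + (b-a)/r) := by
  have hc : Continuous (fun v : ℝ => 1/(|u-v|+r)) :=
    Continuous.div continuous_const (by fun_prop) (fun v => by positivity)
  rw [integral_Icc_eq_integral_Ioc, ← intervalIntegral.integral_of_le (hu.1.trans hu.2),
    ← intervalIntegral.integral_add_adjacent_intervals (b := u) (hc.intervalIntegrable _ _) (hc.intervalIntegrable _ _)]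
  have h1 : ∫ v in a..u, 1/(|u-v|+r) = Real.log (u-a+r) - Real.log r := by
    have : ∫ v in a..u, 1/(|u-v|+r) = -Real.log (u-u+r) - (-Real.log (u-a+r)) := by
      have e : ∫ v in a..u, 1/(|u-v|+r) = ∫ v in a..u, 1/((u-v)+r) := by
        refine intervalIntegral.integral_congr fun v hv => ?_
        rw [Set.uIcc_of_le hu.1] at hv
        rw [abs_of_nonneg (by linarith [hv.2])]
      rw [e]
      refine intervalIntegral.integral_eq_sub_of_hasDerivAt (f := fun v => -Real.log (u-v+r)) (fun v hv => ?_) ?_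
      · rw [Set.uIcc_of_le hu.1] at hv
        have hpos : 0 < u - v + r := by linarith [hv.2]
        have h2 : HasDerivAt (fun v : ℝ => u - v + r) (-1) v := by
          simpa using ((hasDerivAt_id v).const_sub u).add_const r
        have h3 := (h2.log hpos.ne').neg
        have e3 : 1/(u-v+r) = -(-1/(u-v+r)) := by ring
        rw [e3]
        exact h3
      · refine ContinuousOn.intervalIntegrable ?_
        rw [Set.uIcc_of_le hu.1]
        refine ContinuousOn.div continuousOn_const (by fun_prop) fun v hv => ?_
        have := hv.2
        linarith
    rw [this]; rw [sub_self, zero_add]; ring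
  have h2 : ∫ v in u..b, 1/(|u-v|+r) = Real.log (b-u+r) - Real.log r := by
    have : ∫ v in u..b, 1/(|u-v|+r) = Real.log (b-u+r) - (Real.log (u-u+r)) := by
      have e : ∫ v in u..b, 1/(|u-v|+r) = ∫ v in u..b, 1/((v-u)+r) := by
        refine intervalIntegral.integral_congr fun v hv => ?_
        rw [Set.uIcc_of_le hu.2] at hv
        rw [abs_of_nonpos (by linarith [hv.1])]
        ring
      rw [e]
      refine intervalIntegral.integral_eq_sub_of_hasDerivAt (f := fun v => Real.log (v-u+r)) (fun v hv => ?_) ?_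
      · rw [Set.uIcc_of_le hu.2] at hv
        have hpos : 0 < v - u + r := by linarith [hv.1]
        have h2 : HasDerivAt (fun v : ℝ => v - u + r) (1) v := by
          simpa using ((hasDerivAt_id v).sub_const u).add_const r
        exact (h2.log hpos.ne')
      · refine ContinuousOn.intervalIntegrable ?_
        rw [Set.uIcc_of_le hu.2]
        refine ContinuousOn.div continuousOn_const (by fun_prop) fun v hv => ?_
        have := hv.1
        linarith
    rw [this]; rw [sub_self, zero_add]
  rw [h1, h2]
  have e : Real.log (1 + (b-a)/r) = Real.log (b - a + r) - Real.log r := by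
    have h4 : 0 < b - a + r := by linarith [hu.1, hu.2]
    rw [← Real.log_div h4.ne' hr.ne']; congr 1; field_simp; ring
  rw [e]
  have l1 : Real.log (u-a+r) ≤ Real.log (b-a+r) := Real.log_le_log (by linarith [hu.1]) (by linarith [hu.2])
  have l2 : Real.log (b-u+r) ≤ Real.log (b-a+r) := Real.log_le_log (by linarith [hu.2]) (by linarith [hu.1])
  linarith

lemma kern_int (N : ℕ) (hN : 1 ≤ N) (a b : ℝ) (E : Set ℝ) (hE : MeasurableSet E) (hEs : E ⊆ Set.Icc a b) (u D : ℝ) (hu : u ∈ Set.Icc a b)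
    (hD : 0 ≤ D) (hK : ∀ v ∈ Set.Icc a b, ‖Kern N (u-v)‖ ≤ 4 * Real.sqrt N / (|u-v| + 1/Real.sqrt N) + D) :
    ∫ v in E, ‖Kern N (u-v)‖ ≤ 8 * Real.sqrt N * Real.log (1 + (b-a)*Real.sqrt N) + D * (volume E).toReal := by
  have hR : 0 < Real.sqrt N := Real.sqrt_pos.mpr (by exact_mod_cast hN)
  have hfin : volume E ≠ ⊤ := by
    refine ne_top_of_le_ne_top ?_ (measure_mono hEs)
    rw [Real.volume_Icc]; exact ENNReal.ofReal_ne_top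
  have hc : Continuous (fun v : ℝ => 1/(|u-v|+1/Real.sqrt N)) :=
    Continuous.div continuous_const (by fun_prop) (fun v => by positivity)
  have hi : IntegrableOn (fun v : ℝ => 1/(|u-v|+1/Real.sqrt N)) (Set.Icc a b) := hc.continuousOn.integrableOn_Icc
  have hKi : IntegrableOn (fun v : ℝ => ‖Kern N (u-v)‖) (Set.Icc a b) := by
    have : Continuous (fun v : ℝ => ‖Kern N (u-v)‖) := by have := Kern_cont N; fun_prop
    exact this.continuousOn.integrableOn_Icc
  have hD2 : IntegrableOn (fun _ : ℝ => D) E := integrableOn_const hfin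
  calc ∫ v in E, ‖Kern N (u-v)‖ ≤ ∫ v in E, (4 * Real.sqrt N * (1/(|u-v|+1/Real.sqrt N)) + D) := by
        refine setIntegral_mono_on (hKi.mono_set hEs) (((hi.mono_set hEs).const_mul _).add hD2) hE fun v hv => ?_
        have := hK v (hEs hv)
        rw [mul_one_div]; exact this
    _ = 4 * Real.sqrt N * (∫ v in E, 1/(|u-v|+1/Real.sqrt N)) + D * (volume E).toReal := by
        rw [integral_add ((hi.mono_set hEs).const_mul _) hD2, integral_const_mul, setIntegral_const]
        simp [Measure.real, mul_comm]
    _ ≤ 4 * Real.sqrt N * (∫ v in Set.Icc a b, 1/(|u-v|+1/Real.sqrt N)) + D * (volume E).toReal := by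
        gcongr
        exact ae_of_all _ fun v => by positivity
    _ ≤ 4 * Real.sqrt N * (2 * Real.log (1 + (b-a)/(1/Real.sqrt N))) + D * (volume E).toReal := by
        gcongr
        exact log_kernel_int a b u _ (by positivity) hu
    _ = _ := by rw [div_div_eq_mul_div, div_one]; ring

lemma fB_sq_small (N : ℕ) (hN : 1 ≤ N) (c : ℕ → ℂ) (G : ℝ) (hG : ∑ n ∈ Finset.Ico N (2*N), ‖c n‖^2 ≤ G) (a L : ℝ) (hL0 : 0 ≤ L) (hL : L ≤ Real.sqrt N/2) :
    ∫ u in a..(a+L), ‖fB N c u‖^2 ≤ G * (8 * Real.sqrt N * Real.log (1 + L * Real.sqrt N)) := by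
  rw [intervalIntegral.integral_of_le (by linarith), ← integral_Icc_eq_integral_Ioc]
  have hl : 0 ≤ Real.log (1 + L * Real.sqrt N) := Real.log_nonneg (by nlinarith [Real.sqrt_nonneg N])
  have hpos : 0 ≤ 8 * Real.sqrt N * Real.log (1 + L * Real.sqrt N) := by positivity
  refine (dual_bound N c (volume.restrict (Set.Icc a (a+L))) (8 * Real.sqrt N * Real.log (1 + L * Real.sqrt N)) hpos ?_).trans ?_
  · refine (ae_restrict_iff' measurableSet_Icc).mpr (ae_of_all _ fun u hu => ?_)
    have := kern_int N hN a (a+L) (Set.Icc a (a+L)) measurableSet_Icc subset_rfl u 0 hu le_rfl (fun v hv => by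
      rw [add_zero]
      refine Kern_bound N hN _ ?_
      rw [abs_le]; constructor <;> linarith [hu.1, hu.2, hv.1, hv.2])
    simpa using this
  · gcongr

lemma fB_sq_large (N : ℕ) (hN : 1 ≤ N) (c : ℕ → ℂ) (G : ℝ) (hG : ∑ n ∈ Finset.Ico N (2*N), ‖c n‖^2 ≤ G) (a L : ℝ) (hL0 : 0 ≤ L) (E : Set ℝ) (hE : MeasurableSet E) (hEs : E ⊆ Set.Icc a (a+L)) :
    ∫ u in E, ‖fB N c u‖^2 ≤ G * (8 * Real.sqrt N * Real.log (1 + L * Real.sqrt N) + 108 * Real.sqrt (Real.sqrt N * L) * (volume E).toReal) := by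
  have hl : 0 ≤ Real.log (1 + L * Real.sqrt N) := Real.log_nonneg (by nlinarith [Real.sqrt_nonneg N])
  have hpos : 0 ≤ 8 * Real.sqrt N * Real.log (1 + L * Real.sqrt N) + 108 * Real.sqrt (Real.sqrt N * L) * (volume E).toReal := by positivity
  have : IsFiniteMeasure (volume.restrict E) := by
    refine isFiniteMeasure_restrict.mpr (ne_top_of_le_ne_top ?_ (measure_mono hEs))
    rw [Real.volume_Icc]; exact ENNReal.ofReal_ne_top
  refine (dual_bound N c (volume.restrict E) _ hpos ?_).trans ?_
  · refine (ae_restrict_iff' hE).mpr (ae_of_all _ fun u hu => ?_)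
    have hu' := hEs hu
    have := kern_int N hN a (a+L) E hE hEs u (108 * Real.sqrt (Real.sqrt N * L)) hu' (by positivity) (fun v hv => by
      refine (Kern_bound' N hN _).trans ?_
      have : |u - v| ≤ L := by rw [abs_le]; constructor <;> linarith [hu'.1, hu'.2, hv.1, hv.2]
      gcongr)
    simpa using this
  · gcongr

lemma cover_int (h : ℝ → ℝ) (h0 : ∀ u, 0 ≤ h u) (hi : ∀ a b, IntervalIntegrable h volume a b) (L B U : ℝ) (hL : 0 < L) (hU : 0 ≤ U)
    (hB : ∀ a, ∫ u in a..(a+L), h u ≤ B) : ∫ u in U..(2*U), h u ≤ (U/L+1) * B := by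
  have hB0 : 0 ≤ B := (intervalIntegral.integral_nonneg (by linarith : (0:ℝ) ≤ 0 + L) (fun u _ => h0 u)).trans (hB 0)
  set K := ⌈U/L⌉₊ with hK
  have hK1 : U/L ≤ K := Nat.le_ceil _
  have hK2 : (K:ℝ) ≤ U/L + 1 := (Nat.ceil_lt_add_one (by positivity)).le
  have hend : 2*U ≤ U + K*L := by
    rw [div_le_iff₀ hL] at hK1; linarith
  calc ∫ u in U..(2*U), h u ≤ ∫ u in U..(U+K*L), h u := by
        refine intervalIntegral.integral_mono_interval le_rfl (by linarith) hend (ae_of_all _ fun u => h0 u) (hi _ _)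
    _ = ∑ k ∈ Finset.range K, ∫ u in (U+(k:ℕ)*L)..(U+((k+1:ℕ):ℝ)*L), h u := by
        rw [intervalIntegral.sum_integral_adjacent_intervals (a := fun k : ℕ => U + (k:ℝ)*L) (fun k _ => hi _ _)]
        simp
    _ ≤ ∑ k ∈ Finset.range K, B := by
        refine Finset.sum_le_sum fun k _ => ?_
        have := hB (U+k*L)
        have e : U + ((k+1:ℕ):ℝ)*L = U + k*L + L := by push_cast; ring
        rw [e]; exact this
    _ = K * B := by simp
    _ ≤ _ := by gcongr

lemma fB_mean_square (N : ℕ) (hN : 1 ≤ N) (c : ℕ → ℂ) (G : ℝ) (hG : ∑ n ∈ Finset.Ico N (2*N), ‖c n‖^2 ≤ G) (U : ℝ) (hU : 0 ≤ U) :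
    ∫ u in U..(2*U), ‖fB N c u‖^2 ≤ G * (16 * U + 8 * Real.sqrt N) * Real.log (1+N) := by
  have hR : 0 < Real.sqrt N := Real.sqrt_pos.mpr (by exact_mod_cast hN)
  have hG0 : 0 ≤ G := (Finset.sum_nonneg fun _ _ => by positivity).trans hG
  have hc := fB_cont N c
  have := cover_int (fun u => ‖fB N c u‖^2) (fun u => by positivity) (fun a b => by
    refine Continuous.intervalIntegrable ?_ _ _
    fun_prop) (Real.sqrt N/2) (G * (8 * Real.sqrt N * Real.log (1 + N))) U (by positivity) hU (fun a => by
      refine (fB_sq_small N hN c G hG a (Real.sqrt N/2) (by positivity) le_rfl).trans ?_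
      gcongr
      rw [div_mul_eq_mul_div, Real.mul_self_sqrt (by positivity)]
      have : (0:ℝ) ≤ N := by positivity
      linarith)
  refine this.trans (le_of_eq ?_)
  field_simp; ring

noncomputable def lvl (h : ℝ → ℝ) (V U : ℝ) : ℝ := ∫ u in U..(2*U), Set.indicator {u | V ≤ h u} (fun _ => (1:ℝ)) u

lemma lvl_integrable (h : ℝ → ℝ) (hm : Measurable h) (V a b : ℝ) : IntervalIntegrable (Set.indicator {u | V ≤ h u} (fun _ => (1:ℝ))) volume a b := by
  have : MeasurableSet {u | V ≤ h u} := measurableSet_le measurable_const hm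
  rw [intervalIntegrable_iff]
  refine Integrable.indicator ?_ this
  refine integrableOn_const ?_
  rw [Set.uIoc, Real.volume_Ioc]; exact ENNReal.ofReal_ne_top

lemma fB_lvl (N : ℕ) (hN : 1 ≤ N) (c : ℕ → ℂ) (G : ℝ) (hG0 : 0 < G) (hG : ∑ n ∈ Finset.Ico N (2*N), ‖c n‖^2 ≤ G) (U V : ℝ) (hU : 0 < U) (hV : 0 < V) :
    lvl (fun u => ‖fB N c u‖) V U ≤ (46656 * U * G^2 * Real.sqrt N / V^4 + 2) * (16 * G * Real.sqrt N * Real.log (1 + U * Real.sqrt N) / V^2) := by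
  have hR : 0 < Real.sqrt N := Real.sqrt_pos.mpr (by exact_mod_cast hN)
  have hc := fB_cont N c
  set L0 := (V^2/(216*G))^2/Real.sqrt N with hL0
  have hL0p : 0 < L0 := by positivity
  set L := min L0 U with hLd
  have hLp : 0 < L := lt_min hL0p hU
  have hm : Measurable (fun u => ‖fB N c u‖) := hc.norm.measurable
  have hS : MeasurableSet {u | V ≤ ‖fB N c u‖} := measurableSet_le measurable_const hm
  have hlog : 0 ≤ Real.log (1 + U * Real.sqrt N) := Real.log_nonneg (by nlinarith)
  set B := 16 * G * Real.sqrt N * Real.log (1 + U * Real.sqrt N) / V^2 with hB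
  have hB0 : 0 ≤ B := by positivity
  have := cover_int (Set.indicator {u | V ≤ ‖fB N c u‖} (fun _ => (1:ℝ))) (fun u => Set.indicator_nonneg (fun _ _ => zero_le_one) u) (fun a b => lvl_integrable _ hm V a b)
    L B U hLp hU.le (fun a => by
      rw [intervalIntegral.integral_of_le (by linarith), ← integral_Icc_eq_integral_Ioc, setIntegral_indicator hS, setIntegral_const, smul_eq_mul, mul_one]
      set E := Set.Icc a (a+L) ∩ {u | V ≤ ‖fB N c u‖} with hE
      have hEm : MeasurableSet E := measurableSet_Icc.inter hS
      have hfin : volume E ≠ ⊤ := by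
        refine ne_top_of_le_ne_top ?_ (measure_mono Set.inter_subset_left)
        rw [Real.volume_Icc]; exact ENNReal.ofReal_ne_top
      have h1 := fB_sq_large N hN c G hG a L hLp.le E hEm Set.inter_subset_left
      have h2 : V^2 * (volume E).toReal ≤ ∫ u in E, ‖fB N c u‖^2 := by
        have : ∫ u in E, V^2 = V^2 * (volume E).toReal := by rw [setIntegral_const]; simp [Measure.real, mul_comm]
        rw [← this]
        refine setIntegral_mono_on (integrableOn_const hfin) ?_ hEm fun u hu => ?_
        · refine IntegrableOn.mono_set (Continuous.integrableOn_Icc ?_) (Set.inter_subset_left (s := Set.Icc a (a+L)) )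
          fun_prop
        · have : V ≤ ‖fB N c u‖ := hu.2
          gcongr
      have h3 : 108 * Real.sqrt (Real.sqrt N * L) * G ≤ V^2/2 := by
        have : Real.sqrt (Real.sqrt N * L) ≤ V^2/(216*G) := by
          refine Real.sqrt_le_iff.mpr ⟨by positivity, ?_⟩
          calc Real.sqrt N * L ≤ Real.sqrt N * L0 := by gcongr; exact min_le_left _ _
            _ = _ := by rw [hL0]; field_simp
        calc 108 * Real.sqrt (Real.sqrt N * L) * G ≤ 108 * (V^2/(216*G)) * G := by gcongr
          _ = _ := by field_simp; ring
      have h4 : Real.log (1 + L * Real.sqrt N) ≤ Real.log (1 + U * Real.sqrt N) := by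
        refine Real.log_le_log (by positivity) ?_
        have : L ≤ U := min_le_right _ _
        gcongr
      have h5 : G * (8 * Real.sqrt N * Real.log (1 + L * Real.sqrt N)) ≤ G * (8 * Real.sqrt N * Real.log (1 + U * Real.sqrt N)) := by gcongr
      have h6 : 0 ≤ (volume E).toReal := ENNReal.toReal_nonneg
      show (volume E).toReal ≤ B
      rw [hB, le_div_iff₀ (by positivity)]
      nlinarith [mul_le_mul_of_nonneg_right h3 h6])
  unfold lvl
  refine this.trans ?_
  have hcount : U/L + 1 ≤ 46656 * U * G^2 * Real.sqrt N / V^4 + 2 := by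
    have e : U/L0 = 46656 * U * G^2 * Real.sqrt N / V^4 := by
      rw [hL0]; field_simp; norm_num
    rcases min_choice L0 U with h | h
    · rw [hLd, h, e]; linarith
    · rw [hLd, h, div_self hU.ne']
      have : 0 ≤ 46656 * U * G^2 * Real.sqrt N / V^4 := by positivity
      linarith
  gcongr

end

section
open Filter MeasureTheory Topology

def sg (b : Bool) : ℝ := if b then 1 else -1

noncomputable def eta {k : ℕ} (s : Fin k → Bool) (v : Fin k → ℕ) : ℝ := ∑ i, sg (s i) * Real.sqrt (v i)

lemma comp_split (n : ℕ) (p : Polynomial ℤ) : ∃ A B : Polynomial ℤ,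
    ∀ t : ℝ, t^2 = n → (p.map (Int.castRingHom ℝ)).comp (Polynomial.X + Polynomial.C t) =
      A.map (Int.castRingHom ℝ) + Polynomial.C t * B.map (Int.castRingHom ℝ) := by
  induction p using Polynomial.induction_on' with
  | add p q hp hq =>
    obtain ⟨A, B, h⟩ := hp
    obtain ⟨A', B', h'⟩ := hq
    refine ⟨A + A', B + B', fun t ht => ?_⟩
    rw [Polynomial.map_add, Polynomial.add_comp, h t ht, h' t ht, Polynomial.map_add, Polynomial.map_add]
    ring
  | monomial m a =>
    have : ∀ m : ℕ, ∃ A B : Polynomial ℤ, ∀ t : ℝ, t^2 = n → (Polynomial.X + Polynomial.C t)^m =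
      A.map (Int.castRingHom ℝ) + Polynomial.C t * B.map (Int.castRingHom ℝ) := by
      intro m
      induction m with
      | zero => exact ⟨1, 0, fun t _ => by simp⟩
      | succ m ih =>
        obtain ⟨A, B, h⟩ := ih
        refine ⟨Polynomial.X * A + (n : Polynomial ℤ) * B, A + Polynomial.X * B, fun t ht => ?_⟩
        have hC : (Polynomial.C t : Polynomial ℝ)^2 = (n : Polynomial ℝ) := by
          rw [← Polynomial.C_pow, ht]; simp
        rw [pow_succ, h t ht]
        simp only [Polynomial.map_add, Polynomial.map_mul, Polynomial.map_X, Polynomial.map_natCast]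
        rw [← hC]; ring
    obtain ⟨A, B, h⟩ := this m
    refine ⟨Polynomial.C a * A, Polynomial.C a * B, fun t ht => ?_⟩
    rw [← Polynomial.C_mul_X_pow_eq_monomial, Polynomial.map_mul, Polynomial.map_pow, Polynomial.map_X, Polynomial.mul_comp, Polynomial.pow_comp, Polynomial.X_comp, h t ht]
    simp only [Polynomial.map_mul, Polynomial.map_C, Polynomial.C_comp]
    ring

lemma prod_int (k : ℕ) (v : Fin k → ℕ) : ∃ p : Polynomial ℤ, p.map (Int.castRingHom ℝ) =
    ∏ s : Fin k → Bool, (Polynomial.X - Polynomial.C (eta s v)) := by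
  induction k with
  | zero => exact ⟨Polynomial.X, by simp [eta]⟩
  | succ k ih =>
    obtain ⟨p, hp⟩ := ih (fun i => v i.succ)
    obtain ⟨A, B, h⟩ := comp_split (v 0) p
    refine ⟨A^2 - (v 0 : Polynomial ℤ) * B^2, ?_⟩
    have ht : (Real.sqrt (v 0))^2 = (v 0 : ℕ) := Real.sq_sqrt (by positivity)
    have h1 := h (Real.sqrt (v 0)) ht
    have h2 := h (-Real.sqrt (v 0)) (by rw [neg_sq]; exact ht)
    have hC : (Polynomial.C (Real.sqrt (v 0)) : Polynomial ℝ)^2 = ((v 0 : ℕ) : Polynomial ℝ) := by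
      rw [← Polynomial.C_pow, ht]; simp
    have e : ∏ s : Fin (k+1) → Bool, (Polynomial.X - Polynomial.C (eta s v)) =
        ∏ x : Bool × (Fin k → Bool), (Polynomial.X - Polynomial.C (sg x.1 * Real.sqrt (v 0) + eta x.2 (fun i => v i.succ))) := by
      refine (Fintype.prod_equiv (Fin.consEquiv (fun _ => Bool)) _ _ fun x => ?_).symm
      unfold eta
      rw [Fin.sum_univ_succ]
      simp [Fin.consEquiv]
    rw [e, Fintype.prod_prod_type, Fintype.prod_bool]
    have e2 : ∀ t : ℝ, ∏ s : Fin k → Bool, (Polynomial.X - Polynomial.C (t + eta s (fun i => v i.succ))) = (p.map (Int.castRingHom ℝ)).comp (Polynomial.X + Polynomial.C (-t)) := by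
      intro t
      rw [hp, Polynomial.prod_comp]
      refine Finset.prod_congr rfl fun s _ => ?_
      simp only [Polynomial.sub_comp, Polynomial.X_comp, Polynomial.C_comp, Polynomial.C_add, Polynomial.C_neg]
      ring
    simp only [sg, if_true, Bool.false_eq_true, if_false]
    rw [e2, e2]
    rw [one_mul, neg_one_mul, neg_neg, h1, h2]
    simp only [Polynomial.map_sub, Polynomial.map_mul, Polynomial.map_pow, Polynomial.map_natCast, Polynomial.C_neg]
    rw [← hC]; ring

lemma prod_nonzero_ge (k : ℕ) (v : Fin k → ℕ) : 1 ≤ ∏ s : Fin k → Bool with eta s v ≠ 0, |eta s v| := by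
  classical
  obtain ⟨p, hp⟩ := prod_int k v
  set m := (Finset.univ.filter (fun s : Fin k → Bool => ¬ eta s v ≠ 0)).card with hm
  have h1 : ∏ s : Fin k → Bool, (Polynomial.X - Polynomial.C (eta s v)) = (∏ s : Fin k → Bool with eta s v ≠ 0, (Polynomial.X - Polynomial.C (eta s v))) * Polynomial.X^m := by
    rw [← Finset.prod_filter_mul_prod_filter_not Finset.univ (fun s : Fin k → Bool => eta s v ≠ 0)]
    congr 1
    rw [hm, ← Finset.prod_const]
    refine Finset.prod_congr rfl fun s hs => ?_
    have : eta s v = 0 := by simpa using hs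
    rw [this]; simp
  have h2 : (p.coeff m : ℝ) = ∏ s : Fin k → Bool with eta s v ≠ 0, (-eta s v) := by
    have : (p.coeff m : ℝ) = (p.map (Int.castRingHom ℝ)).coeff m := by rw [Polynomial.coeff_map]; simp
    rw [this, hp, h1]
    have := Polynomial.coeff_mul_X_pow (∏ s : Fin k → Bool with eta s v ≠ 0, (Polynomial.X - Polynomial.C (eta s v))) m 0
    rw [zero_add] at this
    rw [this, Polynomial.coeff_zero_eq_eval_zero, Polynomial.eval_prod]
    simp
  have h3 : ∏ s : Fin k → Bool with eta s v ≠ 0, (-eta s v) ≠ 0 := by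
    refine Finset.prod_ne_zero_iff.mpr fun s hs => ?_
    simpa using hs
  have h4 : ∏ s : Fin k → Bool with eta s v ≠ 0, |eta s v| = |(p.coeff m : ℝ)| := by
    rw [h2, Finset.abs_prod]
    refine Finset.prod_congr rfl fun s _ => by rw [abs_neg]
  rw [h4]
  rw [← h2] at h3
  have : p.coeff m ≠ 0 := by exact_mod_cast h3
  have := Int.one_le_abs this
  exact_mod_cast this

lemma eta_abs_le {k : ℕ} (s : Fin k → Bool) (v : Fin k → ℕ) (Y : ℝ) (hv : ∀ i, (v i : ℝ) ≤ Y) : |eta s v| ≤ k * Real.sqrt Y := by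
  unfold eta
  refine (Finset.abs_sum_le_sum_abs _ _).trans ?_
  calc _ ≤ ∑ _i : Fin k, Real.sqrt Y := by
        refine Finset.sum_le_sum fun i _ => ?_
        rw [abs_mul]
        have : |sg (s i)| = 1 := by unfold sg; split_ifs <;> simp
        rw [this, one_mul, abs_of_nonneg (Real.sqrt_nonneg _)]
        exact Real.sqrt_le_sqrt (hv i)
    _ = _ := by simp

lemma eta_lower {k : ℕ} (hk : 1 ≤ k) (s : Fin k → Bool) (v : Fin k → ℕ) (Y : ℝ) (hY : 1 ≤ Y) (hv : ∀ i, (v i : ℝ) ≤ Y) (h : eta s v ≠ 0) :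
    1 / |eta s v| ≤ (k * Real.sqrt Y)^(2^(k-1)-1) := by
  classical
  set M := (k:ℝ) * Real.sqrt Y with hM
  have hM1 : 1 ≤ M := by
    have h1 : (1:ℝ) ≤ k := by exact_mod_cast hk
    have h2 : 1 ≤ Real.sqrt Y := Real.one_le_sqrt.mpr hY
    nlinarith
  set s' : Fin k → Bool := fun i => !(s i) with hs'
  have hneg : eta s' v = - eta s v := by
    unfold eta
    rw [← Finset.sum_neg_distrib]
    refine Finset.sum_congr rfl fun i _ => ?_
    simp only [hs', sg]
    cases s i <;> simp
  have hne : s' ≠ s := by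
    intro he
    have := congrFun he ⟨0, hk⟩
    simp [hs'] at this
  have h1 := prod_nonzero_ge k v
  set Q := Finset.univ.filter (fun s : Fin k → Bool => eta s v ≠ 0) with hQ
  have hsQ : s ∈ Q := by simp [hQ, h]
  have hsQ' : s' ∈ Q.erase s := by simp [hQ, hne, hneg, h]
  rw [← Finset.mul_prod_erase Q _ hsQ, ← Finset.mul_prod_erase _ _ hsQ', hneg, abs_neg] at h1
  have h2 : ∏ x ∈ (Q.erase s).erase s', |eta x v| ≤ M^(2^k-2) := by
    calc _ ≤ ∏ _x ∈ (Q.erase s).erase s', M := Finset.prod_le_prod (fun _ _ => abs_nonneg _) (fun x _ => eta_abs_le x v Y hv)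
      _ = M^((Q.erase s).erase s').card := by rw [Finset.prod_const]
      _ ≤ _ := by
        refine pow_le_pow_right₀ hM1 ?_
        rw [Finset.card_erase_of_mem hsQ', Finset.card_erase_of_mem hsQ]
        have : Q.card ≤ 2^k := by
          refine (Finset.card_le_univ _).trans ?_
          simp
        omega
  have hpos : 0 < |eta s v| := abs_pos.mpr h
  have e : 2^k - 2 = (2^(k-1)-1)*2 := by
    obtain ⟨j, rfl⟩ : ∃ j, k = j+1 := ⟨k-1, by omega⟩
    simp only [Nat.add_sub_cancel, pow_succ]; omega
  rw [e, pow_mul] at h2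
  set Z := M^(2^(k-1)-1) with hZ
  have hZ0 : 0 ≤ Z := by positivity
  rw [div_le_iff₀ hpos]
  have h3 : 1 ≤ (Z * |eta s v|)^2 := by
    calc 1 ≤ _ := h1
      _ ≤ |eta s v| * (|eta s v| * Z^2) := by gcongr
      _ = _ := by ring
  have h4 : 0 ≤ Z * |eta s v| := by positivity
  nlinarith

end

section
open Filter MeasureTheory Topology

lemma trace_sqrt_zero (K : Type*) [Field K] [Algebra ℚ K] [FiniteDimensional ℚ K] (x : K) (m : ℕ) (hx : x^2 = (m:K)) (hm : ¬ IsSquare m) :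
    Algebra.trace ℚ K x = 0 := by
  have hmon : (Polynomial.X^2 - Polynomial.C (m:ℚ) : Polynomial ℚ).Monic := Polynomial.monic_X_pow_sub_C _ (by norm_num)
  have hmin : minpoly ℚ x = Polynomial.X^2 - Polynomial.C (m:ℚ) := by
    refine (minpoly.eq_of_irreducible_of_monic ?_ ?_ hmon).symm
    · have hd : (Polynomial.X^2 - Polynomial.C (m:ℚ) : Polynomial ℚ).natDegree = 2 := Polynomial.natDegree_X_pow_sub_C
      rw [Polynomial.irreducible_iff_roots_eq_zero_of_degree_le_three (by rw [hd]) (by rw [hd]; norm_num)]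
      rw [Multiset.eq_zero_iff_forall_notMem]
      intro r hr
      rw [Polynomial.mem_roots hmon.ne_zero] at hr
      have hr2 : r^2 = m := by
        have := hr
        simp only [Polynomial.IsRoot, Polynomial.eval_sub, Polynomial.eval_pow, Polynomial.eval_X, Polynomial.eval_C] at this
        linarith
      apply hm
      have : IsSquare ((m:ℚ)) := ⟨r, by rw [← hr2]; ring⟩
      rwa [Rat.isSquare_natCast_iff] at this
    · simp [hx]
  rw [trace_eq_finrank_mul_minpoly_nextCoeff, hmin]
  have : (Polynomial.X^2 - Polynomial.C (m:ℚ) : Polynomial ℚ).nextCoeff = 0 := by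
    rw [Polynomial.nextCoeff_of_natDegree_pos (by rw [Polynomial.natDegree_X_pow_sub_C]; norm_num), Polynomial.natDegree_X_pow_sub_C]
    simp [Polynomial.coeff_X]
  rw [this]; simp

lemma nosing {k : ℕ} (s : Fin k → Bool) (v : Fin k → ℕ) (hv : ∀ i, 1 ≤ v i) (h : eta s v = 0) (i : Fin k) :
    ∃ j, j ≠ i ∧ IsSquare (v i * v j) := by
  by_contra hcon
  push Not at hcon
  set S : Set ℝ := Set.range (fun i => Real.sqrt (v i)) with hS
  have hfin : S.Finite := Set.finite_range _
  have hIntg : ∀ x ∈ S, IsIntegral ℚ x := by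
    rintro x ⟨j, rfl⟩
    refine IsIntegral.of_pow (n := 2) (by norm_num) ?_
    rw [Real.sq_sqrt (by positivity)]
    exact isIntegral_algebraMap (R := ℚ) (x := (v j : ℚ)) |> fun h => by simpa using h
  let K := IntermediateField.adjoin ℚ S
  have hfd : FiniteDimensional ℚ K := by
    have : Finite S := hfin
    exact IntermediateField.finiteDimensional_adjoin hIntg
  let r : Fin k → K := fun j => ⟨Real.sqrt (v j), IntermediateField.subset_adjoin ℚ S ⟨j, rfl⟩⟩
  have hr2 : ∀ j, r j ^2 = ((v j : ℕ) : K) := by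
    intro j
    apply Subtype.ext
    push_cast
    exact Real.sq_sqrt (by positivity)
  let sq : Bool → ℚ := fun b => if b then 1 else -1
  have hsum : ∑ j, sq (s j) • (r i * r j) = 0 := by
    apply Subtype.ext
    have e : ((∑ j, sq (s j) • (r i * r j) : K) : ℝ) = Real.sqrt (v i) * eta s v := by
      unfold eta
      rw [Finset.mul_sum]
      push_cast
      refine Finset.sum_congr rfl fun j _ => ?_
      rw [Rat.smul_def]
      simp only [sq, sg]
      split_ifs
      · push_cast; simp only [r]; ring
      · push_cast; simp only [r]; ring
    rw [e, h, mul_zero]; rfl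
  have htr := congrArg (Algebra.trace ℚ K) hsum
  rw [map_zero, map_sum, Finset.sum_eq_single i] at htr
  · have e1 : r i * r i = algebraMap ℚ K (v i : ℚ) := by
      have h1 := hr2 i
      rw [pow_two] at h1
      rw [h1]; simp
    rw [map_smul, e1, Algebra.trace_algebraMap] at htr
    have hd : 0 < Module.finrank ℚ K := Module.finrank_pos
    have h1 : (0:ℚ) < v i := by exact_mod_cast hv i
    have h2 : (0:ℚ) < Module.finrank ℚ K := by exact_mod_cast hd
    have h3 : sq (s i) ≠ 0 := by simp only [sq]; split_ifs <;> norm_num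
    rw [smul_eq_mul, nsmul_eq_mul] at htr
    exact mul_ne_zero h3 (mul_ne_zero h2.ne' h1.ne') htr
  · intro j _ hj
    rw [map_smul, trace_sqrt_zero K (r i * r j) (v i * v j) (by rw [mul_pow, hr2, hr2]; push_cast; ring) (hcon j hj), smul_zero]
  · simp

end

section
open Filter MeasureTheory Topology

def NS {k : ℕ} (v : Fin k → ℕ) : Prop := ∀ i, ∃ j, j ≠ i ∧ IsSquare (v i * v j)

lemma sqfree_eq_of_square (a b : ℕ) (ha : Squarefree a) (hb : Squarefree b) (h : IsSquare (a*b)) : a = b := by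
  have key : ∀ a b : ℕ, Squarefree a → IsSquare (a*b) → a ∣ b := by
    intro a b ha h
    obtain ⟨c, hc⟩ := h
    have h1 : a ∣ c^2 := ⟨b, by rw [pow_two, ← hc]⟩
    have h2 : a ∣ c := (Squarefree.dvd_pow_iff_dvd ha (by norm_num)).mp h1
    obtain ⟨d, rfl⟩ := h2
    have ha0 : a ≠ 0 := ha.ne_zero
    have : a * b = a * (a * d * d) := by rw [hc]; ring
    have := Nat.eq_of_mul_eq_mul_left (Nat.pos_of_ne_zero ha0) this
    exact ⟨d*d, by rw [this]; ring⟩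
  exact Nat.dvd_antisymm (key a b ha h) (key b a hb (by rwa [mul_comm]))

lemma pair_sum_bound (k : ℕ) (al Z : ℝ) (hal : 0 < al) (M : ℕ) (hZ : ∑ x ∈ Finset.Icc 1 M, (x:ℝ)^(-(2*al)) ≤ Z) :
    ∑ q ∈ (Fintype.piFinset (fun _ : Fin k => Finset.Icc 1 M)) with (∀ i, ∃ j, j ≠ i ∧ q i = q j), ∏ i, ((q i : ℕ):ℝ)^(-al) ≤ (k:ℝ)^k * Real.exp Z := by
  classical
  set QQ := (Fintype.piFinset (fun _ : Fin k => Finset.Icc 1 M)).filter (fun q => ∀ i, ∃ j, j ≠ i ∧ q i = q j) with hQQ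
  have hmem : ∀ q ∈ QQ, (∀ i, 1 ≤ q i ∧ q i ≤ M) ∧ ∀ i, ∃ j, j ≠ i ∧ q i = q j := by
    intro q hq
    rw [hQQ, Finset.mem_filter, Fintype.mem_piFinset] at hq
    exact ⟨fun i => Finset.mem_Icc.mp (hq.1 i), hq.2⟩
  have hmap : ∀ q ∈ QQ, Finset.univ.image q ∈ (Finset.Icc 1 M).powerset := by
    intro q hq
    rw [Finset.mem_powerset]
    intro x hx
    obtain ⟨i, _, rfl⟩ := Finset.mem_image.mp hx
    exact Finset.mem_Icc.mpr ((hmem q hq).1 i)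
  rw [← Finset.sum_fiberwise_of_maps_to hmap]
  have hfib : ∀ D ∈ (Finset.Icc 1 M).powerset, ∑ q ∈ QQ with Finset.univ.image q = D, ∏ i, ((q i : ℕ):ℝ)^(-al) ≤ (k:ℝ)^k * ∏ x ∈ D, (x:ℝ)^(-(2*al)) := by
    intro D hD
    have hD1 : ∀ x ∈ D, 1 ≤ x := fun x hx => (Finset.mem_Icc.mp (Finset.mem_powerset.mp hD hx)).1
    have hP0 : 0 ≤ ∏ x ∈ D, (x:ℝ)^(-(2*al)) := Finset.prod_nonneg fun x _ => by positivity
    have h1 : ∀ q ∈ QQ.filter (fun q => Finset.univ.image q = D), ∏ i, ((q i : ℕ):ℝ)^(-al) ≤ ∏ x ∈ D, (x:ℝ)^(-(2*al)) := by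
      intro q hq
      obtain ⟨hq1, hq2⟩ := Finset.mem_filter.mp hq
      rw [Finset.prod_comp (fun x : ℕ => (x:ℝ)^(-al)) q, hq2]
      refine Finset.prod_le_prod (fun x _ => by positivity) fun x hx => ?_
      have hx1 : (1:ℝ) ≤ x := by exact_mod_cast hD1 x hx
      have hcard : 2 ≤ (Finset.univ.filter (fun a => q a = x)).card := by
        rw [← hq2] at hx
        obtain ⟨i, _, hi⟩ := Finset.mem_image.mp hx
        obtain ⟨j, hj, hij⟩ := (hmem q hq1).2 i
        exact Finset.one_lt_card.mpr ⟨i, by simp [hi], j, by simp [← hij, hi], hj.symm⟩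
      calc ((x:ℝ)^(-al))^_ ≤ ((x:ℝ)^(-al))^2 := by
            refine pow_le_pow_of_le_one (by positivity) ?_ hcard
            exact Real.rpow_le_one_of_one_le_of_nonpos hx1 (by linarith)
        _ = _ := by
            rw [← Real.rpow_natCast, ← Real.rpow_mul (by linarith)]; congr 1; push_cast; ring
    refine (Finset.sum_le_card_nsmul _ _ _ h1).trans ?_
    rw [nsmul_eq_mul]
    refine mul_le_mul_of_nonneg_right ?_ hP0
    rcases (QQ.filter (fun q => Finset.univ.image q = D)).eq_empty_or_nonempty with he | ⟨q0, hq0⟩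
    · rw [he]; simp
    · have hDk : D.card ≤ k := by
        rw [← (Finset.mem_filter.mp hq0).2]
        refine Finset.card_image_le.trans ?_
        simp
      have hsub : QQ.filter (fun q => Finset.univ.image q = D) ⊆ Fintype.piFinset (fun _ : Fin k => D) := by
        intro q hq
        rw [Fintype.mem_piFinset]
        intro i
        rw [← (Finset.mem_filter.mp hq).2]
        exact Finset.mem_image_of_mem _ (Finset.mem_univ _)
      have := Finset.card_le_card hsub
      rw [Fintype.card_piFinset_const] at this
      have h3 := this.trans (Nat.pow_le_pow_left hDk k)
      exact_mod_cast h3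
  refine (Finset.sum_le_sum hfib).trans ?_
  rw [← Finset.mul_sum, ← Finset.prod_add_one]
  refine mul_le_mul_of_nonneg_left ?_ (by positivity)
  calc ∏ x ∈ Finset.Icc 1 M, ((x:ℝ)^(-(2*al)) + 1) ≤ ∏ x ∈ Finset.Icc 1 M, Real.exp ((x:ℝ)^(-(2*al))) :=
        Finset.prod_le_prod (fun _ _ => by positivity) fun _ _ => Real.add_one_le_exp _
    _ = Real.exp (∑ x ∈ Finset.Icc 1 M, (x:ℝ)^(-(2*al))) := (Real.exp_sum _ _).symm
    _ ≤ _ := Real.exp_le_exp.mpr hZ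

open Classical in
lemma P_fin (k : ℕ) (al : ℝ) (hal : 1/2 < al) : ∃ C : ℝ, 0 < C ∧ ∀ S : Finset ℕ, (∀ n ∈ S, 1 ≤ n) →
    ∑ v ∈ (Fintype.piFinset (fun _ : Fin k => S)) with NS v, ∏ i, ((v i : ℕ):ℝ)^(-al) ≤ C := by
  have hsum : Summable (fun n : ℕ => (n:ℝ)^(-(2*al))) := Real.summable_nat_rpow.mpr (by linarith)
  set Z := ∑' n : ℕ, (n:ℝ)^(-(2*al)) with hZ
  have hZ0 : 0 ≤ Z := tsum_nonneg fun n => by positivity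
  have hZM : ∀ M : ℕ, ∑ x ∈ Finset.Icc 1 M, (x:ℝ)^(-(2*al)) ≤ Z := fun M => hsum.sum_le_tsum _ fun n _ => by positivity
  refine ⟨(k:ℝ)^k * Real.exp Z * Z^k + 1, by positivity, fun S hS => ?_⟩
  have hdec : ∀ n : ℕ, ∃ p : ℕ × ℕ, 1 ≤ n → (p.2^2 * p.1 = n ∧ Squarefree p.1) := by
    intro n
    by_cases hn : 1 ≤ n
    · obtain ⟨a, b, h1, h2⟩ := Nat.sq_mul_squarefree n
      exact ⟨(a, b), fun _ => ⟨h1, h2⟩⟩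
    · exact ⟨(0,0), fun h => absurd h hn⟩
  choose p hp using hdec
  obtain ⟨M, hM⟩ : ∃ M, ∀ n ∈ S, n ≤ M := ⟨S.sup id, fun n hn => Finset.le_sup (f := id) hn⟩
  have hp1 : ∀ n ∈ S, (1 ≤ (p n).1 ∧ (p n).1 ≤ M) ∧ (1 ≤ (p n).2 ∧ (p n).2 ≤ M) := by
    intro n hn
    obtain ⟨h1, h2⟩ := hp n (hS n hn)
    have hn1 := hS n hn
    have a1 : (p n).1 ≠ 0 := h2.ne_zero
    have a2 : (p n).2 ≠ 0 := by rintro h; rw [h] at h1; simp at h1; omega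
    have d1 : (p n).1 ∣ n := ⟨_, by rw [mul_comm]; exact h1.symm⟩
    have d2 : (p n).2 ∣ n := ⟨(p n).2 * (p n).1, by rw [← mul_assoc, ← pow_two]; exact h1.symm⟩
    have := Nat.le_of_dvd hn1 d1
    have := Nat.le_of_dvd hn1 d2
    have := hM n hn
    omega
  set QQ := (Fintype.piFinset (fun _ : Fin k => Finset.Icc 1 M)).filter (fun q => ∀ i, ∃ j, j ≠ i ∧ q i = q j) with hQQ
  set MM := Fintype.piFinset (fun _ : Fin k => Finset.Icc 1 M) with hMM
  have h1 : ∑ v ∈ (Fintype.piFinset (fun _ : Fin k => S)) with NS v, ∏ i, ((v i : ℕ):ℝ)^(-al) ≤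
      ∑ z ∈ QQ ×ˢ MM, (∏ i, ((z.1 i : ℕ):ℝ)^(-al)) * ∏ i, ((z.2 i : ℕ):ℝ)^(-(2*al)) := by
    set T := (Fintype.piFinset (fun _ : Fin k => S)).filter NS with hT
    have hTm : ∀ v ∈ T, (∀ i, v i ∈ S) ∧ NS v := fun v hv => by
      rw [hT, Finset.mem_filter, Fintype.mem_piFinset] at hv; exact hv
    let Φ : (Fin k → ℕ) → (Fin k → ℕ) × (Fin k → ℕ) := fun v => (fun i => (p (v i)).1, fun i => (p (v i)).2)
    have e : ∑ v ∈ T, ∏ i, ((v i : ℕ):ℝ)^(-al) = ∑ v ∈ T, (fun z : (Fin k → ℕ) × (Fin k → ℕ) => (∏ i, ((z.1 i : ℕ):ℝ)^(-al)) * ∏ i, ((z.2 i : ℕ):ℝ)^(-(2*al))) (Φ v) := by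
      refine Finset.sum_congr rfl fun v hv => ?_
      simp only [Φ]
      rw [← Finset.prod_mul_distrib]
      refine Finset.prod_congr rfl fun i _ => ?_
      have hvi := (hTm v hv).1 i
      have := (hp (v i) (hS _ hvi)).1
      conv_lhs => rw [← this]
      push_cast
      rw [Real.mul_rpow (by positivity) (by positivity), ← Real.rpow_natCast, ← Real.rpow_mul (by positivity)]
      rw [mul_comm]; congr 2; push_cast; ring
    have hinj : Set.InjOn Φ T := by
      intro v hv w hw hvw
      funext i
      have a1 := congrFun (congrArg Prod.fst hvw) i
      have a2 := congrFun (congrArg Prod.snd hvw) i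
      simp only [Φ] at a1 a2
      rw [← (hp (v i) (hS _ ((hTm v hv).1 i))).1, ← (hp (w i) (hS _ ((hTm w hw).1 i))).1, a1, a2]
    rw [e, ← Finset.sum_image (f := fun z : (Fin k → ℕ) × (Fin k → ℕ) => (∏ i, ((z.1 i : ℕ):ℝ)^(-al)) * ∏ i, ((z.2 i : ℕ):ℝ)^(-(2*al))) hinj]
    refine Finset.sum_le_sum_of_subset_of_nonneg ?_ fun z _ _ => mul_nonneg (Finset.prod_nonneg fun i _ => by positivity) (Finset.prod_nonneg fun i _ => by positivity)
    intro z hz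
    obtain ⟨v, hv, rfl⟩ := Finset.mem_image.mp hz
    obtain ⟨b1, b2⟩ := hTm v hv
    rw [Finset.mem_product, hQQ, hMM, Finset.mem_filter, Fintype.mem_piFinset, Fintype.mem_piFinset]
    refine ⟨⟨fun i => Finset.mem_Icc.mpr (hp1 _ (b1 i)).1, fun i => ?_⟩, fun i => Finset.mem_Icc.mpr (hp1 _ (b1 i)).2⟩
    obtain ⟨j, hj, hsq⟩ := b2 i
    refine ⟨j, hj, ?_⟩
    obtain ⟨c1, c2⟩ := hp (v i) (hS _ (b1 i))
    obtain ⟨c3, c4⟩ := hp (v j) (hS _ (b1 j))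
    refine sqfree_eq_of_square _ _ c2 c4 ?_
    obtain ⟨t, ht⟩ := hsq
    rw [← c1, ← c3] at ht
    have e1 : ((p (v i)).2 * (p (v j)).2)^2 * ((p (v i)).1 * (p (v j)).1) = t^2 := by rw [pow_two t, ← ht]; ring
    have hpos : (p (v i)).2 * (p (v j)).2 ≠ 0 := by
      have := (hp1 _ (b1 i)).2.1
      have := (hp1 _ (b1 j)).2.1
      positivity
    have hd : (p (v i)).2 * (p (v j)).2 ∣ t := (Nat.pow_dvd_pow_iff (by norm_num)).mp ⟨_, e1.symm⟩
    obtain ⟨w, rfl⟩ := hd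
    refine ⟨w, ?_⟩
    have : ((p (v i)).2 * (p (v j)).2)^2 * ((p (v i)).1 * (p (v j)).1) = ((p (v i)).2 * (p (v j)).2)^2 * (w*w) := by rw [e1]; ring
    exact Nat.eq_of_mul_eq_mul_left (by positivity) this
  refine h1.trans ?_
  rw [Finset.sum_product]
  simp only [← Finset.mul_sum]
  rw [← Finset.sum_mul]
  have h2 := pair_sum_bound k al Z (by linarith) M (hZM M)
  have h3 : ∑ m ∈ MM, ∏ i, ((m i : ℕ):ℝ)^(-(2*al)) ≤ Z^k := by
    rw [hMM, ← Finset.prod_univ_sum (fun _ : Fin k => Finset.Icc 1 M) (fun _ x => (x:ℝ)^(-(2*al)))]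
    rw [Finset.prod_const, Finset.card_univ, Fintype.card_fin]
    exact pow_le_pow_left₀ (Finset.sum_nonneg fun _ _ => by positivity) (hZM M) k
  have h4 : 0 ≤ ∑ m ∈ MM, ∏ i, ((m i : ℕ):ℝ)^(-(2*al)) := Finset.sum_nonneg fun m _ => Finset.prod_nonneg fun i _ => by positivity
  have h5 : (∑ q ∈ QQ, ∏ i, ((q i : ℕ):ℝ)^(-al)) * (∑ m ∈ MM, ∏ i, ((m i : ℕ):ℝ)^(-(2*al))) ≤ (k:ℝ)^k * Real.exp Z * Z^k := by
    refine mul_le_mul ?_ h3 h4 (by positivity)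
    convert h2 using 2
  linarith

end

section
open Filter MeasureTheory Topology

lemma wt_nonneg (n : ℕ) : 0 ≤ wt n := by unfold wt; positivity

lemma wt_le (ε : ℝ) (hε : 0 < ε) : ∃ C : ℝ, 1 ≤ C ∧ ∀ n : ℕ, 1 ≤ n → wt n ≤ C * (n:ℝ)^(-(1/4:ℝ)+2*ε) * (n:ℝ)^(-(1/2+ε)) := by
  obtain ⟨C, hC1, hC⟩ := divfun_le ε hε
  refine ⟨C, hC1, fun n hn => ?_⟩
  have hn0 : (0:ℝ) < n := by exact_mod_cast hn
  unfold wt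
  calc (divfun n:ℝ) * (n:ℝ)^(-(3/4:ℝ)) ≤ C * (n:ℝ)^ε * (n:ℝ)^(-(3/4:ℝ)) := by gcongr; exact hC n hn
    _ = _ := by rw [mul_assoc, mul_assoc, ← Real.rpow_add hn0, ← Real.rpow_add hn0]; congr 2; ring

lemma F_sub_NS {k : ℕ} (al C : ℝ) (hC : ∀ S : Finset ℕ, (∀ n ∈ S, 1 ≤ n) →
    (open Classical in ∑ v ∈ (Fintype.piFinset (fun _ : Fin k => S)) with NS v, ∏ i, ((v i : ℕ):ℝ)^(-al)) ≤ C)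
    (F : Finset (Fin k → ℕ)) (hF : ∀ v ∈ F, (∀ i, 1 ≤ v i) ∧ NS v) : ∑ v ∈ F, ∏ i, ((v i : ℕ):ℝ)^(-al) ≤ C := by
  classical
  set S := F.biUnion (fun v => Finset.univ.image v) with hS
  refine le_trans ?_ (hC S (fun n hn => ?_))
  · refine Finset.sum_le_sum_of_subset_of_nonneg (fun v hv => ?_) fun v _ _ => Finset.prod_nonneg fun i _ => by positivity
    rw [Finset.mem_filter, Fintype.mem_piFinset]
    refine ⟨fun i => Finset.mem_biUnion.mpr ⟨v, hv, Finset.mem_image_of_mem _ (Finset.mem_univ _)⟩, (hF v hv).2⟩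
  · obtain ⟨v, hv, h⟩ := Finset.mem_biUnion.mp hn
    obtain ⟨i, _, rfl⟩ := Finset.mem_image.mp h
    exact (hF v hv).1 i

lemma diag_tail (k : ℕ) (ε : ℝ) (hε : 0 < ε) : ∃ C : ℝ, 0 < C ∧ ∀ Y : ℝ, 1 ≤ Y → ∀ F : Finset (Fin k → ℕ),
    (∀ v ∈ F, (∀ i, 1 ≤ v i) ∧ NS v ∧ ∃ i, Y ≤ v i) → ∑ v ∈ F, ∏ i, wt (v i) ≤ C * Y^(-(1/4:ℝ)+ε) := by
  set e := min (ε/2) (1/8) with he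
  have he0 : 0 < e := lt_min (by linarith) (by norm_num)
  have he1 : e ≤ ε/2 := min_le_left _ _
  have he2 : e ≤ 1/8 := min_le_right _ _
  obtain ⟨C, hC1, hC⟩ := wt_le e he0
  obtain ⟨P, hP0, hP⟩ := P_fin k (1/2+e) (by linarith)
  refine ⟨C^k * P, by positivity, fun Y hY F hF => ?_⟩
  have h1 : ∀ v ∈ F, ∏ i, wt (v i) ≤ C^k * Y^(-(1/4:ℝ)+ε) * ∏ i, ((v i:ℕ):ℝ)^(-(1/2+e)) := by
    intro v hv
    obtain ⟨a1, a2, i0, a3⟩ := hF v hv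
    have hle1 : ∀ i, ((v i:ℕ):ℝ)^(-(1/4:ℝ)+2*e) ≤ 1 := fun i =>
      Real.rpow_le_one_of_one_le_of_nonpos (by exact_mod_cast a1 i) (by linarith)
    calc ∏ i, wt (v i) ≤ ∏ i, (C * ((v i:ℕ):ℝ)^(-(1/4:ℝ)+2*e) * ((v i:ℕ):ℝ)^(-(1/2+e))) :=
          Finset.prod_le_prod (fun i _ => wt_nonneg _) fun i _ => hC _ (a1 i)
      _ = C^k * (∏ i, ((v i:ℕ):ℝ)^(-(1/4:ℝ)+2*e)) * ∏ i, ((v i:ℕ):ℝ)^(-(1/2+e)) := by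
          rw [Finset.prod_mul_distrib, Finset.prod_mul_distrib, Finset.prod_const, Finset.card_univ, Fintype.card_fin]
      _ ≤ _ := by
          refine mul_le_mul_of_nonneg_right (mul_le_mul_of_nonneg_left ?_ (by positivity)) (Finset.prod_nonneg fun i _ => by positivity)
          rw [← Finset.mul_prod_erase Finset.univ _ (Finset.mem_univ i0)]
          calc _ ≤ ((v i0:ℕ):ℝ)^(-(1/4:ℝ)+2*e) * 1 := by
                refine mul_le_mul_of_nonneg_left (Finset.prod_le_one (fun i _ => by positivity) fun i _ => hle1 i) (by positivity)
            _ ≤ Y^(-(1/4:ℝ)+2*e) := by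
                rw [mul_one]
                exact Real.rpow_le_rpow_of_nonpos (by linarith) a3 (by linarith)
            _ ≤ _ := Real.rpow_le_rpow_of_exponent_le hY (by linarith)
  refine (Finset.sum_le_sum h1).trans ?_
  rw [← Finset.mul_sum]
  have := F_sub_NS (1/2+e) P hP F (fun v hv => ⟨(hF v hv).1, (hF v hv).2.1⟩)
  calc _ ≤ C^k * Y^(-(1/4:ℝ)+ε) * P := by gcongr
    _ = _ := by ring

lemma diag_block (k : ℕ) (ε : ℝ) (hε : 0 < ε) : ∃ C : ℝ, 0 < C ∧ ∀ Y : ℝ, 1 ≤ Y → ∀ F : Finset (Fin k → ℕ),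
    (∀ v ∈ F, NS v ∧ ∀ i, Y ≤ v i) → ∑ v ∈ F, ∏ i, wt (v i) ≤ C * Y^(-(k/4:ℝ)+ε) := by
  set e := min (ε/(2*(k+1))) (1/8) with he
  have he0 : 0 < e := lt_min (by positivity) (by norm_num)
  have he1 : e ≤ ε/(2*(k+1)) := min_le_left _ _
  have he2 : e ≤ 1/8 := min_le_right _ _
  obtain ⟨C, hC1, hC⟩ := wt_le e he0
  obtain ⟨P, hP0, hP⟩ := P_fin k (1/2+e) (by linarith)
  refine ⟨C^k * P, by positivity, fun Y hY F hF => ?_⟩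
  have hv1 : ∀ v ∈ F, ∀ i, 1 ≤ v i := fun v hv i => by
    have := hY.trans ((hF v hv).2 i)
    exact_mod_cast this
  have h1 : ∀ v ∈ F, ∏ i, wt (v i) ≤ C^k * Y^(-(k/4:ℝ)+ε) * ∏ i, ((v i:ℕ):ℝ)^(-(1/2+e)) := by
    intro v hv
    obtain ⟨a2, a3⟩ := hF v hv
    have a1 := hv1 v hv
    calc ∏ i, wt (v i) ≤ ∏ i, (C * Y^(-(1/4:ℝ)+2*e) * ((v i:ℕ):ℝ)^(-(1/2+e))) := by
          refine Finset.prod_le_prod (fun i _ => wt_nonneg _) fun i _ => (hC _ (a1 i)).trans ?_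
          refine mul_le_mul_of_nonneg_right (mul_le_mul_of_nonneg_left ?_ (by positivity)) (by positivity)
          exact Real.rpow_le_rpow_of_nonpos (by linarith) (a3 i) (by linarith)
      _ = C^k * (Y^(-(1/4:ℝ)+2*e))^k * ∏ i, ((v i:ℕ):ℝ)^(-(1/2+e)) := by
          rw [Finset.prod_mul_distrib, Finset.prod_const, Finset.card_univ, Fintype.card_fin, mul_pow]
      _ ≤ _ := by
          refine mul_le_mul_of_nonneg_right (mul_le_mul_of_nonneg_left ?_ (by positivity)) (Finset.prod_nonneg fun i _ => by positivity)
          rw [← Real.rpow_natCast, ← Real.rpow_mul (by linarith)]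
          refine Real.rpow_le_rpow_of_exponent_le hY ?_
          rw [le_div_iff₀ (by positivity)] at he1
          nlinarith
  refine (Finset.sum_le_sum h1).trans ?_
  rw [← Finset.mul_sum]
  have := F_sub_NS (1/2+e) P hP F (fun v hv => ⟨hv1 v hv, (hF v hv).1⟩)
  calc _ ≤ C^k * Y^(-(k/4:ℝ)+ε) * P := by gcongr
    _ = _ := by ring

end

section
open Filter MeasureTheory Topology

noncomputable def sDt (s : Fin 7 → Bool) (v : Fin 7 → ℕ+) : ℝ :=
  open Classical in if eta s (fun i => (v i : ℕ)) = 0 then ∏ i, wt (v i) else 0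

noncomputable def sD (s : Fin 7 → Bool) : ℝ := ∑' v : Fin 7 → ℕ+, sDt s v

noncomputable def Dfin {k : ℕ} (s : Fin k → Bool) (S : Finset ℕ) : ℝ :=
  open Classical in ∑ v ∈ (Fintype.piFinset (fun _ : Fin k => S)) with eta s v = 0, ∏ i, wt (v i)

lemma sDt_nonneg (s : Fin 7 → Bool) (v : Fin 7 → ℕ+) : 0 ≤ sDt s v := by
  unfold sDt
  split_ifs
  · exact Finset.prod_nonneg fun i _ => wt_nonneg _
  · exact le_rfl

lemma s7_eq_sD (l : ℕ) : s7 l = sD (fun j => decide ((j:ℕ) < l)) := by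
  classical
  unfold s7 sD
  have hset : ∀ v : Fin 7 → ℕ+, (∑ j : Fin 7, (if (j : ℕ) < l then (1 : ℝ) else -1) * Real.sqrt ((v j : ℕ)) = 0) ↔ eta (fun j : Fin 7 => decide ((j:ℕ) < l)) (fun i => (v i : ℕ)) = 0 := by
    intro v
    unfold eta sg
    simp only [decide_eq_true_eq]
  have := tsum_subtype {v : Fin 7 → ℕ+ | ∑ j : Fin 7, (if (j : ℕ) < l then (1 : ℝ) else -1) * Real.sqrt ((v j : ℕ)) = 0} (fun v => (∏ j : Fin 7, (divfun (v j) : ℝ)) / (∏ j : Fin 7, ((v j : ℕ) : ℝ)) ^ ((3 : ℝ) / 4))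
  refine Eq.trans this ?_
  refine tsum_congr fun v => ?_
  unfold sDt
  rw [Set.indicator_apply]
  have e : (∏ j : Fin 7, (divfun (v j) : ℝ)) / (∏ j : Fin 7, ((v j : ℕ) : ℝ)) ^ ((3 : ℝ) / 4) = ∏ i, wt (v i) := by
    unfold wt
    rw [Finset.prod_mul_distrib, Real.finsetProd_rpow _ _ (fun i _ => by positivity), Real.rpow_neg (Finset.prod_nonneg fun i _ => by positivity), div_eq_mul_inv]
  rw [e]
  by_cases h : eta (fun j : Fin 7 => decide ((j:ℕ) < l)) (fun i => (v i : ℕ)) = 0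
  · rw [if_pos h]; exact if_pos ((hset v).mpr h)
  · rw [if_neg h]; exact if_neg (fun h' => h ((hset v).mp h'))

lemma sD_perm (s : Fin 7 → Bool) (σ : Equiv.Perm (Fin 7)) : sD (fun i => s (σ i)) = sD s := by
  classical
  unfold sD
  rw [← (Equiv.arrowCongr σ (Equiv.refl ℕ+)).symm.tsum_eq]
  refine tsum_congr fun v => ?_
  unfold sDt
  have e1 : ∀ i, ((Equiv.arrowCongr σ (Equiv.refl ℕ+)).symm v) i = v (σ i) := fun i => by simp [Equiv.arrowCongr]
  simp only [e1]
  have e2 : eta (fun i => s (σ i)) (fun i => ((v (σ i) : ℕ+) : ℕ)) = eta s (fun i => (v i : ℕ)) := by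
    unfold eta
    exact Equiv.sum_comp σ (fun i => sg (s i) * Real.sqrt ((v i : ℕ)))
  have e3 : ∏ i, wt (v (σ i)) = ∏ i, wt (v i) := Equiv.prod_comp σ (fun i => wt (v i))
  rw [e2, e3]

lemma sD_neg (s : Fin 7 → Bool) : sD (fun i => !(s i)) = sD s := by
  classical
  unfold sD
  refine tsum_congr fun v => ?_
  unfold sDt
  have e : eta (fun i => !(s i)) (fun i => (v i : ℕ)) = - eta s (fun i => (v i : ℕ)) := by
    unfold eta
    rw [← Finset.sum_neg_distrib]
    refine Finset.sum_congr rfl fun i _ => ?_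
    unfold sg
    rcases hb : s i <;> simp [hb]
  simp only [e, neg_eq_zero]

def cnt (s : Fin 7 → Bool) : ℕ := (Finset.univ.filter (fun i => s i = true)).card

lemma sD_cnt (s : Fin 7 → Bool) : sD s = s7 (cnt s) := by
  classical
  rw [s7_eq_sD]
  have hle : cnt s ≤ 7 := by
    unfold cnt
    refine (Finset.card_le_univ _).trans ?_
    simp
  have hcard : Fintype.card {i : Fin 7 // s i = true} = Fintype.card {i : Fin 7 // (i:ℕ) < cnt s} := by
    rw [Fintype.card_subtype, Fintype.card_subtype]
    show cnt s = _
    rw [Fin.card_filter_val_lt]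
    omega
  obtain ⟨e⟩ := Fintype.card_eq.mp hcard
  rw [← sD_perm (fun j => decide ((j:ℕ) < cnt s)) (e.extendSubtype)]
  congr 1
  funext i
  by_cases h : s i = true
  · rw [h]; have := e.extendSubtype_mem i h; simpa using this
  · have h2 := e.extendSubtype_not_mem i h
    have : s i = false := by simpa using h
    rw [this]; simpa using h2

lemma s7_symm (l : ℕ) (hl : l ≤ 7) : s7 (7-l) = s7 l := by
  have h1 := s7_eq_sD l
  rw [← sD_neg, sD_cnt] at h1
  rw [h1]; congr 1
  unfold cnt
  interval_cases l <;> decide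

lemma sDt_sum_le (ε : ℝ) (hε : 0 < ε) : ∃ C : ℝ, 0 < C ∧ ∀ Y : ℝ, 1 ≤ Y → ∀ s, ∀ F : Finset (Fin 7 → ℕ+),
    (∀ v ∈ F, ∃ i, Y ≤ (v i : ℕ)) → ∑ v ∈ F, sDt s v ≤ C * Y^(-(1/4:ℝ)+ε) := by
  classical
  obtain ⟨C, hC0, hC⟩ := diag_tail 7 ε hε
  refine ⟨C, hC0, fun Y hY s F hF => ?_⟩
  let Φ : (Fin 7 → ℕ+) → (Fin 7 → ℕ) := fun v i => (v i : ℕ)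
  have hinj : Function.Injective Φ := by
    intro v w h
    funext i
    exact PNat.coe_injective (congrFun h i)
  have e : ∑ v ∈ F, sDt s v = ∑ v ∈ (F.filter (fun v => eta s (Φ v) = 0)).image Φ, ∏ i, wt (v i) := by
    rw [Finset.sum_image hinj.injOn, Finset.sum_filter]
    refine Finset.sum_congr rfl fun v _ => ?_
    rfl
  rw [e]
  refine hC Y hY _ fun v hv => ?_
  obtain ⟨w, hw, rfl⟩ := Finset.mem_image.mp hv
  obtain ⟨hw1, hw2⟩ := Finset.mem_filter.mp hw
  exact ⟨fun i => (w i).pos, nosing s _ (fun i => (w i).pos) hw2, hF w hw1⟩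

lemma sDt_summable (s : Fin 7 → Bool) : Summable (sDt s) := by
  obtain ⟨C, hC0, hC⟩ := sDt_sum_le 1 one_pos
  refine summable_of_sum_le (c := C * 1^(-(1/4:ℝ)+1)) (sDt_nonneg s) fun F => hC 1 le_rfl s F fun v _ => ⟨0, ?_⟩
  exact_mod_cast (v 0).pos

lemma s7_approx (ε : ℝ) (hε : 0 < ε) : ∃ C : ℝ, 0 < C ∧ ∀ Y : ℕ, 1 ≤ Y → ∀ s : Fin 7 → Bool,
    |Dfin s (Finset.Ico 1 Y) - s7 (cnt s)| ≤ C * (Y:ℝ)^(-(1/4:ℝ)+ε) := by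
  classical
  obtain ⟨C, hC0, hC⟩ := sDt_sum_le ε hε
  refine ⟨C, hC0, fun Y hY s => ?_⟩
  set B : Finset (Fin 7 → ℕ+) := Fintype.piFinset (fun _ => (Finset.Ico 1 Y).image Nat.toPNat') with hB
  have hBm : ∀ v, v ∈ B ↔ ∀ i, (v i : ℕ) < Y := by
    intro v
    rw [hB, Fintype.mem_piFinset]
    refine forall_congr' fun i => ?_
    rw [Finset.mem_image]
    constructor
    · rintro ⟨n, hn, h⟩
      rw [Finset.mem_Ico] at hn
      rw [← h, Nat.toPNat'_coe, if_pos (by omega)]; exact hn.2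
    · intro h
      exact ⟨(v i : ℕ), Finset.mem_Ico.mpr ⟨(v i).pos, h⟩, PNat.coe_toPNat' _⟩
  have e : Dfin s (Finset.Ico 1 Y) = ∑ v ∈ B, sDt s v := by
    unfold Dfin sDt
    rw [← Finset.sum_filter]
    refine (Finset.sum_nbij (fun v i => (v i : ℕ)) ?_ ?_ ?_ ?_).symm
    · intro v hv
      obtain ⟨h1, h2⟩ := Finset.mem_filter.mp hv
      rw [Finset.mem_filter, Fintype.mem_piFinset]
      exact ⟨fun i => Finset.mem_Ico.mpr ⟨(v i).pos, (hBm v).mp h1 i⟩, h2⟩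
    · intro v _ w _ h
      funext i
      exact PNat.coe_injective (congrFun h i)
    · intro v hv
      rw [Finset.mem_coe, Finset.mem_filter, Fintype.mem_piFinset] at hv
      obtain ⟨h1, h2⟩ := hv
      have hco : ∀ i, ((Nat.toPNat' (v i) : ℕ+) : ℕ) = v i := fun i => by
        rw [Nat.toPNat'_coe, if_pos (by have := (Finset.mem_Ico.mp (h1 i)).1; omega)]
      refine ⟨fun i => Nat.toPNat' (v i), ?_, ?_⟩
      · rw [Finset.mem_coe, Finset.mem_filter, hBm]
        simp only [hco]
        exact ⟨fun i => (Finset.mem_Ico.mp (h1 i)).2, h2⟩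
      · funext i; exact hco i
    · intro v _; rfl
  rw [e, ← sD_cnt]
  have h1 : ∑ v ∈ B, sDt s v ≤ sD s := (sDt_summable s).sum_le_tsum B fun v _ => sDt_nonneg s v
  have h2 : sD s ≤ ∑ v ∈ B, sDt s v + C * (Y:ℝ)^(-(1/4:ℝ)+ε) := by
    refine (sDt_summable s).tsum_le_of_sum_le fun F => ?_
    calc ∑ v ∈ F, sDt s v ≤ ∑ v ∈ B ∪ F, sDt s v := Finset.sum_le_sum_of_subset_of_nonneg Finset.subset_union_right fun v _ _ => sDt_nonneg s v
      _ = ∑ v ∈ B, sDt s v + ∑ v ∈ F \ B, sDt s v := by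
          rw [← Finset.sum_union Finset.disjoint_sdiff, Finset.union_sdiff_self_eq_union]
      _ ≤ _ := by
          have := hC Y (by exact_mod_cast hY) s (F \ B) fun v hv => by
            have h3 := (Finset.mem_sdiff.mp hv).2
            rw [hBm] at h3
            push Not at h3
            obtain ⟨i, hi⟩ := h3
            exact ⟨i, by exact_mod_cast hi⟩
          linarith
  rw [abs_le]; constructor <;> linarith

end

section
open Filter MeasureTheory Topology

noncomputable def tr (S : Finset ℕ) (u : ℝ) : ℝ := ∑ n ∈ S, wt n * Real.cos (4 * Real.pi * Real.sqrt n * u - Real.pi/4)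

lemma tr_cont (S : Finset ℕ) : Continuous (tr S) := by unfold tr; fun_prop

lemma prod_cos (k : ℕ) (x : Fin k → ℝ) : ∏ i, Real.cos (x i) = (1/2)^k * ∑ s : Fin k → Bool, Real.cos (∑ i, sg (s i) * x i) := by
  have h : ∀ t : ℝ, ((Real.cos t : ℝ):ℂ) = (1/2) * ∑ b : Bool, Complex.exp ((sg b * t : ℝ) * Complex.I) := by
    intro t
    rw [Fintype.sum_bool, Complex.ofReal_cos, Complex.cos]
    simp only [sg, if_true, Bool.false_eq_true, if_false]
    push_cast; ring_nf
  have h2 : ((∏ i, Real.cos (x i) : ℝ) : ℂ) = (1/2)^k * ∑ s : Fin k → Bool, Complex.exp ((∑ i, sg (s i) * x i : ℝ) * Complex.I) := by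
    push_cast
    have : ∀ i : Fin k, Complex.cos (x i) = (1/2) * ∑ b : Bool, Complex.exp ((sg b * x i : ℝ) * Complex.I) := fun i => by
      rw [← h, Complex.ofReal_cos]
    rw [Finset.prod_congr rfl fun i _ => this i, Finset.prod_mul_distrib, Finset.prod_const, Finset.card_univ, Fintype.card_fin, Finset.prod_univ_sum, Fintype.piFinset_univ]
    congr 1
    refine Finset.sum_congr rfl fun s _ => ?_
    rw [← Complex.exp_sum]; congr 1
    rw [Finset.sum_mul]; push_cast; rfl
  have h3 := congrArg Complex.re h2
  rw [Complex.ofReal_re] at h3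
  rw [h3]
  have e : ((1/2:ℂ))^k = (((1/2:ℝ)^k : ℝ) : ℂ) := by push_cast; rfl
  rw [e, Complex.re_ofReal_mul, Complex.re_sum]
  congr 1
  refine Finset.sum_congr rfl fun s _ => ?_
  rw [Complex.exp_ofReal_mul_I_re]

lemma osc_int (A B th et ph : ℝ) (hA : 0 < A) (hAB : A ≤ B) (hth : 0 ≤ th) (het : et ≠ 0) :
    |∫ u in A..B, u^th * Real.cos (4 * Real.pi * et * u - ph)| ≤ B^th * (1/|et|) := by
  set c := 4 * Real.pi * et with hc
  have hc0 : c ≠ 0 := by positivity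
  have hd : ∀ u ∈ Set.uIcc A B, HasDerivAt (fun u : ℝ => u^th * (Real.sin (c*u - ph)/c)) (th * u^(th-1) * (Real.sin (c*u-ph)/c) + u^th * Real.cos (c*u-ph)) u := by
    intro u hu
    rw [Set.uIcc_of_le hAB] at hu
    have hu0 : 0 < u := by linarith [hu.1]
    have h1 : HasDerivAt (fun u : ℝ => u^th) (th * u^(th-1)) u := Real.hasDerivAt_rpow_const (Or.inl hu0.ne')
    have h2 : HasDerivAt (fun u : ℝ => c*u - ph) c u := by
      simpa using ((hasDerivAt_id u).const_mul c).sub_const ph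
    have h3 := (h2.sin.div_const c)
    have h4 := h1.mul h3
    rw [mul_div_cancel_right₀ _ hc0] at h4
    exact h4
  have hcp : ContinuousOn (fun u : ℝ => u^th) (Set.uIcc A B) := by
    refine ContinuousOn.rpow_const continuousOn_id fun u hu => Or.inr hth
  have hcp1 : ContinuousOn (fun u : ℝ => u^(th-1)) (Set.uIcc A B) := by
    refine ContinuousOn.rpow_const continuousOn_id fun u hu => Or.inl ?_
    rw [Set.uIcc_of_le hAB] at hu
    have : 0 < u := by linarith [hu.1]
    exact this.ne'
  have hi1 : IntervalIntegrable (fun u : ℝ => th * u^(th-1) * (Real.sin (c*u-ph)/c)) volume A B := by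
    refine ContinuousOn.intervalIntegrable ?_
    refine (continuousOn_const.mul hcp1).mul (Continuous.continuousOn (by fun_prop))
  have hi2 : IntervalIntegrable (fun u : ℝ => u^th * Real.cos (c*u-ph)) volume A B := by
    refine ContinuousOn.intervalIntegrable ?_
    exact hcp.mul (Continuous.continuousOn (by fun_prop))
  have hft := intervalIntegral.integral_eq_sub_of_hasDerivAt hd (hi1.add hi2)
  rw [intervalIntegral.integral_add hi1 hi2] at hft
  have hB0 : 0 < B := by linarith
  have hbd : |∫ u in A..B, th * u^(th-1) * (Real.sin (c*u-ph)/c)| ≤ B^th/|c| := by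
    have h1 : |∫ u in A..B, th * u^(th-1) * (Real.sin (c*u-ph)/c)| ≤ ∫ u in A..B, th * u^(th-1) * (1/|c|) := by
      have := intervalIntegral.norm_integral_le_of_norm_le hAB (f := fun u => th * u^(th-1) * (Real.sin (c*u-ph)/c)) (g := fun u => th * u^(th-1) * (1/|c|)) (μ := volume) ?_ ?_
      · simpa only [Real.norm_eq_abs] using this
      · refine ae_of_all _ fun u hu => ?_
        have hu0 : 0 < u := by linarith [hu.1]
        rw [norm_mul, Real.norm_of_nonneg (by positivity : 0 ≤ th * u^(th-1)), norm_div, Real.norm_eq_abs, Real.norm_eq_abs]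
        have := Real.abs_sin_le_one (c*u-ph)
        gcongr
      · refine ContinuousOn.intervalIntegrable ?_
        exact (continuousOn_const.mul hcp1).mul continuousOn_const
    have h2 : ∫ u in A..B, th * u^(th-1) * (1/|c|) = (B^th - A^th) * (1/|c|) := by
      rw [intervalIntegral.integral_mul_const]
      congr 1
      refine intervalIntegral.integral_eq_sub_of_hasDerivAt (f := fun u : ℝ => u^th) (fun u hu => ?_) ?_
      · rw [Set.uIcc_of_le hAB] at hu
        have : 0 < u := by linarith [hu.1]
        exact Real.hasDerivAt_rpow_const (Or.inl this.ne')
      · exact (continuousOn_const.mul hcp1).intervalIntegrable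
    rw [h2] at h1
    refine h1.trans ?_
    rw [mul_one_div]
    have : 0 ≤ A^th := by positivity
    gcongr
    linarith
  have hend : ∀ u, 0 < u → u ≤ B → |u^th * (Real.sin (c*u - ph)/c)| ≤ B^th/|c| := by
    intro u hu0 huB
    rw [abs_mul, abs_div, abs_of_nonneg (by positivity : 0 ≤ u^th), ← mul_div_assoc]
    have := Real.abs_sin_le_one (c*u-ph)
    have h2 : u^th ≤ B^th := Real.rpow_le_rpow hu0.le huB hth
    gcongr
    calc u^th * |Real.sin (c*u-ph)| ≤ B^th * 1 := by gcongr
      _ = _ := mul_one _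
  have hB' := hend B hB0 le_rfl
  have hA' := hend A hA hAB
  have key : |∫ u in A..B, u^th * Real.cos (c*u-ph)| ≤ 3 * (B^th/|c|) := by
    rw [abs_le] at *
    constructor <;> linarith
  refine key.trans ?_
  have hpi := Real.pi_gt_three
  have hep : 0 < |et| := abs_pos.mpr het
  have hcabs : |c| = 4 * Real.pi * |et| := by
    rw [hc, abs_mul, abs_of_pos (by positivity : 0 < 4 * Real.pi)]
  rw [hcabs]
  have h0 : 0 ≤ B^th := by positivity
  rw [← mul_div_assoc, mul_one_div, div_le_div_iff₀ (by positivity) hep]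
  have : 0 ≤ B^th * |et| := by positivity
  nlinarith

open Classical in
lemma moment (k : ℕ) (hk : 1 ≤ k) (S : Finset ℕ) (Y A B th : ℝ) (hY : 1 ≤ Y) (hS : ∀ n ∈ S, (n:ℝ) ≤ Y) (hA : 0 < A) (hAB : A ≤ B) (hth : 0 ≤ th) :
    |(∫ u in A..B, u^th * (tr S u)^k) - (∫ u in A..B, u^th) * ((1/2)^k * ∑ s : Fin k → Bool, Real.cos (Real.pi/4 * ∑ i, sg (s i)) * Dfin s S)|
      ≤ B^th * (∑ n ∈ S, wt n)^k * (k * Real.sqrt Y)^(2^(k-1)-1) := by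
  set V := Fintype.piFinset (fun _ : Fin k => S) with hV
  set I : (Fin k → ℕ) → (Fin k → Bool) → ℝ := fun v s => ∫ u in A..B, u^th * Real.cos (4 * Real.pi * eta s v * u - Real.pi/4 * ∑ i, sg (s i)) with hI
  have hcp : ContinuousOn (fun u : ℝ => u^th) (Set.uIcc A B) :=
    ContinuousOn.rpow_const continuousOn_id fun u hu => Or.inr hth
  have hexp : ∀ u, (tr S u)^k = ∑ v ∈ V, ∑ s : Fin k → Bool, (1/2)^k * (∏ i, wt (v i)) * Real.cos (4 * Real.pi * eta s v * u - Real.pi/4 * ∑ i, sg (s i)) := by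
    intro u
    have h1 : (tr S u)^k = ∑ v ∈ V, ∏ i, (wt (v i) * Real.cos (4 * Real.pi * Real.sqrt (v i) * u - Real.pi/4)) := by
      unfold tr
      rw [hV, ← Finset.prod_univ_sum (fun _ : Fin k => S) (fun _ n => wt n * Real.cos (4 * Real.pi * Real.sqrt n * u - Real.pi/4)), Finset.prod_const, Finset.card_univ, Fintype.card_fin]
    rw [h1]
    refine Finset.sum_congr rfl fun v _ => ?_
    rw [Finset.prod_mul_distrib, prod_cos, ← mul_assoc, Finset.mul_sum]
    refine Finset.sum_congr rfl fun s _ => ?_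
    have : ∑ i, sg (s i) * (4 * Real.pi * Real.sqrt (v i) * u - Real.pi/4) = 4 * Real.pi * eta s v * u - Real.pi/4 * ∑ i, sg (s i) := by
      unfold eta
      rw [Finset.mul_sum, Finset.mul_sum, Finset.sum_mul, ← Finset.sum_sub_distrib]
      refine Finset.sum_congr rfl fun i _ => by ring
    rw [this]; ring
  have hIntg : (∫ u in A..B, u^th * (tr S u)^k) = ∑ v ∈ V, ∑ s : Fin k → Bool, (1/2)^k * (∏ i, wt (v i)) * I v s := by
    have e : ∀ u, u^th * (tr S u)^k = ∑ v ∈ V, ∑ s : Fin k → Bool, (1/2)^k * (∏ i, wt (v i)) * (u^th * Real.cos (4 * Real.pi * eta s v * u - Real.pi/4 * ∑ i, sg (s i))) := by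
      intro u
      rw [hexp u, Finset.mul_sum]
      refine Finset.sum_congr rfl fun v _ => ?_
      rw [Finset.mul_sum]
      refine Finset.sum_congr rfl fun s _ => by ring
    simp only [e]
    have hII : ∀ (v : Fin k → ℕ) (s : Fin k → Bool), IntervalIntegrable (fun u : ℝ => (1/2)^k * (∏ i, wt (v i)) * (u^th * Real.cos (4 * Real.pi * eta s v * u - Real.pi/4 * ∑ i, sg (s i)))) volume A B := by
      intro v s
      refine ContinuousOn.intervalIntegrable ?_
      exact continuousOn_const.mul (hcp.mul (Continuous.continuousOn (by fun_prop)))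
    rw [intervalIntegral.integral_finsetSum]
    · refine Finset.sum_congr rfl fun v _ => ?_
      rw [intervalIntegral.integral_finsetSum (fun s _ => hII v s)]
      refine Finset.sum_congr rfl fun s _ => ?_
      rw [intervalIntegral.integral_const_mul]
    · intro v _
      refine ContinuousOn.intervalIntegrable ?_
      refine continuousOn_finsetSum _ fun s _ => ?_
      exact continuousOn_const.mul (hcp.mul (Continuous.continuousOn (by fun_prop)))
  have hmain : (∫ u in A..B, u^th) * ((1/2)^k * ∑ s : Fin k → Bool, Real.cos (Real.pi/4 * ∑ i, sg (s i)) * Dfin s S) =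
      ∑ v ∈ V, ∑ s : Fin k → Bool, (1/2)^k * (∏ i, wt (v i)) * (if eta s v = 0 then Real.cos (Real.pi/4 * ∑ i, sg (s i)) * (∫ u in A..B, u^th) else 0) := by
    rw [Finset.sum_comm, Finset.mul_sum, Finset.mul_sum]
    refine Finset.sum_congr rfl fun s _ => ?_
    unfold Dfin
    rw [Finset.sum_filter, Finset.mul_sum, Finset.mul_sum, Finset.mul_sum]
    refine Finset.sum_congr rfl fun v _ => ?_
    split_ifs
    · ring
    · ring
  rw [hIntg, hmain, ← Finset.sum_sub_distrib]
  have hterm : ∀ v ∈ V, ∀ s : Fin k → Bool, |(1/2)^k * (∏ i, wt (v i)) * I v s - (1/2)^k * (∏ i, wt (v i)) * (if eta s v = 0 then Real.cos (Real.pi/4 * ∑ i, sg (s i)) * (∫ u in A..B, u^th) else 0)| ≤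
      (1/2)^k * (∏ i, wt (v i)) * (B^th * (k * Real.sqrt Y)^(2^(k-1)-1)) := by
    intro v hv s
    have hw : 0 ≤ (1/2)^k * (∏ i, wt (v i)) := mul_nonneg (by positivity) (Finset.prod_nonneg fun i _ => wt_nonneg _)
    rw [← mul_sub, abs_mul, abs_of_nonneg hw]
    refine mul_le_mul_of_nonneg_left ?_ hw
    have hB0 : 0 < B := by linarith
    have hb0 : 0 ≤ B^th * (k * Real.sqrt Y)^(2^(k-1)-1) := by positivity
    split_ifs with h
    · have : I v s = Real.cos (Real.pi/4 * ∑ i, sg (s i)) * (∫ u in A..B, u^th) := by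
        rw [hI]
        simp only
        rw [h, ← intervalIntegral.integral_const_mul]
        refine intervalIntegral.integral_congr fun u _ => ?_
        simp only [mul_zero, zero_mul, zero_sub, Real.cos_neg]
        ring
      rw [this, sub_self, abs_zero]; exact hb0
    · rw [sub_zero]
      refine (osc_int A B th (eta s v) _ hA hAB hth h).trans ?_
      refine mul_le_mul_of_nonneg_left ?_ (by positivity)
      refine eta_lower hk s v Y hY (fun i => hS _ ?_) h
      exact (Fintype.mem_piFinset.mp hv) i
  calc _ ≤ ∑ v ∈ V, ∑ s : Fin k → Bool, (1/2)^k * (∏ i, wt (v i)) * (B^th * (k * Real.sqrt Y)^(2^(k-1)-1)) := by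
        refine (Finset.abs_sum_le_sum_abs _ _).trans (Finset.sum_le_sum fun v hv => ?_)
        rw [← Finset.sum_sub_distrib]
        refine (Finset.abs_sum_le_sum_abs _ _).trans (Finset.sum_le_sum fun s _ => hterm v hv s)
    _ = _ := by
        simp only [Finset.sum_const, Finset.card_univ, Fintype.card_fun, Fintype.card_bool, Fintype.card_fin, nsmul_eq_mul]
        have e1 : ∀ v ∈ V, (((2^k : ℕ):ℝ)) * ((1/2)^k * (∏ i, wt (v i)) * (B^th * (k * Real.sqrt Y)^(2^(k-1)-1))) = (∏ i, wt (v i)) * (B^th * (k * Real.sqrt Y)^(2^(k-1)-1)) := by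
          intro v _
          have : (((2^k : ℕ):ℝ)) * (1/2)^k = 1 := by push_cast; rw [← mul_pow]; norm_num
          calc _ = ((((2^k : ℕ):ℝ)) * (1/2)^k) * ((∏ i, wt (v i)) * (B^th * (k * Real.sqrt Y)^(2^(k-1)-1))) := by ring
            _ = _ := by rw [this, one_mul]
        rw [Finset.sum_congr rfl e1, ← Finset.sum_mul]
        have e2 : ∑ v ∈ V, ∏ i, wt (v i) = (∑ n ∈ S, wt n)^k := by
          rw [hV, ← Finset.prod_univ_sum (fun _ : Fin k => S) (fun _ n => wt n), Finset.prod_const, Finset.card_univ, Fintype.card_fin]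
        rw [e2]; ring

end

section
open Filter MeasureTheory Topology

noncomputable def cw (β : ℝ) (n : ℕ) : ℝ := wt n * Real.exp (-(4 * Real.pi * Real.sqrt n * β))

noncomputable def cB (β : ℝ) (n : ℕ) : ℂ := (cw β n : ℂ)

noncomputable def trb (β : ℝ) (S : Finset ℕ) (u : ℝ) : ℝ := ∑ n ∈ S, cw β n * Real.cos (4 * Real.pi * Real.sqrt n * u - Real.pi/4)

lemma wt_zero : wt 0 = 0 := by simp [wt, divfun]

lemma cw_nonneg (β : ℝ) (n : ℕ) : 0 ≤ cw β n := mul_nonneg (wt_nonneg n) (Real.exp_pos _).le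

lemma cw_le (β : ℝ) (hβ : 0 ≤ β) (n : ℕ) : cw β n ≤ wt n := by
  unfold cw
  have : Real.exp (-(4 * Real.pi * Real.sqrt n * β)) ≤ 1 := Real.exp_le_one_iff.mpr (by
    have : 0 ≤ 4 * Real.pi * Real.sqrt n * β := by positivity
    linarith)
  exact mul_le_of_le_one_right (wt_nonneg n) this

lemma wt_rpow (δ : ℝ) (hδ : 0 < δ) : ∃ C : ℝ, 1 ≤ C ∧ ∀ n : ℕ, 1 ≤ n → wt n ≤ C * (n:ℝ)^(-(3/4:ℝ)+δ) := by
  obtain ⟨C, hC, h⟩ := divfun_le δ hδ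
  refine ⟨C, hC, fun n hn => ?_⟩
  have hn0 : (0:ℝ) < n := by exact_mod_cast hn
  unfold wt
  rw [Real.rpow_add hn0, mul_comm ((n:ℝ)^(-(3/4:ℝ))), ← mul_assoc]
  exact mul_le_mul_of_nonneg_right (h n hn) (by positivity)

lemma Sb_cut : ∃ C : ℝ, 0 < C ∧ ∀ (M : ℕ) (β u : ℝ), 0 < β →
    |Sb β u - trb β (Finset.Ico 1 M) u| ≤ C * β⁻¹ * Real.exp (-(2 * Real.pi * Real.sqrt M * β)) := by
  obtain ⟨C2, hC2, h2⟩ := sum_exp_bound (3/4) 1 (by norm_num) (by norm_num)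
  refine ⟨C2 * 2, by positivity, fun M β u hβ => ?_⟩
  have hs : ∀ b : ℝ, 0 < b → Summable (fun n : ℕ => cw b n) := fun b hb => by
    rw [← summable_pnat_iff_summable_nat]
    exact (h2 b hb).1
  have hb2 : 0 < β/2 := by positivity
  have hs2 := hs (β/2) hb2
  have hb : ∑' n : ℕ, cw (β/2) n ≤ C2 * (β/2)^(-1:ℝ) := by
    rw [← tsum_pnat_eq_tsum_of_eq_zero (by simp [cw, wt_zero])]
    exact (h2 _ hb2).2
  set F : ℕ → ℝ := fun n => cw β n * Real.cos (4 * Real.pi * Real.sqrt n * u - Real.pi/4) with hF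
  have hFb : ∀ n, ‖F n‖ ≤ cw β n := fun n => by
    rw [hF, Real.norm_eq_abs]
    simp only [abs_mul, abs_of_nonneg (cw_nonneg β n)]
    exact mul_le_of_le_one_right (cw_nonneg β n) (Real.abs_cos_le_one _)
  have hFs : Summable F := Summable.of_norm_bounded (hs β hβ) hFb
  have e1 : Sb β u = ∑' n : ℕ, F n := by
    rw [← tsum_pnat_eq_tsum_of_eq_zero (f := F) (by simp [hF, cw, wt_zero])]
    rfl
  have e2 : trb β (Finset.Ico 1 M) u = ∑ n ∈ Finset.range M, F n := by
    unfold trb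
    refine Finset.sum_subset (fun n hn => ?_) fun n hn hn2 => ?_
    · simp only [Finset.mem_Ico, Finset.mem_range] at *; omega
    · have : n = 0 := by simp only [Finset.mem_Ico, Finset.mem_range] at *; omega
      subst this; simp [cw, wt_zero]
  have e3 := hFs.sum_add_tsum_nat_add M
  have e4 := hs2.sum_add_tsum_nat_add M
  have e5 : 0 ≤ ∑ n ∈ Finset.range M, cw (β/2) n := Finset.sum_nonneg fun n _ => cw_nonneg _ _
  rw [e1, e2, ← e3, add_sub_cancel_left, ← Real.norm_eq_abs]
  have hsM : Summable (fun i => cw (β/2) (i+M)) := (summable_nat_add_iff M).mpr hs2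
  have hb3 : ‖∑' i, F (i+M)‖ ≤ (∑' i, cw (β/2) (i+M)) * Real.exp (-(2 * Real.pi * Real.sqrt M * β)) := by
    rw [← tsum_mul_right]
    refine tsum_of_norm_bounded (f := fun i => F (i+M)) (hsM.mul_right _).hasSum fun i => ?_
    refine (hFb _).trans ?_
    unfold cw
    rw [mul_assoc (wt _) (Real.exp _) (Real.exp _), ← Real.exp_add]
    refine mul_le_mul_of_nonneg_left (Real.exp_le_exp.mpr ?_) (wt_nonneg _)
    have h1 : Real.sqrt M ≤ Real.sqrt ((i+M:ℕ):ℝ) := Real.sqrt_le_sqrt (by push_cast; linarith [(Nat.cast_nonneg i : (0:ℝ) ≤ i)])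
    have h2 : Real.pi * β * Real.sqrt M ≤ Real.pi * β * Real.sqrt ((i+M:ℕ):ℝ) := mul_le_mul_of_nonneg_left h1 (by positivity)
    nlinarith
  refine hb3.trans ?_
  refine mul_le_mul_of_nonneg_right ?_ (Real.exp_pos _).le
  have : (β/2)^(-1:ℝ) = 2 * β⁻¹ := by rw [Real.rpow_neg_one]; field_simp
  rw [this] at hb
  linarith

lemma trb_diff : ∃ C : ℝ, 0 < C ∧ ∀ (M : ℕ) (β u : ℝ), 0 ≤ β →
    |trb β (Finset.Ico 1 M) u - tr (Finset.Ico 1 M) u| ≤ C * β * M := by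
  obtain ⟨C, hC, h⟩ := wt_rpow (1/4) (by norm_num)
  have hC0 : 0 < C := by linarith
  refine ⟨4 * Real.pi * C, by positivity, fun M β u hβ => ?_⟩
  unfold trb tr
  rw [← Finset.sum_sub_distrib]
  refine (Finset.abs_sum_le_sum_abs _ _).trans ?_
  have ht : ∀ n ∈ Finset.Ico 1 M, |cw β n * Real.cos (4 * Real.pi * Real.sqrt n * u - Real.pi/4) - wt n * Real.cos (4 * Real.pi * Real.sqrt n * u - Real.pi/4)| ≤ 4 * Real.pi * C * β := by
    intro n hn
    have hn1 : 1 ≤ n := (Finset.mem_Ico.mp hn).1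
    have hn0 : (0:ℝ) < n := by exact_mod_cast hn1
    rw [← sub_mul, abs_mul]
    have h1 : |cw β n - wt n| ≤ 4 * Real.pi * C * β := by
      rw [abs_sub_comm, abs_of_nonneg (by linarith [cw_le β hβ n])]
      unfold cw
      have h2 := Real.add_one_le_exp (-(4 * Real.pi * Real.sqrt n * β))
      calc wt n - wt n * Real.exp (-(4 * Real.pi * Real.sqrt n * β)) = wt n * (1 - Real.exp (-(4 * Real.pi * Real.sqrt n * β))) := by ring
        _ ≤ (C * (n:ℝ)^(-(3/4:ℝ)+1/4)) * (4 * Real.pi * Real.sqrt n * β) := by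
            refine mul_le_mul (h n hn1) (by linarith) ?_ (by positivity)
            have : Real.exp (-(4 * Real.pi * Real.sqrt n * β)) ≤ 1 := Real.exp_le_one_iff.mpr (by
              have : 0 ≤ 4 * Real.pi * Real.sqrt n * β := by positivity
              linarith)
            linarith
        _ = 4 * Real.pi * C * β * ((n:ℝ)^(-(3/4:ℝ)+1/4) * Real.sqrt n) := by ring
        _ = _ := by
            rw [Real.sqrt_eq_rpow, ← Real.rpow_add hn0]; norm_num
    calc _ ≤ 4 * Real.pi * C * β * 1 := mul_le_mul h1 (Real.abs_cos_le_one _) (abs_nonneg _) (by positivity)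
      _ = _ := mul_one _
  refine (Finset.sum_le_sum ht).trans ?_
  rw [Finset.sum_const, Nat.card_Ico, nsmul_eq_mul]
  have : ((M-1:ℕ):ℝ) ≤ M := by exact_mod_cast Nat.sub_le M 1
  have h0 : 0 ≤ 4 * Real.pi * C * β := by positivity
  nlinarith

lemma trb_block (β u : ℝ) (N : ℕ) : |trb β (Finset.Ico N (2*N)) u| ≤ ‖fB N (cB β) u‖ := by
  have h : trb β (Finset.Ico N (2*N)) u = (ee (-(1/8)) * fB N (cB β) u).re := by
    unfold trb fB
    rw [Finset.mul_sum, Complex.re_sum]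
    refine Finset.sum_congr rfl fun n _ => ?_
    have : ee (-(1/8)) * (cB β n * ee (2 * Real.sqrt n * u)) = (cw β n : ℂ) * ee (2 * Real.sqrt n * u - 1/8) := by
      rw [sub_eq_add_neg, ee_add]; unfold cB; ring
    rw [this, Complex.re_ofReal_mul]
    unfold ee
    rw [Complex.exp_ofReal_mul_I_re]
    congr 2; ring
  rw [h]
  refine (Complex.abs_re_le_norm _).trans ?_
  rw [norm_mul, norm_ee, one_mul]

lemma cB_bounds (δ : ℝ) (hδ : 0 < δ) (hδ2 : δ ≤ 3/4) : ∃ C : ℝ, 1 ≤ C ∧ ∀ (β : ℝ) (N : ℕ), 0 ≤ β → 1 ≤ N →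
    (∑ n ∈ Finset.Ico N (2*N), ‖cB β n‖^2 ≤ C * (N:ℝ)^(-(1/2:ℝ)+2*δ)) ∧ (∑ n ∈ Finset.Ico N (2*N), ‖cB β n‖ ≤ C * (N:ℝ)^((1/4:ℝ)+δ)) := by
  obtain ⟨C, hC, h⟩ := wt_rpow δ hδ
  have hC0 : 0 < C := by linarith
  refine ⟨C^2, by nlinarith, fun β N hβ hN => ?_⟩
  have hN0 : (0:ℝ) < N := by exact_mod_cast hN
  have hb : ∀ n ∈ Finset.Ico N (2*N), ‖cB β n‖ ≤ C * (N:ℝ)^(-(3/4:ℝ)+δ) := by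
    intro n hn
    have hn1 : N ≤ n := (Finset.mem_Ico.mp hn).1
    unfold cB
    rw [Complex.norm_real, Real.norm_of_nonneg (cw_nonneg _ _)]
    refine (cw_le β hβ n).trans ((h n (by omega)).trans ?_)
    refine mul_le_mul_of_nonneg_left ?_ hC0.le
    exact Real.rpow_le_rpow_of_nonpos hN0 (by exact_mod_cast hn1) (by linarith)
  have hcard : (Finset.Ico N (2*N)).card = N := by simp; omega
  constructor
  · calc _ ≤ ∑ n ∈ Finset.Ico N (2*N), (C * (N:ℝ)^(-(3/4:ℝ)+δ))^2 := Finset.sum_le_sum fun n hn => by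
          have := hb n hn
          gcongr
      _ = C^2 * ((N:ℝ)^(1:ℝ) * ((N:ℝ)^(-(3/4:ℝ)+δ) * (N:ℝ)^(-(3/4:ℝ)+δ))) := by
          rw [Finset.sum_const, hcard, nsmul_eq_mul, Real.rpow_one]; ring
      _ = _ := by
          rw [← Real.rpow_add hN0, ← Real.rpow_add hN0]; congr 2; ring
  · calc _ ≤ ∑ n ∈ Finset.Ico N (2*N), (C * (N:ℝ)^(-(3/4:ℝ)+δ)) := Finset.sum_le_sum hb
      _ = C * ((N:ℝ)^(1:ℝ) * (N:ℝ)^(-(3/4:ℝ)+δ)) := by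
          rw [Finset.sum_const, hcard, nsmul_eq_mul, Real.rpow_one]; ring
      _ = C * (N:ℝ)^((1/4:ℝ)+δ) := by
          rw [← Real.rpow_add hN0]; congr 2; ring
      _ ≤ _ := mul_le_mul_of_nonneg_right (by nlinarith) (by positivity)

end

section
open Filter MeasureTheory Topology

noncomputable def gD (u : ℝ) : ℝ := DirichletDelta (u^2) / (1/(Real.pi * Real.sqrt 2) * Real.sqrt u)

noncomputable def Rr (m : ℕ) (u : ℝ) : ℝ := gD u - tr (Finset.Ico 1 (2^m)) u

lemma trb_split (β u : ℝ) (m K : ℕ) (h : m ≤ K) : trb β (Finset.Ico 1 (2^K)) u = trb β (Finset.Ico 1 (2^m)) u + ∑ j ∈ Finset.Ico m K, trb β (Finset.Ico (2^j) (2*2^j)) u := by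
  induction K, h using Nat.le_induction with
  | base => simp
  | succ K hK ih =>
    rw [Finset.sum_Ico_succ_top hK, ← add_assoc, ← ih]
    unfold trb
    rw [pow_succ, mul_comm (2^K) 2]
    rw [Finset.sum_Ico_consecutive _ Nat.one_le_two_pow (by omega)]

lemma gD_Sb (ε : ℝ) (hε : 0 < ε) : ∃ C : ℝ, 0 < C ∧ ∀ u β : ℝ, 2 ≤ u → 1/u ≤ β → β ≤ 1 → |gD u - Sb β u| ≤ C * u^(1/2+ε) * β := by
  obtain ⟨C, hC, h⟩ := voronoi ε hε
  refine ⟨C * (Real.pi * Real.sqrt 2), by positivity, fun u β hu h1 h2 => ?_⟩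
  have := h u β hu h1 h2
  have hu0 : 0 < u := by linarith
  have hs : 0 < Real.sqrt u := Real.sqrt_pos.mpr hu0
  set c := 1/(Real.pi * Real.sqrt 2) * Real.sqrt u with hc
  have hc0 : 0 < c := by positivity
  have e : gD u - Sb β u = (DirichletDelta (u^2) - c * Sb β u)/c := by
    unfold gD; rw [← hc]; field_simp
  rw [e, abs_div, abs_of_pos hc0, div_le_iff₀ hc0]
  refine this.trans (le_of_eq ?_)
  have e2 : u^(1+ε) = u^(1/2+ε) * Real.sqrt u := by
    rw [Real.sqrt_eq_rpow, ← Real.rpow_add hu0]; congr 1; ring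
  rw [e2, hc]
  field_simp

lemma exp_small (ε : ℝ) (hε : 0 < ε) : ∃ C : ℝ, 0 < C ∧ ∀ U : ℝ, 0 < U → Real.exp (-(U^(ε/2))) ≤ C * U^(-2:ℝ) := by
  have hk : 0 < 4/ε := by positivity
  refine ⟨(4/ε)^(4/ε), by positivity, fun U hU => ?_⟩
  have := exp_neg_le_rpow (4/ε) (U^(ε/2)) hk (by positivity)
  rw [← Real.rpow_mul hU.le] at this
  have e : ε/2 * -(4/ε) = -2 := by field_simp; norm_num
  rwa [e] at this

lemma Rr_dec (ε : ℝ) (hε : 0 < ε) : ∃ C : ℝ, 0 < C ∧ ∀ U : ℝ, 2 ≤ U → ∀ m : ℕ, (2:ℝ)^m ≤ U^(1/40:ℝ) →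
    ∀ β : ℝ, 1/U ≤ β → β ≤ 1 → ∃ J : ℕ, (2:ℝ)^J ≤ 2 * (β⁻¹)^2 * U^ε ∧ ∀ u : ℝ, U ≤ u → u ≤ 2*U →
      |Rr m u| ≤ C * U^(1/2+ε) * β + ∑ j ∈ Finset.Ico m J, ‖fB (2^j) (cB β) u‖ := by
  obtain ⟨C1, hC1, h1⟩ := gD_Sb ε hε
  obtain ⟨C2, hC2, h2⟩ := Sb_cut
  obtain ⟨C3, hC3, h3⟩ := trb_diff
  obtain ⟨C4, hC4, h4⟩ := exp_small ε hε
  refine ⟨C1 * 2^(1/2+ε) + C2*C4 + C3, by positivity, fun U hU m hm β hβ hβ1 => ?_⟩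
  have hU0 : 0 < U := by linarith
  have hU1 : 1 ≤ U := by linarith
  have hβ0 : 0 < β := lt_of_lt_of_le (by positivity) hβ
  have hbi : 1 ≤ β⁻¹ := (one_le_inv₀ hβ0).mpr hβ1
  have hUe : 1 ≤ U^ε := Real.one_le_rpow hU1 hε.le
  have hx : 1 ≤ (β⁻¹)^2 * U^ε := by nlinarith
  obtain ⟨n, hn1, hn2⟩ := exists_nat_pow_near hx (by norm_num : (1:ℝ) < 2)
  refine ⟨n+1, by rw [pow_succ]; linarith, fun u hu1 hu2 => ?_⟩
  set J := n+1 with hJ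
  set K := max m J with hK
  have a1 := h1 u β (by linarith) ((one_div_le_one_div_of_le hU0 hu1).trans hβ) hβ1
  have a2 := h2 (2^K) β u hβ0
  have a3 := h3 (2^m) β u hβ0.le
  have a4 := trb_split β u m K (le_max_left _ _)
  have hIco : Finset.Ico m K = Finset.Ico m J := by
    rcases le_total m J with h | h
    · rw [hK, max_eq_right h]
    · rw [hK, max_eq_left h, Finset.Ico_self, Finset.Ico_eq_empty (by omega)]
  have a5 : |∑ j ∈ Finset.Ico m K, trb β (Finset.Ico (2^j) (2*2^j)) u| ≤ ∑ j ∈ Finset.Ico m J, ‖fB (2^j) (cB β) u‖ := by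
    rw [hIco]
    exact (Finset.abs_sum_le_sum_abs _ _).trans (Finset.sum_le_sum fun j _ => trb_block β u (2^j))
  have hP : (1:ℝ) ≤ U^(1/2+ε) := Real.one_le_rpow hU1 (by linarith)
  have b1 : C1 * u^(1/2+ε) * β ≤ C1 * 2^(1/2+ε) * (U^(1/2+ε) * β) := by
    have : u^(1/2+ε) ≤ 2^(1/2+ε) * U^(1/2+ε) := by
      rw [← Real.mul_rpow (by norm_num) hU0.le]
      exact Real.rpow_le_rpow (by linarith) hu2 (by linarith)
    calc _ ≤ C1 * (2^(1/2+ε) * U^(1/2+ε)) * β := by gcongr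
      _ = _ := by ring
  have b2 : C2 * β⁻¹ * Real.exp (-(2 * Real.pi * Real.sqrt ((2^K:ℕ):ℝ) * β)) ≤ C2*C4 * (U^(1/2+ε) * β) := by
    have s1 : U^(ε/2) ≤ Real.sqrt ((2^K:ℕ):ℝ) * β := by
      have : U^ε * (β⁻¹)^2 ≤ ((2^K:ℕ):ℝ) := by
        push_cast
        calc _ ≤ (2:ℝ)^J := by rw [mul_comm]; exact hn2.le
          _ ≤ 2^K := pow_le_pow_right₀ (by norm_num) (le_max_right _ _)
      have t := Real.sqrt_le_sqrt this
      rw [Real.sqrt_mul (by positivity), Real.sqrt_sq (by positivity), Real.sqrt_eq_rpow, ← Real.rpow_mul hU0.le] at t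
      have t2 := mul_le_mul_of_nonneg_right t hβ0.le
      rw [mul_assoc, inv_mul_cancel₀ hβ0.ne', mul_one] at t2
      rwa [mul_one_div] at t2
    have s2 : Real.exp (-(2 * Real.pi * Real.sqrt ((2^K:ℕ):ℝ) * β)) ≤ Real.exp (-(U^(ε/2))) := by
      refine Real.exp_le_exp.mpr ?_
      have hp := Real.pi_gt_three
      have : 0 < U^(ε/2) := by positivity
      nlinarith
    have s3 := s2.trans (h4 U hU0)
    have s4 : β⁻¹ ≤ U := by
      rw [inv_le_comm₀ hβ0 hU0, ← one_div]; exact hβ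
    have s5 : U * U^(-2:ℝ) = 1/U := by
      have : U * U^(-2:ℝ) = U^(1:ℝ) * U^(-2:ℝ) := by rw [Real.rpow_one]
      rw [this, ← Real.rpow_add hU0]; norm_num [Real.rpow_neg_one]
    calc C2 * β⁻¹ * Real.exp (-(2 * Real.pi * Real.sqrt ((2^K:ℕ):ℝ) * β)) ≤ C2 * U * (C4 * U^(-2:ℝ)) := by gcongr
      _ = C2 * C4 * (1 * (1/U)) := by rw [← s5]; ring
      _ ≤ _ := by gcongr
  have b3 : C3 * β * ((2^m:ℕ):ℝ) ≤ C3 * (U^(1/2+ε) * β) := by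
    have : ((2^m:ℕ):ℝ) ≤ U^(1/2+ε) := by
      push_cast
      exact hm.trans (Real.rpow_le_rpow_of_exponent_le hU1 (by linarith))
    calc _ ≤ C3 * β * U^(1/2+ε) := by gcongr
      _ = _ := by ring
  have e : Rr m u = (gD u - Sb β u) + (Sb β u - trb β (Finset.Ico 1 (2^K)) u) + (trb β (Finset.Ico 1 (2^m)) u - tr (Finset.Ico 1 (2^m)) u) + ∑ j ∈ Finset.Ico m K, trb β (Finset.Ico (2^j) (2*2^j)) u := by
    unfold Rr; rw [a4]; ring
  rw [e]
  refine (abs_add_le _ _).trans (add_le_add ((abs_add_le _ _).trans ?_) a5)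
  have := abs_add_le (gD u - Sb β u) (Sb β u - trb β (Finset.Ico 1 (2^K)) u)
  calc _ ≤ C1 * 2^(1/2+ε) * (U^(1/2+ε) * β) + C2*C4 * (U^(1/2+ε) * β) + C3 * (U^(1/2+ε) * β) := by linarith
    _ = _ := by ring

end

section
open Filter MeasureTheory Topology

lemma Delta_meas : Measurable DirichletDelta := by
  unfold DirichletDelta
  refine Measurable.sub (Measurable.sub ?_ ?_) ?_
  · exact (measurable_from_nat (f := fun k : ℕ => ∑ n ∈ Finset.Icc 1 k, (divfun n : ℝ))).comp Nat.measurable_floor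
  · exact measurable_id.mul Real.measurable_log
  · exact measurable_const.mul measurable_id

lemma gD_meas : Measurable gD := by
  unfold gD
  refine Measurable.div (Delta_meas.comp (measurable_id.pow_const 2)) ?_
  exact measurable_const.mul Real.continuous_sqrt.measurable

lemma Rr_meas (m : ℕ) : Measurable (Rr m) := gD_meas.sub (tr_cont _).measurable

lemma bdd_integrable (f : ℝ → ℝ) (hf : Measurable f) (a b M : ℝ) (hab : a ≤ b) (h : ∀ u, a ≤ u → u ≤ b → |f u| ≤ M) : IntervalIntegrable f volume a b := by
  rw [intervalIntegrable_iff_integrableOn_Icc_of_le hab]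
  refine Measure.integrableOn_of_bounded (M := M) (by simp) hf.aestronglyMeasurable ?_
  refine (ae_restrict_iff' measurableSet_Icc).mpr (ae_of_all _ fun u hu => ?_)
  exact h u hu.1 hu.2

lemma blk (ε : ℝ) (hε : 0 < ε) (hε1 : ε ≤ 1) : ∃ C : ℝ, 1 ≤ C ∧ ∀ U : ℝ, 2 ≤ U → ∀ j : ℕ, (2:ℝ)^j ≤ U^(4:ℝ) →
    (∀ β : ℝ, 0 ≤ β → (∑ n ∈ Finset.Ico (2^j) (2*2^j), ‖cB β n‖^2 ≤ C * ((2:ℝ)^j)^(-(1/2:ℝ)) * U^ε) ∧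
      ∀ u, ‖fB (2^j) (cB β) u‖ ≤ C * ((2:ℝ)^j)^(1/4:ℝ) * U^ε) ∧
    Real.log (1 + (2:ℝ)^j) ≤ C * U^ε ∧ Real.log (1 + U * Real.sqrt ((2:ℝ)^j)) ≤ C * U^ε ∧ (j:ℝ) ≤ C * U^ε := by
  have hδ : 0 < ε/8 := by positivity
  obtain ⟨C, hC, h⟩ := cB_bounds (ε/8) hδ (by linarith)
  refine ⟨max C (10/ε), le_max_of_le_left hC, fun U hU j hj => ?_⟩
  have hU0 : 0 < U := by linarith
  have hU1 : 1 ≤ U := by linarith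
  have hN0 : (0:ℝ) < (2:ℝ)^j := by positivity
  have hN1 : (1:ℝ) ≤ (2:ℝ)^j := one_le_pow₀ (by norm_num)
  have hCm := le_max_left C (10/ε)
  have hlogU : Real.log U ≤ U^ε/ε := Real.log_le_rpow_div hU0.le hε
  have hUe : 0 < U^ε := by positivity
  have hfin : 10 * Real.log U ≤ max C (10/ε) * U^ε := by
    calc 10 * Real.log U ≤ 10 * (U^ε/ε) := by linarith
      _ = 10/ε * U^ε := by ring
      _ ≤ _ := mul_le_mul_of_nonneg_right (le_max_right _ _) hUe.le
  have hlU0 : 0 < Real.log U := Real.log_pos (by linarith)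
  have hl2 : Real.log 2 ≤ Real.log U := Real.log_le_log (by norm_num) hU
  have hlj : Real.log ((2:ℝ)^j) ≤ 4 * Real.log U := by
    have := Real.log_le_log hN0 hj
    rwa [Real.log_rpow hU0] at this
  have hNp : ∀ x : ℝ, 0 ≤ x → x ≤ ε/4 → ((2:ℝ)^j)^x ≤ U^ε := fun x hx hx2 => by
    calc ((2:ℝ)^j)^x ≤ (U^(4:ℝ))^x := Real.rpow_le_rpow hN0.le hj hx
      _ = U^(4*x) := by rw [← Real.rpow_mul hU0.le]
      _ ≤ _ := Real.rpow_le_rpow_of_exponent_le hU1 (by linarith)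
  refine ⟨fun β hβ => ?_, ?_, ?_, ?_⟩
  · have := h β (2^j) hβ Nat.one_le_two_pow
    push_cast at this
    refine ⟨this.1.trans ?_, fun u => (fB_bd _ _ u).trans (this.2.trans ?_)⟩
    · rw [Real.rpow_add hN0, ← mul_assoc]
      refine mul_le_mul (mul_le_mul_of_nonneg_right hCm (by positivity)) (hNp _ (by positivity) (by linarith)) (by positivity) (by positivity)
    · rw [Real.rpow_add hN0, ← mul_assoc]
      refine mul_le_mul (mul_le_mul_of_nonneg_right hCm (by positivity)) (hNp _ (by positivity) (by linarith)) (by positivity) (by positivity)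
  · refine le_trans ?_ hfin
    have : Real.log (1 + (2:ℝ)^j) ≤ Real.log (2 * (2:ℝ)^j) := Real.log_le_log (by positivity) (by linarith)
    rw [Real.log_mul (by norm_num) hN0.ne'] at this
    linarith
  · refine le_trans ?_ hfin
    have hs : 1 ≤ Real.sqrt ((2:ℝ)^j) := Real.one_le_sqrt.mpr hN1
    have hs2 : Real.sqrt ((2:ℝ)^j) ≤ (2:ℝ)^j := by
      nlinarith [Real.sq_sqrt hN0.le]
    have : Real.log (1 + U * Real.sqrt ((2:ℝ)^j)) ≤ Real.log (2 * U * (2:ℝ)^j) := Real.log_le_log (by positivity) (by nlinarith)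
    rw [Real.log_mul (by positivity) hN0.ne', Real.log_mul (by norm_num) hU0.ne'] at this
    linarith
  · refine le_trans ?_ hfin
    rw [Real.log_pow] at hlj
    have := Real.log_two_gt_d9
    have hj0 : (0:ℝ) ≤ j := Nat.cast_nonneg j
    nlinarith

lemma J_le (ε : ℝ) (hε1 : ε ≤ 1) (U : ℝ) (hU : 2 ≤ U) (β : ℝ) (hβ : 1/U ≤ β) (J : ℕ) (hJ : (2:ℝ)^J ≤ 2 * (β⁻¹)^2 * U^ε) : (2:ℝ)^J ≤ U^(4:ℝ) := by
  have hU0 : 0 < U := by linarith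
  have hβ0 : 0 < β := lt_of_lt_of_le (by positivity) hβ
  have s4 : β⁻¹ ≤ U := by
    rw [inv_le_comm₀ hβ0 hU0, ← one_div]; exact hβ
  have h1 : U^ε ≤ U := by
    calc U^ε ≤ U^(1:ℝ) := Real.rpow_le_rpow_of_exponent_le (by linarith) hε1
      _ = U := Real.rpow_one U
  have h0 : 0 ≤ β⁻¹ := by positivity
  calc (2:ℝ)^J ≤ 2 * (β⁻¹)^2 * U^ε := hJ
    _ ≤ U * U^2 * U := by gcongr
    _ = U^(4:ℝ) := by
      rw [show (4:ℝ) = ((4:ℕ):ℝ) by norm_num, Real.rpow_natCast]; ring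

lemma I1 (ε : ℝ) (hε : 0 < ε) (hε1 : ε ≤ 1/100) : ∃ C : ℝ, 0 < C ∧ ∀ U : ℝ, 2 ≤ U → ∀ m : ℕ, (2:ℝ)^m ≤ U^(1/40:ℝ) →
    IntervalIntegrable (fun u => (Rr m u)^2) volume U (2*U) ∧ ∫ u in U..(2*U), (Rr m u)^2 ≤ C * U^(1+4*ε) * ((2:ℝ)^m)^(-(1/2:ℝ)) := by
  obtain ⟨C1, hC1, h1⟩ := Rr_dec ε hε
  obtain ⟨C2, hC2, h2⟩ := blk ε hε (by linarith)
  refine ⟨2*C1^2 + 48*C2^4, by positivity, fun U hU m hm => ?_⟩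
  have hU0 : 0 < U := by linarith
  have hU1 : 1 ≤ U := by linarith
  have hβ1 : 1/U ≤ U^(-(3/4:ℝ)) := by
    rw [one_div, ← Real.rpow_neg_one]
    exact Real.rpow_le_rpow_of_exponent_le hU1 (by norm_num)
  obtain ⟨J, hJ, hR⟩ := h1 U hU m hm (U^(-(3/4:ℝ))) hβ1 (Real.rpow_le_one_of_one_le_of_nonpos hU1 (by norm_num))
  have hJ4 := J_le ε (by linarith) U hU _ hβ1 J hJ
  set β := U^(-(3/4:ℝ)) with hβ
  have hβ0 : 0 ≤ β := by positivity
  have hj4 : ∀ j ∈ Finset.Ico m J, (2:ℝ)^j ≤ U^(4:ℝ) := fun j hj =>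
    (pow_le_pow_right₀ (by norm_num) (Finset.mem_Ico.mp hj).2.le).trans hJ4
  have hJb := (h2 U hU J hJ4).2.2.2
  set E := C1 * U^(1/2+ε) * β with hE
  set P := U^ε with hP
  have hP1 : 1 ≤ P := Real.one_le_rpow hU1 hε.le
  set Ym := ((2:ℝ)^m)^(-(1/2:ℝ)) with hYm
  have hYm0 : 0 < Ym := by positivity
  have hYl : U^(-(1/80:ℝ)) ≤ Ym := by
    rw [hYm]
    calc U^(-(1/80:ℝ)) = (U^(1/40:ℝ))^(-(1/2:ℝ)) := by rw [← Real.rpow_mul hU0.le]; norm_num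
      _ ≤ _ := Real.rpow_le_rpow_of_nonpos (by positivity) hm (by norm_num)
  have hUY : U^(1/2:ℝ) ≤ U * Ym := by
    calc U^(1/2:ℝ) ≤ U^(1+ -(1/80:ℝ)) := Real.rpow_le_rpow_of_exponent_le hU1 (by norm_num)
      _ = U * U^(-(1/80:ℝ)) := by rw [Real.rpow_add hU0, Real.rpow_one]
      _ ≤ _ := by gcongr
  have hcardJ : ((Finset.Ico m J).card:ℝ) ≤ C2 * P := by
    refine le_trans ?_ hJb
    rw [Nat.card_Ico]; exact_mod_cast Nat.sub_le J m
  have hC20 : 0 < C2 := by linarith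
  -- pointwise
  have hpt : ∀ u, U ≤ u → u ≤ 2*U → (Rr m u)^2 ≤ 2*E^2 + 2*(C2*P) * ∑ j ∈ Finset.Ico m J, ‖fB (2^j) (cB β) u‖^2 := by
    intro u hu1 hu2
    have a1 := hR u hu1 hu2
    set s := ∑ j ∈ Finset.Ico m J, ‖fB (2^j) (cB β) u‖ with hs
    have hs0 : 0 ≤ s := Finset.sum_nonneg fun _ _ => norm_nonneg _
    have a2 : (Rr m u)^2 ≤ (E + s)^2 := by
      rw [← sq_abs]; gcongr
    have a3 : s^2 ≤ (C2*P) * ∑ j ∈ Finset.Ico m J, ‖fB (2^j) (cB β) u‖^2 := by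
      refine (sq_sum_le_card_mul_sum_sq).trans ?_
      exact mul_le_mul_of_nonneg_right hcardJ (Finset.sum_nonneg fun _ _ => sq_nonneg _)
    nlinarith [sq_nonneg (E - s)]
  have hci : ∀ j, Continuous (fun u => ‖fB (2^j) (cB β) u‖^2) := fun j => (fB_cont _ _).norm.pow 2
  have hcs : Continuous (fun u => 2*E^2 + 2*(C2*P) * ∑ j ∈ Finset.Ico m J, ‖fB (2^j) (cB β) u‖^2) :=
    continuous_const.add (continuous_const.mul (continuous_finsetSum _ fun j _ => hci j))
  have hII : IntervalIntegrable (fun u => (Rr m u)^2) volume U (2*U) := by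
    refine IntervalIntegrable.mono_fun (hcs.intervalIntegrable U (2*U)) ((Rr_meas m).pow_const 2).aestronglyMeasurable ?_
    rw [Filter.EventuallyLE, ae_restrict_iff' measurableSet_uIoc]
    refine ae_of_all _ fun u hu => ?_
    rw [Set.uIoc_of_le (by linarith)] at hu
    rw [Real.norm_of_nonneg (sq_nonneg _)]
    exact (hpt u hu.1.le hu.2).trans (le_abs_self _)
  refine ⟨hII, ?_⟩
  have hIntg : ∫ u in U..(2*U), (Rr m u)^2 ≤ ∫ u in U..(2*U), (2*E^2 + 2*(C2*P) * ∑ j ∈ Finset.Ico m J, ‖fB (2^j) (cB β) u‖^2) :=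
    intervalIntegral.integral_mono_on (by linarith) hII (hcs.intervalIntegrable _ _) fun u hu => hpt u hu.1 hu.2
  have hcs2 : Continuous (fun u => 2*(C2*P) * ∑ j ∈ Finset.Ico m J, ‖fB (2^j) (cB β) u‖^2) :=
    continuous_const.mul (continuous_finsetSum _ fun j _ => hci j)
  rw [intervalIntegral.integral_add (by simp) (hcs2.intervalIntegrable _ _),
    intervalIntegral.integral_const, intervalIntegral.integral_const_mul, intervalIntegral.integral_finsetSum (fun j _ => (hci j).intervalIntegrable _ _)] at hIntg
  have hblock : ∀ j ∈ Finset.Ico m J, ∫ u in U..(2*U), ‖fB (2^j) (cB β) u‖^2 ≤ 24 * C2^2 * P^2 * (U * Ym) := by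
    intro j hj
    obtain ⟨b1, b2, -, -⟩ := h2 U hU j (hj4 j hj)
    have b3 := fB_mean_square (2^j) Nat.one_le_two_pow (cB β) _ (b1 β hβ0).1 U hU0.le
    push_cast at b3
    refine b3.trans ?_
    set N := (2:ℝ)^j with hN
    have hN0 : 0 < N := by positivity
    have hNm : N^(-(1/2:ℝ)) ≤ Ym := Real.rpow_le_rpow_of_nonpos (by positivity) (pow_le_pow_right₀ (by norm_num) (Finset.mem_Ico.mp hj).1) (by norm_num)
    have hNs : N^(-(1/2:ℝ)) * Real.sqrt N = 1 := by
      rw [Real.sqrt_eq_rpow, ← Real.rpow_add hN0]; norm_num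
    have hU12 : 1 ≤ U * Ym := (Real.one_le_rpow hU1 (by norm_num)).trans hUY
    have hl0 : 0 ≤ Real.log (1 + N) := Real.log_nonneg (by linarith)
    have k1 : N^(-(1/2:ℝ)) * (16 * U + 8 * Real.sqrt N) ≤ 24 * (U * Ym) := by
      have : N^(-(1/2:ℝ)) * U ≤ Ym * U := mul_le_mul_of_nonneg_right hNm hU0.le
      nlinarith
    calc C2 * N^(-(1/2:ℝ)) * P * (16 * U + 8 * Real.sqrt N) * Real.log (1 + N)
        = C2 * P * (N^(-(1/2:ℝ)) * (16 * U + 8 * Real.sqrt N)) * Real.log (1 + N) := by ring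
      _ ≤ C2 * P * (24 * (U * Ym)) * (C2 * P) := by gcongr
      _ = _ := by ring
  have hsum := Finset.sum_le_sum hblock
  rw [Finset.sum_const, nsmul_eq_mul] at hsum
  have hUYp : 0 ≤ U * Ym := by positivity
  have hsum2 : ∑ j ∈ Finset.Ico m J, ∫ u in U..(2*U), ‖fB (2^j) (cB β) u‖^2 ≤ (C2*P) * (24 * C2^2 * P^2 * (U * Ym)) :=
    hsum.trans (mul_le_mul_of_nonneg_right hcardJ (by positivity))
  have hE2 : U * E^2 ≤ C1^2 * P^2 * (U * Ym) := by
    have : U * E^2 = C1^2 * P^2 * U^(1/2:ℝ) := by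
      have e : U * (U^(1/2+ε) * β)^2 = P^2 * U^(1/2:ℝ) := by
        rw [hβ, hP, ← Real.rpow_add hU0, ← Real.rpow_natCast, ← Real.rpow_natCast, ← Real.rpow_mul hU0.le, ← Real.rpow_mul hU0.le, ← Real.rpow_add hU0]
        nth_rewrite 1 [← Real.rpow_one U]
        rw [← Real.rpow_add hU0]
        congr 1; push_cast; ring
      rw [hE]
      calc U * (C1 * U^(1/2+ε) * β)^2 = C1^2 * (U * (U^(1/2+ε) * β)^2) := by ring
        _ = _ := by rw [e]; ring
    rw [this]
    gcongr
  have hP4 : U^(1+4*ε) = U * P^4 := by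
    rw [Real.rpow_add hU0, Real.rpow_one, hP, ← Real.rpow_natCast, ← Real.rpow_mul hU0.le]
    congr 2; push_cast; ring
  rw [hP4]
  have e1 : (2*U - U) • (2*E^2) = 2 * (U*E^2) := by rw [smul_eq_mul]; ring
  rw [e1] at hIntg
  have hP24 : P^2 ≤ P^4 := pow_le_pow_right₀ hP1 (by norm_num)
  calc _ ≤ 2 * (U*E^2) + 2*(C2*P) * ((C2*P) * (24 * C2^2 * P^2 * (U * Ym))) := hIntg.trans (by gcongr)
    _ ≤ 2 * (C1^2 * P^4 * (U * Ym)) + 2*(C2*P) * ((C2*P) * (24 * C2^2 * P^2 * (U * Ym))) := by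
        have : C1^2 * P^2 * (U * Ym) ≤ C1^2 * P^4 * (U * Ym) := by gcongr
        linarith
    _ = _ := by ring

end

section
open Filter MeasureTheory Topology

lemma Rr_sup (ε : ℝ) (hε : 0 < ε) (hε1 : ε ≤ 1/100) : ∃ C : ℝ, 1 ≤ C ∧ ∀ U : ℝ, 2 ≤ U → ∀ m : ℕ, (2:ℝ)^m ≤ U^(1/40:ℝ) →
    ∀ u : ℝ, U ≤ u → u ≤ 2*U → |Rr m u| ≤ C * U^(1/2+ε) := by
  obtain ⟨C1, hC1, h1⟩ := Rr_dec ε hε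
  obtain ⟨C2, hC2, h2⟩ := blk ε hε (by linarith)
  refine ⟨C1 + 2*C2^2, by nlinarith, fun U hU m hm u hu1 hu2 => ?_⟩
  have hU0 : 0 < U := by linarith
  have hU1 : 1 ≤ U := by linarith
  have hb : 1/U ≤ 1 := by rw [div_le_one hU0]; exact hU1
  obtain ⟨J, hJ, hR⟩ := h1 U hU m hm 1 hb le_rfl
  have hJ4 := J_le ε (by linarith) U hU _ hb J hJ
  have hJb := (h2 U hU J hJ4).2.2.2
  set P := U^ε with hP
  have hP1 : 1 ≤ P := Real.one_le_rpow hU1 hε.le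
  have hcardJ : ((Finset.Ico m J).card:ℝ) ≤ C2 * P := by
    refine le_trans ?_ hJb
    rw [Nat.card_Ico]; exact_mod_cast Nat.sub_le J m
  have hblock : ∀ j ∈ Finset.Ico m J, ‖fB (2^j) (cB 1) u‖ ≤ C2 * (2*P) * P := by
    intro j hj
    have hjJ : (2:ℝ)^j ≤ 2^J := pow_le_pow_right₀ (by norm_num) (Finset.mem_Ico.mp hj).2.le
    refine (((h2 U hU j (hjJ.trans hJ4)).1 1 zero_le_one).2 u).trans ?_
    have : ((2:ℝ)^j)^(1/4:ℝ) ≤ 2*P := by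
      have h3 : (2:ℝ)^j ≤ 2*P := hjJ.trans (by simpa using hJ)
      calc ((2:ℝ)^j)^(1/4:ℝ) ≤ ((2:ℝ)^j)^(1:ℝ) := Real.rpow_le_rpow_of_exponent_le (one_le_pow₀ (by norm_num)) (by norm_num)
        _ = (2:ℝ)^j := Real.rpow_one _
        _ ≤ _ := h3
    gcongr
  have hs := Finset.sum_le_sum hblock
  rw [Finset.sum_const, nsmul_eq_mul] at hs
  have hs2 : ∑ j ∈ Finset.Ico m J, ‖fB (2^j) (cB 1) u‖ ≤ 2*C2^2 * U^(1/2+ε) := by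
    refine hs.trans ((mul_le_mul_of_nonneg_right hcardJ (by positivity)).trans ?_)
    have : P^3 ≤ U^(1/2+ε) := by
      rw [hP, ← Real.rpow_natCast, ← Real.rpow_mul hU0.le]
      refine Real.rpow_le_rpow_of_exponent_le hU1 ?_
      push_cast; linarith
    calc C2 * P * (C2 * (2 * P) * P) = 2*C2^2 * P^3 := by ring
      _ ≤ _ := by gcongr
  have := hR u hu1 hu2
  calc _ ≤ _ := this
    _ ≤ C1 * U^(1/2+ε) * 1 + 2*C2^2 * U^(1/2+ε) := by linarith
    _ = _ := by ring

lemma lvl_union {ι : Type*} (h : ℝ → ℝ) (hm : Measurable h) (V U : ℝ) (hU : 0 ≤ U) (F : Finset ι) (f : ι → ℝ → ℝ) (hf : ∀ i, Measurable (f i)) (W : ℝ)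
    (hc : ∀ u, U ≤ u → u ≤ 2*U → V ≤ h u → ∃ j ∈ F, W ≤ f j u) : lvl h V U ≤ ∑ j ∈ F, lvl (f j) W U := by
  unfold lvl
  rw [← intervalIntegral.integral_finsetSum (fun j _ => lvl_integrable (f j) (hf j) W _ _)]
  refine intervalIntegral.integral_mono_on (by linarith) (lvl_integrable h hm V _ _) ?_ fun u hu => ?_
  · have := IntervalIntegrable.sum (μ := volume) (a := U) (b := 2*U) F (f := fun j => Set.indicator {u | W ≤ f j u} (fun _ => (1:ℝ))) (fun j _ => lvl_integrable (f j) (hf j) W _ _)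
    refine this.congr ?_
    intro u _
    simp
  · have hn : ∀ j ∈ F, (0:ℝ) ≤ Set.indicator {u | W ≤ f j u} (fun _ => (1:ℝ)) u := fun j _ =>
      Set.indicator_nonneg (fun _ _ => zero_le_one) u
    by_cases hV : V ≤ h u
    · obtain ⟨j, hj, hjW⟩ := hc u hu.1 hu.2 hV
      rw [Set.indicator_of_mem (by exact hV)]
      have h1 : Set.indicator {u | W ≤ f j u} (fun _ => (1:ℝ)) u = 1 := Set.indicator_of_mem (by exact hjW) _
      exact h1.symm.le.trans (Finset.single_le_sum hn hj)
    · rw [Set.indicator_of_notMem (by exact hV)]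
      exact Finset.sum_nonneg hn

lemma lvl_nonneg (h : ℝ → ℝ) (V U : ℝ) (hU : 0 ≤ U) : 0 ≤ lvl h V U := by
  unfold lvl
  exact intervalIntegral.integral_nonneg (by linarith) fun u _ => Set.indicator_nonneg (fun _ _ => zero_le_one) u

lemma lvl_zero (h : ℝ → ℝ) (hm : Measurable h) (V U : ℝ) (hU : 0 ≤ U) (hc : ∀ u, U ≤ u → u ≤ 2*U → h u < V) : lvl h V U = 0 := by
  refine le_antisymm ?_ (lvl_nonneg h V U hU)
  have := lvl_union h hm V U hU (∅ : Finset ℕ) (fun _ _ => 0) (fun _ => measurable_const) 1 (fun u h1 h2 h3 => absurd h3 (not_le.mpr (hc u h1 h2)))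
  simpa using this

lemma blk_alg (U P V q C D L Y4 lv : ℝ) (hU : 0 < U) (hP : 1 ≤ P) (hC : 1 ≤ C) (hV : 1 ≤ V) (hq : 0 < q) (hD : 0 < D) (hY4 : 0 < Y4)
    (hqY : q⁻¹ ≤ Y4) (h1 : V ≤ 2*C^2*P^2*q) (hX : V^5 ≤ D * (U*Y4)) (hL : L ≤ C*P)
    (hlv : lv ≤ (46656*U*(C*(q⁻¹)^2*P)^2*q^2/(V/(2*C*P))^4+2)*(16*(C*(q⁻¹)^2*P)*q^2*L/(V/(2*C*P))^2)) :
    V^7*lv ≤ (46656*16*64*2*C^12 + 128*C^4*D)*(U*P^12*Y4) := by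
  have hV0 : 0 < V := by linarith
  have hP0 : 0 < P := by linarith
  have hC0 : 0 < C := by linarith
  have e1 : 46656*U*(C*(q⁻¹)^2*P)^2*q^2/(V/(2*C*P))^4 = 46656*16*C^6*U*P^6*(q⁻¹)^2/V^4 := by
    field_simp; ring
  have e2 : 16*(C*(q⁻¹)^2*P)*q^2*L/(V/(2*C*P))^2 = 64*C^3*P^3*L/V^2 := by
    field_simp; ring
  rw [e1, e2] at hlv
  have hlv2 : lv ≤ (46656*16*C^6*U*P^6*(q⁻¹)^2/V^4+2)*(64*C^3*P^3*(C*P)/V^2) := by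
    refine hlv.trans ?_
    gcongr
  have hVq : V * (q⁻¹)^2 ≤ 2*C^2*P^2*Y4 := by
    calc V * (q⁻¹)^2 ≤ (2*C^2*P^2*q) * (q⁻¹)^2 := by gcongr
      _ = 2*C^2*P^2*q⁻¹ := by field_simp
      _ ≤ _ := by gcongr
  have hP412 : P^4 ≤ P^12 := pow_le_pow_right₀ hP (by norm_num)
  calc V^7*lv ≤ V^7 * ((46656*16*C^6*U*P^6*(q⁻¹)^2/V^4+2)*(64*C^3*P^3*(C*P)/V^2)) := by gcongr
    _ = 46656*16*64*C^10*U*P^10*(V*(q⁻¹)^2) + 128*C^4*P^4*V^5 := by field_simp; ring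
    _ ≤ 46656*16*64*C^10*U*P^10*(2*C^2*P^2*Y4) + 128*C^4*P^12*(D * (U*Y4)) := by gcongr
    _ = _ := by ring

lemma level (ε : ℝ) (hε : 0 < ε) (hε1 : ε ≤ 1/1000) : ∃ C U0 : ℝ, 0 < C ∧ 2 ≤ U0 ∧ ∀ U : ℝ, U0 ≤ U → ∀ m : ℕ, (2:ℝ)^m ≤ U^(1/40:ℝ) →
    ∀ V : ℝ, 1 ≤ V → V^7 * lvl (fun u => |Rr m u|) V U ≤ C * U^(1+13*ε) * ((2:ℝ)^m)^(-(1/4:ℝ)) := by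
  obtain ⟨C1, hC1, h1⟩ := Rr_dec ε hε
  obtain ⟨C2, hC2, h2⟩ := blk ε hε (by linarith)
  obtain ⟨C3, hC3, h3⟩ := Rr_sup ε hε (by linarith)
  set K := 2*C1 + C3 with hK
  have hK1 : 1 ≤ K := by linarith
  have hK0 : 0 < K := by linarith
  have hC20 : 0 < C2 := by linarith
  set D := 32*C2^8*K^2 with hD
  have hD1 : 1 ≤ D := by
    have : 1 ≤ C2^8 := one_le_pow₀ hC2
    have : 1 ≤ K^2 := one_le_pow₀ hK1
    rw [hD]; nlinarith
  set C4 := 46656*16*64*2*C2^12 + 128*C2^4*D with hC4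
  have hC40 : 0 < C4 := by positivity
  refine ⟨C2 * C4, max 2 (K^4), by positivity, le_max_left _ _, fun U hU' m hm V hV => ?_⟩
  have hU : 2 ≤ U := (le_max_left _ _).trans hU'
  have hUK : K^4 ≤ U := (le_max_right _ _).trans hU'
  have hU0 : 0 < U := by linarith
  have hU1 : 1 ≤ U := by linarith
  have hV0 : 0 < V := by linarith
  set P := U^ε with hP
  have hP1 : 1 ≤ P := Real.one_le_rpow hU1 hε.le
  have hP0 : 0 < P := by linarith
  set Y4 := ((2:ℝ)^m)^(-(1/4:ℝ)) with hY4
  have hY40 : 0 < Y4 := by positivity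
  have hP13 : U^(1+13*ε) = U * P^13 := by
    rw [Real.rpow_add hU0, Real.rpow_one, hP, ← Real.rpow_natCast, ← Real.rpow_mul hU0.le]
    congr 2; push_cast; ring
  have hRm : Measurable (fun u => |Rr m u|) := by
    have := (Rr_meas m).norm
    simpa only [Real.norm_eq_abs] using this
  rw [hP13]
  by_cases hne : ∃ u, U ≤ u ∧ u ≤ 2*U ∧ V ≤ |Rr m u|
  swap
  · push Not at hne
    rw [lvl_zero _ hRm V U hU0.le hne, mul_zero]; positivity
  obtain ⟨u0, hu01, hu02, hu0V⟩ := hne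
  have hVs := hu0V.trans (h3 U hU m hm u0 hu01 hu02)
  set H := U^(1/2+ε) with hH
  have hH0 : 0 < H := by positivity
  set β := V/(K*H) with hβ
  have hβ0 : 0 < β := by positivity
  have hβ1 : β ≤ 1 := by
    rw [hβ, div_le_one (by positivity)]
    refine hVs.trans (mul_le_mul_of_nonneg_right (by linarith) hH0.le)
  have hβU : 1/U ≤ β := by
    rw [hβ, div_le_div_iff₀ hU0 (by positivity)]
    have k1 : K ≤ U^(1/4:ℝ) := by
      have := Real.rpow_le_rpow (by positivity) hUK (by norm_num : (0:ℝ) ≤ 1/4)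
      rw [← Real.rpow_natCast, ← Real.rpow_mul hK0.le] at this
      norm_num at this
      simpa using this
    have k2 : K * H ≤ U := by
      calc K * H ≤ U^(1/4:ℝ) * U^(3/4:ℝ) := by
            refine mul_le_mul k1 (Real.rpow_le_rpow_of_exponent_le hU1 (by linarith)) hH0.le (by positivity)
        _ = U := by rw [← Real.rpow_add hU0]; norm_num
    nlinarith
  obtain ⟨J, hJ, hR⟩ := h1 U hU m hm β hβU hβ1
  have hJ4 := J_le ε (by linarith) U hU _ hβU J hJ
  have hJb := (h2 U hU J hJ4).2.2.2
  have hcardJ : ((Finset.Ico m J).card:ℝ) ≤ C2 * P := by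
    refine le_trans ?_ hJb
    rw [Nat.card_Ico]; exact_mod_cast Nat.sub_le J m
  set W := V/(2*C2*P) with hW
  have hW0 : 0 < W := by positivity
  have hun : lvl (fun u => |Rr m u|) V U ≤ ∑ j ∈ Finset.Ico m J, lvl (fun u => ‖fB (2^j) (cB β) u‖) W U := by
    refine lvl_union _ hRm V U hU0.le _ (fun (j : ℕ) u => ‖fB (2^j) (cB β) u‖) (fun j => (fB_cont _ _).norm.measurable) W fun u hu1 hu2 huV => ?_
    by_contra hcon
    push Not at hcon
    have a1 := huV.trans (hR u hu1 hu2)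
    have a2 : C1 * H * β ≤ V/2 := by
      have : C1 * H * β = V * C1 / K := by rw [hβ]; field_simp
      rw [this, div_le_div_iff₀ hK0 (by norm_num)]
      nlinarith
    have a3 : ∑ j ∈ Finset.Ico m J, ‖fB (2^j) (cB β) u‖ < V/2 := by
      rcases (Finset.Ico m J).eq_empty_or_nonempty with he | he
      · rw [he, Finset.sum_empty]; positivity
      · have := Finset.sum_lt_sum_of_nonempty he hcon
        rw [Finset.sum_const, nsmul_eq_mul] at this
        refine this.trans_le ((mul_le_mul_of_nonneg_right hcardJ hW0.le).trans (le_of_eq ?_))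
        rw [hW]; field_simp
    linarith
  have hblock : ∀ j ∈ Finset.Ico m J, V^7 * lvl (fun u => ‖fB (2^j) (cB β) u‖) W U ≤ C4 * (U*P^12*Y4) := by
    intro j hj
    have hjJ : (2:ℝ)^j ≤ 2^J := pow_le_pow_right₀ (by norm_num) (Finset.mem_Ico.mp hj).2.le
    obtain ⟨b1, -, b3, -⟩ := h2 U hU j (hjJ.trans hJ4)
    obtain ⟨b1, b4⟩ := b1 β hβ0.le
    have hNJ := hjJ.trans hJ
    have hlv := fB_lvl (2^j) Nat.one_le_two_pow (cB β) _ (by positivity) b1 U W hU0 hW0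
    push_cast at hlv
    set N := (2:ℝ)^j with hN
    have hN0 : 0 < N := by positivity
    set q := N^(1/4:ℝ) with hq
    have hq0 : 0 < q := by positivity
    have hqN : q^4 = N := by rw [hq, ← Real.rpow_natCast, ← Real.rpow_mul hN0.le]; norm_num
    have hqs : Real.sqrt N = q^2 := by
      rw [hq, Real.sqrt_eq_rpow, ← Real.rpow_natCast, ← Real.rpow_mul hN0.le]; norm_num
    have hqi : N^(-(1/2:ℝ)) = (q⁻¹)^2 := by
      rw [hq, ← Real.rpow_neg hN0.le, ← Real.rpow_natCast, ← Real.rpow_mul hN0.le]; norm_num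
    have hqY : q⁻¹ ≤ Y4 := by
      rw [hq, ← Real.rpow_neg hN0.le]
      exact Real.rpow_le_rpow_of_nonpos (by positivity) (pow_le_pow_right₀ (by norm_num) (Finset.mem_Ico.mp hj).1) (by norm_num)
    by_cases hsm : C2 * q * P < W
    · rw [lvl_zero _ (fB_cont _ _).norm.measurable W U hU0.le (fun u _ _ => (b4 u).trans_lt hsm), mul_zero]
      positivity
    push Not at hsm
    have hVq : V ≤ 2*C2^2*P^2*q := by
      rw [hW, div_le_iff₀ (by positivity)] at hsm
      calc V ≤ _ := hsm
        _ = _ := by ring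
    have hX : V^5 ≤ D * (U*Y4) := by
      have x1 : N * V^2 ≤ 2*K^2*(U*P^3) := by
        have : 2 * (β⁻¹)^2 * P * V^2 = 2*K^2*(U*P^3) := by
          have hHU : H^2 = U * P^2 := by
            rw [hH, hP, ← Real.rpow_natCast, ← Real.rpow_natCast, ← Real.rpow_mul hU0.le, ← Real.rpow_mul hU0.le]
            nth_rewrite 2 [← Real.rpow_one U]
            rw [← Real.rpow_add hU0]; congr 1; push_cast; ring
          calc 2 * (β⁻¹)^2 * P * V^2 = 2*K^2*H^2*P := by rw [hβ]; field_simp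
            _ = _ := by rw [hHU]; ring
        rw [← this]
        exact mul_le_mul_of_nonneg_right hNJ (by positivity)
      have x2 : V^6 ≤ D * (U * P^11) := by
        calc V^6 = V^4 * V^2 := by ring
          _ ≤ (2*C2^2*P^2*q)^4 * V^2 := by gcongr
          _ = 16*C2^8*P^8*(N*V^2) := by rw [← hqN]; ring
          _ ≤ 16*C2^8*P^8*(2*K^2*(U*P^3)) := by gcongr
          _ = _ := by rw [hD]; ring
      have x3 := Real.rpow_le_rpow (by positivity) x2 (by norm_num : (0:ℝ) ≤ 5/6)
      have x4 : (V^6)^(5/6:ℝ) = V^5 := by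
        rw [← Real.rpow_natCast, ← Real.rpow_mul hV0.le, ← Real.rpow_natCast]; norm_num
      rw [x4, Real.mul_rpow (by positivity) (by positivity)] at x3
      refine x3.trans ?_
      refine mul_le_mul ?_ ?_ (by positivity) (by positivity)
      · calc D^(5/6:ℝ) ≤ D^(1:ℝ) := Real.rpow_le_rpow_of_exponent_le hD1 (by norm_num)
          _ = D := Real.rpow_one D
      · have : U * P^11 = U^(1+11*ε) := by
          rw [Real.rpow_add hU0, Real.rpow_one, hP, ← Real.rpow_natCast, ← Real.rpow_mul hU0.le]
          congr 2; push_cast; ring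
        rw [this, ← Real.rpow_mul hU0.le]
        calc U^((1+11*ε)*(5/6)) ≤ U^(1+ -(1/160:ℝ)) := Real.rpow_le_rpow_of_exponent_le hU1 (by linarith)
          _ = U * U^(-(1/160:ℝ)) := by rw [Real.rpow_add hU0, Real.rpow_one]
          _ = U * (U^(1/40:ℝ))^(-(1/4:ℝ)) := by rw [← Real.rpow_mul hU0.le]; norm_num
          _ ≤ U * Y4 := mul_le_mul_of_nonneg_left (Real.rpow_le_rpow_of_nonpos (by positivity) hm (by norm_num)) hU0.le
    rw [hqs, hqi] at hlv
    rw [hqs] at b3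
    exact blk_alg U P V q C2 D _ Y4 _ hU0 hP1 hC2 hV hq0 (by linarith) hY40 hqY hVq hX b3 hlv
  calc V^7 * lvl (fun u => |Rr m u|) V U ≤ V^7 * ∑ j ∈ Finset.Ico m J, lvl (fun u => ‖fB (2^j) (cB β) u‖) W U := by gcongr
    _ = ∑ j ∈ Finset.Ico m J, V^7 * lvl (fun u => ‖fB (2^j) (cB β) u‖) W U := Finset.mul_sum _ _ _
    _ ≤ ∑ j ∈ Finset.Ico m J, C4 * (U*P^12*Y4) := Finset.sum_le_sum hblock
    _ = ((Finset.Ico m J).card:ℝ) * (C4 * (U*P^12*Y4)) := by rw [Finset.sum_const, nsmul_eq_mul]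
    _ ≤ (C2 * P) * (C4 * (U*P^12*Y4)) := mul_le_mul_of_nonneg_right hcardJ (by positivity)
    _ = _ := by ring

end

section
open Filter MeasureTheory Topology

lemma I2 (ε : ℝ) (hε : 0 < ε) (hε1 : ε ≤ 1/1000) : ∃ C U0 : ℝ, 0 < C ∧ 2 ≤ U0 ∧ ∀ U : ℝ, U0 ≤ U → ∀ m : ℕ, (2:ℝ)^m ≤ U^(1/40:ℝ) →
    IntervalIntegrable (fun u => |Rr m u|^7) volume U (2*U) ∧ ∫ u in U..(2*U), |Rr m u|^7 ≤ C * U^(1+14*ε) * ((2:ℝ)^m)^(-(1/4:ℝ)) := by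
  obtain ⟨C1, hC1, h1⟩ := I1 ε hε (by linarith)
  obtain ⟨C2, hC2, h2⟩ := blk ε hε (by linarith)
  obtain ⟨C3, hC3, h3⟩ := Rr_sup ε hε (by linarith)
  obtain ⟨C4, U4, hC4, hU4, h4⟩ := level ε hε hε1
  have hC20 : 0 < C2 := by linarith
  have hC30 : 0 < C3 := by linarith
  refine ⟨C1 + 128*(2*C2)*C4, max U4 C3, by positivity, hU4.trans (le_max_left _ _), fun U hU' m hm => ?_⟩
  have hU : 2 ≤ U := hU4.trans ((le_max_left _ _).trans hU')
  have hUC : C3 ≤ U := (le_max_right _ _).trans hU'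
  have hU0 : 0 < U := by linarith
  have hU1 : 1 ≤ U := by linarith
  set P := U^ε with hP
  have hP1 : 1 ≤ P := Real.one_le_rpow hU1 hε.le
  have hpow : ∀ k : ℕ, U^(1+(k:ℝ)*ε) = U * P^k := fun k => by
    rw [Real.rpow_add hU0, Real.rpow_one, hP, ← Real.rpow_natCast, ← Real.rpow_mul hU0.le]
    congr 2; ring
  have hRm : Measurable (fun u => |Rr m u|) := by
    have := (Rr_meas m).norm
    simpa only [Real.norm_eq_abs] using this
  set H := C3 * U^(1/2+ε) with hH
  have hH1 : 1 ≤ H := by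
    have : 1 ≤ U^(1/2+ε) := Real.one_le_rpow hU1 (by linarith)
    rw [hH]; nlinarith
  have hsup := h3 U hU m hm
  obtain ⟨n, hn1, hn2⟩ := exists_nat_pow_near hH1 (by norm_num : (1:ℝ) < 2)
  have hn4 : (2:ℝ)^n ≤ U^(4:ℝ) := by
    refine hn1.trans ?_
    calc H ≤ U^(1:ℝ) * U^(3:ℝ) := by
          rw [Real.rpow_one]
          exact mul_le_mul hUC (Real.rpow_le_rpow_of_exponent_le hU1 (by linarith)) (by positivity) hU0.le
      _ = _ := by rw [← Real.rpow_add hU0]; norm_num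
  have hnb : ((n+1:ℕ):ℝ) ≤ 2*C2*P := by
    have := (h2 U hU n hn4).2.2.2
    push_cast
    nlinarith
  obtain ⟨i1, b1⟩ := h1 U hU m hm
  have hii : IntervalIntegrable (fun u => |Rr m u|^7) volume U (2*U) := by
    refine bdd_integrable _ (hRm.pow_const 7) U (2*U) (H^7) (by linarith) fun u hu1 hu2 => ?_
    have := hsup u hu1 hu2
    rw [abs_of_nonneg (by positivity)]
    gcongr
  refine ⟨hii, ?_⟩
  have hlI : ∀ j : ℕ, IntervalIntegrable (fun u => (2:ℝ)^(7*(j+1)) * Set.indicator {u | (2:ℝ)^j ≤ |Rr m u|} (fun _ => (1:ℝ)) u) volume U (2*U) := fun j =>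
    (lvl_integrable _ hRm _ _ _).const_mul _
  have hsI : IntervalIntegrable (fun u => ∑ j ∈ Finset.range (n+1), (2:ℝ)^(7*(j+1)) * Set.indicator {u | (2:ℝ)^j ≤ |Rr m u|} (fun _ => (1:ℝ)) u) volume U (2*U) := by
    have := IntervalIntegrable.sum (μ := volume) (a := U) (b := 2*U) (Finset.range (n+1)) (fun j _ => hlI j)
    refine this.congr ?_
    intro u _
    simp
  have hpt : ∀ u, U ≤ u → u ≤ 2*U → |Rr m u|^7 ≤ (Rr m u)^2 + ∑ j ∈ Finset.range (n+1), (2:ℝ)^(7*(j+1)) * Set.indicator {u | (2:ℝ)^j ≤ |Rr m u|} (fun _ => (1:ℝ)) u := by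
    intro u hu1 hu2
    have hnn : ∀ j ∈ Finset.range (n+1), (0:ℝ) ≤ (2:ℝ)^(7*(j+1)) * Set.indicator {u | (2:ℝ)^j ≤ |Rr m u|} (fun _ => (1:ℝ)) u := fun j _ =>
      mul_nonneg (by positivity) (Set.indicator_nonneg (fun _ _ => zero_le_one) u)
    rcases le_total (|Rr m u|) 1 with h | h
    · have : |Rr m u|^7 ≤ |Rr m u|^2 := pow_le_pow_of_le_one (abs_nonneg _) h (by norm_num)
      rw [sq_abs] at this
      have := Finset.sum_nonneg hnn
      linarith
    · obtain ⟨j, hj1, hj2⟩ := exists_nat_pow_near h (by norm_num : (1:ℝ) < 2)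
      have hjn : j ∈ Finset.range (n+1) := by
        rw [Finset.mem_range]
        have : (2:ℝ)^j < 2^(n+1) := hj1.trans_lt ((hsup u hu1 hu2).trans_lt hn2)
        exact (pow_lt_pow_iff_right₀ (by norm_num : (1:ℝ) < 2)).mp this
      have e := Finset.single_le_sum hnn hjn
      have e1 : Set.indicator {u | (2:ℝ)^j ≤ |Rr m u|} (fun _ => (1:ℝ)) u = 1 := Set.indicator_of_mem (by exact hj1) _
      rw [e1, mul_one] at e
      have : |Rr m u|^7 ≤ (2:ℝ)^(7*(j+1)) := by
        rw [mul_comm 7, pow_mul]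
        gcongr
      have := sq_nonneg (Rr m u)
      linarith
  have hIntg := intervalIntegral.integral_mono_on (by linarith) hii (i1.add hsI) (fun u hu => hpt u hu.1 hu.2)
  rw [intervalIntegral.integral_add i1 hsI, intervalIntegral.integral_finsetSum (fun j _ => hlI j)] at hIntg
  refine hIntg.trans ?_
  set Y2 := ((2:ℝ)^m)^(-(1/2:ℝ)) with hY2
  set Y4 := ((2:ℝ)^m)^(-(1/4:ℝ)) with hY4
  have hY24 : Y2 ≤ Y4 := Real.rpow_le_rpow_of_exponent_le (one_le_pow₀ (by norm_num)) (by norm_num)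
  have hY40 : 0 < Y4 := by positivity
  have hblock : ∀ j ∈ Finset.range (n+1), ∫ u in U..(2*U), (2:ℝ)^(7*(j+1)) * Set.indicator {u | (2:ℝ)^j ≤ |Rr m u|} (fun _ => (1:ℝ)) u ≤ 128 * (C4 * (U * P^13) * Y4) := by
    intro j _
    have := h4 U ((le_max_left _ _).trans hU') m hm ((2:ℝ)^j) (one_le_pow₀ (by norm_num))
    have e13 := hpow 13
    push_cast at e13
    rw [e13] at this
    rw [intervalIntegral.integral_const_mul]
    calc _ = 128 * (((2:ℝ)^j)^7 * lvl (fun u => |Rr m u|) ((2:ℝ)^j) U) := by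
          unfold lvl
          rw [← pow_mul, mul_add, pow_add, mul_comm j 7]; ring
      _ ≤ _ := by linarith
  have hs := Finset.sum_le_sum hblock
  rw [Finset.sum_const, Finset.card_range, nsmul_eq_mul] at hs
  have e4 := hpow 4
  have e14 := hpow 14
  push_cast at e4 e14
  rw [e4] at b1
  rw [e14]
  have hP414 : P^4 ≤ P^14 := pow_le_pow_right₀ hP1 (by norm_num)
  calc _ ≤ C1 * (U*P^4) * Y2 + ((n+1:ℕ):ℝ) * (128 * (C4 * (U * P^13) * Y4)) := add_le_add b1 hs
    _ ≤ C1 * (U*P^14) * Y4 + (2*C2*P) * (128 * (C4 * (U * P^13) * Y4)) := by gcongr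
    _ = _ := by ring

end

section
open Filter MeasureTheory Topology

lemma tr_abs_le (S : Finset ℕ) (u : ℝ) : |tr S u| ≤ ∑ n ∈ S, wt n := by
  unfold tr
  refine (Finset.abs_sum_le_sum_abs _ _).trans (Finset.sum_le_sum fun n _ => ?_)
  rw [abs_mul, abs_of_nonneg (wt_nonneg n)]
  exact mul_le_of_le_one_right (wt_nonneg n) (Real.abs_cos_le_one _)

lemma Dfin_nonneg {k : ℕ} (s : Fin k → Bool) (S : Finset ℕ) : 0 ≤ Dfin s S :=
  Finset.sum_nonneg fun _ _ => Finset.prod_nonneg fun _ _ => wt_nonneg _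

lemma block12 (ε : ℝ) (hε : 0 < ε) (hε1 : ε ≤ 1/100) : ∃ C : ℝ, 0 < C ∧ ∀ U : ℝ, 2 ≤ U → ∀ j : ℕ, (2:ℝ)^j ≤ U^(1/40:ℝ) →
    ∫ u in U..(2*U), (tr (Finset.Ico (2^j) (2*2^j)) u)^12 ≤ C * U * (U^ε)^12 := by
  classical
  obtain ⟨C1, hC1, h1⟩ := cB_bounds ε hε (by linarith)
  obtain ⟨C2, hC2, h2⟩ := diag_block 6 ε hε
  refine ⟨C1^6*C2 + C1^12*12^31, by positivity, fun U hU j hj => ?_⟩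
  have hU0 : 0 < U := by linarith
  set N : ℕ := 2^j with hN
  have hN1 : 1 ≤ N := Nat.one_le_two_pow
  have hNr : (N:ℝ) = (2:ℝ)^j := by rw [hN]; push_cast; rfl
  rw [← hNr] at hj
  have hN1r : (1:ℝ) ≤ N := by exact_mod_cast hN1
  have hN0 : (0:ℝ) < N := by linarith
  set P := U^ε with hP
  have hP1 : 1 ≤ P := Real.one_le_rpow (by linarith) hε.le
  have hNU : (N:ℝ) ≤ U := hj.trans (by
    calc U^(1/40:ℝ) ≤ U^(1:ℝ) := Real.rpow_le_rpow_of_exponent_le (by linarith) (by norm_num)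
      _ = U := Real.rpow_one U)
  have hNP : (N:ℝ)^ε ≤ P := Real.rpow_le_rpow hN0.le hNU hε.le
  have hN34 : (N:ℝ)^34 ≤ U := by
    calc (N:ℝ)^34 ≤ (U^(1/40:ℝ))^34 := pow_le_pow_left₀ hN0.le hj 34
      _ = U^(34/40:ℝ) := by rw [← Real.rpow_natCast, ← Real.rpow_mul hU0.le]; norm_num
      _ ≤ U^(1:ℝ) := Real.rpow_le_rpow_of_exponent_le (by linarith) (by norm_num)
      _ = U := Real.rpow_one U
  set S := Finset.Ico N (2*N) with hS
  set W := ∑ n ∈ S, wt n with hW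
  have hW0 : 0 ≤ W := Finset.sum_nonneg fun n _ => wt_nonneg n
  set q := (N:ℝ)^(1/4:ℝ) with hq
  have hq0 : 0 < q := by positivity
  have hq6 : q^6 = (N:ℝ)^(3/2:ℝ) := by rw [hq, ← Real.rpow_natCast, ← Real.rpow_mul hN0.le]; norm_num
  have hq12 : q^12 = (N:ℝ)^3 := by rw [hq, ← Real.rpow_natCast, ← Real.rpow_mul hN0.le]; norm_num
  have hWle : W ≤ C1 * q * P := by
    have := (h1 0 N le_rfl hN1).2
    have e : ∀ n, ‖cB 0 n‖ = wt n := fun n => by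
      unfold cB cw
      rw [Complex.norm_real, Real.norm_eq_abs]; simp [abs_of_nonneg (wt_nonneg n)]
    simp only [e] at this
    refine this.trans ?_
    rw [Real.rpow_add hN0, mul_assoc]
    gcongr
  have hW6 : W^6 ≤ C1^6 * q^6 * P^6 := by
    rw [← mul_pow, ← mul_pow]; exact pow_le_pow_left₀ hW0 hWle 6
  have hW12 : W^12 ≤ C1^12 * (N:ℝ)^3 * P^12 := by
    rw [← hq12, ← mul_pow, ← mul_pow]; exact pow_le_pow_left₀ hW0 hWle 12
  have hD : ∀ s : Fin 6 → Bool, Dfin s S ≤ C2 * (N:ℝ)^(-(3/2:ℝ)+ε) := by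
    intro s
    unfold Dfin
    have := h2 N hN1r ((Fintype.piFinset (fun _ : Fin 6 => S)).filter (fun v => eta s v = 0)) (fun v hv => by
      rw [Finset.mem_filter, Fintype.mem_piFinset] at hv
      have hvi : ∀ i, N ≤ v i := fun i => (Finset.mem_Ico.mp (hv.1 i)).1
      exact ⟨fun i => nosing s v (fun i => hN1.trans (hvi i)) hv.2 i, fun i => by exact_mod_cast hvi i⟩)
    refine this.trans (le_of_eq ?_)
    norm_num
  have hm := moment 6 (by norm_num) S (2*N) U (2*U) 0 (by linarith) (fun n hn => by
    have := (Finset.mem_Ico.mp hn).2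
    exact_mod_cast this.le) hU0 (by linarith) le_rfl
  simp only [Real.rpow_zero, one_mul, intervalIntegral.integral_const, smul_eq_mul, mul_one] at hm
  rw [← hW] at hm
  have hsum : (1/2:ℝ)^6 * ∑ s : Fin 6 → Bool, Real.cos (Real.pi/4 * ∑ i, sg (s i)) * Dfin s S ≤ C2 * (N:ℝ)^(-(3/2:ℝ)+ε) := by
    have : ∑ s : Fin 6 → Bool, Real.cos (Real.pi/4 * ∑ i, sg (s i)) * Dfin s S ≤ ∑ s : Fin 6 → Bool, C2 * (N:ℝ)^(-(3/2:ℝ)+ε) := by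
      refine Finset.sum_le_sum fun s _ => ?_
      refine le_trans ?_ (hD s)
      exact mul_le_of_le_one_left (Dfin_nonneg s S) (Real.cos_le_one _)
    rw [Finset.sum_const, Finset.card_univ, Fintype.card_fun, Fintype.card_bool, Fintype.card_fin, nsmul_eq_mul] at this
    norm_num at this ⊢
    linarith
  have hsq : Real.sqrt (2*N) ≤ 2*N := by
    rw [Real.sqrt_le_left (by positivity)]
    nlinarith
  have hoff : ((6:ℕ) * Real.sqrt (2*N))^(2^(6-1)-1) ≤ 12^31 * (N:ℝ)^31 := by
    rw [← mul_pow]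
    norm_num only
    refine pow_le_pow_left₀ (by positivity) ?_ 31
    push_cast
    linarith
  have hb6 : ∫ u in U..(2*U), (tr S u)^6 ≤ U * (C2 * (N:ℝ)^(-(3/2:ℝ)+ε)) + W^6 * (12^31 * (N:ℝ)^31) := by
    have a1 := (abs_le.mp hm).2
    have a2 : (2*U-U) * ((1/2:ℝ)^6 * ∑ s : Fin 6 → Bool, Real.cos (Real.pi/4 * ∑ i, sg (s i)) * Dfin s S) ≤ U * (C2 * (N:ℝ)^(-(3/2:ℝ)+ε)) := by
      rw [show 2*U-U = U by ring]
      exact mul_le_mul_of_nonneg_left hsum hU0.le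
    have a3 := mul_le_mul_of_nonneg_left hoff (pow_nonneg hW0 6)
    exact (sub_le_iff_le_add'.mp (a1.trans a3)).trans (add_le_add a2 le_rfl)
  have hIntg : ∫ u in U..(2*U), (tr S u)^12 ≤ ∫ u in U..(2*U), W^6 * (tr S u)^6 := by
    refine intervalIntegral.integral_mono_on (by linarith) (((tr_cont S).pow 12).intervalIntegrable _ _) ((((tr_cont S).pow 6).const_mul _).intervalIntegrable _ _) fun u _ => ?_
    have h6 : (tr S u)^6 ≤ W^6 := by
      rw [← Even.pow_abs (by decide : Even 6)]
      exact pow_le_pow_left₀ (abs_nonneg _) (tr_abs_le S u) 6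
    have h60 : 0 ≤ (tr S u)^6 := Even.pow_nonneg (by decide) _
    nlinarith
  rw [intervalIntegral.integral_const_mul] at hIntg
  refine hIntg.trans ((mul_le_mul_of_nonneg_left hb6 (by positivity)).trans ?_)
  have t1 : W^6 * (U * (C2 * (N:ℝ)^(-(3/2:ℝ)+ε))) ≤ C1^6*C2*U*P^12 := by
    have e : (N:ℝ)^(-(3/2:ℝ)+ε) = (q^6)⁻¹ * (N:ℝ)^ε := by
      rw [Real.rpow_add hN0, Real.rpow_neg hN0.le, hq6]
    rw [e]
    calc W^6 * (U * (C2 * ((q^6)⁻¹ * (N:ℝ)^ε))) ≤ (C1^6 * q^6 * P^6) * (U * (C2 * ((q^6)⁻¹ * P))) := by gcongr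
      _ = C1^6 * C2 * U * P^7 := by field_simp
      _ ≤ C1^6*C2*U*P^12 := by
        refine mul_le_mul_of_nonneg_left (pow_le_pow_right₀ hP1 (by norm_num)) (by positivity)
  have t2 : W^6 * (W^6 * (12^31 * (N:ℝ)^31)) ≤ C1^12*12^31*U*P^12 := by
    calc W^6 * (W^6 * (12^31 * (N:ℝ)^31)) = W^12 * (12^31 * (N:ℝ)^31) := by ring
      _ ≤ (C1^12 * (N:ℝ)^3 * P^12) * (12^31 * (N:ℝ)^31) := by
        refine mul_le_mul_of_nonneg_right hW12 (by positivity)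
      _ = (C1^12*12^31*P^12) * (N:ℝ)^34 := by ring
      _ ≤ (C1^12*12^31*P^12) * U := mul_le_mul_of_nonneg_left hN34 (by positivity)
      _ = _ := by ring
  rw [mul_add]
  linarith

lemma tr_split (m : ℕ) (u : ℝ) : tr (Finset.Ico 1 (2^m)) u = ∑ j ∈ Finset.range m, tr (Finset.Ico (2^j) (2*2^j)) u := by
  induction m with
  | zero => simp [tr]
  | succ K ih =>
    rw [Finset.sum_range_succ, ← ih]
    unfold tr
    rw [pow_succ, mul_comm (2^K) 2]
    rw [Finset.sum_Ico_consecutive _ Nat.one_le_two_pow (by omega)]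

lemma I3 (ε : ℝ) (hε : 0 < ε) (hε1 : ε ≤ 1/100) : ∃ C : ℝ, 0 < C ∧ ∀ U : ℝ, 2 ≤ U → ∀ m : ℕ, (2:ℝ)^m ≤ U^(1/40:ℝ) →
    ∫ u in U..(2*U), (tr (Finset.Ico 1 (2^m)) u)^12 ≤ C * U * (U^ε)^24 := by
  obtain ⟨C1, hC1, h1⟩ := block12 ε hε hε1
  obtain ⟨C2, hC2, h2⟩ := blk ε hε (by linarith)
  refine ⟨C1*C2^12, by positivity, fun U hU m hm => ?_⟩
  have hU0 : 0 < U := by linarith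
  set P := U^ε with hP
  have hP0 : 0 < P := by positivity
  have hmP : (m:ℝ) ≤ C2 * P := by
    have := h2 U hU m (hm.trans (Real.rpow_le_rpow_of_exponent_le (by linarith) (by norm_num)))
    exact this.2.2.2
  have hpt : ∀ u, (tr (Finset.Ico 1 (2^m)) u)^12 ≤ (m:ℝ)^11 * ∑ j ∈ Finset.range m, (tr (Finset.Ico (2^j) (2*2^j)) u)^12 := by
    intro u
    rw [tr_split]
    rcases Nat.eq_zero_or_pos m with rfl | hm0
    · simp
    have h := pow_sum_div_card_le_sum_pow (s := Finset.range m) (f := fun j => |tr (Finset.Ico (2^j) (2*2^j)) u|) (fun _ _ => abs_nonneg _) 11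
    rw [Finset.card_range, div_le_iff₀' (by positivity)] at h
    simp only [Nat.reduceAdd, Even.pow_abs (by decide : Even 12)] at h
    refine le_trans ?_ h
    rw [← Even.pow_abs (by decide : Even 12)]
    exact pow_le_pow_left₀ (abs_nonneg _) (Finset.abs_sum_le_sum_abs _ _) 12
  have hc : ∀ j : ℕ, Continuous (fun u => (tr (Finset.Ico (2^j) (2*2^j)) u)^12) := fun j => (tr_cont _).pow 12
  have hi : ∫ u in U..(2*U), (tr (Finset.Ico 1 (2^m)) u)^12 ≤ ∫ u in U..(2*U), (m:ℝ)^11 * ∑ j ∈ Finset.range m, (tr (Finset.Ico (2^j) (2*2^j)) u)^12 := by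
    refine intervalIntegral.integral_mono_on (by linarith) (((tr_cont _).pow 12).intervalIntegrable _ _) ((Continuous.const_mul (continuous_finsetSum _ fun j _ => hc j) _).intervalIntegrable _ _) fun u _ => hpt u
  rw [intervalIntegral.integral_const_mul, intervalIntegral.integral_finsetSum (fun j _ => (hc j).intervalIntegrable _ _)] at hi
  refine hi.trans ?_
  have hs : ∑ j ∈ Finset.range m, ∫ u in U..(2*U), (tr (Finset.Ico (2^j) (2*2^j)) u)^12 ≤ m * (C1 * U * P^12) := by
    have := Finset.sum_le_sum (s := Finset.range m) (f := fun j => ∫ u in U..(2*U), (tr (Finset.Ico (2^j) (2*2^j)) u)^12) (g := fun _ => C1 * U * P^12) fun j hj => h1 U hU j (le_trans (pow_le_pow_right₀ (by norm_num) (Finset.mem_range.mp hj).le) hm)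
    rwa [Finset.sum_const, Finset.card_range, nsmul_eq_mul] at this
  calc (m:ℝ)^11 * ∑ j ∈ Finset.range m, ∫ u in U..(2*U), (tr (Finset.Ico (2^j) (2*2^j)) u)^12 ≤ (m:ℝ)^11 * (m * (C1 * U * P^12)) := mul_le_mul_of_nonneg_left hs (by positivity)
    _ = (m:ℝ)^12 * (C1 * U * P^12) := by ring
    _ ≤ (C2*P)^12 * (C1 * U * P^12) := by
      refine mul_le_mul_of_nonneg_right (pow_le_pow_left₀ (by positivity) hmP 12) (by positivity)
    _ = _ := by ring

end

section
open Filter MeasureTheory Topology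

lemma Delta_bdd (X : ℝ) : ∃ M : ℝ, ∀ x, 1 ≤ x → x ≤ X → |DirichletDelta x| ≤ M := by
  refine ⟨(∑ n ∈ Finset.Icc 1 ⌊X⌋₊, (divfun n : ℝ)) + X * Real.log X + |2 * Real.eulerMascheroniConstant - 1| * X, fun x h1 h2 => ?_⟩
  unfold DirichletDelta
  have a1 : ∑ n ∈ Finset.Icc 1 ⌊x⌋₊, (divfun n : ℝ) ≤ ∑ n ∈ Finset.Icc 1 ⌊X⌋₊, (divfun n : ℝ) :=
    Finset.sum_le_sum_of_subset_of_nonneg (Finset.Icc_subset_Icc le_rfl (Nat.floor_le_floor h2)) fun _ _ _ => by positivity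
  have a0 : 0 ≤ ∑ n ∈ Finset.Icc 1 ⌊x⌋₊, (divfun n : ℝ) := Finset.sum_nonneg fun _ _ => by positivity
  have l0 : 0 ≤ Real.log x := Real.log_nonneg h1
  have l1 : Real.log x ≤ Real.log X := Real.log_le_log (by linarith) h2
  have a2 : x * Real.log x ≤ X * Real.log X := by gcongr; linarith
  have a3 : 0 ≤ x * Real.log x := by positivity
  have a4 : |(2 * Real.eulerMascheroniConstant - 1) * x| ≤ |2 * Real.eulerMascheroniConstant - 1| * X := by
    rw [abs_mul, abs_of_nonneg (by linarith : 0 ≤ x)]; gcongr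
  have a5 := abs_le.mp a4
  rw [abs_le]
  constructor <;> linarith [a5.1, a5.2]

lemma gD_bdd (a b : ℝ) (ha : 1 ≤ a) : ∃ M : ℝ, ∀ u, a ≤ u → u ≤ b → |gD u| ≤ M := by
  obtain ⟨M, hM⟩ := Delta_bdd (b^2)
  refine ⟨M / (1/(Real.pi * Real.sqrt 2)), fun u h1 h2 => ?_⟩
  unfold gD
  have hu : 1 ≤ u := by linarith
  have hs : 1 ≤ Real.sqrt u := by rw [Real.le_sqrt' one_pos]; linarith
  have hD := hM (u^2) (by nlinarith) (by nlinarith)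
  have hM0 : 0 ≤ M := (abs_nonneg _).trans hD
  rw [abs_div, abs_of_pos (by positivity : 0 < 1/(Real.pi * Real.sqrt 2) * Real.sqrt u)]
  have : 1/(Real.pi * Real.sqrt 2) ≤ 1/(Real.pi * Real.sqrt 2) * Real.sqrt u := le_mul_of_one_le_right (by positivity) hs
  exact div_le_div₀ hM0 hD (by positivity) this

lemma gD7_int (th a b : ℝ) (ha : 1 ≤ a) (hab : a ≤ b) (hth : 0 ≤ th) : IntervalIntegrable (fun u => u^th * (gD u)^7) volume a b := by
  obtain ⟨M, hM⟩ := gD_bdd a b ha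
  refine bdd_integrable _ ((measurable_id.pow_const th).mul (gD_meas.pow_const 7)) a b (b^th * M^7) hab fun u h1 h2 => ?_
  have hu : 0 < u := by linarith
  have hb : 0 < b := by linarith
  show |u^th * (gD u)^7| ≤ _
  rw [abs_mul, abs_pow, abs_of_nonneg (by positivity)]
  have := hM u h1 h2
  gcongr

lemma I4 (ε : ℝ) (hε : 0 < ε) (hε1 : ε ≤ 1/1000) : ∃ C U0 : ℝ, 0 < C ∧ 2 ≤ U0 ∧ ∀ U : ℝ, U0 ≤ U → ∀ m : ℕ, (2:ℝ)^m ≤ U^(1/40:ℝ) →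
    ∫ u in U..(2*U), |gD u ^ 7 - tr (Finset.Ico 1 (2^m)) u ^ 7| ≤ C * U * (U^ε)^24 * ((2:ℝ)^m)^(-(1/4:ℝ)) := by
  obtain ⟨C1, hC1, h1⟩ := I1 ε hε (by linarith)
  obtain ⟨C2, U0, hC2, hU0, h2⟩ := I2 ε hε hε1
  obtain ⟨C3, hC3, h3⟩ := I3 ε hε (by linarith)
  refine ⟨224 * (C1 + C2 + C3), U0, by positivity, hU0, fun U hU m hm => ?_⟩
  have hU2 : 2 ≤ U := by linarith
  have hUp : 0 < U := by linarith
  obtain ⟨i1, b1⟩ := h1 U hU2 m hm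
  obtain ⟨i2, b2⟩ := h2 U hU m hm
  have b3 := h3 U hU2 m hm
  set a := tr (Finset.Ico 1 (2^m)) with ha
  have hac : Continuous a := tr_cont _
  set P := U^ε with hP
  have hP1 : 1 ≤ P := Real.one_le_rpow (by linarith) hε.le
  set Y := (2:ℝ)^m with hY
  have hY0 : 0 < Y := by positivity
  set l := Y^(1/4:ℝ) with hl
  have hl0 : 0 < l := by positivity
  have el : Y^(-(1/4:ℝ)) = l⁻¹ := by rw [Real.rpow_neg hY0.le]
  have el2 : Y^(-(1/2:ℝ)) = l⁻¹*l⁻¹ := by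
    rw [← el, ← Real.rpow_add hY0]; norm_num
  have e1 : U^(1+4*ε) = U*P^4 := by
    rw [Real.rpow_add hUp, Real.rpow_one, ← Real.rpow_natCast, ← Real.rpow_mul hUp.le]; congr 2; push_cast; ring
  have e2 : U^(1+14*ε) = U*P^14 := by
    rw [Real.rpow_add hUp, Real.rpow_one, ← Real.rpow_natCast, ← Real.rpow_mul hUp.le]; congr 2; push_cast; ring
  rw [e1, el2] at b1
  rw [e2, el] at b2
  rw [el]
  have hpt : ∀ u, |gD u ^ 7 - a u ^ 7| ≤ 224 * (l * (Rr m u)^2 + l⁻¹ * (a u)^12 + |Rr m u|^7) := by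
    intro u
    have eR : gD u - a u = Rr m u := rfl
    have q1 := abs_pow_sub_pow_le (gD u) (a u) 7
    rw [eR] at q1
    have q2 : max |gD u| |a u| ≤ |a u| + |Rr m u| := by
      refine max_le ?_ (by linarith [abs_nonneg (Rr m u)])
      have : gD u = a u + Rr m u := by rw [← eR]; ring
      rw [this]; exact abs_add_le _ _
    have q3 : max |gD u| |a u| ^ 6 ≤ 32 * (|a u|^6 + |Rr m u|^6) := by
      refine (pow_le_pow_left₀ (le_max_of_le_left (abs_nonneg _)) q2 6).trans ?_
      have := add_pow_le (abs_nonneg (a u)) (abs_nonneg (Rr m u)) 6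
      norm_num at this ⊢
      exact this
    have q4 : |Rr m u| * |a u|^6 ≤ l * (Rr m u)^2 + l⁻¹ * (a u)^12 := by
      have e12 : (a u)^12 = (|a u|^6)^2 := by rw [← pow_mul, Even.pow_abs (by decide)]
      rw [e12, ← sq_abs (Rr m u)]
      set x := |Rr m u|
      set y := |a u|^6
      have hx : 0 ≤ x := abs_nonneg _
      have hy : 0 ≤ y := by positivity
      have e : l * x^2 + l⁻¹ * y^2 - 2*(x*y) = l⁻¹ * (l*x-y)^2 := by field_simp; ring
      have : 0 ≤ l⁻¹ * (l*x-y)^2 := by positivity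
      nlinarith [mul_nonneg hx hy]
    calc _ ≤ _ := q1
      _ ≤ |Rr m u| * 7 * (32 * (|a u|^6 + |Rr m u|^6)) := by
        push_cast
        exact mul_le_mul_of_nonneg_left q3 (by positivity)
      _ = 224 * (|Rr m u| * |a u|^6 + |Rr m u|^7) := by ring
      _ ≤ _ := by linarith
  have j1 : IntervalIntegrable (fun u => l * (Rr m u)^2) volume U (2*U) := i1.const_mul _
  have j2 : IntervalIntegrable (fun u => l⁻¹ * (a u)^12) volume U (2*U) := ((hac.pow 12).const_mul _).intervalIntegrable _ _
  have j12 : IntervalIntegrable (fun u => l * (Rr m u)^2 + l⁻¹ * (a u)^12) volume U (2*U) := j1.add j2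
  have j123 : IntervalIntegrable (fun u => l * (Rr m u)^2 + l⁻¹ * (a u)^12 + |Rr m u|^7) volume U (2*U) := j12.add i2
  have g7 : IntervalIntegrable (fun u => gD u^7) volume U (2*U) := by
    simpa using gD7_int 0 U (2*U) (by linarith) (by linarith) le_rfl
  have hmono : ∫ u in U..(2*U), |gD u ^ 7 - a u ^ 7| ≤ ∫ u in U..(2*U), 224 * (l * (Rr m u)^2 + l⁻¹ * (a u)^12 + |Rr m u|^7) :=
    intervalIntegral.integral_mono_on (by linarith) (g7.sub ((hac.pow 7).intervalIntegrable _ _)).abs (j123.const_mul 224) fun u _ => hpt u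
  rw [intervalIntegral.integral_const_mul, intervalIntegral.integral_add j12 i2, intervalIntegral.integral_add j1 j2, intervalIntegral.integral_const_mul, intervalIntegral.integral_const_mul] at hmono
  refine hmono.trans ?_
  have p4 : P^4 ≤ P^24 := pow_le_pow_right₀ hP1 (by norm_num)
  have p14 : P^14 ≤ P^24 := pow_le_pow_right₀ hP1 (by norm_num)
  have c1 : l * ∫ u in U..(2*U), (Rr m u)^2 ≤ C1 * U * P^24 * l⁻¹ := by
    calc l * ∫ u in U..(2*U), (Rr m u)^2 ≤ l * (C1 * (U*P^4) * (l⁻¹*l⁻¹)) := mul_le_mul_of_nonneg_left b1 hl0.le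
      _ = C1 * U * P^4 * l⁻¹ := by field_simp
      _ ≤ _ := by gcongr
  have c2 : l⁻¹ * ∫ u in U..(2*U), (a u)^12 ≤ C3 * U * P^24 * l⁻¹ := by
    rw [mul_comm]; exact mul_le_mul_of_nonneg_right b3 (by positivity)
  have c3 : ∫ u in U..(2*U), |Rr m u|^7 ≤ C2 * U * P^24 * l⁻¹ := by
    refine b2.trans ?_
    rw [← mul_assoc]; gcongr
  calc _ ≤ 224 * (C1 * U * P^24 * l⁻¹ + C3 * U * P^24 * l⁻¹ + C2 * U * P^24 * l⁻¹) := by gcongr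
    _ = _ := by ring

end

section
open Filter MeasureTheory Topology

noncomputable def Mlim : ℝ := (1/2)^7 * ∑ s : Fin 7 → Bool, Real.cos (Real.pi/4 * ∑ i, sg (s i)) * s7 (cnt s)

lemma sg_sum (s : Fin 7 → Bool) : ∑ i, sg (s i) = 2 * (cnt s : ℝ) - 7 := by
  have : ∀ i, sg (s i) = 2 * (if s i = true then (1:ℝ) else 0) - 1 := fun i => by
    unfold sg; split_ifs <;> norm_num
  simp only [this]
  rw [Finset.sum_sub_distrib, ← Finset.mul_sum, Finset.sum_boole]
  simp [cnt]

lemma s7_zero : s7 0 = 0 := by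
  unfold s7
  have : IsEmpty {v : Fin 7 → ℕ+ // ∑ j : Fin 7, (if (j : ℕ) < 0 then (1 : ℝ) else -1) * Real.sqrt ((v j : ℕ)) = 0} := by
    refine ⟨fun v => ?_⟩
    have h := v.2
    simp only [Nat.not_lt_zero, if_false] at h
    have : ∑ j : Fin 7, (-1:ℝ) * Real.sqrt ((v.1 j : ℕ)) < 0 := by
      refine Finset.sum_neg (fun j _ => ?_) ⟨0, Finset.mem_univ _⟩
      have : (0:ℝ) < ((v.1 j : ℕ):ℝ) := by exact_mod_cast (v.1 j).pos
      have := Real.sqrt_pos.mpr this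
      linarith
    linarith
  exact tsum_empty

lemma sum_cnt (f : ℕ → ℝ) : ∑ s : Fin 7 → Bool, f (cnt s) = f 0 + 7 * f 1 + 21 * f 2 + 35 * f 3 + 35 * f 4 + 21 * f 5 + 7 * f 6 + f 7 := by
  have hm : ∀ s ∈ (Finset.univ : Finset (Fin 7 → Bool)), cnt s ∈ Finset.range 8 := fun s _ => by
    rw [Finset.mem_range]
    have : cnt s ≤ Fintype.card (Fin 7) := Finset.card_le_univ _
    simpa using Nat.lt_succ_of_le this
  rw [← Finset.sum_fiberwise_of_maps_to hm]
  have : ∀ j, ∑ s : Fin 7 → Bool with cnt s = j, f (cnt s) = ((Finset.univ.filter (fun s : Fin 7 → Bool => cnt s = j)).card : ℝ) * f j := fun j => by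
    rw [← nsmul_eq_mul, ← Finset.sum_const]
    refine Finset.sum_congr rfl fun s hs => ?_
    rw [(Finset.mem_filter.mp hs).2]
  simp only [this, Finset.sum_range_succ, Finset.sum_range_zero]
  have c0 : (Finset.univ.filter (fun s : Fin 7 → Bool => cnt s = 0)).card = 1 := by decide
  have c1 : (Finset.univ.filter (fun s : Fin 7 → Bool => cnt s = 1)).card = 7 := by decide
  have c2 : (Finset.univ.filter (fun s : Fin 7 → Bool => cnt s = 2)).card = 21 := by decide
  have c3 : (Finset.univ.filter (fun s : Fin 7 → Bool => cnt s = 3)).card = 35 := by decide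
  have c4 : (Finset.univ.filter (fun s : Fin 7 → Bool => cnt s = 4)).card = 35 := by decide
  have c5 : (Finset.univ.filter (fun s : Fin 7 → Bool => cnt s = 5)).card = 21 := by decide
  have c6 : (Finset.univ.filter (fun s : Fin 7 → Bool => cnt s = 6)).card = 7 := by decide
  have c7 : (Finset.univ.filter (fun s : Fin 7 → Bool => cnt s = 7)).card = 1 := by decide
  rw [c0, c1, c2, c3, c4, c5, c6, c7]
  push_cast; ring

lemma Mlim_eq : Mlim = (1/2)^7 * Real.sqrt 2 * 7 * (5 * s7 3 - 3 * s7 2 - s7 1) := by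
  unfold Mlim
  simp only [sg_sum]
  rw [sum_cnt (fun l => Real.cos (Real.pi/4 * (2 * (l:ℝ) - 7)) * s7 l)]
  have k7 : s7 7 = 0 := by rw [← s7_zero]; exact s7_symm 0 (by norm_num)
  have k4 : s7 4 = s7 3 := s7_symm 3 (by norm_num)
  have k5 : s7 5 = s7 2 := s7_symm 2 (by norm_num)
  have k6 : s7 6 = s7 1 := s7_symm 1 (by norm_num)
  rw [k7, k4, k5, k6, s7_zero]
  have a3 : Real.cos (Real.pi/4 * (2 * ((3:ℕ):ℝ) - 7)) = Real.sqrt 2 / 2 := by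
    rw [show Real.pi/4 * (2 * ((3:ℕ):ℝ) - 7) = -(Real.pi/4) by push_cast; ring, Real.cos_neg, Real.cos_pi_div_four]
  have a4 : Real.cos (Real.pi/4 * (2 * ((4:ℕ):ℝ) - 7)) = Real.sqrt 2 / 2 := by
    rw [show Real.pi/4 * (2 * ((4:ℕ):ℝ) - 7) = Real.pi/4 by push_cast; ring, Real.cos_pi_div_four]
  have a2 : Real.cos (Real.pi/4 * (2 * ((2:ℕ):ℝ) - 7)) = -(Real.sqrt 2 / 2) := by
    rw [show Real.pi/4 * (2 * ((2:ℕ):ℝ) - 7) = Real.pi/4 - Real.pi by push_cast; ring, Real.cos_sub_pi, Real.cos_pi_div_four]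
  have a5 : Real.cos (Real.pi/4 * (2 * ((5:ℕ):ℝ) - 7)) = -(Real.sqrt 2 / 2) := by
    rw [show Real.pi/4 * (2 * ((5:ℕ):ℝ) - 7) = Real.pi - Real.pi/4 by push_cast; ring, Real.cos_pi_sub, Real.cos_pi_div_four]
  have a1 : Real.cos (Real.pi/4 * (2 * ((1:ℕ):ℝ) - 7)) = -(Real.sqrt 2 / 2) := by
    rw [show Real.pi/4 * (2 * ((1:ℕ):ℝ) - 7) = -(Real.pi/4) - Real.pi by push_cast; ring, Real.cos_sub_pi, Real.cos_neg, Real.cos_pi_div_four]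
  have a6 : Real.cos (Real.pi/4 * (2 * ((6:ℕ):ℝ) - 7)) = -(Real.sqrt 2 / 2) := by
    rw [show Real.pi/4 * (2 * ((6:ℕ):ℝ) - 7) = Real.pi/4 + Real.pi by push_cast; ring, Real.cos_add_pi, Real.cos_pi_div_four]
  rw [a1, a2, a3, a4, a5, a6]
  ring

lemma subst_sq (T : ℝ) (hT : 0 < T) : ∫ x in T..(2*T), DirichletDelta x ^ 7 = 2 * (1/(Real.pi * Real.sqrt 2))^7 * ∫ u in (Real.sqrt T)..(Real.sqrt (2*T)), u^(9/2:ℝ) * (gD u)^7 := by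
  have hle : Real.sqrt T ≤ Real.sqrt (2*T) := Real.sqrt_le_sqrt (by linarith)
  have hU : 0 < Real.sqrt T := Real.sqrt_pos.mpr hT
  rw [intervalIntegral.integral_of_le (by linarith), intervalIntegral.integral_of_le hle, ← integral_const_mul]
  have him : (fun u : ℝ => u^2) '' Set.Ioc (Real.sqrt T) (Real.sqrt (2*T)) = Set.Ioc T (2*T) := by
    ext x
    constructor
    · rintro ⟨u, ⟨h1, h2⟩, rfl⟩
      have hu : 0 < u := by linarith
      exact ⟨(Real.sqrt_lt' hu).mp h1, (Real.le_sqrt' hu).mp h2⟩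
    · rintro ⟨h1, h2⟩
      exact ⟨Real.sqrt x, ⟨Real.sqrt_lt_sqrt hT.le h1, Real.sqrt_le_sqrt h2⟩, Real.sq_sqrt (by linarith)⟩
  rw [← him, integral_image_eq_integral_abs_deriv_smul (f' := fun u => 2*u) measurableSet_Ioc]
  · refine setIntegral_congr_fun measurableSet_Ioc fun u hu => ?_
    have hu0 : 0 < u := by linarith [hu.1]
    have hs : 0 < Real.sqrt u := Real.sqrt_pos.mpr hu0
    show |2*u| • DirichletDelta (u^2)^7 = 2 * (1/(Real.pi * Real.sqrt 2))^7 * (u^(9/2:ℝ) * (gD u)^7)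
    rw [abs_of_pos (by positivity), smul_eq_mul]
    have e : u^(9/2:ℝ) = u * (Real.sqrt u)^7 := by
      rw [Real.sqrt_eq_rpow, ← Real.rpow_natCast, ← Real.rpow_mul hu0.le]
      nth_rewrite 2 [← Real.rpow_one u]
      rw [← Real.rpow_add hu0]; norm_num
    have hD : DirichletDelta (u^2) = (1/(Real.pi * Real.sqrt 2) * Real.sqrt u) * gD u := by
      unfold gD; rw [mul_div_cancel₀]; positivity
    rw [hD, e]; ring
  · intro u _
    simpa using (hasDerivAt_pow 2 u).hasDerivWithinAt
  · intro u hu v hv h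
    have hu0 : 0 ≤ u := by linarith [hu.1]
    have hv0 : 0 ≤ v := by linarith [hv.1]
    exact (pow_left_inj₀ hu0 hv0 (by norm_num)).mp h

end

section
open Filter MeasureTheory Topology

lemma main_a (ε : ℝ) (hε : 0 < ε) : ∃ C : ℝ, 0 < C ∧ ∀ U B : ℝ, 2 ≤ U → U ≤ B → B ≤ 2*U → ∀ m : ℕ, (2:ℝ)^m ≤ U^(1/40:ℝ) →
    |(∫ u in U..B, u^(9/2:ℝ) * (tr (Finset.Ico 1 (2^m)) u)^7) - (∫ u in U..B, u^(9/2:ℝ)) * Mlim| ≤ C * ((2*U)^(9/2:ℝ) * U * U^ε * ((2:ℝ)^m)^(-(1/4:ℝ))) := by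
  obtain ⟨C1, hC1, h1⟩ := wt_rpow (3/4) (by norm_num)
  obtain ⟨C2, hC2, h2⟩ := s7_approx ε hε
  refine ⟨C1^7*7^63 + C2, by positivity, fun U B hU hUB hBU m hm => ?_⟩
  have hU0 : 0 < U := by linarith
  have hB0 : 0 < B := by linarith
  set Y := (2:ℝ)^m with hY
  have hY1 : 1 ≤ Y := one_le_pow₀ (by norm_num)
  have hY0 : 0 < Y := by linarith
  have hYn : (((2^m:ℕ)):ℝ) = Y := by push_cast; rfl
  have hYU : Y ≤ U := hm.trans (by
    calc U^(1/40:ℝ) ≤ U^(1:ℝ) := Real.rpow_le_rpow_of_exponent_le (by linarith) (by norm_num)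
      _ = U := Real.rpow_one U)
  have hY39 : Y^39 ≤ U := by
    calc Y^39 ≤ (U^(1/40:ℝ))^39 := pow_le_pow_left₀ hY0.le hm 39
      _ = U^(39/40:ℝ) := by rw [← Real.rpow_natCast, ← Real.rpow_mul hU0.le]; norm_num
      _ ≤ U^(1:ℝ) := Real.rpow_le_rpow_of_exponent_le (by linarith) (by norm_num)
      _ = U := Real.rpow_one U
  set P := U^ε with hP
  have hP1 : 1 ≤ P := Real.one_le_rpow (by linarith) hε.le
  have hYP : Y^ε ≤ P := Real.rpow_le_rpow hY0.le hYU hε.le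
  set S := Finset.Ico 1 (2^m) with hS
  set W := ∑ n ∈ S, wt n with hW
  have hW0 : 0 ≤ W := Finset.sum_nonneg fun n _ => wt_nonneg n
  have hWle : W ≤ C1 * Y := by
    have : W ≤ ∑ n ∈ S, C1 := Finset.sum_le_sum fun n hn => by
      have := h1 n (Finset.mem_Ico.mp hn).1
      norm_num at this
      exact this
    refine this.trans ?_
    rw [Finset.sum_const, hS, Nat.card_Ico, nsmul_eq_mul, mul_comm]
    refine mul_le_mul_of_nonneg_left ?_ (by linarith)
    rw [← hYn]
    exact_mod_cast Nat.sub_le _ _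
  have hm7 := moment 7 (by norm_num) S Y U B (9/2) hY1 (fun n hn => by
    rw [← hYn]
    exact_mod_cast (Finset.mem_Ico.mp hn).2.le) hU0 hUB (by norm_num)
  rw [← hW] at hm7
  set Q := ∑ s : Fin 7 → Bool, Real.cos (Real.pi/4 * ∑ i, sg (s i)) * Dfin s S with hQ
  set J := ∫ u in U..B, u^(9/2:ℝ) with hJ
  have hJ0 : 0 ≤ J := intervalIntegral.integral_nonneg hUB fun u hu => by
    have : 0 ≤ u := by linarith [hu.1]
    positivity
  have hJle : J ≤ (2*U)^(9/2:ℝ) * U := by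
    have := intervalIntegral.norm_integral_le_of_norm_le_const (a := U) (b := B) (f := fun u : ℝ => u^(9/2:ℝ)) (C := (2*U)^(9/2:ℝ)) (fun u hu => by
      rw [Set.uIoc_of_le hUB] at hu
      have hu0 : 0 < u := by linarith [hu.1]
      rw [Real.norm_of_nonneg (by positivity)]
      exact Real.rpow_le_rpow hu0.le (by linarith [hu.2]) (by norm_num))
    rw [← hJ, Real.norm_of_nonneg hJ0, abs_of_nonneg (by linarith)] at this
    refine this.trans (mul_le_mul_of_nonneg_left (by linarith) (by positivity))
  have hMQ : |(1/2)^7 * Q - Mlim| ≤ C2 * Y^(-(1/4:ℝ)+ε) := by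
    unfold Mlim
    rw [← mul_sub, hQ, ← Finset.sum_sub_distrib, abs_mul, abs_of_pos (by positivity)]
    have : |∑ s : Fin 7 → Bool, (Real.cos (Real.pi/4 * ∑ i, sg (s i)) * Dfin s S - Real.cos (Real.pi/4 * ∑ i, sg (s i)) * s7 (cnt s))| ≤ ∑ s : Fin 7 → Bool, C2 * Y^(-(1/4:ℝ)+ε) := by
      refine (Finset.abs_sum_le_sum_abs _ _).trans (Finset.sum_le_sum fun s _ => ?_)
      rw [← mul_sub, abs_mul]
      have := h2 (2^m) Nat.one_le_two_pow s
      rw [hYn] at this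
      exact (mul_le_of_le_one_left (abs_nonneg _) (Real.abs_cos_le_one _)).trans this
    rw [Finset.sum_const, Finset.card_univ, Fintype.card_fun, Fintype.card_bool, Fintype.card_fin, nsmul_eq_mul] at this
    refine (mul_le_mul_of_nonneg_left this (by positivity)).trans (le_of_eq ?_)
    norm_num
    ring
  have hBp : B^(9/2:ℝ) ≤ (2*U)^(9/2:ℝ) := Real.rpow_le_rpow hB0.le hBU (by norm_num)
  set q := Y^(-(1/4:ℝ)) with hq
  have hq0 : 0 < q := by positivity
  have hqY : 1 ≤ q * Real.sqrt Y := by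
    rw [hq, Real.sqrt_eq_rpow, ← Real.rpow_add hY0]
    exact Real.one_le_rpow hY1 (by norm_num)
  have hsY : 0 < Real.sqrt Y := Real.sqrt_pos.mpr hY0
  have t1 : B^(9/2:ℝ) * W^7 * ((7:ℕ) * Real.sqrt Y)^(2^(7-1)-1) ≤ C1^7*7^63 * ((2*U)^(9/2:ℝ) * U * P * q) := by
    have e63 : ((7:ℕ) * Real.sqrt Y)^(2^(7-1)-1) = 7^63 * (Real.sqrt Y)^63 := by
      rw [mul_pow]; norm_num
    rw [e63]
    calc B^(9/2:ℝ) * W^7 * (7^63 * (Real.sqrt Y)^63) ≤ (2*U)^(9/2:ℝ) * (C1*Y)^7 * (7^63 * (Real.sqrt Y)^63) := by gcongr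
      _ = C1^7*7^63 * (2*U)^(9/2:ℝ) * (Y^7 * (Real.sqrt Y)^63 * 1) := by ring
      _ ≤ C1^7*7^63 * (2*U)^(9/2:ℝ) * (Y^7 * (Real.sqrt Y)^63 * (q * Real.sqrt Y)) := by gcongr
      _ = C1^7*7^63 * (2*U)^(9/2:ℝ) * (Y^7 * ((Real.sqrt Y)^2)^32) * q := by ring
      _ = C1^7*7^63 * (2*U)^(9/2:ℝ) * Y^39 * q := by rw [Real.sq_sqrt hY0.le]; ring
      _ ≤ C1^7*7^63 * (2*U)^(9/2:ℝ) * (U*P) * q := by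
        refine mul_le_mul_of_nonneg_right (mul_le_mul_of_nonneg_left ?_ (by positivity)) hq0.le
        exact hY39.trans (le_mul_of_one_le_right hU0.le hP1)
      _ = _ := by ring
  have t2 : |J * ((1/2)^7 * Q) - J * Mlim| ≤ C2 * ((2*U)^(9/2:ℝ) * U * P * q) := by
    rw [← mul_sub, abs_mul, abs_of_nonneg hJ0]
    calc J * |(1/2)^7 * Q - Mlim| ≤ ((2*U)^(9/2:ℝ) * U) * (C2 * (q * P)) := by
          refine mul_le_mul hJle (hMQ.trans ?_) (abs_nonneg _) (by positivity)
          rw [Real.rpow_add hY0]; gcongr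
      _ = _ := by ring
  rw [add_mul]
  exact (abs_sub_le _ (J * ((1/2)^7 * Q)) _).trans (add_le_add (hm7.trans t1) t2)

lemma mainU : ∃ C U0 : ℝ, 0 < C ∧ 2 ≤ U0 ∧ ∀ U B : ℝ, U0 ≤ U → U ≤ B → B ≤ 2*U →
    |(∫ u in U..B, u^(9/2:ℝ) * (gD u)^7) - (∫ u in U..B, u^(9/2:ℝ)) * Mlim| ≤ C * U^(11/2-1/168:ℝ) := by
  set ε : ℝ := 1/100000 with hεd
  have hε : 0 < ε := by norm_num [hεd]
  obtain ⟨C1, U0, hC1, hU0, h1⟩ := I4 ε hε (by norm_num [hεd])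
  obtain ⟨C2, hC2, h2⟩ := main_a ε hε
  refine ⟨2^(9/2:ℝ) * (C1 + C2) * 2, U0, by positivity, hU0, fun U B hU hUB hBU => ?_⟩
  have hU2 : 2 ≤ U := by linarith
  have hUp : 0 < U := by linarith
  obtain ⟨m, hm1, hm2⟩ := exists_nat_pow_near (x := U^(1/40:ℝ)) (y := 2) (Real.one_le_rpow (by linarith) (by norm_num)) (by norm_num)
  have b1 := h1 U hU m hm1
  have b2 := h2 U B hU2 hUB hBU m hm1
  set a := tr (Finset.Ico 1 (2^m)) with ha
  have hac : Continuous a := tr_cont _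
  set P := U^ε with hP
  have hP1 : 1 ≤ P := Real.one_le_rpow (by linarith) hε.le
  set Y := (2:ℝ)^m with hY
  have hY0 : 0 < Y := by positivity
  have hYq : Y^(-(1/4:ℝ)) ≤ 2 * U^(-(1/160):ℝ) := by
    have hYl : U^(1/40:ℝ)/2 ≤ Y := by rw [pow_succ] at hm2; linarith
    calc Y^(-(1/4:ℝ)) ≤ (U^(1/40:ℝ)/2)^(-(1/4:ℝ)) := Real.rpow_le_rpow_of_nonpos (by positivity) hYl (by norm_num)
      _ = U^(-(1/160):ℝ) / 2^(-(1/4:ℝ)) := by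
        rw [Real.div_rpow (by positivity) (by norm_num), ← Real.rpow_mul hUp.le]; norm_num
      _ = 2^(1/4:ℝ) * U^(-(1/160):ℝ) := by
        rw [Real.rpow_neg (by norm_num : (0:ℝ) ≤ 2), div_inv_eq_mul, mul_comm]
      _ ≤ 2^(1:ℝ) * U^(-(1/160):ℝ) := by
        refine mul_le_mul_of_nonneg_right (Real.rpow_le_rpow_of_exponent_le (by norm_num) (by norm_num)) (by positivity)
      _ = _ := by rw [Real.rpow_one]
  set q := Y^(-(1/4:ℝ)) with hq
  have hq0 : 0 < q := by positivity
  have hcp : Continuous (fun u : ℝ => u^(9/2:ℝ)) := Real.continuous_rpow_const (by norm_num)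
  have ig : IntervalIntegrable (fun u => u^(9/2:ℝ) * (gD u)^7) volume U B := gD7_int _ _ _ (by linarith) hUB (by norm_num)
  have ia : IntervalIntegrable (fun u => u^(9/2:ℝ) * (a u)^7) volume U B := (hcp.mul (hac.pow 7)).intervalIntegrable _ _
  have g7 : IntervalIntegrable (fun u => gD u^7) volume U (2*U) := by
    simpa using gD7_int 0 U (2*U) (by linarith) (by linarith) le_rfl
  have gi : IntervalIntegrable (fun u => |gD u^7 - a u^7|) volume U (2*U) := (g7.sub ((hac.pow 7).intervalIntegrable _ _)).abs
  have giB : IntervalIntegrable (fun u => |gD u^7 - a u^7|) volume U B := gi.mono_set (by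
    rw [Set.uIcc_of_le hUB, Set.uIcc_of_le (by linarith)]
    exact Set.Icc_subset_Icc le_rfl hBU)
  have d1 : |(∫ u in U..B, u^(9/2:ℝ) * (gD u)^7) - ∫ u in U..B, u^(9/2:ℝ) * (a u)^7| ≤ (2*U)^(9/2:ℝ) * (C1 * U * P^24 * q) := by
    rw [← intervalIntegral.integral_sub ig ia]
    refine (intervalIntegral.abs_integral_le_integral_abs hUB).trans ?_
    calc ∫ u in U..B, |u^(9/2:ℝ) * (gD u)^7 - u^(9/2:ℝ) * (a u)^7| ≤ ∫ u in U..B, (2*U)^(9/2:ℝ) * |gD u^7 - a u^7| := by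
          refine intervalIntegral.integral_mono_on hUB (ig.sub ia).abs (giB.const_mul _) fun u hu => ?_
          have hu0 : 0 < u := by linarith [hu.1]
          rw [← mul_sub, abs_mul, abs_of_nonneg (by positivity)]
          refine mul_le_mul_of_nonneg_right (Real.rpow_le_rpow hu0.le (by linarith [hu.2]) (by norm_num)) (abs_nonneg _)
      _ = (2*U)^(9/2:ℝ) * ∫ u in U..B, |gD u^7 - a u^7| := intervalIntegral.integral_const_mul _ _
      _ ≤ (2*U)^(9/2:ℝ) * ∫ u in U..(2*U), |gD u^7 - a u^7| := by
          refine mul_le_mul_of_nonneg_left ?_ (by positivity)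
          refine intervalIntegral.integral_mono_interval le_rfl hUB hBU (ae_of_all _ fun u => abs_nonneg _) gi
      _ ≤ _ := mul_le_mul_of_nonneg_left b1 (by positivity)
  have hfin : (2*U)^(9/2:ℝ) * (U * P^24 * q) ≤ 2^(9/2:ℝ) * 2 * U^(11/2-1/168:ℝ) := by
    rw [Real.mul_rpow (by norm_num) hUp.le]
    calc 2^(9/2:ℝ) * U^(9/2:ℝ) * (U * P^24 * q) ≤ 2^(9/2:ℝ) * U^(9/2:ℝ) * (U * P^24 * (2 * U^(-(1/160):ℝ))) := by gcongr
      _ = 2^(9/2:ℝ) * 2 * (U^(9/2:ℝ) * U^(1:ℝ) * P^24 * U^(-(1/160):ℝ)) := by rw [Real.rpow_one]; ring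
      _ = 2^(9/2:ℝ) * 2 * U^(9/2+1+ε*24+(-(1/160)):ℝ) := by
        rw [hP, ← Real.rpow_natCast, ← Real.rpow_mul hUp.le, ← Real.rpow_add hUp, ← Real.rpow_add hUp, ← Real.rpow_add hUp]; norm_num
      _ ≤ _ := by
        refine mul_le_mul_of_nonneg_left (Real.rpow_le_rpow_of_exponent_le (by linarith) ?_) (by positivity)
        norm_num [hεd]
  have hPP : P ≤ P^24 := le_self_pow₀ hP1 (by norm_num)
  refine (abs_sub_le _ (∫ u in U..B, u^(9/2:ℝ) * (a u)^7) _).trans ((add_le_add d1 b2).trans ?_)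
  calc (2*U)^(9/2:ℝ) * (C1 * U * P^24 * q) + C2 * ((2*U)^(9/2:ℝ) * U * P * q) ≤ (2*U)^(9/2:ℝ) * (C1 * U * P^24 * q) + C2 * ((2*U)^(9/2:ℝ) * U * P^24 * q) := by gcongr
    _ = (C1 + C2) * ((2*U)^(9/2:ℝ) * (U * P^24 * q)) := by ring
    _ ≤ (C1 + C2) * (2^(9/2:ℝ) * 2 * U^(11/2-1/168:ℝ)) := mul_le_mul_of_nonneg_left hfin (by positivity)
    _ = _ := by ring

end

section
open Filter MeasureTheory Topology

lemma dyadic_step : ∃ K T0 : ℝ, 0 < K ∧ 4 ≤ T0 ∧ ∀ T : ℝ, T0 ≤ T →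
    |(∫ x in T..(2*T), DirichletDelta x ^ 7) - 7 * (5 * s7 3 - 3 * s7 2 - s7 1) / (2816 * Real.pi ^ 7) * ((2*T)^(11/4:ℝ) - T^(11/4:ℝ))| ≤ K * T^(11/4-1/336:ℝ) := by
  obtain ⟨C, U0, hC, hU0, h⟩ := mainU
  set c : ℝ := 1/(Real.pi * Real.sqrt 2) with hc
  have hc0 : 0 < c := by positivity
  refine ⟨2*c^7*C, U0^2, by positivity, by nlinarith, fun T hT => ?_⟩
  have hT0 : 0 < T := by nlinarith
  have hU : U0 ≤ Real.sqrt T := Real.le_sqrt_of_sq_le hT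
  have hUB : Real.sqrt T ≤ Real.sqrt (2*T) := Real.sqrt_le_sqrt (by linarith)
  have hBU : Real.sqrt (2*T) ≤ 2 * Real.sqrt T := by
    rw [Real.sqrt_le_left (by positivity), mul_pow, Real.sq_sqrt hT0.le]; linarith
  have b := h _ _ hU hUB hBU
  rw [subst_sq T hT0]
  set I := ∫ u in (Real.sqrt T)..(Real.sqrt (2*T)), u^(9/2:ℝ) * (gD u)^7 with hI
  have hJ : ∫ u in (Real.sqrt T)..(Real.sqrt (2*T)), u^(9/2:ℝ) = ((2*T)^(11/4:ℝ) - T^(11/4:ℝ)) / (11/2) := by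
    rw [integral_rpow (Or.inl (by norm_num))]
    have e : ∀ x : ℝ, 0 ≤ x → (Real.sqrt x)^(9/2+1:ℝ) = x^(11/4:ℝ) := fun x hx => by
      rw [Real.sqrt_eq_rpow, ← Real.rpow_mul hx]; norm_num
    rw [e T hT0.le, e (2*T) (by linarith)]; norm_num
  have eT : (Real.sqrt T)^(11/2-1/168:ℝ) = T^(11/4-1/336:ℝ) := by
    rw [Real.sqrt_eq_rpow, ← Real.rpow_mul hT0.le]; norm_num
  rw [hJ, eT] at b
  set X := (2*T)^(11/4:ℝ) - T^(11/4:ℝ) with hX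
  have econst : 7 * (5 * s7 3 - 3 * s7 2 - s7 1) / (2816 * Real.pi ^ 7) * X = 2*c^7*(X/(11/2)*Mlim) := by
    rw [Mlim_eq, hc]
    have h2 : (Real.sqrt 2)^7 = 8 * Real.sqrt 2 := by
      calc (Real.sqrt 2)^7 = ((Real.sqrt 2)^2)^3 * Real.sqrt 2 := by ring
        _ = _ := by rw [Real.sq_sqrt (by norm_num)]; norm_num
    have hs : Real.sqrt 2 ≠ 0 := by positivity
    rw [div_pow, mul_pow, h2]
    field_simp
    ring
  rw [econst, ← mul_sub, abs_mul, abs_of_pos (by positivity), mul_assoc (2*c^7)]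
  exact mul_le_mul_of_nonneg_left b (by positivity)

lemma Delta7_int (a b : ℝ) (ha : 1 ≤ a) (hb : 1 ≤ b) : IntervalIntegrable (fun x => DirichletDelta x ^ 7) volume a b := by
  have key : ∀ a b : ℝ, 1 ≤ a → a ≤ b → IntervalIntegrable (fun x => DirichletDelta x ^ 7) volume a b := by
    intro a b ha hab
    obtain ⟨M, hM⟩ := Delta_bdd b
    refine bdd_integrable _ (Delta_meas.pow_const 7) a b (M^7) hab fun u h1 h2 => ?_
    rw [abs_pow]
    exact pow_le_pow_left₀ (abs_nonneg _) (hM u (by linarith) h2) 7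
  rcases le_total a b with h | h
  · exact key a b ha h
  · exact (key b a hb h).symm

theorem seventh_power_moment (ε : ℝ) (hε : 0 < ε) :
    (fun T : ℝ => (∫ x in (2 : ℝ)..T, DirichletDelta x ^ 7) -
        7 * (5 * s7 3 - 3 * s7 2 - s7 1) / (2816 * Real.pi ^ 7) * T ^ ((11 : ℝ) / 4))
      =O[atTop] fun T : ℝ => T ^ ((11 : ℝ) / 4 - 1 / 336 + ε) := by
  obtain ⟨K, T0, hK, hT0, hstep⟩ := dyadic_step
  set c0 : ℝ := 7 * (5 * s7 3 - 3 * s7 2 - s7 1) / (2816 * Real.pi ^ 7) with hc0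
  set F : ℝ → ℝ := fun T : ℝ => (∫ x in (2 : ℝ)..T, DirichletDelta x ^ 7) - c0 * T ^ ((11 : ℝ) / 4) with hF
  set θ : ℝ := 11/4 - 1/336 with hθ
  obtain ⟨D, hD⟩ := Delta_bdd (2*T0)
  have hD0 : 0 ≤ D := (abs_nonneg _).trans (hD 1 le_rfl (by linarith))
  set M : ℝ := D^7 * (2*T0) + |c0| * (2*T0)^(11/4:ℝ) with hM
  have hM0 : 0 ≤ M := by positivity
  have hbase : ∀ x, T0 ≤ x → x ≤ 2*T0 → |F x| ≤ M := by
    intro x h1 h2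
    have a1 : |∫ x in (2 : ℝ)..x, DirichletDelta x ^ 7| ≤ D^7 * (2*T0) := by
      have := intervalIntegral.norm_integral_le_of_norm_le_const (a := 2) (b := x) (f := fun x => DirichletDelta x ^ 7) (C := D^7) (fun u hu => by
        rw [Set.uIoc_of_le (by linarith)] at hu
        rw [norm_pow, Real.norm_eq_abs]
        exact pow_le_pow_left₀ (abs_nonneg _) (hD u (by linarith [hu.1]) (by linarith [hu.2])) 7)
      rw [Real.norm_eq_abs, abs_of_nonneg (by linarith : 0 ≤ x - 2)] at this
      exact this.trans (mul_le_mul_of_nonneg_left (by linarith) (by positivity))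
    have a2 : |c0 * x^((11:ℝ)/4)| ≤ |c0| * (2*T0)^(11/4:ℝ) := by
      have hx : 0 < x := by linarith
      rw [abs_mul, abs_of_pos (by positivity : 0 < x^((11:ℝ)/4))]
      exact mul_le_mul_of_nonneg_left (Real.rpow_le_rpow hx.le h2 (by norm_num)) (abs_nonneg _)
    exact (abs_sub _ _).trans (add_le_add a1 a2)
  have hdouble : ∀ T, T0 ≤ T → |F (2*T)| ≤ |F T| + K * T^θ := by
    intro T hT
    have e : F (2*T) - F T = (∫ x in T..(2*T), DirichletDelta x ^ 7) - c0 * ((2*T)^(11/4:ℝ) - T^(11/4:ℝ)) := by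
      have := intervalIntegral.integral_add_adjacent_intervals (Delta7_int 2 T (by norm_num) (by linarith)) (Delta7_int T (2*T) (by linarith) (by linarith))
      simp only [hF]
      rw [← this]; ring
    have h1 := hstep T hT
    rw [← e] at h1
    have h2 := abs_sub_abs_le_abs_sub (F (2*T)) (F T)
    linarith
  have hind : ∀ n : ℕ, ∀ x, T0 ≤ x → x ≤ 2*T0 → |F (2^n*x)| ≤ M + K * (2^n*x)^θ := by
    intro n
    induction n with
    | zero =>
      intro x h1 h2
      have hx : 0 < x := by linarith
      have := hbase x h1 h2
      have : 0 ≤ K * x^θ := by positivity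
      simp only [pow_zero, one_mul]
      linarith
    | succ n ih =>
      intro x h1 h2
      have hx : 0 < x := by linarith
      have h3 := ih x h1 h2
      set y := 2^n*x with hy
      have hy0 : 0 < y := by positivity
      have hTy : T0 ≤ y := h1.trans (le_mul_of_one_le_left hx.le (one_le_pow₀ (by norm_num)))
      rw [show (2:ℝ)^(n+1)*x = 2*y by rw [hy]; ring]
      have h4 := hdouble y hTy
      have h5 : (2*y)^θ ≥ 2 * y^θ := by
        rw [Real.mul_rpow (by norm_num) hy0.le]
        refine mul_le_mul_of_nonneg_right ?_ (by positivity)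
        calc (2:ℝ) = 2^(1:ℝ) := (Real.rpow_one 2).symm
          _ ≤ 2^θ := Real.rpow_le_rpow_of_exponent_le (by norm_num) (by norm_num [hθ])
      have h6 := mul_le_mul_of_nonneg_left h5 hK.le
      linarith
  refine Asymptotics.IsBigO.of_bound (M + K) ?_
  filter_upwards [eventually_ge_atTop T0] with T hT
  have hTp : 0 < T := by linarith
  obtain ⟨n, hn1, hn2⟩ := exists_nat_pow_near (x := T/T0) (y := 2) ((one_le_div (by linarith)).mpr hT) (by norm_num)
  have hp : (0:ℝ) < 2^n := by positivity
  rw [le_div_iff₀ (by linarith)] at hn1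
  rw [div_lt_iff₀ (by linarith), pow_succ] at hn2
  have := hind n (T/2^n) (by rw [le_div_iff₀ hp]; linarith) (by rw [div_le_iff₀ hp]; linarith)
  rw [mul_div_cancel₀ _ hp.ne'] at this
  rw [Real.norm_eq_abs, Real.norm_eq_abs, abs_of_pos (by positivity : 0 < T ^ (θ + ε))]
  have t1 : (1:ℝ) ≤ T^(θ+ε) := Real.one_le_rpow (by linarith) (by norm_num [hθ]; linarith)
  have t2 : T^θ ≤ T^(θ+ε) := Real.rpow_le_rpow_of_exponent_le (by linarith) (by linarith)
  have t3 := mul_le_mul_of_nonneg_left t1 hM0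
  have t4 := mul_le_mul_of_nonneg_left t2 hK.le
  refine this.trans ?_
  rw [add_mul]; linarith

end
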